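/- Assume that the vertex weights (t_x^ω)_{x∈ℤ^d} have the same law under P^h as (1{φ_x < h})_{x∈ℤ^d} under P^G. Then for all x ∈ ℤ^d \ {0}: μ_h(x) > 0 if h > h_*, and μ_h(x) = 0 if h < h_*. Moreover, for all h > h_* and δ > 4, there exist positive constants c_2 and c_3 such that for all n ∈ ℕ and x ∈ ℤ^d \ {0}: P^h( d^ω(0,nx) ≤ c_2 n ) ≤ exp( −c_3 n / (log n)^{δ·1{d=3}} ). -/

import Mathlib

open MeasureTheory Filter ENNReal Topology
open scoped Classical

namespace FPPPaper

/-! ## Basic geometry of `ℤ^d` -/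

/-- Vertices of the lattice `ℤ^d`. -/
abbrev Vert (d : ℕ) := Fin d → ℤ

/-- Nearest-neighbour adjacency on `ℤ^d`. -/
def adj {d : ℕ} (x y : Vert d) : Prop := (∑ i, (x i - y i).natAbs) = 1

/-- The `ℓ^∞`-distance on `ℤ^d`. -/
def linfDist {d : ℕ} (x y : Vert d) : ℕ := Finset.univ.sup fun i => (x i - y i).natAbs

/-- The `ℓ^1`-distance on `ℤ^d`. -/
def l1Dist {d : ℕ} (x y : Vert d) : ℕ := ∑ i, (x i - y i).natAbs

/-- The canonical embedding `ℤ^d → ℝ^d`. -/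
def toRvec {d : ℕ} (x : Vert d) : Fin d → ℝ := fun i => (x i : ℝ)

/-- `p` is a nearest-neighbour path from `x` to `y` (a list of consecutively
adjacent vertices starting at `x` and ending at `y`). -/
def IsPathFrom {d : ℕ} (x y : Vert d) (p : List (Vert d)) : Prop :=
  p.head? = some x ∧ p.getLast? = some y ∧ p.Chain' adj

/-- The (ordered) edges traversed by a path. -/
def edgesOf {d : ℕ} (p : List (Vert d)) : List (Vert d × Vert d) := p.zip p.tail

/-- Total weight of a path for edge weights `w`. -/
noncomputable def pathWeight {d : ℕ} (w : Vert d → Vert d → ℝ≥0∞) (p : List (Vert d)) :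
    ℝ≥0∞ :=
  ((edgesOf p).map fun e => w e.1 e.2).sum

/-- The first passage percolation (pseudo-)distance associated to edge weights `w`. -/
noncomputable def fppDist {d : ℕ} (w : Vert d → Vert d → ℝ≥0∞) (x y : Vert d) : ℝ≥0∞ :=
  ⨅ p : {p : List (Vert d) // IsPathFrom x y p}, pathWeight w p.1

/-- Total weight of a path for vertex weights `w`. -/
noncomputable def vertPathWeight {d : ℕ} (w : Vert d → ℝ≥0∞) (p : List (Vert d)) : ℝ≥0∞ :=
  (p.map w).sum

/-- The first passage percolation distance associated to vertex weights `w`. -/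
noncomputable def vfppDist {d : ℕ} (w : Vert d → ℝ≥0∞) (x y : Vert d) : ℝ≥0∞ :=
  ⨅ p : {p : List (Vert d) // IsPathFrom x y p}, vertPathWeight w p.1

/-- `x` and `y` are connected by a path all of whose edges belong to `S`. -/
def ConnectedIn {d : ℕ} (S : Set (Vert d × Vert d)) (x y : Vert d) : Prop :=
  ∃ p, IsPathFrom x y p ∧ ∀ e ∈ edgesOf p, e ∈ S

/-- `x` and `y` are connected by a path all of whose vertices belong to `S`. -/
def VConnectedIn {d : ℕ} (S : Set (Vert d)) (x y : Vert d) : Prop :=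
  ∃ p, IsPathFrom x y p ∧ ∀ v ∈ p, v ∈ S

/-- The cube `Q(x,r) = {y : |x-y|_∞ ≤ r}`. -/
def cubeVerts {d : ℕ} (x : Vert d) (r : ℝ) : Set (Vert d) :=
  {y | ∀ i, |(y i : ℝ) - (x i : ℝ)| ≤ r}

/-- The set of edges with weight zero. -/
def zeroSet {d : ℕ} (w : Vert d → Vert d → ℝ≥0∞) : Set (Vert d × Vert d) :=
  {e | adj e.1 e.2 ∧ w e.1 e.2 = 0}

/-! ## Configuration spaces indexed by vertices and edges -/

/-- Index set for configurations: vertices and (ordered) edges of `ℤ^d`. -/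
abbrev Coord (d : ℕ) := Vert d ⊕ (Vert d × Vert d)

/-- The vertices underlying a coordinate. -/
def coordVerts {d : ℕ} : Coord d → Set (Vert d)
  | Sum.inl v => {v}
  | Sum.inr e => {e.1, e.2}

/-- The configuration space `Ω = ∏_{e} Ω_e × ∏_x Ω_x` with all coordinate spaces
equal to `Γ`. -/
abbrev Config (d : ℕ) (Γ : Type*) := Coord d → Γ

/-- The lattice shift `τ_z` on configurations. -/
def shiftConfig {d : ℕ} {Γ : Type*} (z : Vert d) (ω : Config d Γ) : Config d Γ :=
  fun c => ω (match c with
    | Sum.inl v => Sum.inl (v + z)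
    | Sum.inr e => Sum.inr (e.1 + z, e.2 + z))

/-- A function of the configuration is supported on the set `S` of coordinates. -/
def SupportedOn {d : ℕ} {Γ β : Type*} (S : Set (Coord d)) (f : Config d Γ → β) : Prop :=
  ∀ ω ω' : Config d Γ, (∀ c ∈ S, ω c = ω' c) → f ω = f ω'

/-- An event on pairs of configurations depending only on the coordinates of the first
configuration in `S1` and of the second one in `S2`. -/
def PairSupportedOn {d : ℕ} {Γ : Type*} (S1 S2 : Set (Coord d))
    (A : Set (Config d Γ × Config d Γ)) : Prop :=
  ∀ ω1 ω2 ω1' ω2' : Config d Γ, (∀ c ∈ S1, ω1 c = ω1' c) → (∀ c ∈ S2, ω2 c = ω2' c) →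
    ((ω1, ω2) ∈ A ↔ (ω1', ω2') ∈ A)

/-- The coordinates of the box `Q̄(x,r)`: vertices of the cube `Q(x,r)` together with
the edges having both endpoints in the cube. -/
def boxCoords {d : ℕ} (x : Vert d) (r : ℝ) : Set (Coord d) :=
  {c | ∀ v ∈ coordVerts c, v ∈ cubeVerts x r}

/-- The coordinates within `ℓ^∞`-distance `r` of `x` or `y` (the neighbourhoods
`𝒩 + x` and `𝒩 + y` together with the edge `{x,y}`). -/
def nbhdCoords {d : ℕ} (r : ℕ) (x y : Vert d) : Set (Coord d) :=
  {c | ∀ v ∈ coordVerts c, linfDist v x ≤ r ∨ linfDist v y ≤ r}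

/-- Two sets of coordinates are at mutual distance at least `r`. -/
def coordSetsFar {d : ℕ} (S1 S2 : Set (Coord d)) (r : ℝ) : Prop :=
  ∀ c1 ∈ S1, ∀ c2 ∈ S2, ∀ v1 ∈ coordVerts c1, ∀ v2 ∈ coordVerts c2,
    r ≤ (linfDist v1 v2 : ℝ)

/-! ## The conditions P1, P2, P3, P3', S1, S2 and Z -/

/-- Condition **P1** (invariance and directional ergodicity): each `P u` is invariant
under lattice shifts and every event invariant under a nonzero shift is trivial. -/
def CondP1 {d : ℕ} {Γ : Type*} [MeasurableSpace Γ]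
    (P : ℝ → Measure (Config d Γ)) (I : Set ℝ) : Prop :=
  ∀ u ∈ I, (∀ z : Vert d, MeasurePreserving (shiftConfig z) (P u) (P u)) ∧
    (∀ z : Vert d, z ≠ 0 → ∀ A : Set (Config d Γ), MeasurableSet A →
      shiftConfig z ⁻¹' A = A → P u A = 0 ∨ P u A = 1)

/-- Condition **P2** (stochastic monotonicity in the parameter `u`). -/
def CondP2 {d : ℕ} {Γ : Type*} [MeasurableSpace Γ] [Preorder Γ]
    (P : ℝ → Measure (Config d Γ)) (I : Set ℝ) : Prop :=
  ∀ f : Config d Γ → ℝ, Measurable f → Monotone f → (∀ ω, f ω ∈ Set.Icc (0:ℝ) 1) →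
    ∀ u ∈ I, ∀ u' ∈ I, u ≤ u' → ∫ ω, f ω ∂(P u) ≤ ∫ ω, f ω ∂(P u')

/-- Condition **P3** (decoupling inequality with sprinkling): after possibly
extending the underlying probability space (the extension is given by `Ω'`, `π`
and the family `Q`), for distant boxes and sprinkled levels there is an event `B`
of high probability on which increasing (resp. decreasing) events on the two boxes
can be compared with their probabilities under independent copies. -/
def CondP3 {d : ℕ} {Γ : Type*} [MeasurableSpace Γ] [Preorder Γ]
    (P : ℝ → Measure (Config d Γ)) (I : Set ℝ)
    (ξP εP aP CP χP RP LP : ℝ) : Prop :=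
  1 < ξP ∧ 0 < εP ∧ 0 < aP ∧ 0 < CP ∧ 0 < χP ∧ 0 < RP ∧ 0 < LP ∧
  ∃ (Ω' : Type) (mΩ' : MeasurableSpace Ω') (π : Ω' → Config d Γ)
    (Q : ℝ → @Measure Ω' mΩ') (fP : ℝ → ℝ),
    (@Measurable Ω' (Config d Γ) mΩ' _ π) ∧
    (∀ u ∈ I, @Measure.map Ω' (Config d Γ) mΩ' _ π (Q u) = P u) ∧
    (∀ L : ℝ, LP ≤ L → Real.exp (aP * Real.log L ^ εP) ≤ fP L) ∧
    ∀ (R L : ℝ) (x1 x2 : Vert d) (u uh : ℝ), u ∈ I → uh ∈ I → RP ≤ R → LP ≤ L →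
      (∀ v1 ∈ cubeVerts x1 (L ^ ξP), ∀ v2 ∈ cubeVerts x2 (L ^ ξP),
        R * L ≤ (linfDist v1 v2 : ℝ)) →
      uh + R ^ (-χP) ≤ u →
      ∃ B : Set Ω', @MeasurableSet Ω' mΩ' B ∧
        Q u Bᶜ ≤ ENNReal.ofReal (Real.exp (-(CP * fP L))) ∧
        (∀ A : Set (Config d Γ × Config d Γ), MeasurableSet A → IsUpperSet A →
            PairSupportedOn (boxCoords x1 (L ^ ξP)) (boxCoords x2 (L ^ ξP)) A →
            Q uh {ω' | ω' ∈ B ∧ (π ω', π ω') ∈ A} ≤ ((P u).prod (P u)) A) ∧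
        (∀ A : Set (Config d Γ × Config d Γ), MeasurableSet A → IsLowerSet A →
            PairSupportedOn (boxCoords x1 (L ^ ξP)) (boxCoords x2 (L ^ ξP)) A →
            Q u {ω' | ω' ∈ B ∧ (π ω', π ω') ∈ A} ≤ ((P uh).prod (P uh)) A)

/-- Condition **P3'** (decoupling inequality for sparse sets with super-exponential
error term). -/
def CondP3' {d : ℕ} {Γ : Type*} [MeasurableSpace Γ] [Preorder Γ]
    (P : ℝ → Measure (Config d Γ)) (I : Set ℝ)
    (ξP CP χP RP LP : ℝ) : Prop :=
  1 < ξP ∧ 0 < CP ∧ 0 < χP ∧ 0 < RP ∧ 0 < LP ∧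
  ∀ (R L : ℝ) (x1 x2 : Vert d) (u uh : ℝ), u ∈ I → uh ∈ I → RP ≤ R → LP ≤ L →
    uh + R ^ (-χP) ≤ u →
    ∀ S1 S2 : Set (Coord d), S1 ⊆ boxCoords x1 (L ^ ξP) → S2 ⊆ boxCoords x2 (L ^ ξP) →
      (S1.ncard : ℝ) ≤ L ^ ξP → (S2.ncard : ℝ) ≤ L ^ ξP →
      coordSetsFar S1 S2 (R * L) →
      (∀ f1 f2 : Config d Γ → ℝ, Measurable f1 → Measurable f2 →
        Monotone f1 → Monotone f2 →
        (∀ ω, f1 ω ∈ Set.Icc (0:ℝ) 1) → (∀ ω, f2 ω ∈ Set.Icc (0:ℝ) 1) →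
        SupportedOn S1 f1 → SupportedOn S2 f2 →
        ∫ ω, f1 ω * f2 ω ∂(P uh) ≤ (∫ ω, f1 ω ∂(P u)) * (∫ ω, f2 ω ∂(P u))
          + Real.exp (-(CP * L ^ ξP))) ∧
      (∀ f1 f2 : Config d Γ → ℝ, Measurable f1 → Measurable f2 →
        Antitone f1 → Antitone f2 →
        (∀ ω, f1 ω ∈ Set.Icc (0:ℝ) 1) → (∀ ω, f2 ω ∈ Set.Icc (0:ℝ) 1) →
        SupportedOn S1 f1 → SupportedOn S2 f2 →
        ∫ ω, f1 ω * f2 ω ∂(P u) ≤ (∫ ω, f1 ω ∂(P uh)) * (∫ ω, f2 ω ∂(P uh))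
          + Real.exp (-(CP * L ^ ξP)))

/-- Condition **(Z)**: `liminf_{L→∞} sup_x P^u(Q(x,L) ↔ Q(x,2L)^c in {e : t_e = 0}) = 0`
for every `u ∈ I`. -/
def CondZ {d : ℕ} {Γ : Type*} [MeasurableSpace Γ]
    (P : ℝ → Measure (Config d Γ)) (I : Set ℝ)
    (w : Config d Γ → Vert d → Vert d → ℝ≥0∞) : Prop :=
  ∀ u ∈ I,
    Filter.liminf (fun L : ℕ =>
      ⨆ x : Vert d, P u {ω | ∃ v1 ∈ cubeVerts x (L : ℝ), ∃ v2,
        v2 ∉ cubeVerts x ((2 * L : ℕ) : ℝ) ∧ ConnectedIn (zeroSet (w ω)) v1 v2})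
      Filter.atTop = 0

/-- The function `g_P^{(δ)}` of the main theorem: equal to `L` if condition P3' holds
and otherwise given by the P3-formula. -/
noncomputable def gP3formula (δ εP aP χP L : ℝ) : ℝ :=
  min L (Real.log L ^ (-(δ * (1 + aP + aP / χP))) * Real.exp (aP * Real.log L ^ εP))

noncomputable def gdelta (p3' : Prop) (δ εP aP χP L : ℝ) : ℝ :=
  if p3' then L else gP3formula δ εP aP χP L

/-! ## The renormalization scheme -/

/-- `ρ_k = ρ` for `k < K` and `ρ_k = 1` for `k ≥ K`. -/
def rhok (ρ K k : ℕ) : ℕ := if k < K then ρ else 1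

/-- The sequence of scales `L_{k+1} = 2 L_k (1 + ρ_k/(k+6)^δ)`. -/
noncomputable def Lseq (δ : ℝ) (ρ K : ℕ) (L0 : ℝ) : ℕ → ℝ
  | 0 => L0
  | k + 1 => 2 * Lseq δ ρ K L0 k * (1 + (rhok ρ K k : ℝ) / ((k : ℝ) + 6) ^ δ)

/-- The box `C_x^k = x + [0, L_k)^d ∩ ℤ^d`. -/
def CkSet {d : ℕ} (δ : ℝ) (ρ K : ℕ) (L0 : ℝ) (k : ℕ) (x : Vert d) : Set (Vert d) :=
  {y | ∀ i, (0:ℝ) ≤ ((y i - x i : ℤ) : ℝ) ∧ ((y i - x i : ℤ) : ℝ) < Lseq δ ρ K L0 k}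

/-- The box `D_x^k = x + [-L_k, 2 L_k)^d ∩ ℤ^d`. -/
def DkSet {d : ℕ} (δ : ℝ) (ρ K : ℕ) (L0 : ℝ) (k : ℕ) (x : Vert d) : Set (Vert d) :=
  {y | ∀ i, -(Lseq δ ρ K L0 k) ≤ ((y i - x i : ℤ) : ℝ) ∧
    ((y i - x i : ℤ) : ℝ) < 2 * Lseq δ ρ K L0 k}

/-- `d_k^ω(x)`: the FPP distance between `C_x^k` and the complement of `D_x^k`. -/
noncomputable def dkDist {d : ℕ} (δ : ℝ) (ρ K : ℕ) (L0 : ℝ) (k : ℕ) (x : Vert d)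
    (w : Vert d → Vert d → ℝ≥0∞) : ℝ≥0∞ :=
  ⨅ p : {p : List (Vert d) // ∃ a b, a ∈ CkSet δ ρ K L0 k x ∧ b ∉ DkSet δ ρ K L0 k x ∧
      IsPathFrom a b p}, pathWeight w p.1

/-- `ε_k = Σ_{p ≥ k} ε/(p+6)^δ`. -/
noncomputable def epsk (δ ε : ℝ) (k : ℕ) : ℝ :=
  ∑' j : ℕ, ε / (((k + j : ℕ) : ℝ) + 6) ^ δ

/-- `a_k = 2^k ∏_{i=0}^{k-1} (1 - 1/(i+6)^δ)`. -/
noncomputable def aseq (δ : ℝ) (k : ℕ) : ℝ :=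
  2 ^ k * ∏ i ∈ Finset.range k, (1 - 1 / (((i : ℕ) : ℝ) + 6) ^ δ)

/-- A path visits `A` and visits the complement of `B` ("the path connects `A` to
`B^c`"). -/
def Crosses {d : ℕ} (p : List (Vert d)) (A B : Set (Vert d)) : Prop :=
  (∃ v ∈ p, v ∈ A) ∧ (∃ v ∈ p, v ∉ B)

/-- Two sets of vertices at mutual `ℓ^∞`-distance at least `r`. -/
def SetDistGE {d : ℕ} (A B : Set (Vert d)) (r : ℝ) : Prop :=
  ∀ a ∈ A, ∀ b ∈ B, r ≤ (linfDist a b : ℝ)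

/-- A proper embedding of the binary tree of depth `k` with base `x`, where tree
vertices of depth `n` are encoded as lists of booleans of length `n` and children
are obtained by appending a bit. -/
def ProperEmbedding {d : ℕ} (δ : ℝ) (ρ K : ℕ) (L0 : ℝ)
    (xseq yseq : ℕ → ℕ → Vert d) (k : ℕ) (x : Vert d) (τ : List Bool → Vert d) : Prop :=
  τ [] = x ∧
  (∀ n, n < k → ∀ σ : List Bool, σ.length = n →
    ∃ i < (2 + rhok ρ K (k - n - 1)) ^ d, ∃ j < 2 * d * (6 + rhok ρ K (k - n - 1)) ^ (d - 1),
      τ (σ ++ [true]) = τ σ + xseq (k - n - 1) i ∧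
      τ (σ ++ [false]) = τ σ + yseq (k - n - 1) j) ∧
  (∀ n, n < k → ∀ σ σ' : List Bool, σ.length = n → σ'.length = k - n →
    (DkSet δ ρ K L0 (k - n) (τ σ) ∩ DkSet δ ρ K L0 0 (τ (σ ++ σ'))).Nonempty)

/-- The countable product measure `ν = μ^{⊗ℕ}` characterised on cylinders. -/
def IsIIDProduct {Ω : Type*} [MeasurableSpace Ω] (μ : Measure Ω)
    (ν : Measure (ℕ → Ω)) : Prop :=
  ∀ (s : Finset ℕ) (f : ℕ → Set Ω), (∀ i ∈ s, MeasurableSet (f i)) →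
    ν {ωt | ∀ i ∈ s, ωt i ∈ f i} = ∏ i ∈ s, μ (f i)

/-- The Lorentz `L(d,1)`-norm of a nonnegative random variable. -/
noncomputable def lorentzNorm {Ω : Type*} [MeasurableSpace Ω] (d : ℕ) (P : Measure Ω)
    (X : Ω → ℝ≥0∞) : ℝ≥0∞ :=
  ∫⁻ s in Set.Ioi (0:ℝ), (P {ω | ENNReal.ofReal s < X ω}) ^ ((1:ℝ) / d)

/-! ## The discrete Gaussian free field -/

/-- The neighbours of a vertex of `ℤ^d`. -/
def nbrs {d : ℕ} (x : Vert d) : Finset (Vert d) :=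
  (Finset.univ : Finset (Fin d × Bool)).image
    (fun p => Function.update x p.1 (x p.1 + if p.2 then 1 else -1))

/-- The number of nearest-neighbour walks of length `n` from `x` to `y`. -/
def nStepCount (d : ℕ) : ℕ → Vert d → Vert d → ℕ
  | 0, x, y => if x = y then 1 else 0
  | n + 1, x, y => ∑ z ∈ nbrs x, nStepCount d n z y

/-- The Green function of the simple random walk on `ℤ^d` (with unit weights). -/
noncomputable def greenSRW (d : ℕ) (x y : Vert d) : ℝ≥0∞ :=
  ∑' n : ℕ, (nStepCount d n x y : ℝ≥0∞) / ((2 * d : ℕ) : ℝ≥0∞) ^ n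

/-- `φ` is a centred Gaussian field with covariance `cov` under `P`, characterised by
the moment generating functions of its finite linear combinations. -/
def IsCenteredGaussianField {d : ℕ} {Ω : Type*} [MeasurableSpace Ω] (P : Measure Ω)
    (φ : Ω → Vert d → ℝ) (cov : Vert d → Vert d → ℝ) : Prop :=
  (∀ x, Measurable fun ω => φ ω x) ∧
  ∀ (s : Finset (Vert d)) (c : Vert d → ℝ) (t : ℝ),
    ∫ ω, Real.exp (t * ∑ x ∈ s, c x * φ ω x) ∂P =
      Real.exp (t ^ 2 * (∑ x ∈ s, ∑ y ∈ s, c x * c y * cov x y) / 2)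

/-- The set `S` of vertices percolates (contains an infinite cluster). -/
def PercolatesIn {d : ℕ} (S : Set (Vert d)) : Prop :=
  ∃ x, {y | VConnectedIn S x y}.Infinite

/-- The critical level `h_*` for level-set percolation of the field `φ`. -/
noncomputable def hstar {d : ℕ} {Ω : Type*} [MeasurableSpace Ω] (P : Measure Ω)
    (φ : Ω → Vert d → ℝ) : ℝ :=
  sSup {h : ℝ | P {ω | PercolatesIn {x | h ≤ φ ω x}} ≠ 0}

/-- `h_f = inf {t : f t = 0}` as an extended real number (`⊤` if `f` has no zero). -/
noncomputable def hfEReal (f : ℝ → ℝ) : EReal :=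
  sInf {x : EReal | ∃ s : ℝ, f s = 0 ∧ x = (s : EReal)}

/-! ## Random conductance models -/

/-- An edge is open for conductances `a` if it is a lattice edge with positive
conductance. -/
def openAdj {d : ℕ} (a : Vert d → Vert d → ℝ) (x y : Vert d) : Prop :=
  adj x y ∧ 0 < a x y

/-- A path using only open edges. -/
def IsOpenPath {d : ℕ} (a : Vert d → Vert d → ℝ) (x y : Vert d) (p : List (Vert d)) :
    Prop :=
  p.head? = some x ∧ p.getLast? = some y ∧ p.Chain' (openAdj a)

/-- Connectivity by open paths. -/
def openConn {d : ℕ} (a : Vert d → Vert d → ℝ) (x y : Vert d) : Prop :=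
  ∃ p, IsOpenPath a x y p

/-- The union of the infinite open clusters (the infinite cluster `C_∞` when it is
unique). -/
def Cinf {d : ℕ} (a : Vert d → Vert d → ℝ) : Set (Vert d) :=
  {x | {y | openConn a x y}.Infinite}

/-- The chemical (graph) distance on the open cluster. -/
noncomputable def chemDist {d : ℕ} (a : Vert d → Vert d → ℝ) (x y : Vert d) : ℝ≥0∞ :=
  ⨅ p : {p : List (Vert d) // IsOpenPath a x y p}, ((p.1.length - 1 : ℕ) : ℝ≥0∞)

/-- The closed ball of radius `r` for the chemical distance. -/
def ballCh {d : ℕ} (a : Vert d → Vert d → ℝ) (x : Vert d) (r : ℝ) : Set (Vert d) :=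
  {y | chemDist a x y ≤ ENNReal.ofReal r}

/-- `μ^ω(x) = Σ_{y∼x} a(x,y)`. -/
noncomputable def muA {d : ℕ} (a : Vert d → Vert d → ℝ) (x : Vert d) : ℝ :=
  ∑ y ∈ nbrs x, a x y

/-- `ν^ω(x) = Σ_{y∼x, a(x,y)>0} a(x,y)⁻¹`. -/
noncomputable def nuA {d : ℕ} (a : Vert d → Vert d → ℝ) (x : Vert d) : ℝ :=
  ∑ y ∈ nbrs x, if 0 < a x y then (a x y)⁻¹ else 0

/-- The space-averaged `ℓ^p`-norm `‖f‖_{p,A}` (maximum norm for `p = ∞`). -/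
noncomputable def avgNormR {d : ℕ} (p : ℝ≥0∞) (A : Set (Vert d)) (f : Vert d → ℝ) : ℝ :=
  if p = ∞ then sSup ((fun x => |f x|) '' A)
  else ((∑' x : A, |f (x : Vert d)| ^ p.toReal) / (A.ncard : ℝ)) ^ (1 / p.toReal)

/-- The sum `Σ_{{y,z} open edge} |f(y) - f(z)|` (each unordered edge counted once). -/
noncomputable def edgeGradSum {d : ℕ} (a : Vert d → Vert d → ℝ) (f : Vert d → ℝ) : ℝ :=
  (1 / 2) * ∑' e : Vert d × Vert d, if openAdj a e.1 e.2 then |f e.2 - f e.1| else 0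

/-- The graph assumption: volume regularity of order `d` and a Sobolev inequality
with exponent `d' ≥ d` on large balls of the infinite cluster. -/
def GraphAssumption {d : ℕ} (d' : ℝ) (a : Vert d → Vert d → ℝ)
    (N4 N5 : Vert d → ℕ) (Creg CS1 : ℝ) : Prop :=
  1 ≤ Creg ∧ 1 ≤ CS1 ∧ (d : ℝ) ≤ d' ∧
  (∀ x ∈ Cinf a, ∀ n : ℕ, N4 x ≤ n →
    Creg⁻¹ * (n : ℝ) ^ d ≤ ((ballCh a x n).ncard : ℝ) ∧
      ((ballCh a x n).ncard : ℝ) ≤ Creg * (n : ℝ) ^ d) ∧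
  (∀ x ∈ Cinf a, ∀ n : ℕ, N5 x ≤ n → ∀ f : Vert d → ℝ,
    (∀ y, f y ≠ 0 → y ∈ ballCh a x n) →
    avgNormR (ENNReal.ofReal (d' / (d' - 1))) (ballCh a x n) f ≤
      CS1 * n / ((ballCh a x n).ncard : ℝ) * edgeGradSum a f)

/-- The generator `(ℒ f)(x) = Σ_{y∼x} a(x,y)(f(y)-f(x)) - h κ(x) f(x)`. -/
noncomputable def genL {d : ℕ} (a : Vert d → Vert d → ℝ) (κ : Vert d → ℝ) (h : ℝ)
    (f : Vert d → ℝ) (x : Vert d) : ℝ :=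
  (∑ y ∈ nbrs x, a x y * (f y - f x)) - h * κ x * f x

/-- The carré du champ `Γ(f,g)(x) = Σ_{y∼x} a(x,y)(f(y)-f(x))(g(y)-g(x))`. -/
noncomputable def carre {d : ℕ} (a : Vert d → Vert d → ℝ) (f g : Vert d → ℝ)
    (x : Vert d) : ℝ :=
  ∑ y ∈ nbrs x, a x y * (f y - f x) * (g y - g x)

/-- The weighted carré du champ
`Γ_η(f,g)(x) = Σ_{y∼x} av(η²)({x,y}) a(x,y)(f(y)-f(x))(g(y)-g(x))`. -/
noncomputable def carreEta {d : ℕ} (a : Vert d → Vert d → ℝ) (η f g : Vert d → ℝ)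
    (x : Vert d) : ℝ :=
  ∑ y ∈ nbrs x, ((η x ^ 2 + η y ^ 2) / 2) * (a x y * (f y - f x) * (g y - g x))

/-- The Dirichlet form `E(f) = ⟨∇f, a ∇f⟩ + h ⟨f, κ f⟩`. -/
noncomputable def dirichletE {d : ℕ} (a : Vert d → Vert d → ℝ) (κ : Vert d → ℝ)
    (h : ℝ) (f : Vert d → ℝ) : ℝ :=
  (1 / 2) * (∑' e : Vert d × Vert d,
      if adj e.1 e.2 then a e.1 e.2 * (f e.2 - f e.1) ^ 2 else 0) +
    h * ∑' x, κ x * f x ^ 2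

/-- `g` is the Green function on `C` of the walk with conductances `a` and killing
measure `h·κ`: the minimal nonnegative fundamental solution of `ℒ g(·,y) = -𝟙_y`. -/
def IsGreenFn {d : ℕ} (a : Vert d → Vert d → ℝ) (κ : Vert d → ℝ) (h : ℝ)
    (C : Set (Vert d)) (g : Vert d → Vert d → ℝ) : Prop :=
  (∀ x y, 0 ≤ g x y) ∧
  (∀ y ∈ C, ∀ x ∈ C, genL a κ h (fun z => g z y) x = -(if x = y then (1:ℝ) else 0)) ∧
  (∀ g' : Vert d → Vert d → ℝ, (∀ x y, 0 ≤ g' x y) →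
    (∀ y ∈ C, ∀ x ∈ C, genL a κ h (fun z => g' z y) x ≤ -(if x = y then (1:ℝ) else 0)) →
    ∀ x ∈ C, ∀ y ∈ C, g x y ≤ g' x y)

/-- `q t x y = P_x(X_t = y)` is the (minimal) transition function of the Markov chain
with jump rates `a(x,y)/θ(x)`, characterised via the backward Kolmogorov equations. -/
def IsHeatSemigroup {d : ℕ} (a : Vert d → Vert d → ℝ) (θ : Vert d → ℝ)
    (q : ℝ → Vert d → Vert d → ℝ) : Prop :=
  (∀ x y, q 0 x y = if x = y then (1:ℝ) else 0) ∧
  (∀ t x y, 0 ≤ q t x y) ∧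
  (∀ t x, ∑' y, q t x y ≤ 1) ∧
  (∀ x y, ∀ t : ℝ, 0 ≤ t →
    HasDerivAt (fun s => q s x y) (∑ z ∈ nbrs x, a x z / θ x * (q t z y - q t x y)) t) ∧
  (∀ q' : ℝ → Vert d → Vert d → ℝ,
    (∀ x y, q' 0 x y = if x = y then (1:ℝ) else 0) →
    (∀ t x y, 0 ≤ q' t x y) →
    (∀ x y, ∀ t : ℝ, 0 ≤ t →
      HasDerivAt (fun s => q' s x y)
        (∑ z ∈ nbrs x, a x z / θ x * (q' t z y - q' t x y)) t) →
    ∀ t : ℝ, 0 ≤ t → ∀ x y, q t x y ≤ q' t x y)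

/-- The FPP edge weight `(1 ∧ (κ(x) ∧ κ(y))/a(x,y))^{1/2}` (equal to `∞` on closed
edges); used both for the metric `d_κ` and, with `θ` in place of `κ`, for `d_θ`. -/
noncomputable def kapWeightE {d : ℕ} (a : Vert d → Vert d → ℝ) (κ : Vert d → ℝ)
    (x y : Vert d) : ℝ≥0∞ :=
  if 0 < a x y then ENNReal.ofReal (Real.sqrt (min 1 (min (κ x) (κ y) / a x y))) else ∞

/-- The FPP-type metric `d_κ` on the open cluster. -/
noncomputable def dkap {d : ℕ} (a : Vert d → Vert d → ℝ) (κ : Vert d → ℝ)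
    (x y : Vert d) : ℝ≥0∞ :=
  ⨅ p : {p : List (Vert d) // IsOpenPath a x y p},
    ((edgesOf p.1).map fun e => kapWeightE a κ e.1 e.2).sum

/-- `F_γ(r) = (1+r)^γ (1+1/r)^{1/2}` in `ℝ≥0∞` (so `F_γ(0) = ∞`). -/
noncomputable def FgamE (γ r : ℝ) : ℝ≥0∞ :=
  (1 + ENNReal.ofReal r) ^ γ * (1 + (ENNReal.ofReal r)⁻¹) ^ ((1:ℝ) / 2)

/-- The open cluster of `x` has `ℓ^1`-diameter at least `r`. -/
def clusterDiamGE {d : ℕ} (a : Vert d → Vert d → ℝ) (x : Vert d) (r : ℝ) : Prop :=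
  ∃ y z, openConn a x y ∧ openConn a x z ∧ r ≤ (l1Dist y z : ℝ)

/-- Condition **S1** (local uniqueness of large clusters). -/
def CondS1 {d : ℕ} {Γ : Type*} [MeasurableSpace Γ]
    (P : ℝ → Measure (Config d Γ)) (I : Set ℝ)
    (aC : Config d Γ → Vert d → Vert d → ℝ) : Prop :=
  ∃ fS : ℝ → ℕ → ℝ, ∀ u ∈ I, ∃ ΔS RS : ℝ, 0 < ΔS ∧
    (∀ R : ℕ, RS ≤ R → Real.log (R : ℝ) ^ (1 + ΔS) ≤ fS u R) ∧
    ∀ R : ℕ, 1 ≤ R →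
      (ENNReal.ofReal (1 - Real.exp (-(fS u R))) ≤
        P u {ω | ∃ x ∈ cubeVerts (0 : Vert d) (R : ℝ), clusterDiamGE (aC ω) x (R : ℝ)}) ∧
      (ENNReal.ofReal (1 - Real.exp (-(fS u R))) ≤
        P u {ω | ∀ x ∈ cubeVerts (0 : Vert d) (R : ℝ), ∀ y ∈ cubeVerts (0 : Vert d) (R : ℝ),
          clusterDiamGE (aC ω) x ((R : ℝ) / 10) → clusterDiamGE (aC ω) y ((R : ℝ) / 10) →
          ∃ p, IsOpenPath (aC ω) x y p ∧ ∀ v ∈ p, v ∈ cubeVerts (0 : Vert d) ((2 * R : ℕ) : ℝ)})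

/-- Condition **S2**: `u ↦ P^u(0 ∈ C_∞)` is positive and continuous on `I`. -/
def CondS2 {d : ℕ} {Γ : Type*} [MeasurableSpace Γ]
    (P : ℝ → Measure (Config d Γ)) (I : Set ℝ)
    (aC : Config d Γ → Vert d → Vert d → ℝ) : Prop :=
  (∀ u ∈ I, 0 < P u {ω | (0 : Vert d) ∈ Cinf (aC ω)}) ∧
  ContinuousOn (fun u => (P u {ω | (0 : Vert d) ∈ Cinf (aC ω)}).toReal) I

/-- Weighted `p`-th moment `E[X^p w]` (essential supremum of `X` for `p = ∞`). -/
noncomputable def wMoment {Ω : Type*} [MeasurableSpace Ω] (μm : Measure Ω) (p : ℝ≥0∞)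
    (X w : Ω → ℝ≥0∞) : ℝ≥0∞ :=
  if p = ∞ then essSup X μm else ∫⁻ ω, X ω ^ p.toReal * w ω ∂μm

/-- `p_* = p/(p-1)` (with `∞_* = 1`). -/
noncomputable def pstar (p : ℝ≥0∞) : ℝ≥0∞ :=
  if p = ∞ then 1 else ENNReal.ofReal (p.toReal / (p.toReal - 1))

/-- `‖∇η‖_{ℓ^∞(E)}`: the supremum of `|η(y)-η(x)|` over open edges. -/
noncomputable def gradSup {d : ℕ} (a : Vert d → Vert d → ℝ) (η : Vert d → ℝ) : ℝ :=
  sSup {r : ℝ | ∃ x y, openAdj a x y ∧ r = |η y - η x|}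

/-- `exp(-ζ x)` for `x ∈ ℝ≥0∞` (equal to `0` at `x = ∞`). -/
noncomputable def expNegE (ζ : ℝ) (x : ℝ≥0∞) : ℝ≥0∞ :=
  if x = ∞ then 0 else ENNReal.ofReal (Real.exp (-(ζ * x.toReal)))

/-- The `m^ω(n)` factor of the maximal inequality. -/
noncomputable def mBound {d : ℕ} (a : Vert d → Vert d → ℝ) (p q : ℝ≥0∞)
    (phi : Vert d → ℝ) (x0 : Vert d) (n : ℕ) : ℝ :=
  avgNormR p (ballCh a x0 (n : ℝ)) (fun x => max 1 (muA a x)) *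
    avgNormR q (ballCh a x0 (n : ℝ)) (fun x => max 1 (nuA a x)) *
    (1 + avgNormR p (ballCh a x0 (n : ℝ)) (carre a phi fun z => (phi z)⁻¹) * (n : ℝ) ^ 2)

/-- The Caccioppoli estimate with constant `c35` (for the data `a`, `κ`, `h`). -/
def CaccEst {d : ℕ} (a : Vert d → Vert d → ℝ) (κ : Vert d → ℝ) (h : ℝ) (c35 : ℝ) :
    Prop :=
  ∀ B : Set (Vert d), B.Finite → B ⊆ Cinf a →
    (∀ x ∈ B, ∀ y ∈ B, ∃ p, IsOpenPath a x y p ∧ ∀ v ∈ p, v ∈ B) →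
  ∀ η : Vert d → ℝ, (∀ x, η x ∈ Set.Icc (0:ℝ) 1) → (∀ x, η x ≠ 0 → x ∈ B) →
    (∀ x ∈ B, (∃ y, y ∉ B ∧ openAdj a x y) → η x = 0) →
  ∀ u : Vert d → ℝ, (∀ x, 0 ≤ u x) → (∀ x ∈ B, 0 ≤ genL a κ h u x) →
  ∀ phi : Vert d → ℝ, (∀ x, 0 < phi x) →
  ∀ α : ℝ, 1 ≤ α →
    dirichletE a κ h (fun x => η x * (phi x * u x) ^ α) ≤
      c35 * α ^ 2 * ∑' x, (phi x * u x) ^ (2 * α) *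
        (carre a η η x - carreEta a η phi (fun z => (phi z)⁻¹) x)


section
open ProbabilityTheory

/-! ### P0: laws determined by moment generating functions -/

lemma map_eq_of_mgf {Ω Ω' : Type*} {mΩ : MeasurableSpace Ω} {mΩ' : MeasurableSpace Ω'}
    {μ : Measure Ω} {μ' : Measure Ω'} [IsFiniteMeasure μ] [IsFiniteMeasure μ']
    {X : Ω → ℝ} {Y : Ω' → ℝ} (hX : Measurable X) (hY : Measurable Y)
    (hnt : ∀ t : ℝ, Integrable (fun ω => Real.exp (t * X ω)) μ)
    (h : ∀ t, ∫ ω, Real.exp (t * X ω) ∂μ = ∫ ω, Real.exp (t * Y ω) ∂μ') :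
    μ.map X = μ'.map Y := by
  have hXY : mgf X μ = mgf Y μ' := by ext t; exact h t
  have h0 : μ = 0 ↔ μ' = 0 := by
    have := h 0
    simp only [zero_mul, Real.exp_zero, integral_const, smul_eq_mul, mul_one] at this
    rw [← Measure.measure_univ_eq_zero, ← Measure.measure_univ_eq_zero,
      ← measureReal_eq_zero_iff, ← measureReal_eq_zero_iff, this]
  have hu : integrableExpSet X μ = Set.univ := by
    ext t; simp only [Set.mem_univ, iff_true]; exact hnt t
  apply Measure.ext_of_complexMGF_eq hX.aemeasurable hY.aemeasurable
  ext z
  exact eqOn_complexMGF_of_mgf' hXY h0 (by simp [hu])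

lemma ext_of_mgf {ι : Type*} {ν1 ν2 : Measure (ι → ℝ)} [IsFiniteMeasure ν1] [IsFiniteMeasure ν2]
    (hnt : ∀ (s : Finset ι) (c : ι → ℝ),
      Integrable (fun ω => Real.exp (∑ x ∈ s, c x * ω x)) ν1)
    (h : ∀ (s : Finset ι) (c : ι → ℝ), ∫ ω, Real.exp (∑ x ∈ s, c x * ω x) ∂ν1
      = ∫ ω, Real.exp (∑ x ∈ s, c x * ω x) ∂ν2) : ν1 = ν2 := by
  have key : ∀ I : Finset ι, ν2.map I.restrict = ν1.map I.restrict := by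
    intro I
    apply Measure.ext_of_charFunDual
    ext L
    have hm : Measurable (I.restrict : (ι → ℝ) → _) := by fun_prop
    rw [charFunDual_eq_charFun_map_one, charFunDual_eq_charFun_map_one,
      Measure.map_map (by fun_prop) hm, Measure.map_map (by fun_prop) hm]
    congr 1
    set c : ι → ℝ := fun x => if hx : x ∈ I then L (Pi.single ⟨x, hx⟩ 1) else 0
    have e : (fun v => L v) ∘ (I.restrict : (ι → ℝ) → _) = fun ω => ∑ x ∈ I, c x * ω x := by
      ext ω
      simp only [Function.comp]
      conv_lhs => rw [← Finset.univ_sum_single (Finset.restrict I ω)]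
      rw [map_sum, ← Finset.sum_coe_sort I]
      refine Finset.sum_congr rfl fun x _ => ?_
      have : (Pi.single x (Finset.restrict I ω x) : I → ℝ) =
        (ω x) • Pi.single x 1 := by ext y; simp [Pi.single_apply]
      rw [this, map_smul]
      simp [c, mul_comm]
    rw [show (⇑L : _ → ℝ) ∘ (I.restrict : (ι → ℝ) → _) = _ from e]
    have hmm : Measurable fun ω : ι → ℝ => ∑ x ∈ I, c x * ω x := by fun_prop
    have e2 : ∀ t : ℝ, (fun ω : ι → ℝ => Real.exp (t * ∑ x ∈ I, c x * ω x)) =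
        fun ω => Real.exp (∑ x ∈ I, (t * c x) * ω x) := by
      intro t; ext ω; rw [Finset.mul_sum]; simp only [mul_assoc]
    refine (map_eq_of_mgf hmm hmm (fun t => ?_) (fun t => ?_)).symm
    · rw [e2]; exact hnt I _
    · simp_rw [e2]; exact h I _
  have : ∀ i, IsFiniteMeasure ((fun I : Finset ι => ν1.map I.restrict) i) := by
    intro i; dsimp only; infer_instance
  exact IsProjectiveLimit.unique (P := fun I : Finset ι => ν1.map I.restrict) (fun I => rfl) key

/-- centred Gaussian law with covariance `C`. -/
structure GaussLaw {ι : Type*} (ν : Measure (ι → ℝ)) (C : ι → ι → ℝ) : Prop where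
  prob : IsProbabilityMeasure ν
  mgf : ∀ (s : Finset ι) (c : ι → ℝ), ∫ ω, Real.exp (∑ x ∈ s, c x * ω x) ∂ν =
    Real.exp ((∑ x ∈ s, ∑ y ∈ s, c x * c y * C x y) / 2)

namespace GaussLaw
variable {ι : Type*} {ν ν' : Measure (ι → ℝ)} {C : ι → ι → ℝ}

lemma int_exp (h : GaussLaw ν C) (s : Finset ι) (c : ι → ℝ) :
    Integrable (fun ω => Real.exp (∑ x ∈ s, c x * ω x)) ν := by
  by_contra hc
  have := h.mgf s c
  rw [integral_undef hc] at this
  exact (Real.exp_pos _).ne this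

lemma ext (h : GaussLaw ν C) (h' : GaussLaw ν' C) : ν = ν' := by
  have := h.prob
  have := h'.prob
  exact ext_of_mgf h.int_exp fun s c => by rw [h.mgf, h'.mgf]

lemma mgf_mul (h : GaussLaw ν C) (s : Finset ι) (c : ι → ℝ) (t : ℝ) :
    ∫ ω, Real.exp (t * ∑ x ∈ s, c x * ω x) ∂ν =
      Real.exp (t ^ 2 * (∑ x ∈ s, ∑ y ∈ s, c x * c y * C x y) / 2) := by
  have := h.mgf s (fun x => t * c x)
  simp_rw [Finset.mul_sum, ← mul_assoc]
  rw [this]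
  congr 2
  refine Finset.sum_congr rfl fun x _ => Finset.sum_congr rfl fun y _ => ?_
  ring

lemma int_exp_mul (h : GaussLaw ν C) (s : Finset ι) (c : ι → ℝ) (t : ℝ) :
    Integrable (fun ω => Real.exp (t * ∑ x ∈ s, c x * ω x)) ν := by
  have := h.int_exp s (fun x => t * c x)
  simp_rw [Finset.mul_sum, ← mul_assoc]
  exact this

/-- linear images of Gaussian laws -/
lemma map_lin (h : GaussLaw ν C) {κ : Type*} (s : κ → Finset ι) (a : κ → ι → ℝ) :
    GaussLaw (ν.map fun ω k => ∑ x ∈ s k, a k x * ω x)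
      (fun k l => ∑ x ∈ s k, ∑ y ∈ s l, a k x * a l y * C x y) := by
  have := h.prob
  have hm : Measurable fun (ω : ι → ℝ) (k : κ) => ∑ x ∈ s k, a k x * ω x := by
    fun_prop
  refine ⟨Measure.isProbabilityMeasure_map hm.aemeasurable, fun u c => ?_⟩
  rw [integral_map hm.aemeasurable (by
    exact Measurable.aestronglyMeasurable (by fun_prop))]
  set S := u.biUnion s
  set b : ι → ℝ := fun x => ∑ k ∈ u, if x ∈ s k then c k * a k x else 0
  have e : ∀ k ∈ u, ∀ f : ι → ℝ, ∑ x ∈ s k, f x = ∑ x ∈ S, if x ∈ s k then f x else 0 := by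
    intro k hk f
    rw [← Finset.sum_filter]
    congr 1
    ext x
    simp only [Finset.mem_filter, S, Finset.mem_biUnion]
    exact ⟨fun h => ⟨⟨k, hk, h⟩, h⟩, fun h => h.2⟩
  have e1 : ∀ ω : ι → ℝ, ∑ k ∈ u, c k * ∑ x ∈ s k, a k x * ω x = ∑ x ∈ S, b x * ω x := by
    intro ω
    simp only [b, Finset.sum_mul]
    rw [Finset.sum_comm]
    refine Finset.sum_congr rfl fun k hk => ?_
    rw [e k hk, Finset.mul_sum]
    refine Finset.sum_congr rfl fun x _ => ?_
    split_ifs <;> ring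
  simp_rw [e1]
  rw [h.mgf]
  congr 2
  have e2 : ∀ k ∈ u, ∀ l ∈ u, c k * c l * ∑ x ∈ s k, ∑ y ∈ s l, a k x * a l y * C x y =
      ∑ x ∈ S, ∑ y ∈ S, (if x ∈ s k then c k * a k x else 0) *
        (if y ∈ s l then c l * a l y else 0) * C x y := by
    intro k hk l hl
    rw [e k hk, Finset.mul_sum]
    refine Finset.sum_congr rfl fun x _ => ?_
    split_ifs
    · rw [e l hl, Finset.mul_sum]
      refine Finset.sum_congr rfl fun y _ => ?_
      split_ifs <;> ring
    · simp
  rw [Finset.sum_congr rfl fun k hk => Finset.sum_congr rfl fun l hl => e2 k hk l hl]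
  have e3 : ∀ x y, b x * b y * C x y = ∑ k ∈ u, ∑ l ∈ u, (if x ∈ s k then c k * a k x else 0) *
        (if y ∈ s l then c l * a l y else 0) * C x y := by
    intro x y
    simp only [b]
    rw [Finset.sum_mul_sum, Finset.sum_mul]
    exact Finset.sum_congr rfl fun k _ => Finset.sum_mul _ _ _
  simp only [e3]
  rw [Finset.sum_congr rfl fun x _ => Finset.sum_comm, Finset.sum_comm]
  refine Finset.sum_congr rfl fun k _ => ?_
  rw [Finset.sum_congr rfl fun x _ => Finset.sum_comm, Finset.sum_comm]

/-- Chernoff bound -/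
lemma tail (h : GaussLaw ν C) (s : Finset ι) (c : ι → ℝ) {v r : ℝ} (hv : 0 < v) (hr : 0 ≤ r)
    (hC : ∑ x ∈ s, ∑ y ∈ s, c x * c y * C x y ≤ v) :
    ν.real {ω | r ≤ ∑ x ∈ s, c x * ω x} ≤ Real.exp (-(r ^ 2 / (2 * v))) := by
  have := h.prob
  have h1 := measure_ge_le_exp_mul_mgf (μ := ν) (X := fun ω : ι → ℝ => ∑ x ∈ s, c x * ω x) r
    (t := r / v) (by positivity) (h.int_exp_mul s c _)
  refine h1.trans ?_
  rw [ProbabilityTheory.mgf, h.mgf_mul, ← Real.exp_add]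
  apply Real.exp_le_exp.2
  have : (r / v) ^ 2 * (∑ x ∈ s, ∑ y ∈ s, c x * c y * C x y) / 2 ≤ (r / v) ^ 2 * v / 2 := by
    gcongr
  refine (add_le_add_right this _).trans (le_of_eq ?_)
  field_simp
  ring

end GaussLaw
end

section
open ProbabilityTheory

/-! ### P2: Cameron-Martin -/
namespace GaussLaw
variable {ι : Type*} {ν ν' : Measure (ι → ℝ)} {C : ι → ι → ℝ}

lemma cm_measure (h : GaussLaw ν C) (hsymm : ∀ x y, C x y = C y x) (s : Finset ι) (u : ι → ℝ)
    (hu : ∀ x, x ∉ s → u x = 0) (a : ι → ℝ) (ha : ∀ y, a y = ∑ x ∈ s, u x * C x y) :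
    ν.map (fun ω => ω + a) = ν.withDensity (fun ω => ENNReal.ofReal
      (Real.exp (∑ x ∈ s, u x * ω x - (∑ x ∈ s, u x * a x) / 2))) := by
  have := h.prob
  have hm : Measurable fun ω : ι → ℝ => ω + a := by fun_prop
  have hd : Measurable fun ω : ι → ℝ =>
      Real.exp (∑ x ∈ s, u x * ω x - (∑ x ∈ s, u x * a x) / 2) := by fun_prop
  have hint0 : Integrable (fun ω : ι → ℝ =>
      Real.exp (∑ x ∈ s, u x * ω x - (∑ x ∈ s, u x * a x) / 2)) ν := by
    simp_rw [Real.exp_sub]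
    exact (h.int_exp s u).div_const _
  have : IsFiniteMeasure (ν.withDensity (fun ω => ENNReal.ofReal
      (Real.exp (∑ x ∈ s, u x * ω x - (∑ x ∈ s, u x * a x) / 2)))) :=
    isFiniteMeasure_withDensity_ofReal hint0.2
  have hme : ∀ (r : Finset ι) (c : ι → ℝ), Measurable fun ω : ι → ℝ =>
    Real.exp (∑ x ∈ r, c x * ω x) := by intro r c; fun_prop
  have he : ∀ (r : Finset ι) (c : ι → ℝ) (ω : ι → ℝ), Real.exp (∑ x ∈ r, c x * (ω + a) x) =
    Real.exp (∑ x ∈ r, c x * ω x) * Real.exp (∑ x ∈ r, c x * a x) := by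
    intro r c ω
    rw [← Real.exp_add, ← Finset.sum_add_distrib]
    simp [mul_add]
  have := Measure.isProbabilityMeasure_map (μ := ν) hm.aemeasurable
  refine ext_of_mgf (fun r c => ?_) (fun r c => ?_)
  · rw [integrable_map_measure (hme r c).aestronglyMeasurable hm.aemeasurable]
    simp only [Function.comp_def, he]
    exact (h.int_exp r c).mul_const _
  · rw [integral_map hm.aemeasurable (hme r c).aestronglyMeasurable,
      integral_withDensity_eq_integral_toReal_smul hd.ennreal_ofReal (by simp)]
    simp only [he, integral_mul_const, h.mgf, smul_eq_mul, ENNReal.toReal_ofReal (Real.exp_pos _).le]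
    set c' : ι → ℝ := fun x => if x ∈ r then c x else 0
    set S := s ∪ r
    have e1 : ∀ f : ι → ℝ, ∑ x ∈ r, c x * f x = ∑ x ∈ S, c' x * f x := by
      intro f
      rw [← Finset.sum_subset (s₁ := r) (Finset.subset_union_right)]
      · exact Finset.sum_congr rfl fun x hx => by simp [c', hx]
      · intro x _ hx; simp [c', hx]
    have e2 : ∀ f : ι → ℝ, ∑ x ∈ s, u x * f x = ∑ x ∈ S, u x * f x := by
      intro f
      rw [← Finset.sum_subset (s₁ := s) (Finset.subset_union_left)]
      intro x _ hx; simp [hu x hx]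
    have e3 : ∀ (p q : Finset ι) (f g : ι → ℝ), ∑ x ∈ p, ∑ y ∈ q, f x * g y * C x y =
        ∑ x ∈ p, f x * ∑ y ∈ q, g y * C x y := by
      intro p q f g
      simp only [Finset.mul_sum, mul_assoc]
    have e4 : ∀ ω : ι → ℝ, Real.exp (∑ x ∈ s, u x * ω x - (∑ x ∈ s, u x * a x) / 2) *
        Real.exp (∑ x ∈ r, c x * ω x) =
        Real.exp (∑ x ∈ S, (u x + c' x) * ω x) * Real.exp (-(∑ x ∈ S, u x * a x) / 2) := by
      intro ω
      rw [e1, e2, e2, ← Real.exp_add, ← Real.exp_add]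
      congr 1
      simp only [add_mul, Finset.sum_add_distrib]
      ring
    simp only [e4, integral_mul_const, h.mgf]
    rw [← Real.exp_add, ← Real.exp_add]
    congr 1
    have e5 : ∀ x, ∑ y ∈ S, u y * C x y = a x := by
      intro x
      rw [ha, e2]
      exact Finset.sum_congr rfl fun y _ => by rw [hsymm]
    have e6 : ∀ x, ∑ y ∈ S, (u y + c' y) * C x y = a x + ∑ y ∈ S, c' y * C x y := by
      intro x
      simp only [add_mul, Finset.sum_add_distrib, e5]
    have e7 : ∑ x ∈ S, u x * ∑ y ∈ S, c' y * C x y = ∑ x ∈ S, c' x * a x := by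
      simp only [← e5, Finset.mul_sum]
      rw [Finset.sum_comm]
      refine Finset.sum_congr rfl fun x _ => Finset.sum_congr rfl fun y _ => ?_
      rw [hsymm]; ring
    rw [e3, e3]
    simp only [e6]
    simp only [e1, add_mul, mul_add, Finset.sum_add_distrib, e7]
    ring

lemma cm_apply (h : GaussLaw ν C) (hsymm : ∀ x y, C x y = C y x) (s : Finset ι) (u : ι → ℝ)
    (hu : ∀ x, x ∉ s → u x = 0) (a : ι → ℝ) (ha : ∀ y, a y = ∑ x ∈ s, u x * C x y)
    {A : Set (ι → ℝ)} (hA : MeasurableSet A) (t : ℝ) :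
    ν.real {ω | ω + t • a ∈ A} = Real.exp (-(t ^ 2 * (∑ x ∈ s, u x * a x)) / 2) *
      ProbabilityTheory.mgf (fun ω => ∑ x ∈ s, u x * ω x) (ν.restrict A) t := by
  have := h.prob
  have hm : Measurable fun ω : ι → ℝ => ω + t • a := by fun_prop
  have h1 := h.cm_measure hsymm s (fun x => t * u x) (fun x hx => by simp [hu x hx]) (t • a)
    (fun y => by simp [ha, Finset.mul_sum, mul_assoc])
  have h2 : ν.real {ω | ω + t • a ∈ A} = (ν.map fun ω => ω + t • a).real A := by
    rw [map_measureReal_apply hm hA]; rfl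
  rw [h2, h1, measureReal_def, withDensity_apply _ hA, ProbabilityTheory.mgf,
    ← integral_eq_lintegral_of_nonneg_ae (ae_of_all _ fun _ => (Real.exp_pos _).le)
      (Measurable.aestronglyMeasurable (by fun_prop)), ← integral_const_mul]
  congr 1
  ext ω
  rw [← Real.exp_add]
  congr 1
  simp only [Finset.mul_sum, Pi.smul_apply, smul_eq_mul, Finset.sum_div, neg_div,
    ← Finset.sum_neg_distrib, ← Finset.sum_add_distrib, ← Finset.sum_sub_distrib]
  refine Finset.sum_congr rfl fun x _ => ?_
  ring

lemma int_exp_restrict (h : GaussLaw ν C) (s : Finset ι) (u : ι → ℝ) (A : Set (ι → ℝ)) :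
    integrableExpSet (fun ω => ∑ x ∈ s, u x * ω x) (ν.restrict A) = Set.univ := by
  ext t
  simp only [Set.mem_univ, iff_true]
  exact (h.int_exp_mul s u t).restrict

lemma memLp (h : GaussLaw ν C) (s : Finset ι) (u : ι → ℝ) (p : NNReal) :
    MemLp (fun ω => ∑ x ∈ s, u x * ω x) p ν :=
  memLp_of_mem_interior_integrableExpSet (by
    have := h.int_exp_restrict s u Set.univ
    rw [Measure.restrict_univ] at this
    simp [this]) p

lemma cm_deriv (h : GaussLaw ν C) (hsymm : ∀ x y, C x y = C y x) (s : Finset ι) (u : ι → ℝ)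
    (hu : ∀ x, x ∉ s → u x = 0) (a : ι → ℝ) (ha : ∀ y, a y = ∑ x ∈ s, u x * C x y)
    {A : Set (ι → ℝ)} (hA : MeasurableSet A) :
    HasDerivAt (fun t : ℝ => ν.real {ω | ω + t • a ∈ A})
      (∫ ω in A, (∑ x ∈ s, u x * ω x) ∂ν) 0 := by
  have e : (fun t : ℝ => ν.real {ω | ω + t • a ∈ A}) = _ :=
    funext fun t => h.cm_apply hsymm s u hu a ha hA t
  rw [e]
  have h1 : HasDerivAt (ProbabilityTheory.mgf (fun ω => ∑ x ∈ s, u x * ω x) (ν.restrict A))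
      (∫ ω in A, (∑ x ∈ s, u x * ω x) ∂ν) 0 := by
    have := hasDerivAt_mgf (X := fun ω => ∑ x ∈ s, u x * ω x) (μ := ν.restrict A) (t := 0)
      (by simp [h.int_exp_restrict s u A])
    simpa using this
  have h2 : HasDerivAt (fun t : ℝ => Real.exp (-(t ^ 2 * (∑ x ∈ s, u x * a x)) / 2)) 0 0 := by
    have h0 : HasDerivAt (fun t : ℝ => -(t ^ 2 * (∑ x ∈ s, u x * a x)) / 2) 0 0 := by
      have := (((hasDerivAt_pow 2 (0:ℝ)).mul_const (∑ x ∈ s, u x * a x)).fun_neg).div_const 2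
      simpa using this
    simpa using h0.exp
  have h3 := h2.mul h1
  simp only [zero_mul, zero_add, ne_eq, OfNat.ofNat_ne_zero, not_false_eq_true, zero_pow, neg_zero,
    zero_div, Real.exp_zero, one_mul] at h3
  exact h3

end GaussLaw
end

section
/-! ### P1: simple random walk -/
section SRW
variable {d : ℕ}

/-- unit vectors -/
def ev (p : Fin d × Bool) : Vert d := Pi.single p.1 (if p.2 then 1 else -1)

lemma ev_inj : Function.Injective (ev (d := d)) := by
  intro p q h
  have h1 : p.1 = q.1 := by
    by_contra hne
    have := congrFun h p.1
    simp only [ev, Pi.single_eq_same, Pi.single_eq_of_ne hne] at this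
    split_ifs at this <;> simp at this
  have h2 := congrFun h p.1
  simp only [ev, Pi.single_eq_same, h1] at h2
  refine Prod.ext h1 ?_
  revert h2
  cases p.2 <;> cases q.2 <;> simp

lemma nbrs_eq (x : Vert d) : nbrs x = Finset.univ.image fun p => x + ev p := by
  unfold nbrs
  congr 1
  ext p i
  by_cases h : i = p.1
  · subst h; simp [ev]
  · simp [ev, h]

lemma sum_nbrs {M : Type*} [AddCommMonoid M] (x : Vert d) (f : Vert d → M) :
    ∑ z ∈ nbrs x, f z = ∑ p, f (x + ev p) := by
  rw [nbrs_eq, Finset.sum_image]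
  intro p _ q _ h
  exact ev_inj (add_left_cancel h)

lemma mem_nbrs {x y : Vert d} : y ∈ nbrs x ↔ ∃ p, y = x + ev p := by
  rw [nbrs_eq]; simp [eq_comm]

lemma neg_ev (p : Fin d × Bool) : -ev p = ev (p.1, !p.2) := by
  ext i
  by_cases h : i = p.1
  · subst h; cases hb : p.2 <;> simp [ev, hb]
  · simp [ev, h]

lemma adj_iff {x y : Vert d} : adj x y ↔ ∃ p, y = x + ev p := by
  constructor
  · intro h
    unfold adj at h
    have : ∃ i, (x i - y i).natAbs ≠ 0 := by
      by_contra hc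
      push Not at hc
      rw [Finset.sum_eq_zero fun i _ => hc i] at h
      exact zero_ne_one h
    obtain ⟨i, hi⟩ := this
    rw [← Finset.add_sum_erase _ _ (Finset.mem_univ i)] at h
    have h1 : (x i - y i).natAbs = 1 := by omega
    have h2 : ∑ j ∈ Finset.univ.erase i, (x j - y j).natAbs = 0 := by omega
    have h3 : ∀ j, j ≠ i → y j = x j := by
      intro j hj
      have := Finset.sum_eq_zero_iff.1 h2 j (by simp [hj])
      omega
    refine ⟨(i, decide (y i = x i + 1)), ?_⟩
    ext j
    by_cases hj : j = i
    · subst hj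
      simp only [ev, Pi.add_apply, Pi.single_eq_same, decide_eq_true_eq]
      split_ifs <;> omega
    · simp [ev, hj, h3 j hj]
  · rintro ⟨p, rfl⟩
    unfold adj
    rw [Finset.sum_eq_single p.1]
    · simp only [ev, Pi.add_apply, Pi.single_eq_same]; split_ifs <;> simp
    · intro j _ hj; simp [ev, hj]
    · simp

lemma adj_symm {x y : Vert d} (h : adj x y) : adj y x := by
  obtain ⟨p, rfl⟩ := adj_iff.1 h
  exact adj_iff.2 ⟨(p.1, !p.2), by rw [← neg_ev]; simp⟩

lemma adj_iff_nbrs {x y : Vert d} : adj x y ↔ y ∈ nbrs x := by rw [adj_iff, mem_nbrs]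

/-- transition probabilities -/
noncomputable def pn (n : ℕ) (x y : Vert d) : ℝ := (nStepCount d n x y : ℝ) / (2 * d : ℝ) ^ n

lemma pn_zero (x y : Vert d) : pn 0 x y = if x = y then 1 else 0 := by
  simp [pn, nStepCount]

lemma pn_nonneg (n : ℕ) (x y : Vert d) : 0 ≤ pn n x y := by unfold pn; positivity

lemma pn_succ (n : ℕ) (x y : Vert d) :
    pn (n + 1) x y = (∑ p, pn n (x + ev p) y) / (2 * d) := by
  simp only [pn, nStepCount]
  push_cast
  rw [sum_nbrs x (fun z => (nStepCount d n z y : ℝ)), ← Finset.sum_div, pow_succ, div_div]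

lemma pn_add (n : ℕ) (x y z : Vert d) : pn n (x + z) (y + z) = pn n x y := by
  induction n generalizing x with
  | zero => simp [pn_zero]
  | succ n ih => 
    simp only [pn_succ]
    congr 1
    refine Finset.sum_congr rfl fun p _ => ?_
    rw [← ih]; congr 1; abel

lemma sum_neg_ev (f : Vert d → ℝ) : ∑ p, f (-ev p) = ∑ p : Fin d × Bool, f (ev p) := by
  simp only [neg_ev]
  exact Fintype.sum_equiv (Equiv.prodCongr (Equiv.refl _) Equiv.boolNot) _ _ fun p => rfl

lemma pn_succ' (n : ℕ) (x y : Vert d) :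
    pn (n + 1) x y = (∑ p, pn n x (y + ev p)) / (2 * d) := by
  rw [pn_succ]
  congr 1
  rw [← sum_neg_ev fun v => pn n x (y + v)]
  refine Finset.sum_congr rfl fun p _ => ?_
  rw [← pn_add n x (y + -ev p) (ev p)]
  congr 1; abel

lemma pn_symm (n : ℕ) (x y : Vert d) : pn n x y = pn n y x := by
  induction n generalizing x y with
  | zero => simp [pn_zero, eq_comm]
  | succ n ih => 
    rw [pn_succ, pn_succ']
    simp only [ih y]

/-- finite boxes -/
noncomputable def box (x : Vert d) (R : ℕ) : Finset (Vert d) :=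
  Finset.Icc (fun i => x i - R) (fun i => x i + R)

lemma mem_box {x y : Vert d} {R : ℕ} : y ∈ box x R ↔ ∀ i, (y i - x i).natAbs ≤ R := by
  simp only [box, Finset.mem_Icc, Pi.le_def]
  constructor
  · rintro ⟨h1, h2⟩ i; have := h1 i; have := h2 i; omega
  · intro h; exact ⟨fun i => by have := h i; omega, fun i => by have := h i; omega⟩

lemma mem_box_iff {x y : Vert d} {R : ℕ} : y ∈ box x R ↔ linfDist x y ≤ R := by
  rw [mem_box, linfDist, Finset.sup_le_iff]
  simp only [Finset.mem_univ, forall_const]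
  exact forall_congr' fun i => by omega

lemma card_box (x : Vert d) (R : ℕ) : (box x R).card = (2 * R + 1) ^ d := by
  rw [box, Pi.card_Icc]
  simp only [Int.card_Icc]
  rw [Finset.prod_congr rfl (g := fun _ => 2 * R + 1) fun i _ => by omega]
  simp

lemma ev_natAbs (p : Fin d × Bool) (i : Fin d) : (ev p i).natAbs ≤ 1 := by
  by_cases h : i = p.1
  · subst h; simp only [ev, Pi.single_eq_same]; split_ifs <;> simp
  · simp [ev, h]

lemma pn_range {n : ℕ} {x y : Vert d} (h : y ∉ box x n) : pn n x y = 0 := by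
  induction n generalizing x with
  | zero => 
    rw [pn_zero, if_neg]
    rintro rfl
    exact h (mem_box.2 fun i => by simp)
  | succ n ih => 
    rw [pn_succ, Finset.sum_eq_zero, zero_div]
    intro p _
    apply ih
    intro h2
    apply h
    rw [mem_box] at h2 ⊢
    intro i
    have := h2 i
    have := ev_natAbs p i
    simp only [Pi.add_apply] at *
    omega

lemma sum_const_ev (hd : 0 < d) (c : ℝ) : (∑ _p : Fin d × Bool, c) / (2 * d) = c := by
  have : (d : ℝ) ≠ 0 := by positivity
  simp only [Finset.sum_const, Finset.card_univ, Fintype.card_prod, Fintype.card_fin,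
    Fintype.card_bool, nsmul_eq_mul]
  push_cast
  field_simp

/-- Chapman-Kolmogorov over a finite set containing the range -/
lemma pn_ck (m n : ℕ) (x y : Vert d) (S : Finset (Vert d)) (hS : box x m ⊆ S) :
    pn (m + n) x y = ∑ z ∈ S, pn m x z * pn n z y := by
  induction m generalizing x with
  | zero => 
    have hx : x ∈ S := hS (mem_box.2 fun i => by simp)
    simp [pn_zero, hx]
  | succ m ih => 
    have h1 : ∀ p : Fin d × Bool, box (x + ev p) m ⊆ S := by
      intro p z hz
      apply hS
      rw [mem_box] at hz ⊢
      intro i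
      have := hz i
      have := ev_natAbs p i
      simp only [Pi.add_apply] at *
      omega
    rw [show m + 1 + n = (m + n) + 1 by ring, pn_succ]
    simp only [fun p => ih (x + ev p) (h1 p), pn_succ m x]
    rw [Finset.sum_comm, Finset.sum_div]
    refine Finset.sum_congr rfl fun z _ => ?_
    rw [← Finset.sum_mul]; ring

lemma pn_sum_le (hd : 0 < d) (n : ℕ) (x : Vert d) (S : Finset (Vert d)) :
    ∑ y ∈ S, pn n x y ≤ 1 := by
  induction n generalizing x with
  | zero => 
    simp only [pn_zero, Finset.sum_ite_eq]
    split_ifs <;> norm_num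
  | succ n ih => 
    simp only [pn_succ]
    rw [← Finset.sum_div, Finset.sum_comm, ← sum_const_ev hd 1]
    gcongr
    exact ih _

lemma pn_le_one (hd : 0 < d) (n : ℕ) (x y : Vert d) : pn n x y ≤ 1 := by
  have := pn_sum_le hd n x {y}
  simpa using this

/-- off-diagonal exponential bound -/
lemma pn_offdiag (hd : 0 < d) (n : ℕ) (x y : Vert d) (i : Fin d) (l : ℝ) :
    pn n x y ≤ Real.exp (l * (x i - y i) + n * l ^ 2 / 2) := by
  induction n generalizing x with
  | zero => 
    rw [pn_zero]
    split_ifs with h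
    · subst h; simp
    · positivity
  | succ n ih => 
    rw [pn_succ]
    have h1 : ∀ p : Fin d × Bool, pn n (x + ev p) y ≤
        Real.exp (l * (x i - y i) + n * l ^ 2 / 2) * Real.exp (l * (ev p i : ℤ)) := by
      intro p
      refine (ih _).trans (le_of_eq ?_)
      rw [← Real.exp_add]; congr 1; simp only [Pi.add_apply]; push_cast; ring
    have h2 : (∑ p : Fin d × Bool, Real.exp (l * (ev p i : ℤ))) ≤
        ∑ p : Fin d × Bool, Real.exp (l ^ 2 / 2) := by
      rw [Fintype.sum_prod_type, Fintype.sum_prod_type]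
      refine Finset.sum_le_sum fun j _ => ?_
      simp only [Fintype.sum_bool]
      by_cases hj : i = j
      · subst hj
        have := Real.cosh_le_exp_half_sq l
        rw [Real.cosh_eq] at this
        simp only [ev, Pi.single_eq_same, if_true]
        simp
        linarith
      · simp only [ev, Pi.single_eq_of_ne hj]
        have : 1 ≤ Real.exp (l ^ 2 / 2) := Real.one_le_exp (by positivity)
        simp
        linarith
    calc (∑ p, pn n (x + ev p) y) / (2 * d) ≤ (∑ p : Fin d × Bool, 
          Real.exp (l * (x i - y i) + n * l ^ 2 / 2) * Real.exp (l * (ev p i : ℤ))) / (2 * d) := by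
          gcongr; exact h1 _
      _ ≤ (∑ p : Fin d × Bool, 
          Real.exp (l * (x i - y i) + n * l ^ 2 / 2) * Real.exp (l ^ 2 / 2)) / (2 * d) := by
          rw [← Finset.mul_sum, ← Finset.mul_sum]; gcongr
      _ = _ := by
          rw [sum_const_ev hd, ← Real.exp_add]; congr 1; push_cast; ring

end SRW
end

section
section Heat
variable {d : ℕ}

/-- uniform law on the circle -/
noncomputable def circ : Measure ℝ := (ENNReal.ofReal (2 * Real.pi))⁻¹ •
  (volume.restrict (Set.Ioc (-Real.pi) Real.pi))

lemma circ_integral {E : Type*} [NormedAddCommGroup E] [NormedSpace ℝ E] (f : ℝ → E) :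
    ∫ θ, f θ ∂circ = (2 * Real.pi)⁻¹ • ∫ θ in (-Real.pi)..Real.pi, f θ := by
  rw [circ, integral_smul_measure, intervalIntegral.integral_of_le (by linarith [Real.pi_pos])]
  congr 1
  rw [ENNReal.toReal_inv, ENNReal.toReal_ofReal (by positivity)]

instance : IsProbabilityMeasure circ := by
  constructor
  rw [circ, Measure.smul_apply, Measure.restrict_apply_univ, Real.volume_Ioc, smul_eq_mul,
    show Real.pi - -Real.pi = 2 * Real.pi by ring]
  apply ENNReal.inv_mul_cancel
  · have := Real.pi_pos; simp only [ne_eq, ofReal_eq_zero, not_le]; positivity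
  · exact ENNReal.ofReal_ne_top

lemma circ_exp (k : ℤ) : ∫ θ, Complex.exp (Complex.I * (k * θ : ℝ)) ∂circ = if k = 0 then 1 else 0 := by
  rw [circ_integral]
  split_ifs with h
  · subst h
    simp
    field_simp
    norm_cast
  · have h1 : Complex.I * k ≠ 0 := by simp [h]
    have := integral_exp_mul_complex (a := -Real.pi) (b := Real.pi) h1
    have e : ∀ θ : ℝ, Complex.exp (Complex.I * (k * θ : ℝ)) = Complex.exp (Complex.I * k * θ) := by
      intro θ; congr 1; push_cast; ring
    simp only [e]
    rw [this]
    have e2 : Complex.exp (Complex.I * k * (Real.pi : ℝ)) =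
        Complex.exp (Complex.I * k * ((-Real.pi : ℝ) : ℂ)) := by
      rw [Complex.exp_eq_exp_iff_exists_int]
      exact ⟨k, by push_cast; ring⟩
    rw [e2]; simp

/-- The torus measure -/
noncomputable def torus (d : ℕ) : Measure (Fin d → ℝ) := Measure.pi fun _ => circ

instance : IsProbabilityMeasure (torus d) := by unfold torus; infer_instance

lemma torus_int {f : (Fin d → ℝ) → ℝ} (hf : Continuous f) (B : ℝ) (hB : ∀ θ, |f θ| ≤ B) :
    Integrable f (torus d) :=
  Integrable.of_bound hf.aestronglyMeasurable B (ae_of_all _ fun θ => by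
    rw [Real.norm_eq_abs]; exact hB θ)

lemma torus_cos (z : Vert d) : ∫ θ, Real.cos (∑ i, z i * θ i) ∂torus d = if z = 0 then 1 else 0 := by
  have h1 : ∫ θ, Complex.exp (Complex.I * (∑ i, z i * θ i : ℝ)) ∂torus d =
      if z = 0 then 1 else 0 := by
    have e : ∀ θ : Fin d → ℝ, Complex.exp (Complex.I * (∑ i, z i * θ i : ℝ)) =
        ∏ i, Complex.exp (Complex.I * (z i * θ i : ℝ)) := by
      intro θ; rw [← Complex.exp_sum]; congr 1; push_cast; rw [Finset.mul_sum]
    simp only [e]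
    rw [torus, integral_fintype_prod_eq_prod (𝕜 := ℂ)
      (f := fun i (x : ℝ) => Complex.exp (Complex.I * (z i * x : ℝ)))]
    simp only [circ_exp]
    split_ifs with h
    · subst h; simp
    · obtain ⟨i, hi⟩ := Function.ne_iff.1 h
      exact Finset.prod_eq_zero (Finset.mem_univ i) (by simp only [Pi.zero_apply] at hi; simp [hi])
  have h2 := congrArg Complex.re h1
  have hnt : Integrable (fun θ : Fin d → ℝ => Complex.exp (Complex.I * (∑ i, z i * θ i : ℝ)))
      (torus d) := by
    refine Integrable.of_bound (Continuous.aestronglyMeasurable (by fun_prop)) 1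
      (ae_of_all _ fun θ => ?_)
    rw [mul_comm, Complex.norm_exp_ofReal_mul_I]
  rw [← RCLike.re_to_complex, ← integral_re hnt] at h2
  convert h2 using 1
  · congr 1
    ext θ
    rw [mul_comm, RCLike.re_to_complex, Complex.exp_ofReal_mul_I_re]
  · split_ifs <;> simp

/-- symbol of the walk -/
noncomputable def symb (θ : Fin d → ℝ) : ℝ := (∑ i, Real.cos (θ i)) / d

lemma pn_fourier (hd : 0 < d) (n : ℕ) (x y : Vert d) :
    pn n x y = ∫ θ, Real.cos (∑ i, (x i - y i : ℤ) * θ i) * symb θ ^ n ∂torus d := by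
  induction n generalizing x with
  | zero => 
    have := torus_cos (x - y)
    rw [if_congr sub_eq_zero rfl rfl] at this
    simp only [Pi.sub_apply] at this
    simp only [pn_zero, pow_zero, mul_one, this]
  | succ n ih => 
    rw [pn_succ]
    simp only [ih]
    rw [← integral_finsetSum, ← integral_div]
    · congr 1
      ext θ
      rw [← Finset.sum_mul, Fintype.sum_prod_type]
      have e : ∀ j : Fin d, ∑ b : Bool, Real.cos (∑ i, ((x + ev (j, b)) i - y i : ℤ) * θ i) =
          2 * Real.cos (∑ i, (x i - y i : ℤ) * θ i) * Real.cos (θ j) := by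
        intro j
        have e2 : ∀ b : Bool, ∑ i, (((x + ev (j, b)) i - y i : ℤ) : ℝ) * θ i =
          (∑ i, (x i - y i : ℤ) * θ i) + (if b then 1 else -1) * θ j := by
          intro b
          have : (if b then (1:ℝ) else -1) * θ j = ∑ i, ((ev (j, b) i : ℤ) : ℝ) * θ i := by
            rw [Finset.sum_eq_single j]
            · simp [ev]
            · intro i _ hi; simp [ev, hi]
            · simp
          rw [this, ← Finset.sum_add_distrib]
          refine Finset.sum_congr rfl fun i _ => ?_
          simp only [Pi.add_apply]; push_cast; ring
        rw [Fintype.sum_bool, e2, e2]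
        simp only [if_true, Bool.false_eq_true, if_false, one_mul, neg_mul, Real.cos_add,
          Real.cos_neg, Real.sin_neg]
        ring
      simp only [e, ← Finset.mul_sum]
      rw [symb, pow_succ]
      have : (d : ℝ) ≠ 0 := by positivity
      field_simp
    · intro p _
      refine torus_int (by unfold symb; fun_prop) 1 fun θ => ?_
      rw [abs_mul, abs_pow]
      have h1 : |symb θ| ≤ 1 := by
        rw [symb, abs_div, Nat.abs_cast, div_le_one (by positivity)]
        calc |∑ i, Real.cos (θ i)| ≤ ∑ i : Fin d, |Real.cos (θ i)| := Finset.abs_sum_le_sum_abs _ _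
          _ ≤ ∑ i : Fin d, 1 := Finset.sum_le_sum fun i _ => Real.abs_cos_le_one _
          _ = d := by simp
      calc _ ≤ 1 * 1 := mul_le_mul (Real.abs_cos_le_one _) (pow_le_one₀ (abs_nonneg _) h1)
            (by positivity) zero_le_one
        _ = 1 := by ring

lemma abs_symb_le (hd : 0 < d) (θ : Fin d → ℝ) :
    |symb θ| ≤ Real.exp (-(∑ i, Real.sin (θ i) ^ 2) / (2 * d)) := by
  have h : ∀ t : ℝ, |Real.cos t| ≤ 1 - Real.sin t ^ 2 / 2 := by
    intro t
    apply abs_le_of_sq_le_sq' _ _ |> abs_le.2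
    · have := Real.sin_sq_add_cos_sq t
      nlinarith [sq_nonneg (Real.sin t)]
    · nlinarith [Real.sin_sq_add_cos_sq t, sq_nonneg (Real.cos t)]
  calc |symb θ| ≤ (∑ i : Fin d, |Real.cos (θ i)|) / d := by
        rw [symb, abs_div, Nat.abs_cast]; gcongr; exact Finset.abs_sum_le_sum_abs _ _
    _ ≤ (∑ i : Fin d, (1 - Real.sin (θ i) ^ 2 / 2)) / d := by gcongr; exact h _
    _ = -(∑ i, Real.sin (θ i) ^ 2) / (2 * d) + 1 := by
        rw [Finset.sum_sub_distrib, ← Finset.sum_div]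
        have : (d : ℝ) ≠ 0 := by positivity
        simp; field_simp; ring
    _ ≤ _ := Real.add_one_le_exp _

lemma circ_bound (a : ℝ) (ha : 0 < a) :
    ∫ θ, Real.exp (-(a * Real.sin θ ^ 2)) ∂circ ≤ 3 / Real.sqrt a := by
  rw [circ_integral, intervalIntegral.integral_of_le (by linarith [Real.pi_pos])]
  set b := a * (4 / Real.pi ^ 2)
  have hpi := Real.pi_pos
  have hb : 0 < b := by positivity
  have hg := integrable_exp_neg_mul_sq hb
  have hI : ∀ c : ℝ, Integrable fun x : ℝ => Real.exp (-b * (x - c) ^ 2) := fun c =>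
    hg.comp_sub_right c
  have hE : ∀ c : ℝ, ∫ x : ℝ, Real.exp (-b * (x - c) ^ 2) = Real.sqrt (Real.pi / b) := by
    intro c
    rw [integral_sub_right_eq_self (fun x : ℝ => Real.exp (-b * x ^ 2)), integral_gaussian]
  have key : ∀ c x : ℝ, |x - c| ≤ Real.pi / 2 → Real.sin x ^ 2 = Real.sin (x - c) ^ 2 →
      Real.exp (-(a * Real.sin x ^ 2)) ≤ Real.exp (-b * (x - c) ^ 2) := by
    intro c x h1 h2
    rw [h2]
    apply Real.exp_le_exp.2
    have h3 : 2 / Real.pi * |x - c| ≤ Real.sin |x - c| := Real.mul_le_sin (abs_nonneg _) h1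
    have h4 : (2 / Real.pi * |x - c|) ^ 2 ≤ Real.sin (x - c) ^ 2 := by
      have : Real.sin (x - c) ^ 2 = Real.sin |x - c| ^ 2 := by
        rcases abs_choice (x - c) with h | h <;> rw [h]
        rw [Real.sin_neg]; ring
      rw [this]; gcongr
    rw [mul_pow, sq_abs] at h4
    simp only [b]
    have := mul_le_mul_of_nonneg_left h4 ha.le
    have e : a * ((2 / Real.pi) ^ 2 * (x - c) ^ 2) = a * (4 / Real.pi ^ 2) * (x - c) ^ 2 := by ring
    linarith
  have hle : ∫ θ in Set.Ioc (-Real.pi) Real.pi, Real.exp (-(a * Real.sin θ ^ 2)) ≤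
      3 * Real.sqrt (Real.pi / b) := by
    calc _ ≤ ∫ θ in Set.Ioc (-Real.pi) Real.pi, (Real.exp (-b * (θ - 0) ^ 2) +
          Real.exp (-b * (θ - Real.pi) ^ 2) + Real.exp (-b * (θ - (-Real.pi)) ^ 2)) := by
          apply setIntegral_mono_on
          · exact (Continuous.integrableOn_Icc (by fun_prop)).mono_set Set.Ioc_subset_Icc_self
          · exact (((hI _).add (hI _)).add (hI _)).integrableOn
          · exact measurableSet_Ioc
          · intro x hx
            have p1 := Real.exp_pos (-b * (x - 0) ^ 2)
            have p2 := Real.exp_pos (-b * (x - Real.pi) ^ 2)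
            have p3 := Real.exp_pos (-b * (x - (-Real.pi)) ^ 2)
            rcases le_or_gt |x| (Real.pi / 2) with h | h
            · have := key 0 x (by simpa using h) (by simp)
              linarith
            · rcases lt_abs.1 h with h | h
              · have := key Real.pi x (abs_le.2 ⟨by linarith, by linarith [hx.2]⟩)
                  (by rw [Real.sin_sub_pi]; ring)
                linarith
              · have := key (-Real.pi) x (abs_le.2 ⟨by linarith [hx.1], by linarith [hx.1]⟩)
                  (by rw [sub_neg_eq_add, Real.sin_add_pi]; ring)
                linarith
      _ ≤ ∫ θ, (Real.exp (-b * (θ - 0) ^ 2) +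
          Real.exp (-b * (θ - Real.pi) ^ 2) + Real.exp (-b * (θ - (-Real.pi)) ^ 2)) := by
          apply setIntegral_le_integral (((hI _).add (hI _)).add (hI _))
          exact ae_of_all _ fun x => (show (0:ℝ) ≤ Real.exp _ + Real.exp _ + Real.exp _ by positivity)
      _ = _ := by
          rw [integral_add (f := fun θ => Real.exp (-b * (θ - 0) ^ 2) +
            Real.exp (-b * (θ - Real.pi) ^ 2)) ((hI _).add (hI _)) (hI _), integral_add (hI _) (hI _), hE, hE, hE]
          ring
  rw [smul_eq_mul]
  have e : Real.sqrt (Real.pi / b) = Real.sqrt Real.pi * Real.pi / (2 * Real.sqrt a) := by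
    rw [Real.sqrt_eq_iff_mul_self_eq_of_pos (by positivity), ← sq]
    simp only [b]
    rw [div_pow, mul_pow, mul_pow, Real.sq_sqrt hpi.le, Real.sq_sqrt ha.le]
    field_simp
    norm_num
  rw [e] at hle
  calc (2 * Real.pi)⁻¹ * _ ≤ (2 * Real.pi)⁻¹ * (3 * (Real.sqrt Real.pi * Real.pi / (2 * Real.sqrt a))) := by
        gcongr
    _ = (Real.sqrt Real.pi / 4) * (3 / Real.sqrt a) := by field_simp; norm_num
    _ ≤ 1 * (3 / Real.sqrt a) := by
        gcongr
        rw [div_le_one (by norm_num), Real.sqrt_le_iff]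
        exact ⟨by norm_num, by linarith [Real.pi_le_four]⟩
    _ = _ := one_mul _

/-- heat kernel bound -/
lemma pn_heat (hd : 0 < d) {n : ℕ} (hn : 0 < n) (x y : Vert d) :
    pn n x y ≤ (3 * Real.sqrt (2 * d)) ^ d / Real.sqrt n ^ d := by
  rw [pn_fourier hd]
  have hn' : (0:ℝ) < n := by positivity
  have hd' : (0:ℝ) < d := by positivity
  calc _ ≤ ∫ θ, ∏ i, Real.exp (-((n / (2 * d) : ℝ) * Real.sin (θ i) ^ 2)) ∂torus d := by
        have hpos : ∀ θ : Fin d → ℝ,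
            ∏ i, Real.exp (-((n / (2 * d) : ℝ) * Real.sin (θ i) ^ 2)) ≤ 1 := fun θ =>
          Finset.prod_le_one (fun i _ => (Real.exp_pos _).le) fun i _ =>
            Real.exp_le_one_iff.2 (by have := sq_nonneg (Real.sin (θ i)); 
                                      have : (0:ℝ) ≤ n / (2 * d) * Real.sin (θ i) ^ 2 := by positivity
                                      linarith)
        have hle : ∀ θ : Fin d → ℝ, |Real.cos (∑ i, (x i - y i : ℤ) * θ i) * symb θ ^ n| ≤
            ∏ i, Real.exp (-((n / (2 * d) : ℝ) * Real.sin (θ i) ^ 2)) := by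
          intro θ
          rw [abs_mul, abs_pow]
          calc _ ≤ 1 * Real.exp (-(∑ i, Real.sin (θ i) ^ 2) / (2 * d)) ^ n := by
                gcongr
                · exact Real.abs_cos_le_one _
                · exact abs_symb_le hd θ
            _ = _ := by
                rw [one_mul, ← Real.exp_nat_mul, ← Real.exp_sum]
                congr 1
                rw [Finset.sum_neg_distrib, ← Finset.mul_sum]
                ring
        apply integral_mono
        · exact torus_int (by unfold symb; fun_prop) 1 fun θ => (hle θ).trans (hpos θ)
        · refine torus_int (by fun_prop) 1 fun θ => ?_
          rw [abs_of_nonneg (Finset.prod_nonneg fun i _ => (Real.exp_pos _).le)]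
          exact hpos θ
        · intro θ
          exact (le_abs_self _).trans (hle θ)
    _ = (∫ t, Real.exp (-((n / (2 * d) : ℝ) * Real.sin t ^ 2)) ∂circ) ^ d := by
        rw [torus, integral_fintype_prod_eq_prod (𝕜 := ℝ)
          (f := fun _ (t : ℝ) => Real.exp (-((n / (2 * d) : ℝ) * Real.sin t ^ 2)))]
        simp
    _ ≤ (3 / Real.sqrt (n / (2 * d))) ^ d := by
        gcongr
        exact circ_bound _ (by positivity)
    _ = _ := by
        rw [← div_pow, Real.sqrt_div hn'.le]
        congr 1
        field_simp

end Heat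
end

section
/-! ### Green function -/
section Green
variable {d : ℕ}

/-- decay exponent -/
noncomputable def bexp (d : ℕ) : ℝ := if d = 3 then 1/2 else 1

lemma bexp_ge : (1/2 : ℝ) ≤ bexp d := by unfold bexp; split_ifs <;> norm_num
lemma bexp_le : bexp d ≤ 1 := by unfold bexp; split_ifs <;> norm_num
lemma bexp_pos : 0 < bexp d := by have := bexp_ge (d := d); linarith

/-- heat kernel constant -/
noncomputable def KH (d : ℕ) : ℝ := (3 * Real.sqrt (2 * d)) ^ d

lemma KH_pos (hd : 3 ≤ d) : 0 < KH d := by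
  have : (0:ℝ) < d := by exact_mod_cast (by omega : 0 < d)
  unfold KH; positivity

lemma pn_heat' (hd : 3 ≤ d) {n : ℕ} (hn : 0 < n) (x y : Vert d) :
    pn n x y ≤ KH d * (n:ℝ) ^ (-(1 + bexp d)) := by
  refine (pn_heat (by omega) hn x y).trans ?_
  have hn' : (1:ℝ) ≤ n := by exact_mod_cast hn
  have hn0 : (0:ℝ) < n := by linarith
  rw [div_eq_mul_inv]
  refine mul_le_mul_of_nonneg_left ?_ (KH_pos hd).le
  rw [Real.sqrt_eq_rpow, ← Real.rpow_natCast, ← Real.rpow_mul hn0.le, ← Real.rpow_neg hn0.le]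
  apply Real.rpow_le_rpow_of_exponent_le hn'
  unfold bexp
  split_ifs with h
  · rw [h]; norm_num
  · have : (4:ℝ) ≤ d := by exact_mod_cast (by omega : 4 ≤ d)
    linarith

lemma rpow_tele {β : ℝ} (h1 : 1/2 ≤ β) (h2 : β ≤ 1) {n : ℕ} (hn : 0 < n) :
    (n:ℝ) ^ (-(1 + β)) ≤ 4 * ((n:ℝ) ^ (-β) - ((n+1 : ℕ):ℝ) ^ (-β)) := by
  have hn' : (1:ℝ) ≤ n := by exact_mod_cast hn
  have hn0 : (0:ℝ) < n := by linarith
  have hn1 : (0:ℝ) < n + 1 := by linarith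
  have e1 : ((n+1 : ℕ):ℝ) ^ (-β) = (n:ℝ) ^ (-β) * ((n:ℝ) / (n + 1)) ^ β := by
    push_cast
    rw [Real.div_rpow hn0.le hn1.le, Real.rpow_neg hn0.le, Real.rpow_neg hn1.le]
    have : (n:ℝ) ^ β ≠ 0 := by positivity
    field_simp
  have e2 : (n:ℝ) ^ (-(1 + β)) = (n:ℝ) ^ (-β) * (n:ℝ)⁻¹ := by
    rw [neg_add, add_comm, Real.rpow_add hn0, Real.rpow_neg_one]
  have e3 : ((n:ℝ) / (n + 1)) ^ β ≤ 1 - β / (n + 1) := by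
    have := rpow_one_add_le_one_add_mul_self (s := -(1 / ((n:ℝ) + 1)))
      (by rw [neg_le_neg_iff, div_le_one hn1]; linarith) (by linarith) h2
    rw [show 1 + -(1 / ((n:ℝ) + 1)) = n / (n + 1) by field_simp; ring] at this
    refine this.trans (le_of_eq (by ring))
  rw [e1, e2, ← mul_one_sub, mul_left_comm]
  refine mul_le_mul_of_nonneg_left ?_ (by positivity)
  have : (n:ℝ)⁻¹ ≤ 4 * (β / (n + 1)) := by
    rw [inv_eq_one_div, ← mul_div_assoc, div_le_div_iff₀ hn0 hn1]
    nlinarith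
  linarith

lemma pn_sum_tail (hd : 3 ≤ d) {N : ℕ} (hN : 0 < N) (M : ℕ) (x y : Vert d) :
    ∑ n ∈ Finset.range M, pn (N + n) x y ≤ 4 * KH d * (N:ℝ) ^ (-bexp d) := by
  have h : ∀ M : ℕ, ∑ n ∈ Finset.range M, pn (N + n) x y ≤
      4 * KH d * ((N:ℝ) ^ (-bexp d) - ((N + M : ℕ) : ℝ) ^ (-bexp d)) := by
    intro M
    induction M with
    | zero => simp
    | succ M ih =>
      rw [Finset.sum_range_succ]
      have h1 := pn_heat' hd (by omega : 0 < N + M) x y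
      have h2 := rpow_tele (bexp_ge (d := d)) bexp_le (by omega : 0 < N + M)
      have h3 := mul_le_mul_of_nonneg_left h2 (KH_pos hd).le
      rw [← add_assoc]
      nlinarith
  refine (h M).trans ?_
  have : 0 ≤ ((N + M : ℕ) : ℝ) ^ (-bexp d) := by positivity
  have := KH_pos hd
  gcongr
  linarith

lemma pn_summable (hd : 3 ≤ d) (x y : Vert d) : Summable fun n => pn n x y := by
  rw [← summable_nat_add_iff 1]
  refine summable_of_sum_range_le (c := 4 * KH d * ((1:ℕ):ℝ) ^ (-bexp d)) (fun n => pn_nonneg _ _ _) fun M => ?_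
  simpa only [add_comm] using pn_sum_tail hd one_pos M x y

/-- Green function as a real number -/
noncomputable def gr (x y : Vert d) : ℝ := ∑' n, pn n x y

lemma greenSRW_toReal (hd : 3 ≤ d) (x y : Vert d) : (greenSRW d x y).toReal = gr x y := by
  have : greenSRW d x y = ∑' n, ENNReal.ofReal (pn n x y) := by
    unfold greenSRW
    refine tsum_congr fun n => ?_
    have hd' : (0:ℝ) < 2 * d := by have : 0 < d := by omega
                                   positivity
    rw [pn, ENNReal.ofReal_div_of_pos (by positivity), ENNReal.ofReal_natCast,
      ENNReal.ofReal_pow hd'.le]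
    congr 2
    rw [← ENNReal.ofReal_natCast]
    push_cast; rfl
  rw [this, ← ENNReal.ofReal_tsum_of_nonneg (fun n => pn_nonneg _ _ _) (pn_summable hd x y),
    ENNReal.toReal_ofReal (tsum_nonneg fun n => pn_nonneg _ _ _)]
  rfl

lemma gr_nonneg (x y : Vert d) : 0 ≤ gr x y := tsum_nonneg fun n => pn_nonneg _ _ _
lemma gr_symm (x y : Vert d) : gr x y = gr y x := by simp only [gr, pn_symm _ x y]
lemma gr_add (x y z : Vert d) : gr (x + z) (y + z) = gr x y := by simp only [gr, pn_add]

lemma gr_eq (hd : 3 ≤ d) (x y : Vert d) :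
    gr x y = (if x = y then 1 else 0) + (∑ p, gr (x + ev p) y) / (2 * d) := by
  rw [gr, (pn_summable hd x y).tsum_eq_zero_add, pn_zero]
  congr 1
  simp only [pn_succ, gr]
  rw [tsum_div_const, Summable.tsum_finsetSum fun i _ => pn_summable hd _ _]

/-- tails of the Green function -/
lemma gr_tail (hd : 3 ≤ d) {N : ℕ} (hN : 0 < N) (x y : Vert d) :
    ∑' n, pn (N + n) x y ≤ 4 * KH d * (N:ℝ) ^ (-bexp d) := by
  have : Summable fun n => pn (N + n) x y := by
    simpa only [add_comm] using (summable_nat_add_iff N).2 (pn_summable hd x y)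
  refine this.tsum_le_of_sum_range_le fun M => ?_
  exact pn_sum_tail hd hN M x y

lemma pn_offdiag' (hd : 0 < d) (n : ℕ) (hn : 0 < n) (x y : Vert d) :
    pn n x y ≤ Real.exp (-((linfDist x y : ℝ) ^ 2 / (2 * n))) := by
  have : Nonempty (Fin d) := ⟨⟨0, hd⟩⟩
  obtain ⟨i, -, hi⟩ := Finset.exists_mem_eq_sup (Finset.univ : Finset (Fin d)) Finset.univ_nonempty
    (fun i => (x i - y i).natAbs)
  have hr : (linfDist x y : ℝ) = |((x i - y i : ℤ) : ℝ)| := by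
    rw [linfDist, hi, Nat.cast_natAbs]; push_cast; rfl
  have hn' : (0:ℝ) < n := by exact_mod_cast hn
  have := pn_offdiag hd n x y i (-((x i - y i : ℤ) : ℝ) / n)
  refine this.trans (Real.exp_le_exp.2 (le_of_eq ?_))
  rw [hr, sq_abs]
  push_cast
  field_simp
  ring

/-- decay function -/
noncomputable def gdec (d r : ℕ) : ℝ := ((1 + Real.log r) / (r:ℝ) ^ 2) ^ bexp d

/-- decay constant -/
noncomputable def KG (d : ℕ) : ℝ := 32 * KH d + 2

lemma gr_decay (hd : 3 ≤ d) {x y : Vert d} (hr : 1 ≤ linfDist x y) :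
    gr x y ≤ KG d * gdec d (linfDist x y) := by
  set r := linfDist x y with hrdef
  have hr' : (1:ℝ) ≤ r := by exact_mod_cast hr
  have hl : 0 ≤ Real.log r := Real.log_nonneg hr'
  have hl2 : Real.log r ≤ r - 1 := Real.log_le_sub_one_of_pos (by linarith)
  have hxy : x ≠ y := by
    rintro rfl
    simp [hrdef, linfDist] at hr
  set t : ℝ := (r:ℝ) ^ 2 / (8 * (1 + Real.log r)) with ht
  have ht0 : 0 < t := by positivity
  set N := ⌈t⌉₊ with hN
  have hN0 : 0 < N := Nat.ceil_pos.2 ht0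
  have hbase : (1 + Real.log r) / (r:ℝ) ^ 2 ≤ 1 := by
    rw [div_le_one (by positivity)]; nlinarith
  have hg : ((r:ℝ) ^ 2)⁻¹ ≤ gdec d r := by
    calc ((r:ℝ) ^ 2)⁻¹ ≤ (1 + Real.log r) / (r:ℝ) ^ 2 := by
          rw [inv_eq_one_div]; gcongr; linarith
      _ = ((1 + Real.log r) / (r:ℝ) ^ 2) ^ (1:ℝ) := (Real.rpow_one _).symm
      _ ≤ _ := Real.rpow_le_rpow_of_exponent_ge (by positivity) hbase bexp_le
  have hsmall : ∑ n ∈ Finset.range N, pn n x y ≤ 2 * gdec d r := by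
    have h1 : ∀ n ∈ Finset.range N, pn n x y ≤ ((r:ℝ) ^ 4)⁻¹ := by
      intro n hn
      rcases Nat.eq_zero_or_pos n with rfl | hn0
      · rw [pn_zero, if_neg hxy]; positivity
      · refine (pn_offdiag' (by omega) n hn0 x y).trans ?_
        have hnt : (n:ℝ) < t := Nat.lt_ceil.1 (Finset.mem_range.1 hn)
        have hnp : (0:ℝ) < n := by exact_mod_cast hn0
        have e : ((r:ℝ) ^ 4)⁻¹ = Real.exp (-(4 * Real.log r)) := by
          rw [Real.exp_neg, ← Real.exp_log (x := (r:ℝ)^4) (by positivity), Real.log_pow]; norm_num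
        rw [e]
        refine Real.exp_le_exp.2 (neg_le_neg ?_)
        rw [← hrdef, le_div_iff₀ (by positivity)]
        have : n * (8 * (1 + Real.log r)) < (r:ℝ) ^ 2 := by
          rwa [ht, lt_div_iff₀ (by positivity)] at hnt
        nlinarith
    refine (Finset.sum_le_card_nsmul _ _ _ h1).trans ?_
    rw [Finset.card_range, nsmul_eq_mul]
    have hNle : (N:ℝ) ≤ 2 * (r:ℝ) ^ 2 := by
      have := (Nat.ceil_lt_add_one ht0.le).le
      have : t ≤ (r:ℝ) ^ 2 := div_le_self (by positivity) (by linarith)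
      nlinarith
    calc (N:ℝ) * ((r:ℝ) ^ 4)⁻¹ ≤ 2 * (r:ℝ) ^ 2 * ((r:ℝ) ^ 4)⁻¹ := by gcongr
      _ = 2 * ((r:ℝ) ^ 2)⁻¹ := by field_simp
      _ ≤ _ := by gcongr
  have hbig : ∑' n, pn (N + n) x y ≤ 32 * KH d * gdec d r := by
    refine (gr_tail hd hN0 x y).trans ?_
    have h1 : (N:ℝ) ^ (-bexp d) ≤ t ^ (-bexp d) :=
      Real.rpow_le_rpow_of_nonpos ht0 (Nat.le_ceil _) (by linarith [bexp_pos (d := d)])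
    have h2 : t ^ (-bexp d) = 8 ^ bexp d * gdec d r := by
      rw [gdec, ← Real.mul_rpow (by norm_num) (by positivity), Real.rpow_neg ht0.le,
        ← Real.inv_rpow ht0.le, ht]
      congr 1
      field_simp
    have h3 : (8:ℝ) ^ bexp d ≤ 8 := by
      calc (8:ℝ) ^ bexp d ≤ 8 ^ (1:ℝ) := Real.rpow_le_rpow_of_exponent_le (by norm_num) bexp_le
        _ = 8 := Real.rpow_one _
    have h4 : 0 ≤ gdec d r := by unfold gdec; positivity
    have := KH_pos hd
    calc 4 * KH d * (N:ℝ) ^ (-bexp d) ≤ 4 * KH d * (8 ^ bexp d * gdec d r) := by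
          rw [← h2]; gcongr
      _ ≤ 4 * KH d * (8 * gdec d r) := by gcongr
      _ = _ := by ring
  have : gr x y = ∑ n ∈ Finset.range N, pn n x y + ∑' n, pn (N + n) x y := by
    rw [gr, ← (pn_summable hd x y).sum_add_tsum_nat_add N]
    simp only [add_comm]
  rw [this, KG]
  linarith

end Green
end

section
/-! ### Gaussian fields: sums, shifts -/
namespace GaussLaw
variable {ι : Type*} {ν ν' : Measure (ι → ℝ)} {C C' : ι → ι → ℝ}

lemma congr_cov (h : GaussLaw ν C) (e : ∀ x y, C x y = C' x y) : GaussLaw ν C' := by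
  have : C = C' := by ext x y; exact e x y
  rwa [← this]

lemma sum_pi {β : Type*} [Fintype β] {ν : β → Measure (ι → ℝ)} {C : β → ι → ι → ℝ}
    (h : ∀ b, GaussLaw (ν b) (C b)) :
    GaussLaw ((Measure.pi ν).map fun (ω : β → ι → ℝ) (k : ι) => ∑ b, ω b k)
      (fun k l => ∑ b, C b k l) := by
  have hp := fun b => (h b).prob
  have hm : Measurable fun (ω : β → ι → ℝ) (k : ι) => ∑ b, ω b k := by
    refine measurable_pi_lambda _ fun k => Finset.measurable_sum _ fun b _ => ?_
    exact (measurable_pi_apply k).comp (measurable_pi_apply b)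
  refine ⟨Measure.isProbabilityMeasure_map hm.aemeasurable, fun s c => ?_⟩
  rw [integral_map hm.aemeasurable (Measurable.aestronglyMeasurable (by fun_prop))]
  have e : ∀ ω : β → ι → ℝ, Real.exp (∑ x ∈ s, c x * ∑ b, ω b x) =
      ∏ b, Real.exp (∑ x ∈ s, c x * ω b x) := by
    intro ω
    rw [← Real.exp_sum, Finset.sum_comm]
    simp only [Finset.mul_sum]
  simp_rw [e]
  rw [integral_fintype_prod_eq_prod (𝕜 := ℝ) (fun b (ω : ι → ℝ) => Real.exp (∑ x ∈ s, c x * ω x))]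
  simp only [(h _).mgf]
  rw [← Real.exp_sum, ← Finset.sum_div, Finset.sum_comm]
  congr 2
  refine Finset.sum_congr rfl fun x _ => ?_
  rw [Finset.sum_comm]
  simp only [Finset.mul_sum]

lemma add_prod (h : GaussLaw ν C) (h' : GaussLaw ν' C') :
    GaussLaw ((ν.prod ν').map fun p : (ι → ℝ) × (ι → ℝ) => p.1 + p.2)
      (fun k l => C k l + C' k l) := by
  have := h.prob
  have := h'.prob
  have hm : Measurable fun p : (ι → ℝ) × (ι → ℝ) => p.1 + p.2 := by fun_prop
  refine ⟨Measure.isProbabilityMeasure_map hm.aemeasurable, fun s c => ?_⟩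
  rw [integral_map hm.aemeasurable (Measurable.aestronglyMeasurable (by fun_prop))]
  have e : ∀ p : (ι → ℝ) × (ι → ℝ), Real.exp (∑ x ∈ s, c x * (p.1 + p.2) x) =
      Real.exp (∑ x ∈ s, c x * p.1 x) * Real.exp (∑ x ∈ s, c x * p.2 x) := by
    intro p
    rw [← Real.exp_add, ← Finset.sum_add_distrib]
    simp [mul_add]
  simp_rw [e]
  rw [integral_prod_mul (fun ω : ι → ℝ => Real.exp (∑ x ∈ s, c x * ω x))
    (fun ω : ι → ℝ => Real.exp (∑ x ∈ s, c x * ω x)), h.mgf, h'.mgf, ← Real.exp_add]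
  congr 1
  simp only [mul_add, Finset.sum_add_distrib]
  ring

end GaussLaw

/-! ### the free field -/
section GFF
variable {d : ℕ} {μ : Measure (Vert d → ℝ)}

lemma gff_shift (hμ : GaussLaw μ (gr (d := d))) (z : Vert d) :
    μ.map (fun ω x => ω (x + z)) = μ := by
  have h := hμ.map_lin (κ := Vert d) (fun x => {x + z}) (fun _ _ => 1)
  simp only [Finset.sum_singleton, one_mul, gr_add] at h
  exact h.ext hμ

/-- discrete Laplacian `(I - P) f` -/
noncomputable def lapl (f : Vert d → ℝ) (z : Vert d) : ℝ := f z - (∑ p, f (z + ev p)) / (2 * d)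

lemma lapl_gr (hd : 3 ≤ d) (z y : Vert d) : lapl (fun x => gr x y) z = if z = y then 1 else 0 := by
  unfold lapl; dsimp only
  rw [gr_eq hd z y]; ring

lemma lapl_lin (B : Finset (Vert d)) (a : Vert d → ℝ) : ∃ (s : Finset (Vert d)) (u : Vert d → ℝ),
    (∀ x, x ∉ s → u x = 0) ∧ ∀ f : Vert d → ℝ, ∑ x ∈ s, u x * f x = ∑ z ∈ B, a z * lapl f z := by
  refine ⟨B ∪ B.biUnion nbrs, fun x => ∑ z ∈ B, a z * ((if x = z then 1 else 0) -
    (∑ p, if x = z + ev p then 1 else 0) / (2 * d)), ?_, ?_⟩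
  · intro x hx
    refine Finset.sum_eq_zero fun z hz => ?_
    have h1 : x ≠ z := by rintro rfl; exact hx (Finset.mem_union_left _ hz)
    have h2 : ∀ p, x ≠ z + ev p := by
      rintro p rfl
      exact hx (Finset.mem_union_right _ (Finset.mem_biUnion.2 ⟨z, hz, mem_nbrs.2 ⟨p, rfl⟩⟩))
    simp [h1, h2]
  · intro f
    simp only [Finset.sum_mul]
    rw [Finset.sum_comm]
    refine Finset.sum_congr rfl fun z hz => ?_
    simp only [mul_assoc]
    rw [← Finset.mul_sum]
    congr 1
    simp only [sub_mul, Finset.sum_sub_distrib, lapl]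
    congr 1
    · simp [hz]
    · simp only [div_mul_eq_mul_div, ← Finset.sum_div, Finset.sum_mul]
      rw [Finset.sum_comm]
      congr 1
      refine Finset.sum_congr rfl fun p _ => ?_
      have : z + ev p ∈ B ∪ B.biUnion nbrs :=
        Finset.mem_union_right _ (Finset.mem_biUnion.2 ⟨z, hz, mem_nbrs.2 ⟨p, rfl⟩⟩)
      simp [this]

/-- restriction of a function to a finite set -/
noncomputable def rst (B : Finset (Vert d)) (a : Vert d → ℝ) : Vert d → ℝ :=
  fun y => if y ∈ B then a y else 0

lemma rst_gr (hd : 3 ≤ d) (B : Finset (Vert d)) (a : Vert d → ℝ) (y : Vert d) :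
    rst B a y = ∑ z ∈ B, a z * lapl (fun x => gr x y) z := by
  simp [lapl_gr hd, rst]

lemma gff_deriv (hd : 3 ≤ d) (hμ : GaussLaw μ (gr (d := d))) (B : Finset (Vert d)) (a : Vert d → ℝ)
    {A : Set (Vert d → ℝ)} (hA : MeasurableSet A) :
    HasDerivAt (fun t : ℝ => μ.real {ω | ω + t • rst B a ∈ A})
      (∫ ω in A, (∑ z ∈ B, a z * lapl ω z) ∂μ) 0 := by
  obtain ⟨s, u, hu, h⟩ := lapl_lin B a
  have := hμ.cm_deriv gr_symm s u hu (rst B a) (fun y => by rw [rst_gr hd, h fun x => gr x y]) hA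
  simpa only [h] using this

lemma lapl_integrable (hμ : GaussLaw μ (gr (d := d))) (z : Vert d) :
    Integrable (fun ω => lapl ω z) μ := by
  have := hμ.prob
  obtain ⟨s, u, hu, h⟩ := lapl_lin {z} (fun _ => 1)
  have := (hμ.memLp s u 1).integrable (by simp)
  simpa [h] using this

/-- directional derivative -/
noncomputable def DD (μ : Measure (Vert d → ℝ)) (A : Set (Vert d → ℝ)) (z : Vert d) : ℝ :=
  ∫ ω in A, lapl ω z ∂μ

lemma gff_deriv' (hd : 3 ≤ d) (hμ : GaussLaw μ (gr (d := d))) (B : Finset (Vert d))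
    {A : Set (Vert d → ℝ)} (hA : MeasurableSet A) :
    HasDerivAt (fun t : ℝ => μ.real {ω | ω + t • rst B 1 ∈ A}) (∑ z ∈ B, DD μ A z) 0 := by
  have := gff_deriv hd hμ B 1 hA
  simp only [Pi.one_apply, one_mul] at this
  rw [integral_finsetSum _ fun z _ => (lapl_integrable hμ z).restrict] at this
  exact this

lemma rst_nonneg {B : Finset (Vert d)} : 0 ≤ rst B (1 : Vert d → ℝ) := by
  intro y; unfold rst; split_ifs <;> simp

lemma DD_nonneg (hd : 3 ≤ d) (hμ : GaussLaw μ (gr (d := d)))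
    {A : Set (Vert d → ℝ)} (hA : MeasurableSet A) (hup : IsUpperSet A) (z : Vert d) :
    0 ≤ DD μ A z := by
  have := hμ.prob
  have h := gff_deriv' hd hμ {z} hA
  rw [Finset.sum_singleton] at h
  have hmono : Monotone (fun t : ℝ => μ.real {ω | ω + t • rst {z} 1 ∈ A}) := by
    intro s t hst
    refine measureReal_mono fun ω (hω : ω + s • rst {z} 1 ∈ A) => ?_
    refine hup ?_ hω
    gcongr
    exact rst_nonneg
  rw [← h.deriv]
  exact hmono.deriv_nonneg

lemma gff_ac (hd : 3 ≤ d) (hμ : GaussLaw μ (gr (d := d))) (B : Finset (Vert d)) (a : Vert d → ℝ)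
    {A : Set (Vert d → ℝ)} (hA : MeasurableSet A) (h0 : μ A = 0) :
    μ {ω | ω + rst B a ∈ A} = 0 := by
  obtain ⟨s, u, hu, h⟩ := lapl_lin B a
  have := hμ.cm_measure gr_symm s u hu (rst B a) (fun y => by rw [rst_gr hd, h fun x => gr x y])
  have hm : Measurable fun ω : Vert d → ℝ => ω + rst B a := by fun_prop
  have e : μ {ω | ω + rst B a ∈ A} = μ.map (fun ω => ω + rst B a) A := by
    rw [Measure.map_apply hm hA]; rfl
  rw [e, this]
  exact withDensity_absolutelyContinuous _ _ h0

/-! ### hitting kernel -/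

/-- probability to hit `A` for the first time at `z` before time `n` -/
noncomputable def hitn (A : Finset (Vert d)) : ℕ → Vert d → Vert d → ℝ
  | 0, y, z => if y ∈ A ∧ y = z then 1 else 0
  | n + 1, y, z => if y ∈ A then (if y = z then 1 else 0) else (∑ p, hitn A n (y + ev p) z) / (2 * d)

lemma hitn_mem {A : Finset (Vert d)} {y : Vert d} (hy : y ∈ A) (n : ℕ) (z : Vert d) :
    hitn A n y z = if y = z then 1 else 0 := by
  cases n <;> simp [hitn, hy]

lemma hitn_nonneg (A : Finset (Vert d)) (n : ℕ) (y z : Vert d) : 0 ≤ hitn A n y z := by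
  induction n generalizing y with
  | zero => unfold hitn; split_ifs <;> norm_num
  | succ n ih =>
    unfold hitn
    split_ifs
    · norm_num
    · norm_num
    · exact div_nonneg (Finset.sum_nonneg fun p _ => ih _) (by positivity)

lemma hitn_mono (A : Finset (Vert d)) (y z : Vert d) : Monotone fun n => hitn A n y z := by
  refine monotone_nat_of_le_succ fun n => ?_
  induction n generalizing y with
  | zero =>
    by_cases hy : y ∈ A
    · simp [hitn_mem hy]
    · have : hitn A 0 y z = 0 := by simp [hitn, hy]
      rw [this]; exact hitn_nonneg _ _ _ _
  | succ n ih =>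
    by_cases hy : y ∈ A
    · simp [hitn_mem hy]
    · rw [hitn, hitn, if_neg hy, if_neg hy]
      gcongr
      exact ih _

lemma hitn_sum_le (hd : 0 < d) (A : Finset (Vert d)) (n : ℕ) (y : Vert d) :
    ∑ z ∈ A, hitn A n y z ≤ 1 := by
  induction n generalizing y with
  | zero =>
    by_cases hy : y ∈ A <;> simp [hitn, hy]
  | succ n ih =>
    by_cases hy : y ∈ A
    · simp [hitn_mem hy, hy]
    · simp only [hitn, if_neg hy]
      rw [← Finset.sum_div, Finset.sum_comm, ← sum_const_ev hd 1]
      gcongr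
      exact ih _

lemma hitn_le_one (hd : 0 < d) (A : Finset (Vert d)) (n : ℕ) (y : Vert d) {z : Vert d} (hz : z ∈ A) :
    hitn A n y z ≤ 1 :=
  (Finset.single_le_sum (fun w _ => hitn_nonneg A n y w) hz).trans (hitn_sum_le hd A n y)

/-- hitting distribution -/
noncomputable def hit (A : Finset (Vert d)) (y z : Vert d) : ℝ := ⨆ n, hitn A n y z

lemma hit_tendsto (hd : 0 < d) (A : Finset (Vert d)) (y : Vert d) {z : Vert d} (hz : z ∈ A) :
    Tendsto (fun n => hitn A n y z) atTop (𝓝 (hit A y z)) :=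
  tendsto_atTop_ciSup (hitn_mono A y z) ⟨1, by rintro _ ⟨n, rfl⟩; exact hitn_le_one hd A n y hz⟩

lemma hit_nonneg (A : Finset (Vert d)) (y z : Vert d) : 0 ≤ hit A y z :=
  Real.iSup_nonneg fun n => hitn_nonneg _ _ _ _

lemma hit_sum_le (hd : 0 < d) (A : Finset (Vert d)) (y : Vert d) : ∑ z ∈ A, hit A y z ≤ 1 :=
  le_of_tendsto (tendsto_finsetSum _ fun z hz => hit_tendsto hd A y hz)
    (Eventually.of_forall fun n => hitn_sum_le hd A n y)

lemma hit_interior {A : Finset (Vert d)} {y z : Vert d} (hy : y ∉ A) (hz : nbrs z ⊆ A) :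
    hit A y z = 0 := by
  have : ∀ n y, y ∉ A → hitn A n y z = 0 := by
    intro n
    induction n with
    | zero => intro y hy; simp [hitn, hy]
    | succ n ih =>
      intro y hy
      rw [hitn, if_neg hy, Finset.sum_eq_zero, zero_div]
      intro p _
      by_cases h : y + ev p ∈ A
      · rw [hitn_mem h, if_neg]
        intro h2
        exact hy (hz (adj_iff_nbrs.1 (adj_symm (adj_iff.2 ⟨p, h2.symm⟩))))
      · exact ih _ h
  simp [hit, this _ y hy]

lemma hit_green (hd : 3 ≤ d) (A : Finset (Vert d)) (y : Vert d) {w : Vert d} (hw : w ∈ A) :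
    ∑ z ∈ A, hit A y z * gr z w = gr y w := by
  have hd0 : 0 < d := by omega
  have hsum : ∀ N y, Summable fun n => pn (N + n) y w := fun N y => by
    simpa only [add_comm] using (summable_nat_add_iff N).2 (pn_summable hd y w)
  have key : ∀ n y, |gr y w - ∑ z ∈ A, hitn A n y z * gr z w| ≤ ∑' m, pn (n + m) y w := by
    intro n
    induction n with
    | zero =>
      intro y
      simp only [zero_add]
      change _ ≤ gr y w
      by_cases hy : y ∈ A
      · simp [hitn_mem hy, hy, gr_nonneg]
      · simp [hitn, hy, abs_of_nonneg (gr_nonneg y w)]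
    | succ n ih =>
      intro y
      by_cases hy : y ∈ A
      · simp only [hitn_mem hy, ite_mul, one_mul, zero_mul, Finset.sum_ite_eq, hy, if_true, sub_self,
          abs_zero]
        exact tsum_nonneg fun _ => pn_nonneg _ _ _
      · have hyw : y ≠ w := by rintro rfl; exact hy hw
        have e1 : gr y w - ∑ z ∈ A, hitn A (n+1) y z * gr z w =
            (∑ p, (gr (y + ev p) w - ∑ z ∈ A, hitn A n (y + ev p) z * gr z w)) / (2 * d) := by
          rw [gr_eq hd y w, if_neg hyw, zero_add, Finset.sum_sub_distrib, sub_div]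
          congr 1
          simp only [hitn, if_neg hy, div_mul_eq_mul_div, Finset.sum_mul]
          rw [← Finset.sum_div, Finset.sum_comm]
        have e2 : ∑' m, pn (n + 1 + m) y w = (∑ p, ∑' m, pn (n + m) (y + ev p) w) / (2 * d) := by
          rw [← Summable.tsum_finsetSum fun p _ => hsum n _, ← tsum_div_const]
          refine tsum_congr fun m => ?_
          rw [show n + 1 + m = n + m + 1 by ring, pn_succ]
        rw [e1, e2, abs_div, abs_of_nonneg (by positivity : (0:ℝ) ≤ 2 * d)]
        gcongr
        refine (Finset.abs_sum_le_sum_abs _ _).trans (Finset.sum_le_sum fun p _ => ih _)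
  have h1 : Tendsto (fun n => gr y w - ∑ z ∈ A, hitn A n y z * gr z w) atTop
      (𝓝 (gr y w - ∑ z ∈ A, hit A y z * gr z w)) :=
    tendsto_const_nhds.sub (tendsto_finsetSum _ fun z hz => (hit_tendsto hd0 A y hz).mul_const _)
  have h2 : Tendsto (fun n => ∑' m, pn (n + m) y w) atTop (𝓝 0) := by
    have := tendsto_sum_nat_add fun n => pn n y w
    simpa only [add_comm] using this
  have h3 := squeeze_zero_norm (f := fun n => gr y w - ∑ z ∈ A, hitn A n y z * gr z w) (fun n => key n y) h2
  linarith [tendsto_nhds_unique h1 h3]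

/-- projection on the field in `A` -/
noncomputable def hproj (A : Finset (Vert d)) (ω : Vert d → ℝ) (y : Vert d) : ℝ :=
  ∑ z ∈ A, hit A y z * ω z

lemma hit_green2 (hd : 3 ≤ d) (A : Finset (Vert d)) (x y : Vert d) :
    ∑ z ∈ A, ∑ w ∈ A, hit A x z * hit A y w * gr z w = ∑ z ∈ A, hit A x z * gr z y := by
  refine Finset.sum_congr rfl fun z hz => ?_
  simp only [mul_assoc]
  rw [← Finset.mul_sum, gr_symm z y, ← hit_green hd A y hz]
  congr 1
  exact Finset.sum_congr rfl fun w _ => by rw [gr_symm z w]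

/-- Markov property in the form of an identity in law -/
lemma gff_decouple (hd : 3 ≤ d) (hμ : GaussLaw μ (gr (d := d))) (A : Finset (Vert d)) :
    (μ.prod μ).map (fun p : (Vert d → ℝ) × (Vert d → ℝ) => hproj A p.1 + (p.2 - hproj A p.2)) = μ := by
  have := hμ.prob
  have h1 := hμ.map_lin (κ := Vert d) (fun _ => A) (hit A)
  have h2 := hμ.map_lin (κ := Vert d) (fun y => insert y A)
    (fun y z => (if z = y then 1 else 0) - if z ∈ A then hit A y z else 0)
  have e : ∀ (y : Vert d) (f : Vert d → ℝ), ∑ z ∈ insert y A, ((if z = y then 1 else 0) -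
      if z ∈ A then hit A y z else 0) * f z = f y - ∑ z ∈ A, hit A y z * f z := by
    intro y f
    simp only [sub_mul, Finset.sum_sub_distrib]
    congr 1
    · simp
    · rw [← Finset.sum_subset (Finset.subset_insert y A)]
      · exact Finset.sum_congr rfl fun z hz => by simp [hz]
      · intro z _ hz; simp [hz]
  have h3 := h1.add_prod h2
  simp only [e] at h3
  have hm1 : Measurable fun (ω : Vert d → ℝ) (k : Vert d) => ∑ z ∈ A, hit A k z * ω z := by fun_prop
  have hm2 : Measurable fun (ω : Vert d → ℝ) (k : Vert d) => ω k - ∑ z ∈ A, hit A k z * ω z := by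
    fun_prop
  rw [Measure.map_prod_map _ _ hm1 hm2, Measure.map_map (by fun_prop) (hm1.prodMap hm2)] at h3
  refine GaussLaw.ext (h3.congr_cov (C' := gr) fun x y => ?_) hμ
  rw [hit_green2 hd]
  have e2 : ∑ z ∈ insert x A, ∑ w ∈ insert y A, ((if z = x then 1 else 0) -
      if z ∈ A then hit A x z else 0) * ((if w = y then 1 else 0) -
      if w ∈ A then hit A y w else 0) * gr z w = gr x y - ∑ z ∈ A, hit A x z * gr z y := by
    have : ∀ z, ∑ w ∈ insert y A, ((if z = x then 1 else 0) -
      if z ∈ A then hit A x z else 0) * ((if w = y then 1 else 0) -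
      if w ∈ A then hit A y w else 0) * gr z w = ((if z = x then 1 else 0) -
      if z ∈ A then hit A x z else 0) * (gr z y - ∑ w ∈ A, hit A y w * gr z w) := by
      intro z
      simp only [mul_assoc]
      rw [← Finset.mul_sum, e y fun w => gr z w]
    simp only [this]
    rw [e x fun z => gr z y - ∑ w ∈ A, hit A y w * gr z w]
    have h4 : ∀ z ∈ A, gr z y - ∑ w ∈ A, hit A y w * gr z w = 0 := by
      intro z hz
      rw [gr_symm z y, ← hit_green hd A y hz, sub_eq_zero]
      exact Finset.sum_congr rfl fun w _ => by rw [gr_symm z w]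
    have h6 : ∑ z ∈ A, hit A x z * (gr z y - ∑ w ∈ A, hit A y w * gr z w) = 0 :=
      Finset.sum_eq_zero (fun z hz => by rw [h4 z hz, mul_zero])
    rw [h6, sub_zero]
    congr 1
    have h5 : ∀ w ∈ A, hit A y w * gr x w = ∑ z ∈ A, hit A x z * (hit A y w * gr z w) := by
      intro w hw
      rw [← hit_green hd A x hw, Finset.mul_sum]
      exact Finset.sum_congr rfl fun z _ => by ring
    rw [Finset.sum_congr rfl h5, Finset.sum_comm, ← hit_green2 hd]
    exact Finset.sum_congr rfl fun z _ => Finset.sum_congr rfl fun w _ => by ring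
  rw [e2]; ring

/-- conditional mean on `A` -/
lemma gff_cond_mean (hd : 3 ≤ d) (hμ : GaussLaw μ (gr (d := d))) (A : Finset (Vert d))
    {E : Set (Vert d → ℝ)} (hE : MeasurableSet E)
    (hdep : ∀ ω ω' : Vert d → ℝ, (∀ x ∈ A, ω x = ω' x) → ω ∈ E → ω' ∈ E) {y : Vert d} (hy : y ∉ A) :
    ∫ ω in E, ω y ∂μ = ∑ z ∈ A, hit A y z * ∫ ω in E, ω z ∂μ := by
  have := hμ.prob
  set u : Vert d → ℝ := fun z => if z = y then 1 else if z ∈ A then - hit A y z else 0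
  have hu : ∀ f : Vert d → ℝ, ∑ z ∈ insert y A, u z * f z = f y - ∑ z ∈ A, hit A y z * f z := by
    intro f
    rw [Finset.sum_insert hy, sub_eq_add_neg, ← Finset.sum_neg_distrib]
    congr 1
    · simp [u]
    · refine Finset.sum_congr rfl fun z hz => ?_
      have : z ≠ y := by rintro rfl; exact hy hz
      simp [u, this, hz]
  have hnt : ∀ z, Integrable (fun ω : Vert d → ℝ => ω z) μ := fun z => by
    simpa using (hμ.memLp {z} 1 1).integrable (by simp)
  have h := hμ.cm_deriv gr_symm (insert y A) u (by
    intro x hx; simp only [Finset.mem_insert, not_or] at hx; simp [u, hx]) 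
    (fun w => ∑ x ∈ insert y A, u x * gr x w) (fun _ => rfl) hE
  have hconst : (fun t : ℝ => μ.real {ω | ω + t • (fun w => ∑ x ∈ insert y A, u x * gr x w) ∈ E}) =
      fun _ => μ.real E := by
    ext t
    congr 1
    have h0 : ∀ w ∈ A, ∑ x ∈ insert y A, u x * gr x w = 0 := by
      intro w hw
      rw [hu fun x => gr x w, hit_green hd A y hw, sub_self]
    ext ω
    constructor
    · exact fun h => hdep _ _ (fun x hx => by simp [h0 x hx]) h
    · exact fun h => hdep _ _ (fun x hx => by simp [h0 x hx]) h
  rw [hconst] at h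
  have h2 := h.unique (hasDerivAt_const _ _)
  simp only [hu] at h2
  rw [integral_sub (hnt y).restrict (integrable_finsetSum _ fun z _ => ((hnt z).const_mul _).restrict),
    integral_finsetSum _ fun z _ => ((hnt z).const_mul _).restrict] at h2
  simp only [integral_const_mul] at h2
  linarith

end GFF
end

section
/-! ### Paths and connectivity -/
section Conn
variable {d : ℕ}

lemma isPath_iff {x y : Vert d} {p : List (Vert d)} :
    IsPathFrom x y p ↔ p.head? = some x ∧ p.getLast? = some y ∧ p.IsChain adj := Iff.rfl

lemma isPath_single (x : Vert d) : IsPathFrom x x [x] := by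
  rw [isPath_iff]; simp

lemma isPath_ne_nil {x y : Vert d} {p : List (Vert d)} (h : IsPathFrom x y p) : p ≠ [] := by
  rintro rfl; simp [isPath_iff] at h

lemma isPath_cons {x z y : Vert d} {p : List (Vert d)} (h : IsPathFrom z y p) (ha : adj x z) :
    IsPathFrom x y (x :: p) := by
  rw [isPath_iff] at *
  obtain ⟨h1, h2, h3⟩ := h
  cases p with
  | nil => simp at h1
  | cons b l =>
    simp only [List.head?_cons, Option.some.injEq] at h1
    subst h1
    exact ⟨rfl, by simpa using h2, List.isChain_cons_cons.2 ⟨ha, h3⟩⟩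

lemma isPath_append {x y z w : Vert d} {p q : List (Vert d)} (h : IsPathFrom x y p)
    (h' : IsPathFrom z w q) (ha : adj y z) : IsPathFrom x w (p ++ q) := by
  have hp := isPath_ne_nil h
  have hq := isPath_ne_nil h'
  rw [isPath_iff] at *
  refine ⟨by rw [List.head?_append_of_ne_nil _ hp]; exact h.1,
    by rw [List.getLast?_append_of_ne_nil _ hq]; exact h'.2.1,
    List.isChain_append.2 ⟨h.2.2, h'.2.2, ?_⟩⟩
  rw [h.2.1, h'.1]
  simpa using ha

lemma isPath_reverse {x y : Vert d} {p : List (Vert d)} (h : IsPathFrom x y p) :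
    IsPathFrom y x p.reverse := by
  rw [isPath_iff] at *
  refine ⟨by simpa using h.2.1, by simpa using h.1, List.isChain_reverse.2 ?_⟩
  exact h.2.2.imp fun a b hab => adj_symm hab

lemma isPath_start_mem {x y : Vert d} {p : List (Vert d)} (h : IsPathFrom x y p) : x ∈ p :=
  List.mem_of_mem_head? (by rw [h.1]; rfl)

lemma isPath_end_mem {x y : Vert d} {p : List (Vert d)} (h : IsPathFrom x y p) : y ∈ p :=
  List.mem_of_mem_getLast? (by rw [h.2.1]; rfl)

/-- induction along a path -/
lemma isPath_induct {x y : Vert d} {p : List (Vert d)} (h : IsPathFrom x y p)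
    {motive : Vert d → List (Vert d) → Prop} (h0 : motive y [y])
    (h1 : ∀ a b q, adj a b → IsPathFrom b y q → motive b q → motive a (a :: q)) : motive x p := by
  induction p generalizing x with
  | nil => simp [isPath_iff] at h
  | cons a l ih =>
    rw [isPath_iff] at h
    obtain ⟨e1, e2, e3⟩ := h
    simp only [List.head?_cons, Option.some.injEq] at e1
    subst e1
    cases l with
    | nil =>
      simp only [List.getLast?_singleton, Option.some.injEq] at e2
      subst e2; exact h0
    | cons b l =>
      rw [List.isChain_cons_cons] at e3
      have hb : IsPathFrom b y (b :: l) := ⟨rfl, by simpa using e2, e3.2⟩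
      exact h1 a b _ e3.1 hb (ih hb)

lemma isPath_shift {x y z : Vert d} {p : List (Vert d)} (h : IsPathFrom x y p) :
    IsPathFrom (x + z) (y + z) (p.map (· + z)) := by
  refine isPath_induct h (motive := fun a q => IsPathFrom (a + z) (y + z) (q.map (· + z)))
    (isPath_single _) fun a b q hab _ ih => ?_
  refine isPath_cons ih ?_
  obtain ⟨p, rfl⟩ := adj_iff.1 hab
  exact adj_iff.2 ⟨p, by abel⟩

lemma vconn_mem {S : Set (Vert d)} {x y : Vert d} (h : VConnectedIn S x y) : x ∈ S ∧ y ∈ S := by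
  obtain ⟨p, hp, h⟩ := h
  exact ⟨h _ (isPath_start_mem hp), h _ (isPath_end_mem hp)⟩

lemma vconn_refl {S : Set (Vert d)} {x : Vert d} (h : x ∈ S) : VConnectedIn S x x :=
  ⟨[x], isPath_single x, by simpa using h⟩

lemma vconn_symm {S : Set (Vert d)} {x y : Vert d} (h : VConnectedIn S x y) : VConnectedIn S y x := by
  obtain ⟨p, hp, h⟩ := h
  exact ⟨p.reverse, isPath_reverse hp, by simpa using h⟩

lemma vconn_cons {S : Set (Vert d)} {x y z : Vert d} (hx : x ∈ S) (ha : adj x y)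
    (h : VConnectedIn S y z) : VConnectedIn S x z := by
  obtain ⟨p, hp, h⟩ := h
  exact ⟨x :: p, isPath_cons hp ha, by simp; exact ⟨hx, h⟩⟩

/-- induction for connections -/
lemma vconn_induct {S : Set (Vert d)} {x y : Vert d} (h : VConnectedIn S x y)
    {motive : Vert d → Prop} (h0 : motive y)
    (h1 : ∀ a b, a ∈ S → adj a b → VConnectedIn S b y → motive b → motive a) : motive x := by
  obtain ⟨p, hp, h⟩ := h
  have := isPath_induct hp (motive := fun a q => (∀ v ∈ q, v ∈ S) → motive a) (fun _ => h0)
    (fun a b q hab hq ih hs => h1 a b (hs a (by simp)) hab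
      ⟨q, hq, fun v hv => hs v (by simp [hv])⟩ (ih fun v hv => hs v (by simp [hv])))
  exact this h

lemma vconn_trans {S : Set (Vert d)} {x y z : Vert d} (h : VConnectedIn S x y)
    (h' : VConnectedIn S y z) : VConnectedIn S x z :=
  vconn_induct h h' fun _ _ ha hab _ ih => vconn_cons ha hab ih

lemma vconn_mono {S T : Set (Vert d)} (hST : S ⊆ T) {x y : Vert d} (h : VConnectedIn S x y) :
    VConnectedIn T x y := by
  obtain ⟨p, hp, h⟩ := h
  exact ⟨p, hp, fun v hv => hST (h v hv)⟩

lemma linf_triangle (x y z : Vert d) : linfDist x z ≤ linfDist x y + linfDist y z := by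
  unfold linfDist
  refine Finset.sup_le fun i hi => ?_
  have h1 := Finset.le_sup (f := fun i => (x i - y i).natAbs) hi
  have h2 := Finset.le_sup (f := fun i => (y i - z i).natAbs) hi
  omega

lemma linf_symm (x y : Vert d) : linfDist x y = linfDist y x := by
  unfold linfDist; congr 1; ext i; omega

lemma linf_self (x : Vert d) : linfDist x x = 0 := by simp [linfDist]

lemma linf_add (x y z : Vert d) : linfDist (x + z) (y + z) = linfDist x y := by simp [linfDist]

lemma linf_adj {x y : Vert d} (h : adj x y) : linfDist x y ≤ 1 := by
  obtain ⟨p, rfl⟩ := adj_iff.1 h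
  refine Finset.sup_le fun i _ => ?_
  have := ev_natAbs p i
  simp only [Pi.add_apply]; omega

lemma linf_le_of_sub {x y : Vert d} {i : Fin d} : (x i - y i).natAbs ≤ linfDist x y :=
  Finset.le_sup (f := fun i => (x i - y i).natAbs) (Finset.mem_univ i)

/-- a path leaving a ball has a first exit -/
lemma exit_pre {c x y : Vert d} {p : List (Vert d)} (h : IsPathFrom x y p) {R : ℕ}
    (hx : linfDist c x ≤ R) (hy : ∃ v ∈ p, R ≤ linfDist c v) :
    ∃ p1 p2 z, p = p1 ++ p2 ∧ IsPathFrom x z p1 ∧ linfDist c z = R ∧ ∀ v ∈ p1, linfDist c v ≤ R := by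
  have := isPath_induct h (motive := fun a q => linfDist c a ≤ R → (∃ v ∈ q, R ≤ linfDist c v) →
    ∃ p1 p2 z, q = p1 ++ p2 ∧ IsPathFrom a z p1 ∧ linfDist c z = R ∧ ∀ v ∈ p1, linfDist c v ≤ R) ?_ ?_
  · exact this hx hy
  · intro h1 ⟨v, hv, hR⟩
    simp only [List.mem_singleton] at hv
    subst hv
    exact ⟨[v], [], v, rfl, isPath_single v, le_antisymm h1 hR, by simpa using h1⟩
  · intro a b q hab hq ih h1 ⟨v, hv, hR⟩
    rcases h1.lt_or_eq with h1' | h1'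
    · have hb : linfDist c b ≤ R := by
        have := linf_triangle c a b
        have := linf_adj hab
        omega
      have hv' : v ∈ q := by
        rcases List.mem_cons.1 hv with rfl | h
        · omega
        · exact h
      obtain ⟨p1, p2, z, e, hp1, hz, hin⟩ := ih hb ⟨v, hv', hR⟩
      refine ⟨a :: p1, p2, z, by simp [e], isPath_cons hp1 hab, hz, ?_⟩
      simpa using ⟨h1, hin⟩
    · exact ⟨[a], q, a, rfl, isPath_single a, h1', by simpa using h1⟩

/-- paths from `x` to the sphere of radius `R` inside the ball -/
def ArmPath (x : Vert d) (R : ℕ) (p : List (Vert d)) : Prop :=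
  ∃ y, IsPathFrom x y p ∧ linfDist x y = R ∧ ∀ v ∈ p, linfDist x v ≤ R

lemma exists_arm (hd : 0 < d) (x : Vert d) (R : ℕ) : ∃ p, ArmPath x R p := by
  have h : ∀ n : ℕ, ∃ p, IsPathFrom x (x + n • ev (⟨0, hd⟩, true)) p := by
    intro n
    induction n with
    | zero => exact ⟨[x], by simpa using isPath_single x⟩
    | succ n ih =>
      obtain ⟨p, hp⟩ := ih
      exact ⟨p ++ [_], isPath_append hp (isPath_single _) (adj_iff.2 ⟨(⟨0, hd⟩, true), by
        rw [succ_nsmul, add_assoc]⟩)⟩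
  obtain ⟨p, hp⟩ := h R
  have hR : R ≤ linfDist x (x + R • ev (⟨0, hd⟩, true)) := by
    refine le_trans ?_ (linf_le_of_sub (i := ⟨0, hd⟩))
    simp [ev]
  obtain ⟨p1, p2, z, -, h1, h2, h3⟩ := exit_pre (c := x) hp (R := R) (by simp [linf_self])
    ⟨_, isPath_end_mem hp, hR⟩
  exact ⟨p1, z, h1, h2, h3⟩

/-- number of closed vertices -/
noncomputable def cost (h : ℝ) (ω : Vert d → ℝ) (p : List (Vert d)) : ℕ :=
  (p.map fun v => if ω v < h then 1 else 0).sum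

lemma cost_append (h : ℝ) (ω : Vert d → ℝ) (p q : List (Vert d)) :
    cost h ω (p ++ q) = cost h ω p + cost h ω q := by simp [cost]

lemma cost_reverse (h : ℝ) (ω : Vert d → ℝ) (p : List (Vert d)) :
    cost h ω p.reverse = cost h ω p := by simp [cost, List.sum_reverse]

lemma cost_eq_zero {h : ℝ} {ω : Vert d → ℝ} {p : List (Vert d)} :
    cost h ω p = 0 ↔ ∀ v ∈ p, h ≤ ω v := by
  simp only [cost, List.sum_eq_zero_iff, List.mem_map, forall_exists_index, and_imp,
    forall_apply_eq_imp_iff₂]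
  refine forall₂_congr fun v _ => ?_
  split_ifs with hv
  · simp [hv]
  · simpa using hv

lemma cost_congr {h : ℝ} {ω ω' : Vert d → ℝ} {p : List (Vert d)} (e : ∀ v ∈ p, ω v = ω' v) :
    cost h ω p = cost h ω' p := by
  unfold cost
  congr 1
  exact List.map_congr_left fun v hv => by rw [e v hv]

lemma cost_anti {h : ℝ} {ω ω' : Vert d → ℝ} {p : List (Vert d)} (e : ∀ v ∈ p, ω v ≤ ω' v) :
    cost h ω' p ≤ cost h ω p := by
  unfold cost
  refine List.sum_le_sum fun v hv => ?_
  have := e v hv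
  split_ifs <;> first | omega | linarith

lemma cost_measurable (h : ℝ) (p : List (Vert d)) : Measurable fun ω : Vert d → ℝ => cost h ω p := by
  induction p with
  | nil => simp [cost]
  | cons a l ih =>
    have : (fun ω : Vert d → ℝ => cost h ω (a :: l)) =
      fun ω => (if ω a < h then 1 else 0) + cost h ω l := by ext ω; simp [cost]
    rw [this]
    refine Measurable.add (Measurable.ite ?_ measurable_const measurable_const) ih
    exact measurableSet_lt (measurable_pi_apply a) measurable_const

/-- FPP distance from `x` to the sphere of radius `R` -/
noncomputable def fd (h : ℝ) (R : ℕ) (x : Vert d) (ω : Vert d → ℝ) : ℕ :=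
  sInf {m | ∃ p, ArmPath x R p ∧ cost h ω p = m}

lemma fd_spec (hd : 0 < d) (h : ℝ) (R : ℕ) (x : Vert d) (ω : Vert d → ℝ) :
    ∃ p, ArmPath x R p ∧ cost h ω p = fd h R x ω := by
  obtain ⟨p, hp⟩ := exists_arm hd x R
  exact Nat.sInf_mem (s := {m | ∃ p, ArmPath x R p ∧ cost h ω p = m}) ⟨_, p, hp, rfl⟩

lemma fd_le {h : ℝ} {R : ℕ} {x : Vert d} {ω : Vert d → ℝ} {p : List (Vert d)} (hp : ArmPath x R p) :
    fd h R x ω ≤ cost h ω p := Nat.sInf_le ⟨p, hp, rfl⟩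

lemma fd_le_of_path {h : ℝ} {R : ℕ} {x y : Vert d} {ω : Vert d → ℝ} {p : List (Vert d)}
    (hp : IsPathFrom x y p) (hy : ∃ v ∈ p, R ≤ linfDist x v) : ∃ p1 p2, p = p1 ++ p2 ∧
    ArmPath x R p1 ∧ fd h R x ω ≤ cost h ω p1 := by
  obtain ⟨p1, p2, z, e, h1, h2, h3⟩ := exit_pre (c := x) hp (R := R) (by simp [linf_self]) hy
  exact ⟨p1, p2, e, ⟨z, h1, h2, h3⟩, fd_le ⟨z, h1, h2, h3⟩⟩

lemma fd_le_iff (hd : 0 < d) {h : ℝ} {R : ℕ} {x : Vert d} {ω : Vert d → ℝ} {m : ℕ} :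
    fd h R x ω ≤ m ↔ ∃ p, ArmPath x R p ∧ cost h ω p ≤ m := by
  constructor
  · intro hm
    obtain ⟨p, hp, e⟩ := fd_spec hd h R x ω
    exact ⟨p, hp, e ▸ hm⟩
  · rintro ⟨p, hp, e⟩
    exact (fd_le hp).trans e

lemma fd_measurable (hd : 0 < d) (h : ℝ) (R : ℕ) (x : Vert d) :
    Measurable (fd (d := d) h R x) := by
  refine measurable_of_Iic fun m => ?_
  have : fd h R x ⁻¹' Set.Iic m = ⋃ p ∈ {p : List (Vert d) | ArmPath x R p}, {ω | cost h ω p ≤ m} := by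
    ext ω
    simp [fd_le_iff hd]
  rw [this]
  exact MeasurableSet.biUnion (Set.to_countable _) fun p _ =>
    (cost_measurable h p) (measurableSet_Iic)

lemma fd_congr {h : ℝ} {R : ℕ} {x : Vert d} {ω ω' : Vert d → ℝ}
    (e : ∀ v ∈ box x R, ω v = ω' v) : fd h R x ω = fd h R x ω' := by
  unfold fd
  congr 1
  ext m
  refine exists_congr fun p => and_congr_right fun ⟨y, hp⟩ => ?_
  rw [cost_congr fun v hv => e v (mem_box_iff.2 (hp.2.2 v hv))]

lemma fd_anti (hd : 0 < d) {h : ℝ} {R : ℕ} {x : Vert d} {ω ω' : Vert d → ℝ}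
    (e : ∀ v ∈ box x R, ω v ≤ ω' v) : fd h R x ω' ≤ fd h R x ω := by
  obtain ⟨p, hp, hc⟩ := fd_spec hd h R x ω
  rw [← hc]
  refine (fd_le hp).trans (cost_anti fun v hv => e v ?_)
  obtain ⟨y, -, -, h3⟩ := hp
  exact mem_box_iff.2 (h3 v hv)

lemma fd_shift_level (h c : ℝ) (R : ℕ) (x : Vert d) (ω : Vert d → ℝ) :
    fd h R x (fun v => ω v + c) = fd (h - c) R x ω := by
  simp [fd, cost, lt_sub_iff_add_lt]

lemma armPath_shift {x z : Vert d} {R : ℕ} {p : List (Vert d)} (h : ArmPath x R p) :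
    ArmPath (x + z) R (p.map (· + z)) := by
  obtain ⟨y, h1, h2, h3⟩ := h
  refine ⟨y + z, isPath_shift h1, by rw [linf_add, h2], ?_⟩
  simpa [linf_add] using h3

lemma fd_shift_le (hd : 0 < d) (h : ℝ) (R : ℕ) (x z : Vert d) (ω : Vert d → ℝ) :
    fd h R (x + z) ω ≤ fd h R x (fun v => ω (v + z)) := by
  obtain ⟨p, hp, hc⟩ := fd_spec hd h R x (fun v => ω (v + z))
  rw [← hc]
  refine (fd_le (armPath_shift hp)).trans (le_of_eq ?_)
  simp [cost, Function.comp_def]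

lemma fd_shift (hd : 0 < d) (h : ℝ) (R : ℕ) (x z : Vert d) (ω : Vert d → ℝ) :
    fd h R (x + z) ω = fd h R x (fun v => ω (v + z)) := by
  refine le_antisymm (fd_shift_le hd h R x z ω) ?_
  have := fd_shift_le hd h R (x + z) (-z) (fun v => ω (v + z))
  simpa using this

/-- the recursive inequality -/
lemma fd_rec (hd : 0 < d) (h : ℝ) (ω : Vert d → ℝ) (x : Vert d) {L L' : ℕ} (hL : 2 * L < L') :
    ∃ y ∈ box x L', linfDist x y = L' ∧ fd h L x ω + fd h L y ω ≤ fd h L' x ω := by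
  obtain ⟨p, ⟨y, hp, hy, hin⟩, hc⟩ := fd_spec hd h L' x ω
  refine ⟨y, mem_box_iff.2 hy.le, hy, ?_⟩
  obtain ⟨p1, p2, z, e, h1, h2, h3⟩ := exit_pre (c := x) hp (R := L) (by simp [linf_self])
    ⟨y, isPath_end_mem hp, by omega⟩
  have hf1 : fd h L x ω ≤ cost h ω p1 := fd_le ⟨z, h1, h2, h3⟩
  -- the rest of the path
  obtain ⟨q1, q2, w, e', g1, g2, g3⟩ := exit_pre (c := y) (isPath_reverse hp) (R := L)
    (by simp [linf_self]) ⟨x, isPath_end_mem (isPath_reverse hp), by rw [linf_symm]; omega⟩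
  have hf2 : fd h L y ω ≤ cost h ω q1 := fd_le ⟨w, g1, g2, g3⟩
  have hpre : q1.reverse <:+ p2 := by
    have hs1 : p = q2.reverse ++ q1.reverse := by
      rw [← List.reverse_append, ← e', List.reverse_reverse]
    rcases List.append_eq_append_iff.1 (hs1.symm.trans e) with ⟨r, hr1, hr2⟩ | ⟨r, hr1, hr2⟩
    · -- p1 = q2.reverse ++ r , q1.reverse = r ++ p2
      cases r with
      | nil => exact ⟨[], by simpa using hr2⟩
      | cons v r =>
        exfalso
        have hv1 : v ∈ p1 := by rw [hr1]; simp
        have hv2 : v ∈ q1 := by rw [← List.mem_reverse, hr2]; simp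
        have a1 := h3 v hv1
        have a2 := g3 v hv2
        have := linf_triangle x v y
        rw [linf_symm v y] at this
        omega
    · exact ⟨r, hr2.symm⟩
  obtain ⟨r, hr⟩ := hpre
  rw [← hc, e, cost_append, ← hr, cost_append, cost_reverse]
  omega

end Conn
end

section
/-! ### Decoupling inequality -/
section Decouple
variable {d : ℕ} {μ : Measure (Vert d → ℝ)}

lemma hit_of_mem {A : Finset (Vert d)} {y : Vert d} (hy : y ∈ A) (z : Vert d) :
    hit A y z = if y = z then 1 else 0 := by
  simp [hit, hitn_mem hy]

lemma hproj_mem {A : Finset (Vert d)} {y : Vert d} (hy : y ∈ A) (ω : Vert d → ℝ) :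
    hproj A ω y = ω y := by
  simp [hproj, hit_of_mem hy, hy]

lemma hproj_tail (hd : 3 ≤ d) (hμ : GaussLaw μ (gr (d := d))) (A : Finset (Vert d)) (y : Vert d)
    {σ2 ε : ℝ} (hσ : 0 < σ2) (hε : 0 ≤ ε) (h : ∀ z ∈ A, gr z y ≤ σ2) :
    μ.real {ω | ε ≤ hproj A ω y} ≤ Real.exp (-(ε ^ 2 / (2 * σ2))) ∧
    μ.real {ω | ε ≤ - hproj A ω y} ≤ Real.exp (-(ε ^ 2 / (2 * σ2))) := by
  have hv : ∑ z ∈ A, ∑ w ∈ A, hit A y z * hit A y w * gr z w ≤ σ2 := by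
    rw [hit_green2 hd]
    calc ∑ z ∈ A, hit A y z * gr z y ≤ ∑ z ∈ A, hit A y z * σ2 :=
          Finset.sum_le_sum fun z hz => mul_le_mul_of_nonneg_left (h z hz) (hit_nonneg _ _ _)
      _ = (∑ z ∈ A, hit A y z) * σ2 := by rw [Finset.sum_mul]
      _ ≤ 1 * σ2 := by gcongr; exact hit_sum_le (by omega) A y
      _ = σ2 := one_mul _
  refine ⟨hμ.tail A (fun z => hit A y z) hσ hε hv, ?_⟩
  have := hμ.tail A (fun z => - hit A y z) hσ hε (by simpa using hv)
  simpa [hproj] using this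

lemma hproj_measurable (A : Finset (Vert d)) : Measurable fun ω : Vert d → ℝ => hproj A ω := by
  refine measurable_pi_lambda _ fun y => ?_
  unfold hproj
  fun_prop

lemma decouple (hd : 3 ≤ d) (hμ : GaussLaw μ (gr (d := d))) (B1 B2 : Finset (Vert d))
    {σ2 ε : ℝ} (hσ : 0 < σ2) (hε : 0 ≤ ε) (hg : ∀ z ∈ B1, ∀ y ∈ B2, gr z y ≤ σ2)
    {f1 f2 : (Vert d → ℝ) → ℝ} (m1 : Measurable f1) (m2 : Measurable f2)
    (n1 : ∀ ω, 0 ≤ f1 ω) (n2 : ∀ ω, 0 ≤ f2 ω) (u1 : ∀ ω, f1 ω ≤ 1) (u2 : ∀ ω, f2 ω ≤ 1)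
    (dep1 : ∀ ω ω', (∀ v ∈ B1, ω v = ω' v) → f1 ω = f1 ω')
    (dep2 : ∀ ω ω', (∀ v ∈ B2, ω v ≤ ω' v) → f2 ω ≤ f2 ω') :
    ∫ ω, f1 ω * f2 ω ∂μ ≤ (∫ ω, f1 ω ∂μ) * (∫ ω, f2 (fun v => ω v + 2 * ε) ∂μ) +
      2 * (B2.card * Real.exp (-(ε ^ 2 / (2 * σ2)))) := by
  have := hμ.prob
  have hmp := hproj_measurable (d := d) B1
  let Ψ := fun p : (Vert d → ℝ) × (Vert d → ℝ) => hproj B1 p.1 + (p.2 - hproj B1 p.2)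
  have hΨ : Measurable Ψ := by
    exact (hmp.comp measurable_fst).add (measurable_snd.sub (hmp.comp measurable_snd))
  let E1 : Set (Vert d → ℝ) := ⋃ y ∈ B2, {ω | ε ≤ hproj B1 ω y}
  let E2 : Set (Vert d → ℝ) := ⋃ y ∈ B2, {ω | ε ≤ - hproj B1 ω y}
  have mE1 : MeasurableSet E1 := Finset.measurableSet_biUnion _ fun y _ =>
    measurableSet_le measurable_const ((measurable_pi_apply y).comp hmp)
  have mE2 : MeasurableSet E2 := Finset.measurableSet_biUnion _ fun y _ =>
    measurableSet_le measurable_const ((measurable_pi_apply y).comp hmp).neg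
  have p1 : μ.real E1 ≤ B2.card * Real.exp (-(ε ^ 2 / (2 * σ2))) := by
    refine (measureReal_biUnion_finset_le _ _).trans ?_
    rw [← nsmul_eq_mul]
    exact Finset.sum_le_card_nsmul _ _ _ fun y hy =>
      (hproj_tail hd hμ B1 y hσ hε fun z hz => hg z hz y hy).1
  have p2 : μ.real E2 ≤ B2.card * Real.exp (-(ε ^ 2 / (2 * σ2))) := by
    refine (measureReal_biUnion_finset_le _ _).trans ?_
    rw [← nsmul_eq_mul]
    exact Finset.sum_le_card_nsmul _ _ _ fun y hy =>
      (hproj_tail hd hμ B1 y hσ hε fun z hz => hg z hz y hy).2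
  have ms : Measurable fun ω : Vert d → ℝ => fun v => ω v + 2 * ε :=
    measurable_pi_lambda _ fun v => (measurable_pi_apply v).add_const _
  have hnt : ∀ f : (Vert d → ℝ) → ℝ, Measurable f → (∀ ω, 0 ≤ f ω) → (∀ ω, f ω ≤ 1) →
      Integrable f μ := fun f mf nf uf =>
    Integrable.of_bound mf.aestronglyMeasurable 1 (ae_of_all _ fun ω => by
      rw [Real.norm_eq_abs, abs_of_nonneg (nf ω)]; exact uf ω)
  have i1 := hnt f1 m1 n1 u1
  have i2 := hnt (fun ω => f2 (fun v => ω v + 2 * ε)) (m2.comp ms) (fun _ => n2 _) (fun _ => u2 _)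
  have i12 : Integrable (fun p : (Vert d → ℝ) × (Vert d → ℝ) =>
      f1 p.1 * f2 (fun v => p.2 v + 2 * ε)) (μ.prod μ) := i1.mul_prod i2
  have ind : ∀ E : Set (Vert d → ℝ), MeasurableSet E → Integrable (E.indicator fun _ => (1:ℝ)) μ :=
    fun E hE => (integrable_const 1).indicator hE
  have iE1 : Integrable (fun p : (Vert d → ℝ) × (Vert d → ℝ) =>
      E1.indicator (fun _ => (1:ℝ)) p.1) (μ.prod μ) := (ind E1 mE1).comp_fst _
  have iE2 : Integrable (fun p : (Vert d → ℝ) × (Vert d → ℝ) =>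
      E2.indicator (fun _ => (1:ℝ)) p.2) (μ.prod μ) := (ind E2 mE2).comp_snd _
  have key : ∀ p : (Vert d → ℝ) × (Vert d → ℝ), f1 (Ψ p) * f2 (Ψ p) ≤
      f1 p.1 * f2 (fun v => p.2 v + 2 * ε) + E1.indicator (fun _ => (1:ℝ)) p.1 +
        E2.indicator (fun _ => (1:ℝ)) p.2 := by
    intro p
    have h0 : 0 ≤ f1 p.1 * f2 (fun v => p.2 v + 2 * ε) := mul_nonneg (n1 _) (n2 _)
    have hle : f1 (Ψ p) * f2 (Ψ p) ≤ 1 := mul_le_one₀ (u1 _) (n2 _) (u2 _)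
    have e1 : 0 ≤ E1.indicator (fun _ => (1:ℝ)) p.1 := Set.indicator_nonneg (fun _ _ => zero_le_one) _
    have e2 : 0 ≤ E2.indicator (fun _ => (1:ℝ)) p.2 := Set.indicator_nonneg (fun _ _ => zero_le_one) _
    by_cases hp1 : p.1 ∈ E1
    · rw [Set.indicator_of_mem hp1] at *; linarith
    by_cases hp2 : p.2 ∈ E2
    · rw [Set.indicator_of_mem hp2] at *; linarith
    have : f1 (Ψ p) = f1 p.1 := dep1 _ _ fun v hv => by
      simp [Ψ, hproj_mem hv]
    rw [this]
    have : f2 (Ψ p) ≤ f2 (fun v => p.2 v + 2 * ε) := dep2 _ _ fun v hv => by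
      simp only [E1, E2, Set.mem_iUnion, Set.mem_setOf_eq, not_exists, not_le] at hp1 hp2
      have a1 := hp1 v hv
      have a2 := hp2 v hv
      simp only [Ψ, Pi.add_apply, Pi.sub_apply]
      linarith
    have := mul_le_mul_of_nonneg_left this (n1 p.1)
    linarith
  have mf12 : Measurable fun ω => f1 ω * f2 ω := m1.mul m2
  calc ∫ ω, f1 ω * f2 ω ∂μ = ∫ ω, f1 ω * f2 ω ∂((μ.prod μ).map Ψ) := by
        rw [gff_decouple hd hμ B1]
    _ = ∫ p, f1 (Ψ p) * f2 (Ψ p) ∂(μ.prod μ) :=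
        integral_map hΨ.aemeasurable mf12.aestronglyMeasurable
    _ ≤ ∫ p, (f1 p.1 * f2 (fun v => p.2 v + 2 * ε) + E1.indicator (fun _ => (1:ℝ)) p.1 +
        E2.indicator (fun _ => (1:ℝ)) p.2) ∂(μ.prod μ) := by
        refine integral_mono_of_nonneg (ae_of_all _ fun p => mul_nonneg (n1 _) (n2 _))
          ((i12.add iE1).add iE2) (ae_of_all _ key)
    _ = (∫ ω, f1 ω ∂μ) * (∫ ω, f2 (fun v => ω v + 2 * ε) ∂μ) + μ.real E1 + μ.real E2 := by
        have ia := i12.add iE1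
        simp only [Pi.add_def] at ia
        rw [integral_add ia iE2, integral_add i12 iE1, integral_prod_mul (μ := μ) (ν := μ) f1
          (fun ω : Vert d → ℝ => f2 (fun v => ω v + 2 * ε)),
          integral_fun_fst (fun ω => E1.indicator (fun _ => (1:ℝ)) ω),
          integral_fun_snd (fun ω => E2.indicator (fun _ => (1:ℝ)) ω),
          integral_indicator_const _ mE1, integral_indicator_const _ mE2]
        simp
    _ ≤ _ := by linarith

end Decouple
end

section
/-! ### Renormalization: one step -/
section Renorm
variable {d : ℕ} {μ : Measure (Vert d → ℝ)}

/-- exponential moment of the point-to-sphere distance -/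
noncomputable def mm (μ : Measure (Vert d → ℝ)) (h : ℝ) (L : ℕ) (l : ℝ) : ℝ :=
  ∫ ω, Real.exp (-(l * fd h L 0 ω)) ∂μ

lemma fd_level (hd : 0 < d) {h h' : ℝ} (hh : h ≤ h') (R : ℕ) (x : Vert d) (ω : Vert d → ℝ) :
    fd h R x ω ≤ fd h' R x ω := by
  have e := fd_shift_level h' (h' - h) R x ω
  rw [show h' - (h' - h) = h by ring] at e
  rw [← e]
  exact fd_anti hd fun v _ => by linarith

lemma fd_radius (hd : 0 < d) (h : ℝ) {R R' : ℕ} (hR : R ≤ R') (x : Vert d) (ω : Vert d → ℝ) :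
    fd h R x ω ≤ fd h R' x ω := by
  obtain ⟨p, ⟨y, hp, hy, -⟩, hc⟩ := fd_spec hd h R' x ω
  obtain ⟨p1, p2, e, -, h1⟩ := fd_le_of_path (h := h) (ω := ω) (R := R) hp
    ⟨y, isPath_end_mem hp, by omega⟩
  rw [← hc, e, cost_append]
  omega

lemma mexp_meas (hd : 0 < d) (h : ℝ) (L : ℕ) (x : Vert d) (l : ℝ) :
    Measurable fun ω : Vert d → ℝ => Real.exp (-(l * fd h L x ω)) := by
  have : Measurable fun ω : Vert d → ℝ => (fd h L x ω : ℝ) :=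
    (measurable_from_nat (f := fun n : ℕ => (n:ℝ))).comp (fd_measurable hd h L x)
  fun_prop

lemma mexp_le {h : ℝ} {L : ℕ} {x : Vert d} {l : ℝ} (hl : 0 ≤ l) (ω : Vert d → ℝ) :
    Real.exp (-(l * fd h L x ω)) ≤ 1 := by
  rw [Real.exp_le_one_iff]
  have : 0 ≤ l * (fd h L x ω : ℝ) := by positivity
  linarith

lemma mexp_int (hd : 0 < d) [IsProbabilityMeasure μ] (h : ℝ) (L : ℕ) (x : Vert d) {l : ℝ}
    (hl : 0 ≤ l) : Integrable (fun ω : Vert d → ℝ => Real.exp (-(l * fd h L x ω))) μ :=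
  Integrable.of_bound (mexp_meas hd h L x l).aestronglyMeasurable 1 (ae_of_all _ fun ω => by
    rw [Real.norm_eq_abs, Real.abs_exp]; exact mexp_le hl ω)

lemma mm_nonneg (h : ℝ) (L : ℕ) (l : ℝ) : 0 ≤ mm μ h L l :=
  integral_nonneg fun _ => (Real.exp_pos _).le

lemma mm_anti (hd : 0 < d) [IsProbabilityMeasure μ] {h h' : ℝ} (hh : h ≤ h') (L : ℕ) {l : ℝ}
    (hl : 0 ≤ l) : mm μ h' L l ≤ mm μ h L l := by
  refine integral_mono (mexp_int hd _ _ _ hl) (mexp_int hd _ _ _ hl) fun ω => ?_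
  have : (fd h L 0 ω : ℝ) ≤ fd h' L 0 ω := by exact_mod_cast fd_level hd hh L 0 ω
  dsimp only
  gcongr

lemma mm_shift (hd : 0 < d) (hμ : GaussLaw μ (gr (d := d))) (h : ℝ) (L : ℕ) (l : ℝ) (y : Vert d) :
    ∫ ω, Real.exp (-(l * fd h L y ω)) ∂μ = mm μ h L l := by
  have ms : Measurable fun ω : Vert d → ℝ => fun x => ω (x + y) :=
    measurable_pi_lambda _ fun x => measurable_pi_apply _
  unfold mm
  conv_rhs => rw [← gff_shift hμ y]
  rw [integral_map ms.aemeasurable (mexp_meas hd h L 0 l).aestronglyMeasurable]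
  have : ∀ ω : Vert d → ℝ, fd h L y ω = fd h L 0 (fun x => ω (x + y)) := fun ω => by
    have := fd_shift hd h L 0 y ω
    rwa [zero_add] at this
  simp only [this]

lemma mm_jensen (hd : 0 < d) [IsProbabilityMeasure μ] (h : ℝ) (L : ℕ) {l l' a : ℝ}
    (hl' : 0 < l') (hll : l' ≤ l) (ha : mm μ h L l ≤ Real.exp (-a)) :
    mm μ h L l' ≤ Real.exp (-(a * (l' / l))) := by
  have hl : 0 < l := hl'.trans_le hll
  have hp : 1 ≤ l / l' := (one_le_div hl').2 hll
  have hpow : ∀ ω : Vert d → ℝ, (Real.exp (-(l' * fd h L 0 ω))) ^ (l / l') =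
      Real.exp (-(l * fd h L 0 ω)) := fun ω => by
    rw [← Real.exp_mul]; congr 1; field_simp
  have := (convexOn_rpow hp).map_integral_le (μ := μ)
    (f := fun ω : Vert d → ℝ => Real.exp (-(l' * fd h L 0 ω)))
    (Real.continuous_rpow_const (by positivity)).continuousOn isClosed_Ici
    (ae_of_all _ fun ω => (Real.exp_pos _).le) (mexp_int hd _ _ _ hl'.le) (by
      simp only [Function.comp_def, hpow]
      exact mexp_int hd _ _ _ hl.le)
  simp only [hpow] at this
  have h2 : (mm μ h L l') ^ (l / l') ≤ Real.exp (-a) := this.trans ha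
  have h3 := Real.rpow_le_rpow (by have := mm_nonneg (μ := μ) h L l'; positivity) h2
    (show 0 ≤ l' / l by positivity)
  rw [← Real.rpow_mul (mm_nonneg _ _ _), div_mul_div_comm, mul_comm l l', div_self (by positivity),
    Real.rpow_one, ← Real.exp_mul] at h3
  exact h3.trans (le_of_eq (by congr 1; ring))

lemma box_card_le {x : Vert d} {R : ℕ} {l : ℝ} (h : (2 * R + 1 : ℝ) ≤ Real.exp l) :
    ((box x R).card : ℝ) ≤ Real.exp (d * l) := by
  rw [card_box, Real.exp_nat_mul]
  push_cast
  gcongr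

lemma mm_step (hd : 3 ≤ d) (hμ : GaussLaw μ (gr (d := d))) (h : ℝ) {L L' : ℕ} (hL : 2 * L < L')
    {l ε σ2 : ℝ} (hl : 0 ≤ l) (hε : 0 ≤ ε) (hσ : 0 < σ2)
    (hg : ∀ x y : Vert d, L' - 2 * L ≤ linfDist x y → linfDist x y ≤ 2 * L' → gr x y ≤ σ2) :
    mm μ (h + 2 * ε) L' l ≤ (box (0 : Vert d) L').card *
      (mm μ h L l ^ 2 + 2 * ((box (0 : Vert d) L).card * Real.exp (-(ε ^ 2 / (2 * σ2))))) := by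
  have hd0 : 0 < d := by omega
  have := hμ.prob
  set h' := h + 2 * ε with hh'
  set F := (box (0 : Vert d) L').filter fun y => linfDist 0 y = L' with hF
  have i2 : ∀ y : Vert d, Integrable (fun ω => Real.exp (-(l * fd h' L 0 ω)) *
      Real.exp (-(l * fd h' L y ω))) μ := fun y =>
    Integrable.of_bound ((mexp_meas hd0 _ _ _ _).mul (mexp_meas hd0 _ _ _ _)).aestronglyMeasurable 1
      (ae_of_all _ fun ω => by
        rw [Real.norm_eq_abs, abs_mul, Real.abs_exp, Real.abs_exp]
        exact mul_le_one₀ (mexp_le hl ω) (Real.exp_pos _).le (mexp_le hl ω))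
  have h1 : mm μ h' L' l ≤ ∑ y ∈ F, ∫ ω, Real.exp (-(l * fd h' L 0 ω)) *
      Real.exp (-(l * fd h' L y ω)) ∂μ := by
    rw [← integral_finsetSum _ fun y _ => i2 y]
    refine integral_mono (mexp_int hd0 _ _ _ hl) (integrable_finsetSum _ fun y _ => i2 y) fun ω => ?_
    obtain ⟨y, hy, hyL, hle⟩ := fd_rec hd0 h' ω 0 hL
    have hle' : (fd h' L 0 ω : ℝ) + fd h' L y ω ≤ fd h' L' 0 ω := by exact_mod_cast hle
    dsimp only
    calc Real.exp (-(l * fd h' L' 0 ω)) ≤ Real.exp (-(l * fd h' L 0 ω)) *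
        Real.exp (-(l * fd h' L y ω)) := by
          rw [← Real.exp_add]
          apply Real.exp_le_exp.2
          nlinarith [mul_le_mul_of_nonneg_left hle' hl]
      _ ≤ _ := Finset.single_le_sum (f := fun y => Real.exp (-(l * fd h' L 0 ω)) *
          Real.exp (-(l * fd h' L y ω))) (fun _ _ => by positivity)
          (Finset.mem_filter.2 ⟨hy, hyL⟩)
  have h2 : ∀ y ∈ F, ∫ ω, Real.exp (-(l * fd h' L 0 ω)) * Real.exp (-(l * fd h' L y ω)) ∂μ ≤
      mm μ h L l ^ 2 + 2 * ((box (0 : Vert d) L).card * Real.exp (-(ε ^ 2 / (2 * σ2)))) := by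
    intro y hy
    have hyL := (Finset.mem_filter.1 hy).2
    have := decouple hd hμ (box 0 L) (box y L) hσ hε (by
        intro z hz w hw
        have hz := mem_box_iff.1 hz
        have hw := mem_box_iff.1 hw
        have t1 := linf_triangle 0 z y
        have t2 := linf_triangle z w y
        have t3 := linf_triangle z y w
        have t4 := linf_triangle z 0 y
        rw [linf_symm w y] at t2
        rw [linf_symm z 0] at t4
        exact hg z w (by omega) (by omega))
      (mexp_meas hd0 h' L 0 l) (mexp_meas hd0 h' L y l)
      (fun _ => (Real.exp_pos _).le) (fun _ => (Real.exp_pos _).le)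
      (mexp_le hl) (mexp_le hl) (fun ω ω' e => by rw [fd_congr e])
      (fun ω ω' e => by
        have : (fd h' L y ω' : ℝ) ≤ fd h' L y ω := by exact_mod_cast fd_anti hd0 e
        gcongr)
    simp only [fd_shift_level] at this
    have hcard : (box y L).card = (box (0 : Vert d) L).card := by rw [card_box, card_box]
    rw [mm_shift hd0 hμ, mm_shift hd0 hμ, show h' - 2 * ε = h by rw [hh']; ring, hcard] at this
    have hmul : mm μ h' L l * mm μ h L l ≤ mm μ h L l ^ 2 := by
      rw [sq]
      exact mul_le_mul_of_nonneg_right (mm_anti hd0 (by rw [hh']; linarith) L hl) (mm_nonneg _ _ _)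
    linarith
  calc mm μ h' L' l ≤ _ := h1
    _ ≤ ∑ y ∈ F, (mm μ h L l ^ 2 + 2 * ((box (0 : Vert d) L).card * Real.exp (-(ε ^ 2 / (2 * σ2))))) :=
        Finset.sum_le_sum h2
    _ = F.card * (mm μ h L l ^ 2 + 2 * ((box (0 : Vert d) L).card * Real.exp (-(ε ^ 2 / (2 * σ2))))) := by
        rw [Finset.sum_const, nsmul_eq_mul]
    _ ≤ _ := by
        refine mul_le_mul_of_nonneg_right ?_ (by positivity)
        exact_mod_cast Finset.card_le_card (Finset.filter_subset _ _)

/-- the step with exponents -/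
lemma mm_step' (hd : 3 ≤ d) (hμ : GaussLaw μ (gr (d := d))) (h : ℝ) {L L' : ℕ} (hL : 2 * L < L')
    {l l' ε σ2 a Λ a' : ℝ} (hl' : 0 < l') (hll : l' ≤ l) (hε : 0 ≤ ε) (hσ : 0 < σ2)
    (hg : ∀ x y : Vert d, L' - 2 * L ≤ linfDist x y → linfDist x y ≤ 2 * L' → gr x y ≤ σ2)
    (hb : (2 * L' + 1 : ℝ) ≤ Real.exp Λ) (ha : mm μ h L l ≤ Real.exp (-a))
    (c1 : d * Λ + 1 + a' ≤ 2 * (a * (l' / l)))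
    (c2 : 2 * (d * Λ) + 2 + a' ≤ ε ^ 2 / (2 * σ2)) :
    mm μ (h + 2 * ε) L' l' ≤ Real.exp (-a') := by
  have := hμ.prob
  have s1 := mm_step hd hμ h hL hl'.le hε hσ hg
  have s2 := mm_jensen (by omega) h L hl' hll ha
  have n1 := box_card_le (d := d) (x := 0) hb
  have n2 : ((box (0 : Vert d) L).card : ℝ) ≤ Real.exp (d * Λ) := box_card_le (by
    refine le_trans ?_ hb
    have : (L : ℝ) ≤ L' := by exact_mod_cast (by omega : L ≤ L')
    linarith)
  have hm := mm_nonneg (μ := μ) h L l'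
  have e2 : 2 ≤ Real.exp 1 := by have := Real.add_one_le_exp (1:ℝ); linarith
  have e4 : 4 ≤ Real.exp 2 := by
    rw [show (2:ℝ) = 1 + 1 by norm_num, Real.exp_add]; nlinarith
  calc mm μ (h + 2 * ε) L' l' ≤ Real.exp (d * Λ) * (Real.exp (-(a * (l' / l))) ^ 2 +
        2 * (Real.exp (d * Λ) * Real.exp (-(ε ^ 2 / (2 * σ2))))) := by
        refine s1.trans ?_
        gcongr
    _ = Real.exp (d * Λ - 2 * (a * (l' / l))) +
        2 * Real.exp (2 * (d * Λ) - ε ^ 2 / (2 * σ2)) := by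
        rw [← Real.exp_nat_mul, mul_add, ← Real.exp_add, ← Real.exp_add,
          show ∀ x y : ℝ, x * (2 * y) = 2 * (x * y) by intros; ring, ← Real.exp_add]
        congr 2
        · push_cast; ring
        · ring_nf
    _ ≤ Real.exp (-a' - 1) + 2 * Real.exp (-a' - 2) := by
        refine add_le_add (Real.exp_le_exp.2 (by linarith)) ?_
        exact mul_le_mul_of_nonneg_left (Real.exp_le_exp.2 (by linarith)) (by norm_num)
    _ ≤ Real.exp (-a') := by
        rw [Real.exp_sub, Real.exp_sub]
        have hpos := Real.exp_pos (-a')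
        have f1 : Real.exp (-a') / Real.exp 1 ≤ Real.exp (-a') / 2 := by gcongr
        have f2 : Real.exp (-a') / Real.exp 2 ≤ Real.exp (-a') / 4 := by gcongr
        linarith

end Renorm
end

section
/-! ### Renormalization: scales -/
section Renorm2
variable {d : ℕ} {μ : Measure (Vert d → ℝ)}

noncomputable def qq (k : ℕ) : ℝ := (k + 1 : ℝ) ^ (9/8 : ℝ)

lemma qq_pos (k : ℕ) : 0 < qq k := by unfold qq; positivity

lemma qq_summable : Summable fun k => 1 / qq k := by
  have h := (summable_nat_add_iff 1).2 (Real.summable_one_div_nat_rpow (p := 9/8)|>.2 (by norm_num))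
  simpa [qq] using h

noncomputable def ZZ : ℝ := ∑' k, 1 / qq k

lemma ZZ_part (k : ℕ) : ∑ j ∈ Finset.range k, 1 / qq j ≤ ZZ :=
  qq_summable.sum_le_tsum _ fun j _ => by have := qq_pos j; positivity

lemma ZZ_ge : 1 ≤ ZZ := by
  have := ZZ_part 1
  simpa [qq] using this

noncomputable def ww (d k : ℕ) : ℝ := if d = 3 then (14 / (k + 14 : ℝ)) ^ 4 else 1

lemma ww_pos (d k : ℕ) : 0 < ww d k := by unfold ww; split_ifs <;> positivity

lemma ww_succ_le (d k : ℕ) : ww d (k + 1) ≤ ww d k := by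
  unfold ww; split_ifs
  · push_cast; gcongr; linarith
  · exact le_rfl

lemma ww_ratio (d k : ℕ) : 3 / 4 * ww d k ≤ ww d (k + 1) := by
  unfold ww; split_ifs
  · push_cast
    have h : (14/15 : ℝ) * (14 / (k + 14 : ℝ)) ≤ 14 / (k + 1 + 14 : ℝ) := by
      rw [div_mul_div_comm, div_le_div_iff₀ (by positivity) (by positivity)]
      have : (0:ℝ) ≤ k := by positivity
      nlinarith
    have h2 := pow_le_pow_left₀ (by positivity) h 4
    rw [mul_pow] at h2
    refine le_trans ?_ h2
    gcongr
    norm_num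
  · norm_num

lemma pow_bound (m : ℕ) : ∃ K : ℝ, 0 < K ∧ ∀ k : ℕ, (k + 14 : ℝ) ^ m ≤ K * 2 ^ k := by
  have h := (tendsto_pow_const_div_const_pow_of_one_lt m (r := (2:ℝ)) (by norm_num)).bddAbove_range
  obtain ⟨K, hK⟩ := h
  refine ⟨(|K| + 1) * 2 ^ 14, by positivity, fun k => ?_⟩
  have := hK ⟨k + 14, rfl⟩
  simp only at this
  rw [div_le_iff₀ (by positivity)] at this
  push_cast at this
  refine this.trans ?_
  rw [pow_add, mul_assoc, mul_comm ((2:ℝ) ^ k)]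
  gcongr
  have := le_abs_self K
  linarith

lemma KG_pos (hd : 3 ≤ d) : 0 < KG d := by unfold KG; have := KH_pos hd; positivity

lemma err_cond (hd : 3 ≤ d) : ∃ K : ℝ, 0 < K ∧ ∀ (s L0 X : ℝ), 0 < s → 1 ≤ L0 → 1 ≤ X →
    K * X ^ 2 ≤ s ^ 2 * L0 → ∀ (k : ℕ) (Λ : ℝ), 0 < Λ → Λ ≤ (k + 1) * X →
    2 ^ k * ((8 * d + 1) * X) * ww d k + 7 * d * ((k + 1) * X) ≤
      (s / (2 * ZZ * qq k)) ^ 2 / (2 * (KG d * (Λ / (2 ^ k * L0 / qq k) ^ 2) ^ bexp d)) := by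
  obtain ⟨K, hK, hKk⟩ := pow_bound 6
  have hG := KG_pos hd
  have hZ := ZZ_ge
  refine ⟨8 * ZZ ^ 2 * KG d * (((8 * d + 1) * 14 ^ 4 + 7 * d * K) * 1 + K * (15 * d + 1)),
    by positivity, fun s L0 X hs hL hX hc k Λ hΛ hΛX => ?_⟩
  have hq := qq_pos k
  have hk0 : (0:ℝ) ≤ k := by positivity
  have hk1 : (1:ℝ) ≤ k + 1 := by linarith
  set r := 2 ^ k * L0 / qq k with hr
  have hrpos : 0 < r := by positivity
  have hrew : (s / (2 * ZZ * qq k)) ^ 2 / (2 * (KG d * (Λ / r ^ 2) ^ bexp d)) =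
      s ^ 2 / (8 * ZZ ^ 2 * KG d) * ((r ^ 2 / Λ) ^ bexp d / qq k ^ 2) := by
    rw [show Λ / r ^ 2 = (r ^ 2 / Λ)⁻¹ by rw [inv_div], Real.inv_rpow (by positivity)]
    field_simp
    norm_num
  rw [hrew]
  have hkp : ∀ p : ℝ, ∀ m : ℕ, p ≤ m → (k + 1 : ℝ) ^ p ≤ (k + 14 : ℝ) ^ m := fun p m hp => by
    calc (k + 1 : ℝ) ^ p ≤ (k + 1 : ℝ) ^ (m : ℝ) := Real.rpow_le_rpow_of_exponent_le hk1 hp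
      _ = (k + 1 : ℝ) ^ m := Real.rpow_natCast _ _
      _ ≤ _ := by gcongr; norm_num
  have h2k : (0:ℝ) < 2 ^ k := by positivity
  set G := 8 * ZZ ^ 2 * KG d with hGdef
  have hGpos : 0 < G := by positivity
  have hK6 := hKk k
  by_cases h3 : d = 3
  · have hb : bexp d = 1 / 2 := by simp [bexp, h3]
    have hw : ww d k = 14 ^ 4 / (k + 14 : ℝ) ^ 4 := by simp [ww, h3, div_pow]
    rw [hb, hw, ← Real.sqrt_eq_rpow, Real.sqrt_div (by positivity), Real.sqrt_sq hrpos.le]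
    -- lower bound
    have hsq : Real.sqrt Λ ≤ (k + 1 : ℝ) ^ (1/2 : ℝ) * X := by
      rw [← Real.sqrt_eq_rpow]
      calc Real.sqrt Λ ≤ Real.sqrt ((k + 1) * X) := Real.sqrt_le_sqrt hΛX
        _ = Real.sqrt (k + 1) * Real.sqrt X := Real.sqrt_mul (by positivity) _
        _ ≤ Real.sqrt (k + 1) * X := by
          gcongr
          rw [Real.sqrt_le_left (by linarith)]; nlinarith
    have hden : Real.sqrt Λ * qq k ^ 2 * qq k ≤ (k + 14 : ℝ) ^ 4 * X := by
      calc Real.sqrt Λ * qq k ^ 2 * qq k ≤ ((k + 1 : ℝ) ^ (1/2 : ℝ) * X) * qq k ^ 2 * qq k := by gcongr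
        _ = (k + 1 : ℝ) ^ (31/8 : ℝ) * X := by
          have : qq k ^ 2 * qq k = (k + 1 : ℝ) ^ (27/8 : ℝ) := by
            rw [← pow_succ, qq, ← Real.rpow_natCast, ← Real.rpow_mul (by positivity)]; norm_num
          rw [mul_assoc, this, mul_right_comm, ← Real.rpow_add (by positivity)]; norm_num
        _ ≤ _ := by gcongr; exact hkp _ 4 (by norm_num)
    have hE : 2 ^ k * L0 / ((k + 14 : ℝ) ^ 4 * X) ≤ r / Real.sqrt Λ / qq k ^ 2 := by
      rw [hr, div_div, div_div]
      have : 0 < Real.sqrt Λ := Real.sqrt_pos.2 hΛ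
      refine div_le_div_of_nonneg_left (by positivity) (by positivity) ?_
      calc _ = Real.sqrt Λ * qq k ^ 2 * qq k := by ring
        _ ≤ _ := hden
    have hkk : (k + 1 : ℝ) ≤ K * 2 ^ k / (k + 14 : ℝ) ^ 4 := by
      rw [le_div_iff₀ (by positivity)]
      refine le_trans ?_ hK6
      rw [show (6:ℕ) = 2 + 4 by norm_num, pow_add]
      gcongr
      nlinarith
    have hc' : G * ((8 * d + 1) * 14 ^ 4 + 7 * d * K) * X ^ 2 ≤ s ^ 2 * L0 := by
      refine le_trans ?_ hc
      have : 0 ≤ K * (15 * d + 1 : ℝ) := by positivity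
      exact mul_le_mul_of_nonneg_right (mul_le_mul_of_nonneg_left (by linarith) hGpos.le) (by positivity)
    calc 2 ^ k * ((8 * d + 1) * X) * (14 ^ 4 / (k + 14 : ℝ) ^ 4) + 7 * d * ((k + 1) * X)
        ≤ 2 ^ k * ((8 * d + 1) * X) * (14 ^ 4 / (k + 14 : ℝ) ^ 4) +
          7 * d * (K * 2 ^ k / (k + 14 : ℝ) ^ 4 * X) := by gcongr
      _ = (G * ((8 * d + 1) * 14 ^ 4 + 7 * d * K) * X ^ 2) * (2 ^ k / ((k + 14 : ℝ) ^ 4 * X * G)) := by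
          field_simp
      _ ≤ (s ^ 2 * L0) * (2 ^ k / ((k + 14 : ℝ) ^ 4 * X * G)) := by gcongr
      _ = s ^ 2 / G * (2 ^ k * L0 / ((k + 14 : ℝ) ^ 4 * X)) := by field_simp
      _ ≤ _ := by gcongr
  · have hb : bexp d = 1 := by simp [bexp, h3]
    have hw : ww d k = 1 := by simp [ww, h3]
    rw [hb, hw, Real.rpow_one]
    have hden : Λ * qq k ^ 2 * qq k ^ 2 ≤ K * 2 ^ k * X := by
      calc Λ * qq k ^ 2 * qq k ^ 2 ≤ ((k + 1) * X) * qq k ^ 2 * qq k ^ 2 := by gcongr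
        _ = (k + 1 : ℝ) ^ (11/2 : ℝ) * X := by
          have : qq k ^ 2 * qq k ^ 2 = (k + 1 : ℝ) ^ (9/2 : ℝ) := by
            rw [← pow_add, qq, ← Real.rpow_natCast, ← Real.rpow_mul (by positivity)]; norm_num
          rw [mul_assoc, this, mul_right_comm]
          nth_rewrite 1 [← Real.rpow_one (k + 1 : ℝ)]
          rw [← Real.rpow_add (by positivity)]; norm_num
        _ ≤ _ := by gcongr; exact (hkp _ 6 (by norm_num)).trans hK6
    have hE : 2 ^ k * L0 / (K * X) ≤ r ^ 2 / Λ / qq k ^ 2 := by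
      rw [hr, div_pow, div_div, div_div, div_le_div_iff₀ (by positivity) (by positivity)]
      calc 2 ^ k * L0 * (qq k ^ 2 * (Λ * qq k ^ 2)) = 2 ^ k * L0 * (Λ * qq k ^ 2 * qq k ^ 2) := by ring
        _ ≤ 2 ^ k * L0 * (K * 2 ^ k * X) := by gcongr
        _ = (2 ^ k) ^ 2 * L0 * (K * X) := by ring
        _ ≤ (2 ^ k * L0) ^ 2 * (K * X) := by
          rw [mul_pow]; gcongr; nlinarith
    have hkk : (k + 1 : ℝ) ≤ 2 ^ k := by
      have : k + 1 ≤ 2 ^ k := Nat.lt_two_pow_self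
      exact_mod_cast this
    have hc' : G * (K * (15 * d + 1)) * X ^ 2 ≤ s ^ 2 * L0 := by
      refine le_trans ?_ hc
      have : 0 ≤ (8 * d + 1) * 14 ^ 4 + 7 * d * K := by positivity
      exact mul_le_mul_of_nonneg_right (mul_le_mul_of_nonneg_left (by linarith) hGpos.le) (by positivity)
    calc 2 ^ k * ((8 * d + 1) * X) * 1 + 7 * d * ((k + 1) * X)
        ≤ 2 ^ k * ((8 * d + 1) * X) * 1 + 7 * d * (2 ^ k * X) := by gcongr
      _ = (G * (K * (15 * d + 1)) * X ^ 2) * (2 ^ k / (K * X * G)) := by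
          field_simp; ring
      _ ≤ (s ^ 2 * L0) * (2 ^ k / (K * X * G)) := by gcongr
      _ = s ^ 2 / G * (2 ^ k * L0 / (K * X)) := by field_simp
      _ ≤ _ := by gcongr

/-- the scales -/
noncomputable def LL (L0 : ℕ) : ℕ → ℕ
  | 0 => L0
  | k + 1 => 2 * LL L0 k + ⌈2 ^ k * L0 / qq k⌉₊

lemma LL_upper (L0 : ℕ) (hL0 : 1 ≤ L0) (k : ℕ) :
    (LL L0 k : ℝ) + 1 ≤ 2 ^ k * L0 * (2 + ∑ j ∈ Finset.range k, 1 / qq j) := by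
  have h1 : (1:ℝ) ≤ L0 := by exact_mod_cast hL0
  induction k with
  | zero => simp [LL]; linarith
  | succ k ih =>
    have hq := qq_pos k
    have hc := (Nat.ceil_lt_add_one (show 0 ≤ 2 ^ k * (L0:ℝ) / qq k by positivity)).le
    rw [Finset.sum_range_succ]
    simp only [LL]
    push_cast
    have : 2 ^ (k + 1) * (L0:ℝ) * (2 + (∑ j ∈ Finset.range k, 1 / qq j + 1 / qq k)) =
      2 * (2 ^ k * L0 * (2 + ∑ j ∈ Finset.range k, 1 / qq j)) + 2 * (2 ^ k * L0 / qq k) := by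
      field_simp; ring
    rw [this]
    have : 0 ≤ 2 ^ k * (L0:ℝ) / qq k := by positivity
    linarith

lemma LL_le (L0 : ℕ) (hL0 : 1 ≤ L0) (k : ℕ) : (LL L0 k : ℝ) + 1 ≤ 2 ^ k * L0 * (2 + ZZ) := by
  refine (LL_upper L0 hL0 k).trans ?_
  gcongr
  exact ZZ_part k

/-- the constant in the seed estimate -/
noncomputable def CR : ℝ := Real.log (4 * (2 + ZZ)) + 10

set_option maxHeartbeats 800000 in
lemma renorm_bound (hd : 3 ≤ d) (hμ : GaussLaw μ (gr (d := d))) : ∃ K : ℝ, 0 < K ∧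
    ∀ (s : ℝ) (L0 : ℕ), 0 < s → 1 ≤ L0 → K * (Real.log L0 + CR) ^ 2 ≤ s ^ 2 * L0 →
    ∀ h0 : ℝ, μ.real {ω | fd h0 L0 0 ω = 0} ≤
      1 / 2 * Real.exp (-(8 * d * (Real.log L0 + CR) + 1)) →
    ∀ k : ℕ, mm μ (h0 + s) (LL L0 k) ((8 * d * (Real.log L0 + CR) + 2) * ww d k) ≤
      Real.exp (-(2 ^ k * ((8 * d * (Real.log L0 + CR) + 2) * ww d k) / 2)) := by
  obtain ⟨K, hK, hKc⟩ := err_cond hd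
  refine ⟨K, hK, fun s L0 hs hL0 hc h0 hseed => ?_⟩
  have := hμ.prob
  have hd0 : 0 < d := by omega
  have hd3 : (3:ℝ) ≤ d := by exact_mod_cast hd
  have hZ := ZZ_ge
  have hL1 : (1:ℝ) ≤ L0 := by exact_mod_cast hL0
  set X := Real.log L0 + CR with hX
  have hX10 : 10 ≤ X := by
    have h1 := Real.log_nonneg hL1
    have h2 : 0 ≤ Real.log (4 * (2 + ZZ)) := Real.log_nonneg (by linarith)
    rw [hX, CR]; linarith
  set l0 := 8 * d * X + 2 with hl0
  have hl0pos : 0 < l0 := by positivity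
  have hl0le : l0 ≤ (8 * d + 1) * X := by rw [hl0]; nlinarith
  let H : ℕ → ℝ := fun k => h0 + s / ZZ * ∑ j ∈ Finset.range k, 1 / qq j
  have hH : ∀ k, H k ≤ h0 + s := fun k => by
    have := ZZ_part k
    have : s / ZZ * ∑ j ∈ Finset.range k, 1 / qq j ≤ s / ZZ * ZZ := by gcongr
    rw [div_mul_cancel₀ _ (by positivity)] at this
    simp only [H]; linarith
  have main : ∀ k : ℕ, mm μ (H k) (LL L0 k) (l0 * ww d k) ≤
      Real.exp (-(2 ^ k * (l0 * ww d k) / 2 + 4 * d * (k + X))) := by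
    intro k
    induction k with
    | zero =>
      have hw : ww d 0 = 1 := by simp [ww]
      simp only [H, hw, LL, Finset.range_zero, Finset.sum_empty, mul_zero, add_zero, mul_one,
        pow_zero, one_mul, Nat.cast_zero, zero_add]
      have hm : MeasurableSet {ω : Vert d → ℝ | fd h0 L0 0 ω = 0} :=
        (fd_measurable hd0 h0 L0 0) (measurableSet_singleton 0)
      have h1 : mm μ h0 L0 l0 ≤ μ.real {ω | fd h0 L0 0 ω = 0} + Real.exp (-l0) := by
        have : ∫ ω, ({ω | fd h0 L0 0 ω = 0}.indicator (fun _ => (1:ℝ)) ω + Real.exp (-l0)) ∂μ =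
            μ.real {ω | fd h0 L0 0 ω = 0} + Real.exp (-l0) := by
          rw [integral_add ((integrable_const _).indicator hm) (integrable_const _),
            integral_indicator_const _ hm]
          simp
        rw [← this]
        refine integral_mono (mexp_int hd0 _ _ _ hl0pos.le)
          (((integrable_const _).indicator hm).add (integrable_const _)) fun ω => ?_
        dsimp only
        by_cases hω : fd h0 L0 0 ω = 0
        · rw [Set.indicator_of_mem (by exact hω)]
          have := mexp_le (h := h0) (L := L0) (x := 0) hl0pos.le ω
          have := Real.exp_pos (-l0)
          linarith
        · rw [Set.indicator_of_notMem (by exact hω), zero_add]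
          have : (1:ℝ) ≤ fd h0 L0 0 ω := by exact_mod_cast Nat.one_le_iff_ne_zero.2 hω
          apply Real.exp_le_exp.2
          nlinarith
      have e : l0 / 2 + 4 * d * X = l0 - 1 := by rw [hl0]; ring
      rw [e]
      have e1 : Real.exp (-l0) ≤ 1 / 2 * Real.exp (-(l0 - 1)) := by
        rw [show -(l0 - 1) = -l0 + 1 by ring, Real.exp_add]
        have := Real.add_one_le_exp (1:ℝ)
        have := Real.exp_pos (-l0)
        nlinarith
      rw [show 8 * d * X + 1 = l0 - 1 by rw [hl0]; ring] at hseed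
      linarith
    | succ k ih =>
      have hq := qq_pos k
      have hw := ww_pos d k
      have hw' := ww_pos d (k + 1)
      have hww := ww_succ_le d k
      have hwr := ww_ratio d k
      set Λ : ℝ := k + X with hΛ
      have hk0 : (0:ℝ) ≤ k := by positivity
      have hΛ10 : 10 ≤ Λ := by rw [hΛ]; linarith
      set r : ℝ := 2 ^ k * L0 / qq k with hr
      have hrpos : 0 < r := by positivity
      have hLs : LL L0 (k + 1) = 2 * LL L0 k + ⌈r⌉₊ := rfl
      have hexp : 4 * (2 + ZZ) * (2 ^ k * L0) ≤ Real.exp (Λ - 10) := by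
        rw [hΛ, hX, CR, show (k:ℝ) + (Real.log L0 + (Real.log (4 * (2 + ZZ)) + 10)) - 10 =
          k * 1 + Real.log L0 + Real.log (4 * (2 + ZZ)) by ring, Real.exp_add, Real.exp_add,
          Real.exp_log (by positivity), Real.exp_log (by positivity), Real.exp_nat_mul, mul_comm]
        gcongr
        have := Real.add_one_le_exp (1:ℝ); linarith
      have hLL := LL_le L0 hL0 (k + 1)
      have h2L : 2 * (LL L0 (k + 1) : ℝ) + 1 ≤ Real.exp (Λ - 10) := by
        refine le_trans ?_ hexp
        rw [pow_succ] at hLL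
        nlinarith
      have step := mm_step' hd hμ (H k) (L := LL L0 k) (L' := LL L0 (k + 1))
        (l := l0 * ww d k) (l' := l0 * ww d (k + 1)) (ε := s / (2 * ZZ * qq k))
        (σ2 := KG d * (Λ / r ^ 2) ^ bexp d) (a := 2 ^ k * (l0 * ww d k) / 2 + 4 * d * Λ) (Λ := Λ)
        (a' := 2 ^ (k + 1) * (l0 * ww d (k + 1)) / 2 + 4 * d * (Λ + 1))
        (by
          have : 0 < ⌈r⌉₊ := Nat.ceil_pos.2 hrpos
          omega) (by positivity) (by gcongr) (by positivity)
        (by have := KG_pos hd; positivity) ?_ ?_ ih ?_ ?_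
      · have e : H k + 2 * (s / (2 * ZZ * qq k)) = H (k + 1) := by
          simp only [H, Finset.sum_range_succ]; field_simp; ring
        rw [e] at step
        convert step using 4
        push_cast; rw [hΛ]; ring
      · intro x y h1 h2
        have hb : ⌈r⌉₊ ≤ linfDist x y := by omega
        have hb1 : r ≤ linfDist x y := Nat.ceil_le.1 hb
        have hpos : 1 ≤ linfDist x y := by
          have : 0 < ⌈r⌉₊ := Nat.ceil_pos.2 hrpos
          omega
        refine (gr_decay hd hpos).trans ?_
        have hG := KG_pos hd
        have hD : (0:ℝ) < linfDist x y := by exact_mod_cast hpos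
        unfold gdec
        have hlog : 0 ≤ Real.log (linfDist x y : ℝ) := Real.log_nonneg (by exact_mod_cast hpos)
        refine mul_le_mul_of_nonneg_left (Real.rpow_le_rpow (by positivity) ?_ bexp_pos.le) hG.le
        have : 1 + Real.log (linfDist x y : ℝ) ≤ Λ := by
          have h2' : (linfDist x y : ℝ) ≤ 2 * LL L0 (k + 1) := by exact_mod_cast h2
          have := (Real.log_le_iff_le_exp hD).2 (h2'.trans (by linarith : _ ≤ Real.exp (Λ - 10)))
          linarith
        gcongr
      · refine h2L.trans (Real.exp_le_exp.2 (by linarith))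
      · have e : l0 * ww d (k + 1) / (l0 * ww d k) = ww d (k + 1) / ww d k := by
          field_simp
        rw [e]
        have e2 : 2 * ((2 ^ k * (l0 * ww d k) / 2 + 4 * d * Λ) * (ww d (k + 1) / ww d k)) =
          2 ^ (k + 1) * (l0 * ww d (k + 1)) / 2 + 8 * d * Λ * (ww d (k + 1) / ww d k) := by
          field_simp; ring
        rw [e2]
        have h34 : 3 / 4 ≤ ww d (k + 1) / ww d k := (le_div_iff₀ hw).2 hwr
        have : 8 * d * Λ * (3 / 4) ≤ 8 * d * Λ * (ww d (k + 1) / ww d k) :=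
          mul_le_mul_of_nonneg_left h34 (by positivity)
        have t4 : (d:ℝ) * 10 ≤ d * Λ := mul_le_mul_of_nonneg_left hΛ10 (by positivity)
        linarith
      · have hE := hKc s L0 X hs hL1 (by linarith) hc k Λ (by linarith) (by
          rw [hΛ]; have := mul_nonneg hk0 (by linarith : 0 ≤ X - 1); linarith)
        refine le_trans ?_ hE
        have h2k : (0:ℝ) < 2 ^ k := by positivity
        have t1 : 2 ^ (k + 1) * (l0 * ww d (k + 1)) / 2 ≤ 2 ^ k * ((8 * d + 1) * X) * ww d k := by
          rw [pow_succ]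
          calc _ = 2 ^ k * (l0 * ww d (k + 1)) := by ring
            _ ≤ 2 ^ k * (((8 * d + 1) * X) * ww d k) :=
              mul_le_mul_of_nonneg_left (mul_le_mul hl0le hww hw'.le (by positivity)) h2k.le
            _ = _ := by ring
        have t2 : Λ ≤ (k + 1) * X := by
          rw [hΛ]; have := mul_nonneg hk0 (by linarith : 0 ≤ X - 1); linarith
        have t3 : 7 * d * Λ ≤ 7 * d * ((k + 1) * X) :=
          mul_le_mul_of_nonneg_left t2 (by positivity)
        have t4 : (d:ℝ) * 10 ≤ d * Λ := mul_le_mul_of_nonneg_left hΛ10 (by positivity)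
        linarith
  intro k
  have hl : 0 ≤ l0 * ww d k := by have := ww_pos d k; positivity
  refine (mm_anti hd0 (hH k) _ hl).trans ((main k).trans (Real.exp_le_exp.2 ?_))
  have : 0 ≤ 4 * d * (k + X) := by positivity
  linarith

end Renorm2
end

section
section Renorm3
variable {d : ℕ} {μ : Measure (Vert d → ℝ)}

/-- strong decay at level `h` -/
def Decay (μ : Measure (Vert d → ℝ)) (h : ℝ) : Prop :=
  ∃ K : ℕ, 0 < K ∧ ∀ k : ℕ, μ.real {ω | 4 * fd h (K * 2 ^ k) 0 ω ≤ 2 ^ k} ≤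
    Real.exp (-(2 ^ k * ww d k / 2))

lemma renorm (hd : 3 ≤ d) (hμ : GaussLaw μ (gr (d := d))) {s : ℝ} (hs : 0 < s) :
    ∀ᶠ L0 : ℕ in atTop, ∀ h0 : ℝ, μ.real {ω | fd h0 L0 0 ω = 0} ≤
      1 / 2 * Real.exp (-(8 * d * (Real.log L0 + CR) + 1)) → Decay μ (h0 + s) := by
  obtain ⟨K, hK, hmain⟩ := renorm_bound hd hμ
  have := hμ.prob
  have hlim : Tendsto (fun L0 : ℕ => K * (Real.log L0 + CR) ^ 2 / (L0:ℝ)) atTop (𝓝 0) := by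
    have h2 : Tendsto (fun x : ℝ => Real.log x ^ 2 / x) atTop (𝓝 0) :=
      (Real.isLittleO_pow_log_id_atTop (n := 2)).tendsto_div_nhds_zero
    have h1 : Tendsto (fun x : ℝ => Real.log x ^ 1 / x) atTop (𝓝 0) :=
      (Real.isLittleO_pow_log_id_atTop (n := 1)).tendsto_div_nhds_zero
    have h0 : Tendsto (fun x : ℝ => CR ^ 2 / x) atTop (𝓝 0) := tendsto_const_nhds.div_atTop tendsto_id
    have := (((h2.add (h1.const_mul (2 * CR))).add h0).const_mul K).comp tendsto_natCast_atTop_atTop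
    simp only [mul_zero, add_zero] at this
    refine this.congr fun n => ?_
    simp only [Function.comp_apply]
    ring
  filter_upwards [hlim.eventually (gt_mem_nhds (show (0:ℝ) < s ^ 2 by positivity)), eventually_ge_atTop 1]
    with L0 h1 hL0 h0 hseed
  have hLpos : (0:ℝ) < L0 := by exact_mod_cast hL0
  rw [div_lt_iff₀ hLpos] at h1
  have hb := hmain s L0 hs hL0 h1.le h0 hseed
  have hZ := ZZ_ge
  have hX0 : 0 ≤ Real.log L0 + CR := by
    have h1 := Real.log_nonneg (show (1:ℝ) ≤ L0 by exact_mod_cast hL0)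
    have h2 : 0 ≤ Real.log (4 * (2 + ZZ)) := Real.log_nonneg (by linarith)
    rw [CR]; linarith
  have hl2 : 2 ≤ 8 * d * (Real.log L0 + CR) + 2 := by
    have : 0 ≤ 8 * d * (Real.log L0 + CR) := by positivity
    linarith
  set l0 := 8 * d * (Real.log L0 + CR) + 2 with hl0
  clear_value l0
  refine ⟨⌈L0 * (2 + ZZ)⌉₊, Nat.ceil_pos.2 (by positivity), fun k => ?_⟩
  have hw := ww_pos d k
  have h2k : (0:ℝ) < 2 ^ k := by positivity
  have hl : 0 ≤ l0 * ww d k := by positivity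
  have hR : LL L0 k ≤ ⌈L0 * (2 + ZZ)⌉₊ * 2 ^ k := by
    have a := LL_le L0 hL0 k
    have b := Nat.le_ceil ((L0:ℝ) * (2 + ZZ))
    have c : (LL L0 k : ℝ) ≤ ⌈L0 * (2 + ZZ)⌉₊ * 2 ^ k := by
      have := mul_le_mul_of_nonneg_right b h2k.le
      linarith
    exact_mod_cast c
  set T : Set (Vert d → ℝ) := {ω | 4 * fd (h0 + s) (⌈L0 * (2 + ZZ)⌉₊ * 2 ^ k) 0 ω ≤ 2 ^ k} with hT
  have hTm : MeasurableSet T := by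
    have := (fd_measurable (d := d) (by omega) (h0 + s) (⌈L0 * (2 + ZZ)⌉₊ * 2 ^ k) 0)
    exact measurableSet_le (measurable_const.mul this) measurable_const
  have hmarkov : Real.exp (-(l0 * ww d k * (2 ^ k / 4))) * μ.real T ≤
      mm μ (h0 + s) (LL L0 k) (l0 * ww d k) := by
    have e : ∫ ω, T.indicator (fun _ => Real.exp (-(l0 * ww d k * (2 ^ k / 4)))) ω ∂μ =
        Real.exp (-(l0 * ww d k * (2 ^ k / 4))) * μ.real T := by
      rw [integral_indicator_const _ hTm, smul_eq_mul, mul_comm]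
    rw [← e]
    refine integral_mono ((integrable_const _).indicator hTm) (mexp_int (by omega) _ _ _ hl) fun ω => ?_
    dsimp only
    by_cases hω : ω ∈ T
    · rw [Set.indicator_of_mem hω]
      apply Real.exp_le_exp.2
      have h4 : 4 * fd (h0 + s) (LL L0 k) 0 ω ≤ 2 ^ k :=
        (Nat.mul_le_mul_left 4 (fd_radius (by omega) _ hR 0 ω)).trans hω
      have h5 : (fd (h0 + s) (LL L0 k) 0 ω : ℝ) ≤ 2 ^ k / 4 := by
        rw [le_div_iff₀ (by norm_num), mul_comm]; exact_mod_cast h4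
      have := mul_le_mul_of_nonneg_left h5 hl
      linarith
    · rw [Set.indicator_of_notMem hω]; positivity
  have h6 := hmarkov.trans (hb k)
  have h7 : μ.real T ≤ Real.exp (-(2 ^ k * (l0 * ww d k) / 2)) * Real.exp (l0 * ww d k * (2 ^ k / 4)) := by
    have := mul_le_mul_of_nonneg_right h6 (Real.exp_pos (l0 * ww d k * (2 ^ k / 4))).le
    rwa [mul_right_comm, ← Real.exp_add, neg_add_cancel, Real.exp_zero, one_mul] at this
  refine h7.trans ?_
  rw [← Real.exp_add]
  apply Real.exp_le_exp.2
  have : 2 * (2 ^ k * ww d k) ≤ l0 * (2 ^ k * ww d k) := mul_le_mul_of_nonneg_right hl2 (by positivity)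
  linarith

end Renorm3
end

section
/-! ### Percolation and decay -/
section Perc
variable {d : ℕ} {μ : Measure (Vert d → ℝ)}

/-- one-arm probability -/
noncomputable def th (μ : Measure (Vert d → ℝ)) (h : ℝ) (n : ℕ) : ℝ := μ.real {ω | fd h n 0 ω = 0}

lemma arm_meas (hd : 0 < d) (h : ℝ) (n : ℕ) (x : Vert d) :
    MeasurableSet {ω : Vert d → ℝ | fd h n x ω = 0} :=
  (fd_measurable hd h n x) (measurableSet_singleton 0)

lemma th_nonneg (h : ℝ) (n : ℕ) : 0 ≤ th μ h n := measureReal_nonneg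

lemma th_le_one [IsProbabilityMeasure μ] (h : ℝ) (n : ℕ) : th μ h n ≤ 1 := measureReal_le_one

lemma th_anti (hd : 0 < d) [IsProbabilityMeasure μ] {h h' : ℝ} (hh : h ≤ h') {n n' : ℕ} (hn : n ≤ n') :
    th μ h' n' ≤ th μ h n := by
  refine measureReal_mono fun ω (hω : fd h' n' 0 ω = 0) => ?_
  have h1 := fd_level hd hh n 0 ω
  have h2 := fd_radius hd h' hn 0 ω
  show fd h n 0 ω = 0
  omega

lemma fd_eq_zero (hd : 0 < d) {h : ℝ} {R : ℕ} {x : Vert d} {ω : Vert d → ℝ} :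
    fd h R x ω = 0 ↔ ∃ y, linfDist x y = R ∧ ∃ p, IsPathFrom x y p ∧ (∀ v ∈ p, h ≤ ω v) ∧
      ∀ v ∈ p, linfDist x v ≤ R := by
  rw [← Nat.le_zero, fd_le_iff hd]
  simp only [Nat.le_zero, cost_eq_zero, ArmPath]
  constructor
  · rintro ⟨p, ⟨y, h1, h2, h3⟩, h4⟩
    exact ⟨y, h2, p, h1, h4, h3⟩
  · rintro ⟨y, h2, p, h1, h4, h3⟩
    exact ⟨p, ⟨y, h1, h2, h3⟩, h4⟩

lemma infinite_iff (hd : 0 < d) {h : ℝ} {x : Vert d} {ω : Vert d → ℝ} :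
    {y | VConnectedIn {v | h ≤ ω v} x y}.Infinite ↔ ∀ R, fd h R x ω = 0 := by
  constructor
  · intro hinf R
    have : ∃ y ∈ {y | VConnectedIn {v | h ≤ ω v} x y}, y ∉ box x R :=
      hinf.exists_notMem_finset _
    obtain ⟨y, ⟨p, hp, hop⟩, hy⟩ := this
    rw [mem_box_iff, not_le] at hy
    obtain ⟨p1, p2, e, h1, h2⟩ := fd_le_of_path (h := h) (ω := ω) (R := R) hp
      ⟨y, isPath_end_mem hp, hy.le⟩
    have : cost h ω p1 = 0 := cost_eq_zero.2 fun v hv => hop v (by rw [e]; simp [hv])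
    omega
  · intro hR hfin
    have : ∃ R, ∀ y ∈ {y | VConnectedIn {v | h ≤ ω v} x y}, linfDist x y < R := by
      obtain ⟨R, hR⟩ := (hfin.image (linfDist x)).bddAbove
      exact ⟨R + 1, fun y hy => Nat.lt_succ_of_le (hR ⟨y, hy, rfl⟩)⟩
    obtain ⟨R, hlt⟩ := this
    obtain ⟨y, hy, p, hp, hop, -⟩ := (fd_eq_zero hd).1 (hR R)
    have := hlt y ⟨p, hp, hop⟩
    omega

lemma perc_iff (hd : 0 < d) {h : ℝ} {ω : Vert d → ℝ} :
    PercolatesIn {v | h ≤ ω v} ↔ ∃ x, ∀ R, fd h R x ω = 0 := by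
  unfold PercolatesIn
  exact exists_congr fun x => infinite_iff hd

lemma inf_meas (hd : 0 < d) (h : ℝ) (x : Vert d) :
    MeasurableSet {ω : Vert d → ℝ | ∀ R, fd h R x ω = 0} := by
  rw [Set.setOf_forall]
  exact MeasurableSet.iInter fun R => arm_meas hd h R x

lemma perc_meas (hd : 0 < d) (h : ℝ) :
    MeasurableSet {ω : Vert d → ℝ | PercolatesIn {v | h ≤ ω v}} := by
  simp only [perc_iff hd, Set.setOf_exists]
  exact MeasurableSet.iUnion fun x => inf_meas hd h x

lemma shift_event (hμ : GaussLaw μ (gr (d := d))) (z : Vert d) {A : Set (Vert d → ℝ)}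
    (hA : MeasurableSet A) : μ {ω | (fun x => ω (x + z)) ∈ A} = μ A := by
  conv_rhs => rw [← gff_shift hμ z]
  rw [Measure.map_apply (measurable_pi_lambda _ fun x => measurable_pi_apply _) hA]
  rfl

lemma inf_shift (hd : 0 < d) (hμ : GaussLaw μ (gr (d := d))) (h : ℝ) (x : Vert d) :
    μ {ω : Vert d → ℝ | ∀ R, fd h R x ω = 0} = μ {ω : Vert d → ℝ | ∀ R, fd h R 0 ω = 0} := by
  rw [← shift_event hμ x (inf_meas hd h 0)]
  congr 1
  ext ω
  have : ∀ R, fd h R x ω = fd h R 0 (fun y => ω (y + x)) := fun R => by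
    simpa using fd_shift hd h R 0 x ω
  simp [this]

lemma perc_zero_iff (hd : 0 < d) (hμ : GaussLaw μ (gr (d := d))) (h : ℝ) :
    μ {ω : Vert d → ℝ | PercolatesIn {v | h ≤ ω v}} = 0 ↔
      μ {ω : Vert d → ℝ | ∀ R, fd h R 0 ω = 0} = 0 := by
  simp only [perc_iff hd, Set.setOf_exists, measure_iUnion_null_iff, inf_shift hd hμ]
  exact forall_const _

lemma th_tendsto (hd : 0 < d) [IsProbabilityMeasure μ] (h : ℝ) :
    Tendsto (fun n => th μ h n) atTop (𝓝 (μ.real {ω : Vert d → ℝ | ∀ R, fd h R 0 ω = 0})) := by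
  have e : {ω : Vert d → ℝ | ∀ R, fd h R 0 ω = 0} = ⋂ R, {ω | fd h R 0 ω = 0} := by
    ext ω; simp
  rw [e]
  refine (ENNReal.tendsto_toReal (measure_ne_top _ _)).comp
    (tendsto_measure_iInter_atTop (fun n => (arm_meas hd h n 0).nullMeasurableSet) ?_ ⟨0, measure_ne_top _ _⟩)
  intro n m hnm ω (hω : fd h m 0 ω = 0)
  have := fd_radius hd h hnm 0 ω
  show fd h n 0 ω = 0
  omega

lemma th_tendsto_zero (hd : 0 < d) (hμ : GaussLaw μ (gr (d := d))) {h : ℝ}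
    (h0 : μ {ω : Vert d → ℝ | PercolatesIn {v | h ≤ ω v}} = 0) :
    Tendsto (fun n => th μ h n) atTop (𝓝 0) := by
  have := hμ.prob
  have h1 := th_tendsto (μ := μ) hd h
  rwa [Measure.real, (perc_zero_iff hd hμ h).1 h0, ENNReal.toReal_zero] at h1

lemma pw_tendsto (d : ℕ) : Tendsto (fun k : ℕ => (2:ℝ) ^ k * ww d k) atTop atTop := by
  unfold ww
  split_ifs with h3
  · have h := tendsto_pow_const_div_const_pow_of_one_lt 4 (r := (2:ℝ)) (by norm_num)
    have h' := (tendsto_add_atTop_iff_nat (f := fun n : ℕ => (n:ℝ) ^ 4 / 2 ^ n) 14).2 h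
    have h2 : Tendsto (fun k : ℕ => ((k + 14 : ℕ) : ℝ) ^ 4 / 2 ^ (k + 14)) atTop (𝓝[>] 0) :=
      tendsto_nhdsWithin_iff.2 ⟨h', Eventually.of_forall fun k => by
        exact Set.mem_Ioi.2 (by positivity)⟩
    have h3 := (h2.inv_tendsto_nhdsGT_zero).const_mul_atTop (show (0:ℝ) < 14 ^ 4 / 2 ^ 14 by positivity)
    refine h3.congr fun k => ?_
    simp only [Pi.inv_apply]
    push_cast
    rw [inv_div, div_pow, pow_add]
    field_simp
  · simpa using tendsto_pow_atTop_atTop_of_one_lt (r := (2:ℝ)) (by norm_num)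

lemma decay_no_perc (hd : 0 < d) (hμ : GaussLaw μ (gr (d := d))) {h : ℝ} (hD : Decay μ h) :
    μ {ω : Vert d → ℝ | PercolatesIn {v | h ≤ ω v}} = 0 := by
  have := hμ.prob
  obtain ⟨K, hK, hk⟩ := hD
  rw [perc_zero_iff hd hμ]
  have hle : ∀ k : ℕ, μ.real {ω : Vert d → ℝ | ∀ R, fd h R 0 ω = 0} ≤ Real.exp (-(2 ^ k * ww d k / 2)) :=
    fun k => (measureReal_mono fun ω (hω : ∀ R, fd h R 0 ω = 0) => by simp [hω]).trans (hk k)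
  have hlim : Tendsto (fun k : ℕ => Real.exp (-(2 ^ k * ww d k / 2))) atTop (𝓝 0) :=
    Real.tendsto_exp_neg_atTop_nhds_zero.comp ((pw_tendsto d).atTop_div_const (by norm_num))
  have := le_antisymm (ge_of_tendsto' hlim hle) measureReal_nonneg
  rwa [Measure.real, ENNReal.toReal_eq_zero_iff, or_iff_left (measure_ne_top _ _)] at this

/-- weights -/
noncomputable def wt (h : ℝ) (ω : Vert d → ℝ) (x : Vert d) : ℝ≥0∞ := if ω x < h then 1 else 0

lemma wt_path (h : ℝ) (ω : Vert d → ℝ) (p : List (Vert d)) :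
    vertPathWeight (wt h ω) p = (cost h ω p : ℝ≥0∞) := by
  induction p with
  | nil => simp [vertPathWeight, cost]
  | cons a l ih =>
    simp only [vertPathWeight, cost, List.map_cons, List.sum_cons] at ih ⊢
    rw [ih]
    push_cast
    congr 1

lemma fd_le_vfpp {h : ℝ} {ω : Vert d → ℝ} {R : ℕ} {x y : Vert d} (hR : R ≤ linfDist x y) :
    (fd h R x ω : ℝ≥0∞) ≤ vfppDist (wt h ω) x y := by
  refine le_iInf fun ⟨p, hp⟩ => ?_
  rw [wt_path]
  obtain ⟨p1, p2, e, h1, h2⟩ := fd_le_of_path (h := h) (ω := ω) (R := R) hp ⟨y, isPath_end_mem hp, hR⟩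
  have e2 : cost h ω p = cost h ω p1 + cost h ω p2 := by rw [← cost_append, ← e]
  have h3 : fd h R x ω ≤ cost h ω p := h2.trans (by omega)
  exact_mod_cast h3

lemma nsmul_dist {x : Vert d} (hx : x ≠ 0) (n : ℕ) : n ≤ linfDist 0 (n • x) := by
  obtain ⟨i, hi⟩ := Function.ne_iff.1 hx
  refine le_trans ?_ (linf_le_of_sub (i := i))
  have h1 : 1 ≤ (x i).natAbs := Int.natAbs_pos.2 hi
  simp only [Pi.zero_apply, zero_sub, Int.natAbs_neg, Pi.smul_apply, nsmul_eq_mul, Int.natAbs_mul,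
    Int.natAbs_natCast]
  nlinarith

lemma site_prob (hd : 0 < d) (hμ : GaussLaw μ (gr (d := d))) {h : ℝ} (hD : Decay μ h) :
    μ.real {ω | h ≤ ω 0} < 1 := by
  have := hμ.prob
  refine lt_of_le_of_ne measureReal_le_one fun h1 => ?_
  have m0 : ∀ x : Vert d, MeasurableSet {ω : Vert d → ℝ | h ≤ ω x} := fun x =>
    measurableSet_le measurable_const (measurable_pi_apply x)
  have hall : ∀ x : Vert d, ∀ᵐ ω ∂μ, h ≤ ω x := fun x => by
    have e := shift_event hμ x (m0 0)
    simp only [Set.mem_setOf_eq, zero_add] at e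
    refine (mem_ae_iff_prob_eq_one (m0 x)).2 ?_
    rw [e]
    rw [Measure.real] at h1
    rw [← ENNReal.ofReal_toReal (measure_ne_top μ {ω : Vert d → ℝ | h ≤ ω 0}), h1, ENNReal.ofReal_one]
  obtain ⟨K, hK, hk⟩ := hD
  have h2 : ∀ᵐ ω ∂μ, ω ∈ {ω : Vert d → ℝ | 4 * fd h (K * 2 ^ 0) 0 ω ≤ 2 ^ 0} := by
    filter_upwards [ae_all_iff.2 hall] with ω hω
    obtain ⟨p, hp⟩ := exists_arm hd (0 : Vert d) (K * 2 ^ 0)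
    have := fd_le (h := h) (ω := ω) hp
    rw [cost_eq_zero.2 fun v _ => hω v] at this
    show 4 * fd h (K * 2 ^ 0) 0 ω ≤ 2 ^ 0
    omega
  have h3 := hk 0
  have h4 : μ.real {ω : Vert d → ℝ | 4 * fd h (K * 2 ^ 0) 0 ω ≤ 2 ^ 0} = 1 := by
    have h6 := measure_congr (eventuallyEq_univ.2 h2)
    rw [Measure.real]; erw [h6]
    simp
  rw [h4] at h3
  have h5 : Real.exp (-(2 ^ 0 * ww d 0 / 2)) < 1 := by
    rw [Real.exp_lt_one_iff]
    have := ww_pos d 0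
    simp; linarith
  linarith

end Perc
end

section
section Dec
variable {d : ℕ} {μ : Measure (Vert d → ℝ)}

lemma log_bd {δ ρ : ℝ} (hρ : 0 ≤ ρ) (hρδ : ρ ≤ δ) (n : ℕ) :
    (n:ℝ) / Real.log n ^ ρ ≤ n / Real.log 2 ^ δ := by
  have l2 : 0 < Real.log 2 := Real.log_pos (by norm_num)
  have l21 : Real.log 2 ≤ 1 := Real.log_two_lt_d9.le.trans (by norm_num)
  have hp : 0 < Real.log 2 ^ δ := Real.rpow_pos_of_pos l2 _
  have hp1 : Real.log 2 ^ δ ≤ 1 := Real.rpow_le_one l2.le l21 (hρ.trans hρδ)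
  rcases Nat.lt_or_ge n 2 with hn | hn
  · interval_cases n
    · simp
    · simp only [Nat.cast_one, Real.log_one]
      by_cases h0 : ρ = 0
      · subst h0
        rw [Real.rpow_zero]
        exact one_div_le_one_div_of_le hp hp1
      · rw [Real.zero_rpow h0, _root_.div_zero]; positivity
  · have hl : Real.log 2 ≤ Real.log n := Real.log_le_log (by norm_num) (by exact_mod_cast hn)
    refine div_le_div_of_nonneg_left (by positivity) hp ?_
    exact (Real.rpow_le_rpow_of_exponent_ge l2 l21 hρδ).trans (Real.rpow_le_rpow l2.le hl hρ)

lemma log_ww {δ : ℝ} (hδ : 4 < δ) {n k : ℕ} (hn : 2 ≤ n) (hk : 2 ^ k ≤ n) :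
    Real.log 2 ^ (δ - 4) * (14 / 15 * Real.log 2) ^ 4 ≤ Real.log n ^ δ * (14 / (k + 14 : ℝ)) ^ 4 := by
  have l2 : 0 < Real.log 2 := Real.log_pos (by norm_num)
  have hl : Real.log 2 ≤ Real.log n := Real.log_le_log (by norm_num) (by exact_mod_cast hn)
  have hl0 : 0 < Real.log n := l2.trans_le hl
  have hk' : k * Real.log 2 ≤ Real.log n := by
    rw [← Real.log_pow]
    exact Real.log_le_log (by positivity) (by exact_mod_cast hk)
  have e : Real.log n ^ δ = Real.log n ^ (δ - 4) * Real.log n ^ 4 := by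
    rw [← Real.rpow_natCast, ← Real.rpow_add hl0]; norm_num
  rw [e, mul_assoc, ← mul_pow]
  have h1 : Real.log 2 ^ (δ - 4) ≤ Real.log n ^ (δ - 4) := Real.rpow_le_rpow l2.le hl (by linarith)
  have h2 : 14 / 15 * Real.log 2 ≤ Real.log n * (14 / (k + 14 : ℝ)) := by
    rw [mul_div_assoc', le_div_iff₀ (by positivity)]
    nlinarith
  exact mul_le_mul h1 (pow_le_pow_left₀ (by positivity) h2 4) (by positivity) (by positivity)

lemma decay_main (hd : 0 < d) (hμ : GaussLaw μ (gr (d := d))) {h : ℝ} (hD : Decay μ h) {δ : ℝ}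
    (hδ : 4 < δ) : ∃ c2 c3 : ℝ, 0 < c2 ∧ 0 < c3 ∧ ∀ (n : ℕ) (x : Vert d), x ≠ 0 →
      μ {ω | vfppDist (wt h ω) 0 (n • x) ≤ ENNReal.ofReal (c2 * n)} ≤
        ENNReal.ofReal (Real.exp (-(c3 * n / Real.log n ^ (if d = 3 then δ else 0)))) := by
  have := hμ.prob
  have hs := site_prob hd hμ hD
  obtain ⟨K, hK, hk⟩ := hD
  have l2 : 0 < Real.log 2 := Real.log_pos (by norm_num)
  have hK' : (0:ℝ) < K := by exact_mod_cast hK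
  set q : ℝ := max (μ.real {ω : Vert d → ℝ | h ≤ ω 0}) (1/2) with hq
  have hq0 : 0 < q := lt_max_of_lt_right (by norm_num)
  have hq1 : q < 1 := max_lt hs (by norm_num)
  have hlq : 0 < -Real.log q := by have := Real.log_neg hq0 hq1; linarith
  set ρ : ℝ := if d = 3 then δ else 0 with hρ
  have hρ0 : 0 ≤ ρ := by rw [hρ]; split_ifs <;> linarith
  have hρδ : ρ ≤ δ := by rw [hρ]; split_ifs <;> linarith
  have hp : 0 < Real.log 2 ^ δ := Real.rpow_pos_of_pos l2 _
  set a1 : ℝ := -Real.log q * Real.log 2 ^ δ / K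
  set a2 : ℝ := 1 / (4 * K)
  set a3 : ℝ := Real.log 2 ^ (δ - 4) * (14 / 15 * Real.log 2) ^ 4 / (4 * K) with ha3
  have ha1p : 0 < a1 := by positivity
  have ha2p : 0 < a2 := by positivity
  have ha3p : 0 < a3 := by have := Real.rpow_pos_of_pos l2 (δ - 4); positivity
  set c3 : ℝ := min a1 (min a2 a3)
  have hc3 : 0 < c3 := lt_min ha1p (lt_min ha2p ha3p)
  have hc1 : c3 ≤ a1 := min_le_left _ _
  have hc2 : c3 ≤ a2 := (min_le_right _ _).trans (min_le_left _ _)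
  have hc3' : c3 ≤ a3 := (min_le_right _ _).trans (min_le_right _ _)
  refine ⟨1 / (16 * K), c3, by positivity, hc3, fun n x hx => ?_⟩
  have key : ∀ R : ℕ, R ≤ n → {ω | vfppDist (wt h ω) 0 (n • x) ≤ ENNReal.ofReal (1 / (16 * K) * n)} ⊆
      {ω : Vert d → ℝ | (fd h R 0 ω : ℝ) ≤ 1 / (16 * K) * n} := by
    intro R hR ω hω
    have h1 := (fd_le_vfpp (h := h) (ω := ω) (hR.trans (nsmul_dist hx n))).trans hω
    rw [← ENNReal.ofReal_natCast] at h1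
    exact (ENNReal.ofReal_le_ofReal_iff (by positivity)).1 h1
  suffices H : μ.real {ω | vfppDist (wt h ω) 0 (n • x) ≤ ENNReal.ofReal (1 / (16 * K) * n)} ≤
      Real.exp (-(c3 * n / Real.log n ^ ρ)) by
    rw [← ENNReal.ofReal_toReal (measure_ne_top μ _)]
    exact ENNReal.ofReal_le_ofReal H
  rcases Nat.lt_or_ge n K with hn | hn
  · have hn' : (n:ℝ) < K := by exact_mod_cast hn
    have h1 : μ.real {ω | vfppDist (wt h ω) 0 (n • x) ≤ ENNReal.ofReal (1 / (16 * K) * n)} ≤ q := by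
      refine le_trans (measureReal_mono fun ω hω => ?_) (le_max_left _ _)
      have h2 := key 0 (Nat.zero_le _) hω
      simp only [Set.mem_setOf_eq] at h2
      have h3 : (fd h 0 0 ω : ℝ) < 1 := by
        refine h2.trans_lt ?_
        rw [one_div, inv_mul_lt_iff₀ (by positivity)]; linarith
      have h4 : fd h 0 0 ω = 0 := by
        have : fd h 0 0 ω < 1 := by exact_mod_cast h3
        omega
      obtain ⟨y, -, p, hp, ho, -⟩ := (fd_eq_zero hd).1 h4
      exact ho 0 (isPath_start_mem hp)
    refine h1.trans ?_
    rw [← Real.exp_log hq0, Real.exp_le_exp, mul_div_assoc]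
    have h5 : (n:ℝ) / Real.log n ^ ρ ≤ K / Real.log 2 ^ δ :=
      (log_bd hρ0 hρδ n).trans (div_le_div_of_nonneg_right hn'.le hp.le)
    have h6 : c3 * ((n:ℝ) / Real.log n ^ ρ) ≤ a1 * (K / Real.log 2 ^ δ) :=
      mul_le_mul hc1 h5 (div_nonneg (by positivity) (Real.rpow_nonneg (Real.log_natCast_nonneg n) _)) ha1p.le
    have h7 : a1 * (K / Real.log 2 ^ δ) = -Real.log q := by
      simp only [a1]; field_simp
    linarith
  · obtain ⟨k, hk1, hk2⟩ : ∃ k, K * 2 ^ k ≤ n ∧ n < K * 2 ^ (k + 1) := by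
      refine ⟨Nat.log 2 (n / K), ?_, ?_⟩
      · have h1 : n / K ≠ 0 := (Nat.div_pos hn hK).ne'
        have := Nat.pow_log_le_self 2 h1
        calc K * 2 ^ Nat.log 2 (n / K) ≤ K * (n / K) := Nat.mul_le_mul_left _ this
          _ ≤ n := Nat.mul_div_le n K
      · have := Nat.lt_pow_succ_log_self (b := 2) (by norm_num) (n / K)
        rw [Nat.div_lt_iff_lt_mul hK] at this
        rw [mul_comm]; exact this
    have hk2' : (n:ℝ) ≤ K * 2 ^ (k + 1) := by exact_mod_cast hk2.le
    refine (measureReal_mono fun ω hω => ?_).trans ((hk k).trans ?_)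
    · have h2 := key _ hk1 hω
      simp only [Set.mem_setOf_eq] at h2 ⊢
      have h3 : (fd h (K * 2 ^ k) 0 ω : ℝ) ≤ 2 ^ k / 8 := by
        refine h2.trans ?_
        rw [one_div, inv_mul_le_iff₀ (by positivity)]
        rw [pow_succ] at hk2'; linarith
      have h4 : (4:ℝ) * fd h (K * 2 ^ k) 0 ω ≤ 2 ^ k := by
        have : (0:ℝ) < 2 ^ k := by positivity
        linarith
      exact_mod_cast h4
    · rw [Real.exp_le_exp]
      refine neg_le_neg ?_
      have h2k : (2:ℕ) ^ k ≤ n := (Nat.le_mul_of_pos_left _ hK).trans hk1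
      by_cases h3 : d = 3
      · have e : ρ = δ := by rw [hρ, if_pos h3]
        rw [e]
        rcases Nat.lt_or_ge n 2 with hn2 | hn2
        · have : n = 1 := by
            have := Nat.one_le_two_pow (n := k); omega
          subst this
          simp only [Nat.cast_one, Real.log_one]
          rw [Real.zero_rpow (by linarith), _root_.div_zero]
          have := ww_pos d k; positivity
        · have hl0 : 0 < Real.log n := Real.log_pos (by exact_mod_cast (by omega : 1 < n))
          rw [div_le_iff₀ (Real.rpow_pos_of_pos hl0 _)]
          have hw : ww d k = (14 / (k + 14 : ℝ)) ^ 4 := by rw [ww, if_pos h3]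
          have h5 := log_ww hδ hn2 h2k
          rw [← hw] at h5
          have h6 : c3 * n ≤ a3 * (K * 2 ^ (k + 1)) := mul_le_mul hc3' hk2' (by positivity) ha3p.le
          have h7 : a3 * (K * 2 ^ (k + 1)) = Real.log 2 ^ (δ - 4) * (14 / 15 * Real.log 2) ^ 4 * (2 ^ k / 2) := by
            simp only [a3]; rw [pow_succ]; field_simp; ring
          have h8 := mul_le_mul_of_nonneg_right h5 (show (0:ℝ) ≤ 2 ^ k / 2 by positivity)
          calc _ ≤ _ := h6
            _ ≤ _ := h7.le.trans h8
            _ = _ := by ring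
      · have e : ρ = 0 := by rw [hρ, if_neg h3]
        rw [e, Real.rpow_zero, div_one, ww, if_neg h3]
        have h6 : c3 * n ≤ a2 * (K * 2 ^ (k + 1)) := mul_le_mul hc2 hk2' (by positivity) ha2p.le
        have h7 : a2 * (K * 2 ^ (k + 1)) = 2 ^ k / 2 := by
          simp only [a2]; rw [pow_succ]; field_simp; ring
        linarith

end Dec
end

section
/-! ### OSSS inequality -/
section OSSS
variable {I : Type} [Fintype I] {E : Type} [MeasurableSpace E]

/-- hybrid configuration along an exploration -/
noncomputable def hyb (nxt : Finset I → (I → E) → Option I) : ℕ → Finset I → (I → E) → (I → E) → (I → E)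
  | 0, _, _, Y => Y
  | n + 1, S, X, Y => match nxt S X with
    | none => Y
    | some i => Function.update (hyb nxt n (insert i S) X Y) i (X i)

/-- sites revealed by the exploration -/
noncomputable def vis (nxt : Finset I → (I → E) → Option I) : ℕ → Finset I → (I → E) → Finset I
  | 0, _, _ => ∅
  | n + 1, S, X => match nxt S X with
    | none => ∅
    | some i => insert i (vis nxt n (insert i S) X)

/-- exploration rules -/
structure Rule (nxt : Finset I → (I → E) → Option I) : Prop where
  fresh : ∀ S X i, nxt S X = some i → i ∉ S
  loc : ∀ S X Y, (∀ i ∈ S, X i = Y i) → nxt S X = nxt S Y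
  meas : ∀ S i, MeasurableSet {X | nxt S X = some i}

variable {nxt : Finset I → (I → E) → Option I}

lemma vis_disj (hr : Rule nxt) (n : ℕ) (S : Finset I) (X : I → E) : ∀ i ∈ S, i ∉ vis nxt n S X := by
  induction n generalizing S with
  | zero => intro i _; simp [vis]
  | succ n ih =>
    intro i hi
    rw [vis]
    cases h : nxt S X with
    | none => simp
    | some k =>
      have := hr.fresh S X k h
      simp only [Finset.mem_insert, not_or]
      exact ⟨fun e => this (e ▸ hi), ih _ i (Finset.mem_insert_of_mem hi)⟩

lemma hyb_vis (n : ℕ) (S : Finset I) (X Y : I → E) :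
    ∀ i ∈ vis nxt n S X, hyb nxt n S X Y i = X i := by
  induction n generalizing S with
  | zero => intro i hi; simp [vis] at hi
  | succ n ih =>
    intro i hi
    rw [vis] at hi
    rw [hyb]
    cases h : nxt S X with
    | none => simp [h] at hi
    | some k =>
      simp only [h, Finset.mem_insert] at hi
      by_cases e : i = k
      · subst e; simp
      · simp only [Function.update_of_ne e]
        exact ih _ i (hi.resolve_left e)

lemma hyb_meas (hr : Rule nxt) (n : ℕ) (S : Finset I) :
    Measurable fun p : (I → E) × (I → E) => hyb nxt n S p.1 p.2 := by
  induction n generalizing S with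
  | zero => exact measurable_snd
  | succ n ih =>
    have e : (fun p : (I → E) × (I → E) => hyb nxt (n + 1) S p.1 p.2) =
        fun p => (fun q : Option I × ((I → E) × (I → E)) => match q.1 with
          | none => q.2.2
          | some i => Function.update (hyb nxt n (insert i S) q.2.1 q.2.2) i (q.2.1 i)) (nxt S p.1, p) := by
      funext p; rfl
    letI : MeasurableSpace (Option I) := ⊤
    have hm : Measurable (fun p : (I → E) × (I → E) => nxt S p.1) := by
      refine Measurable.comp (g := nxt S) ?_ measurable_fst
      have hs : ∀ o : Option I, MeasurableSet (nxt S ⁻¹' {o}) := by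
        intro o
        cases o with
        | some i => exact hr.meas S i
        | none =>
          have : nxt S ⁻¹' {none} = (⋃ i, {X | nxt S X = some i})ᶜ := by
            ext X; cases h : nxt S X <;> simp [h]
          rw [this]
          exact (MeasurableSet.iUnion fun i => hr.meas S i).compl
      exact measurable_to_countable' hs
    rw [e]
    refine Measurable.comp (g := (fun q : Option I × ((I → E) × (I → E)) => match q.1 with
          | none => q.2.2
          | some i => Function.update (hyb nxt n (insert i S) q.2.1 q.2.2) i (q.2.1 i)))
      (measurable_from_prod_countable_right ?_) (hm.prodMk measurable_id)
    intro o
    cases o with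
    | none => exact measurable_snd
    | some i =>
      exact measurable_update'.comp ((ih _).prodMk ((measurable_pi_apply i).comp measurable_fst))

lemma vis_meas (hr : Rule nxt) (n : ℕ) (S : Finset I) (i : I) :
    MeasurableSet {X | i ∈ vis nxt n S X} := by
  induction n generalizing S with
  | zero => simp [vis]
  | succ n ih =>
    have e : {X | i ∈ vis nxt (n + 1) S X} =
        ⋃ k, {X | nxt S X = some k} ∩ {X | i = k ∨ i ∈ vis nxt n (insert k S) X} := by
      ext X
      simp only [vis, Set.mem_setOf_eq, Set.mem_iUnion, Set.mem_inter_iff]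
      cases h : nxt S X with
      | none => simp
      | some k => simp
    rw [e]
    refine MeasurableSet.iUnion fun k => (hr.meas S k).inter ?_
    exact (MeasurableSet.const _).union (ih _)

variable {ν : I → Measure E} [∀ i, IsProbabilityMeasure (ν i)]

lemma pi_update (ν : I → Measure E) [∀ i, IsProbabilityMeasure (ν i)] (i : I) :
    ((ν i).prod (Measure.pi ν)).map (fun p => Function.update p.2 i p.1) = Measure.pi ν := by
  refine (Measure.pi_eq fun s hs => ?_).symm
  have hm : Measurable (fun p : E × (I → E) => Function.update p.2 i p.1) :=
    measurable_update'.comp (measurable_snd.prodMk measurable_fst)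
  rw [Measure.map_apply hm (MeasurableSet.univ_pi hs)]
  have e : (fun p : E × (I → E) => Function.update p.2 i p.1) ⁻¹' (Set.univ.pi s) =
      s i ×ˢ (Set.univ.pi (Function.update s i Set.univ)) := by
    ext p
    simp only [Set.mem_preimage, Set.mem_pi, Set.mem_univ, true_imp_iff, Set.mem_prod]
    constructor
    · intro h
      refine ⟨by simpa using h i, fun k => ?_⟩
      by_cases e : k = i
      · subst e; simp
      · simpa [Function.update_of_ne e] using h k
    · rintro ⟨h1, h2⟩ k
      by_cases e : k = i
      · subst e; simpa using h1
      · simpa [Function.update_of_ne e] using h2 k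
  rw [e, Measure.prod_prod, Measure.pi_pi]
  rw [← Finset.mul_prod_erase Finset.univ (fun k => ν k (s k)) (Finset.mem_univ i),
    ← Finset.mul_prod_erase Finset.univ _ (Finset.mem_univ i)]
  simp only [Function.update_self, measure_univ, one_mul]
  congr 1
  refine Finset.prod_congr rfl fun k hk => ?_
  rw [Function.update_of_ne (Finset.ne_of_mem_erase hk)]

lemma lint_update (i : I) {F : (I → E) → ℝ≥0∞} (hF : Measurable F) :
    ∫⁻ X, F X ∂Measure.pi ν = ∫⁻ a, ∫⁻ X, F (Function.update X i a) ∂Measure.pi ν ∂ν i := by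
  have hm : Measurable (fun p : E × (I → E) => Function.update p.2 i p.1) :=
    measurable_update'.comp (measurable_snd.prodMk measurable_fst)
  conv_lhs => rw [← pi_update ν i]
  rw [lintegral_map hF hm]
  exact lintegral_prod _ (hF.comp hm).aemeasurable

/-- `x` on `S`, `X` off `S` -/
noncomputable def mrg (S : Finset I) (x X : I → E) : I → E := fun i => if i ∈ S then x i else X i

lemma mrg_meas (S : Finset I) (x : I → E) : Measurable (mrg S x) := by
  refine measurable_pi_lambda _ fun i => ?_
  unfold mrg
  split_ifs
  · exact measurable_const
  · exact measurable_pi_apply i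

lemma mrg_update {S : Finset I} {i : I} (hi : i ∉ S) (x X : I → E) (a : E) :
    mrg S x (Function.update X i a) = mrg (insert i S) (Function.update x i a) X := by
  funext k
  unfold mrg
  by_cases e : k = i
  · subst e; simp [hi]
  · simp [Function.update_of_ne e, e]

lemma nxt_mrg (hr : Rule nxt) (S : Finset I) (x X : I → E) : nxt S (mrg S x X) = nxt S x :=
  hr.loc _ _ _ fun i hi => by simp [mrg, hi]

lemma hyb_law (hr : Rule nxt) (n : ℕ) (S : Finset I) (x : I → E) {g : (I → E) → ℝ≥0∞} (hg : Measurable g) :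
    ∫⁻ X, ∫⁻ Y, g (hyb nxt n S (mrg S x X) Y) ∂Measure.pi ν ∂Measure.pi ν = ∫⁻ Y, g Y ∂Measure.pi ν := by
  induction n generalizing S x g with
  | zero => simp [hyb]
  | succ n ih =>
    simp only [hyb, nxt_mrg hr]
    cases h : nxt S x with
    | none => simp
    | some i =>
      have hi := hr.fresh S x i h
      have hm : Measurable fun X : I → E => ∫⁻ Y, g (Function.update (hyb nxt n (insert i S) (mrg S x X) Y) i
          (mrg S x X i)) ∂Measure.pi ν := by
        refine Measurable.lintegral_prod_right' (f := fun p : (I → E) × (I → E) =>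
          g (Function.update (hyb nxt n (insert i S) (mrg S x p.1) p.2) i (mrg S x p.1 i))) ?_
        refine hg.comp (measurable_update'.comp (Measurable.prodMk ?_ ?_))
        · exact (hyb_meas hr n _).comp (((mrg_meas S x).comp measurable_fst).prodMk measurable_snd)
        · exact (measurable_pi_apply i).comp ((mrg_meas S x).comp measurable_fst)
      simp only
      rw [lint_update i hm, lint_update i hg]
      refine lintegral_congr fun a => ?_
      simp only [mrg_update hi]
      have h2 : ∀ X : I → E, mrg (insert i S) (Function.update x i a) X i = a := fun X => by simp [mrg]
      simp only [h2]
      exact ih (insert i S) (Function.update x i a) (g := fun Y => g (Function.update Y i a))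
        (hg.comp (measurable_update_left))

/-- influence of coordinate i -/
noncomputable def infl (ν : I → Measure E) (A : Set (I → E)) (i : I) : ℝ≥0∞ :=
  ∫⁻ a, Measure.pi ν {Y | ¬ (Function.update Y i a ∈ A ↔ Y ∈ A)} ∂ν i

lemma osss_step (hr : Rule nxt) {A : Set (I → E)} (hA : MeasurableSet A) (n : ℕ) (S : Finset I) (x : I → E) :
    ∫⁻ X, Measure.pi ν {Y | ¬ (hyb nxt n S (mrg S x X) Y ∈ A ↔ Y ∈ A)} ∂Measure.pi ν ≤
      ∑ i, Measure.pi ν {X | i ∈ vis nxt n S (mrg S x X)} * infl ν A i := by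
  induction n generalizing S x with
  | zero => simp [hyb]
  | succ n ih =>
    simp only [hyb, vis, nxt_mrg hr]
    cases h : nxt S x with
    | none => simp
    | some i =>
      have hi := hr.fresh S x i h
      have hxor : ∀ {P Q : (I → E) × (I → E) → (I → E)}, Measurable P → Measurable Q →
          MeasurableSet {p : (I → E) × (I → E) | ¬ (P p ∈ A ↔ Q p ∈ A)} := fun hP hQ =>
        (MeasurableSet.iff (hP hA) (hQ hA)).compl
      have hm : Measurable fun X : I → E => Measure.pi ν {Y | ¬ (Function.update (hyb nxt n (insert i S) (mrg S x X) Y) i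
          (mrg S x X i) ∈ A ↔ Y ∈ A)} := by
        refine measurable_measure_prodMk_left (s := {p : (I → E) × (I → E) |
          ¬ (Function.update (hyb nxt n (insert i S) (mrg S x p.1) p.2) i (mrg S x p.1 i) ∈ A ↔ p.2 ∈ A)}) ?_
        refine hxor (measurable_update'.comp (Measurable.prodMk ?_ ?_)) measurable_snd
        · exact (hyb_meas hr n _).comp (((mrg_meas S x).comp measurable_fst).prodMk measurable_snd)
        · exact (measurable_pi_apply i).comp ((mrg_meas S x).comp measurable_fst)
      simp only
      rw [lint_update i hm]
      simp only [mrg_update hi]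
      have h2 : ∀ (X : I → E) a, mrg (insert i S) (Function.update x i a) X i = a := fun X a => by simp [mrg]
      simp only [h2]
      -- split
      have hsplit : ∀ a, ∫⁻ X, Measure.pi ν {Y | ¬ (Function.update (hyb nxt n (insert i S)
            (mrg (insert i S) (Function.update x i a) X) Y) i a ∈ A ↔ Y ∈ A)} ∂Measure.pi ν ≤
          Measure.pi ν {Y | ¬ (Function.update Y i a ∈ A ↔ Y ∈ A)} +
          ∑ k, Measure.pi ν {X | k ∈ vis nxt n (insert i S) (mrg (insert i S) (Function.update x i a) X)} * infl ν A k := by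
        intro a
        set x' := Function.update x i a
        set S' := insert i S
        have hG : MeasurableSet {Y : I → E | ¬ (Function.update Y i a ∈ A ↔ Y ∈ A)} :=
          (MeasurableSet.iff (measurable_update_left hA) hA).compl
        have hlaw := hyb_law (ν := ν) hr n S' x' (g := Set.indicator {Y : I → E | ¬ (Function.update Y i a ∈ A ↔ Y ∈ A)} 1)
          (measurable_one.indicator hG)
        rw [lintegral_indicator_one hG] at hlaw
        refine le_trans ?_ (add_le_add_right (ih S' x') _)
        rw [← hlaw]
        have hm2 : ∀ X : I → E, Measurable fun Y => hyb nxt n S' (mrg S' x' X) Y := fun X =>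
          (hyb_meas hr n S').comp (measurable_const.prodMk measurable_id)
        rw [← lintegral_add_left]
        · refine lintegral_mono fun X => ?_
          have : ∫⁻ Y, Set.indicator {Y : I → E | ¬ (Function.update Y i a ∈ A ↔ Y ∈ A)} (1 : (I → E) → ℝ≥0∞)
              (hyb nxt n S' (mrg S' x' X) Y) ∂Measure.pi ν =
              Measure.pi ν ((fun Y => hyb nxt n S' (mrg S' x' X) Y) ⁻¹' {Y : I → E | ¬ (Function.update Y i a ∈ A ↔ Y ∈ A)}) := by
            rw [← lintegral_indicator_one (hm2 X hG)]
            rfl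
          rw [this]
          refine le_trans (measure_mono ?_) (measure_union_le _ _)
          intro Y hY
          simp only [Set.mem_setOf_eq, Set.mem_union, Set.mem_preimage] at hY ⊢
          tauto
        · refine Measurable.lintegral_prod_right' (f := fun p : (I → E) × (I → E) =>
            Set.indicator {Y : I → E | ¬ (Function.update Y i a ∈ A ↔ Y ∈ A)} (1 : (I → E) → ℝ≥0∞)
              (hyb nxt n S' (mrg S' x' p.1) p.2)) ?_
          refine (measurable_one.indicator hG).comp ?_
          exact (hyb_meas hr n _).comp (((mrg_meas S' x').comp measurable_fst).prodMk measurable_snd)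
      refine (lintegral_mono hsplit).trans ?_
      have hmG : Measurable fun a => Measure.pi ν {Y | ¬ (Function.update Y i a ∈ A ↔ Y ∈ A)} :=
        measurable_measure_prodMk_left (s := {p : E × (I → E) | ¬ (Function.update p.2 i p.1 ∈ A ↔ p.2 ∈ A)})
          (MeasurableSet.iff ((measurable_update'.comp (measurable_snd.prodMk measurable_fst)) hA)
            (measurable_snd hA)).compl
      have hmv : ∀ k, Measurable fun X => ({X | k ∈ vis nxt n (insert i S) (mrg S x X)}.indicator (1 : (I → E) → ℝ≥0∞)) X :=
        fun k => measurable_one.indicator ((mrg_meas S x) (vis_meas hr n _ k))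
      have hmva : ∀ k, Measurable fun a => Measure.pi ν {X | k ∈ vis nxt n (insert i S) (mrg (insert i S) (Function.update x i a) X)} := by
        intro k
        simp only [← mrg_update hi]
        refine measurable_measure_prodMk_left (s := {p : E × (I → E) | k ∈ vis nxt n (insert i S) (mrg S x (Function.update p.2 i p.1))}) ?_
        exact ((mrg_meas S x).comp (measurable_update'.comp (measurable_snd.prodMk measurable_fst))) (vis_meas hr n _ k)
      rw [lintegral_add_left hmG, lintegral_finsetSum _ fun k _ => (hmva k).mul_const _]
      have hk : ∀ k, ∫⁻ a, Measure.pi ν {X | k ∈ vis nxt n (insert i S) (mrg (insert i S) (Function.update x i a) X)} * infl ν A k ∂ν i =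
          Measure.pi ν {X | k ∈ vis nxt n (insert i S) (mrg S x X)} * infl ν A k := by
        intro k
        rw [lintegral_mul_const _ (hmva k)]
        congr 1
        have hV : MeasurableSet {X | k ∈ vis nxt n (insert i S) (mrg S x X)} := (mrg_meas S x) (vis_meas hr n _ k)
        rw [← lintegral_indicator_one hV]
        have := lint_update (ν := ν) i (hmv k)
        refine Eq.trans ?_ this.symm
        refine lintegral_congr fun a => ?_
        simp only [← mrg_update hi]
        rw [← lintegral_indicator_one]
        · rfl
        · exact ((mrg_meas S x).comp measurable_update_left) (vis_meas hr n _ k)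
      simp only [hk]
      rw [← Finset.add_sum_erase _ _ (Finset.mem_univ i)]
      conv_rhs => rw [← Finset.add_sum_erase _ _ (Finset.mem_univ i)]
      have h0 : Measure.pi ν {X | i ∈ vis nxt n (insert i S) (mrg S x X)} = 0 := by
        have : {X | i ∈ vis nxt n (insert i S) (mrg S x X)} = ∅ := by
          ext X; simpa using vis_disj hr n (insert i S) (mrg S x X) i (Finset.mem_insert_self _ _)
        rw [this]; simp
      rw [h0, zero_mul, zero_add]
      refine add_le_add ?_ (Finset.sum_le_sum fun k hk => ?_)
      · have : {X : I → E | i ∈ insert i (vis nxt n (insert i S) (mrg S x X))} = Set.univ := by ext; simp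
        rw [this]; simp [infl]
      · refine mul_le_mul_left (measure_mono fun X hX => ?_) _
        exact Finset.mem_insert_of_mem hX

/-- OSSS inequality. -/
theorem osss (hr : Rule nxt) {A : Set (I → E)} (hA : MeasurableSet A) (n : ℕ)
    (hdet : ∀ X Y, (∀ i ∈ vis nxt n ∅ X, Y i = X i) → (Y ∈ A ↔ X ∈ A)) :
    2 * Measure.pi ν A * Measure.pi ν Aᶜ ≤
      ∑ i, Measure.pi ν {X | i ∈ vis nxt n ∅ X} * infl ν A i := by
  rcases isEmpty_or_nonempty (I → E) with he | ⟨⟨x⟩⟩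
  · have : A = ∅ := Set.eq_empty_of_isEmpty A
    simp [this]
  have h := osss_step (ν := ν) hr hA n ∅ x
  have e : ∀ X, mrg ∅ x X = X := fun X => by funext i; simp [mrg]
  simp only [e] at h
  refine le_trans (le_of_eq ?_) h
  have e2 : ∀ X, {Y | ¬ (hyb nxt n ∅ X Y ∈ A ↔ Y ∈ A)} = if X ∈ A then Aᶜ else A := by
    intro X
    ext Y
    simp only [Set.mem_setOf_eq, hdet X (hyb nxt n ∅ X Y) fun i hi => hyb_vis n ∅ X Y i hi]
    split_ifs with h <;> simp [h]
  simp only [e2]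
  rw [← lintegral_add_compl _ hA, setLIntegral_congr_fun hA (g := fun _ => Measure.pi ν Aᶜ) (fun X hX => by simp [hX]),
    setLIntegral_congr_fun hA.compl (g := fun _ => Measure.pi ν A) (fun X hX => by
      have : X ∉ A := hX
      simp [this])]
  simp only [setLIntegral_const]
  ring

end OSSS
end

section
/-! ### Block decomposition of the free field -/
section Blocks
variable {d : ℕ} {μ : Measure (Vert d → ℝ)}

lemma gauss_white {ι : Type} [Fintype ι] :
    GaussLaw (Measure.pi fun _ : ι => ProbabilityTheory.gaussianReal 0 1) (fun i j => if i = j then (1:ℝ) else 0) := by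
  refine ⟨inferInstance, fun s c => ?_⟩
  have e : ∀ ω : ι → ℝ, Real.exp (∑ x ∈ s, c x * ω x) =
      ∏ x, (fun y => Real.exp ((if x ∈ s then c x else 0) * y)) (ω x) := by
    intro ω
    rw [← Real.exp_sum]
    congr 1
    rw [← Finset.sum_filter_add_sum_filter_not Finset.univ (· ∈ s)]
    rw [Finset.sum_congr rfl (g := fun x => (if x ∈ s then c x else 0) * ω x) (s₁ := s) fun x hx => by simp [hx]]
    have h1 : Finset.univ.filter (· ∈ s) = s := by ext; simp
    rw [h1]
    have h2 : ∑ x ∈ Finset.univ.filter (· ∉ s), (if x ∈ s then c x else 0) * ω x = 0 :=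
      Finset.sum_eq_zero fun x hx => by simp [(Finset.mem_filter.1 hx).2]
    rw [h2, add_zero]
  simp only [e]
  rw [integral_fintype_prod_eq_prod (f := fun (x : ι) (y : ℝ) => Real.exp ((if x ∈ s then c x else 0) * y))]
  have h3 : ∀ t : ℝ, ∫ y, Real.exp (t * y) ∂(ProbabilityTheory.gaussianReal 0 1) = Real.exp (t ^ 2 / 2) := by
    intro t
    have := congrFun (ProbabilityTheory.mgf_id_gaussianReal (μ := 0) (v := 1)) t
    simpa [ProbabilityTheory.mgf] using this
  simp only [h3]
  rw [← Real.exp_sum]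
  congr 1
  rw [← Finset.sum_div]
  congr 1
  have : ∀ x ∈ s, ∑ y ∈ s, c x * c y * (if x = y then (1:ℝ) else 0) = c x ^ 2 := by
    intro x hx
    simp [hx, sq]
  rw [Finset.sum_congr rfl this]
  have h4 : ∀ x : ι, (if x ∈ s then c x else 0) ^ 2 = if x ∈ s then c x ^ 2 else 0 := fun x => by split_ifs <;> simp
  simp only [h4]
  rw [Finset.sum_ite_mem]; simp

lemma gauss_gram {ι κ : Type} (B : Finset ι) (a : κ → ι → ℝ) :
    ∃ ν : Measure (κ → ℝ), GaussLaw ν (fun x y => ∑ i ∈ B, a x i * a y i) := by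
  refine ⟨_, ((gauss_white (ι := B)).map_lin (κ := κ) (fun _ => Finset.univ) (fun x i => a x i)).congr_cov fun x y => ?_⟩
  simp only [mul_ite, mul_one, mul_zero, Finset.sum_ite_eq, Finset.mem_univ, if_true]
  rw [Finset.sum_coe_sort B (fun i => a x i * a y i)]

lemma box_sub {x y : Vert d} {r s : ℕ} (h : linfDist y x + r ≤ s) : box x r ⊆ box y s := fun z hz => by
  rw [mem_box_iff] at *
  exact (linf_triangle y x z).trans (by omega)

lemma gram_pn (hd : 0 < d) (k : ℕ) (x y : Vert d) (S : Finset (Vert d)) (hx : box x (k + 1) ⊆ S)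
    (hy : box y k ⊆ S) :
    ∑ z ∈ S, ∑ p, (pn k x z + pn k x (z + ev p)) * (pn k y z + pn k y (z + ev p)) =
      4 * d * (pn (2 * k) x y + pn (2 * k + 1) x y) := by
  have hd' : (0:ℝ) < d := by exact_mod_cast hd
  have hcard : (Fintype.card (Fin d × Bool) : ℝ) = 2 * d := by simp [mul_comm]
  have hx0 : box x k ⊆ S := (box_sub (by simp [linf_self])).trans hx
  have e : ∀ z, ∑ p, (pn k x z + pn k x (z + ev p)) * (pn k y z + pn k y (z + ev p)) =
      2 * d * (pn k x z * pn k z y) + 2 * d * (pn k x z * pn (k + 1) z y) +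
        2 * d * (pn (k + 1) x z * pn k z y) + ∑ p, pn k x (z + ev p) * pn k (z + ev p) y := by
    intro z
    have h1 : ∑ p, pn k x (z + ev p) = 2 * d * pn (k + 1) x z := by rw [pn_succ']; field_simp
    have h2 : ∑ p, pn k y (z + ev p) = 2 * d * pn (k + 1) z y := by rw [pn_symm (k+1) z y, pn_succ']; field_simp
    have : ∀ p, (pn k x z + pn k x (z + ev p)) * (pn k y z + pn k y (z + ev p)) =
        pn k x z * pn k z y + pn k x z * pn k y (z + ev p) + pn k x (z + ev p) * pn k z y +
          pn k x (z + ev p) * pn k (z + ev p) y := by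
      intro p; rw [pn_symm k z y, pn_symm k (z + ev p) y]; ring
    simp only [this, Finset.sum_add_distrib, ← Finset.mul_sum, ← Finset.sum_mul, h1, h2]
    rw [Finset.sum_const, Finset.card_univ, nsmul_eq_mul, hcard]
    ring
  simp only [e, Finset.sum_add_distrib, ← Finset.mul_sum]
  rw [← pn_ck k k x y S hx0, ← pn_ck k (k + 1) x y S hx0, ← pn_ck (k + 1) k x y S hx, Finset.sum_comm]
  have h4 : ∀ p, ∑ z ∈ S, pn k x (z + ev p) * pn k (z + ev p) y = pn (k + k) x y := by
    intro p
    rw [pn_ck k k x y (S.image (· + ev p)), Finset.sum_image]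
    · intro a _ b _ h; simpa using h
    · intro w hw
      rw [Finset.mem_image]
      refine ⟨w - ev p, hx ?_, by simp⟩
      rw [mem_box] at *
      intro i
      have := hw i
      have := ev_natAbs p i
      simp only [Pi.sub_apply]; omega
  simp only [h4, Finset.sum_const, Finset.card_univ, nsmul_eq_mul, hcard]
  rw [show k + k = 2 * k by ring, show k + (k + 1) = 2 * k + 1 by ring, show k + 1 + k = 2 * k + 1 by ring]
  ring

lemma rem_cov (hd : 3 ≤ d) (N : ℕ) (x y : Vert d) :
    ∑ z ∈ box x N, ∑ w ∈ box y N, pn N x z * pn N y w * gr z w = ∑' n, pn (2 * N + n) x y := by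
  have e : ∀ n, pn (2 * N + n) x y = ∑ z ∈ box x N, ∑ w ∈ box y N, pn N x z * pn N y w * pn n z w := by
    intro n
    rw [show 2 * N + n = N + (N + n) by ring, pn_ck N (N + n) x y _ subset_rfl]
    refine Finset.sum_congr rfl fun z _ => ?_
    rw [pn_symm (N + n) z y, pn_ck N n y z _ subset_rfl, Finset.mul_sum]
    refine Finset.sum_congr rfl fun w _ => ?_
    rw [pn_symm n w z]; ring
  simp only [e]
  rw [Summable.tsum_finsetSum]
  · refine Finset.sum_congr rfl fun z _ => ?_
    rw [Summable.tsum_finsetSum]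
    · refine Finset.sum_congr rfl fun w _ => ?_
      rw [tsum_mul_left]; rfl
    · exact fun w _ => (pn_summable hd z w).mul_left _
  · exact fun z _ => summable_sum fun w _ => (pn_summable hd z w).mul_left _

/-- feature map -/
noncomputable def feat (d R : ℕ) (x : Vert d) (i : ℕ × Vert d × (Fin d × Bool)) : ℝ :=
  if x ∈ box (0 : Vert d) R then
    (pn i.1 x i.2.1 + pn i.1 x (i.2.1 + ev i.2.2)) / Real.sqrt (4 * d) else 0

/-- block label of a noise variable -/
def blk (i : ℕ × Vert d × (Fin d × Bool)) : ℕ × Vert d :=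
  (Nat.log 2 (i.1 + 1), fun k => i.2.1 k / 2 ^ Nat.log 2 (i.1 + 1))

noncomputable def bidx (d R : ℕ) : Finset (ℕ × Vert d × (Fin d × Bool)) :=
  Finset.range (2 ^ R - 1) ×ˢ (box (0 : Vert d) (R + 2 ^ R) ×ˢ Finset.univ)

lemma feat_mul (hd : 0 < d) (R : ℕ) {x y : Vert d} (hx : x ∈ box 0 R) (hy : y ∈ box 0 R) {k : ℕ} (z : Vert d)
    (p : Fin d × Bool) : feat d R x (k, z, p) * feat d R y (k, z, p) =
      (pn k x z + pn k x (z + ev p)) * (pn k y z + pn k y (z + ev p)) / (4 * d) := by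
  have hd' : (0:ℝ) < d := by exact_mod_cast hd
  rw [feat, feat, if_pos hx, if_pos hy, div_mul_div_comm, Real.mul_self_sqrt (by positivity)]

lemma feat_sum (hd : 0 < d) (R : ℕ) {x y : Vert d} (hx : x ∈ box 0 R) (hy : y ∈ box 0 R) {k : ℕ}
    (hk : k < 2 ^ R - 1) :
    ∑ z ∈ box (0 : Vert d) (R + 2 ^ R), ∑ p, feat d R x (k, z, p) * feat d R y (k, z, p) =
      pn (2 * k) x y + pn (2 * k + 1) x y := by
  have hd' : (0:ℝ) < d := by exact_mod_cast hd
  simp only [feat_mul hd R hx hy, ← Finset.sum_div]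
  rw [mem_box_iff] at hx hy
  rw [gram_pn hd k x y _ (box_sub (by omega)) (box_sub (by omega))]
  field_simp

lemma sum_pairs (f : ℕ → ℝ) (N : ℕ) :
    ∑ k ∈ Finset.range N, (f (2 * k) + f (2 * k + 1)) = ∑ n ∈ Finset.range (2 * N), f n := by
  induction N with
  | zero => simp
  | succ N ih =>
    rw [Finset.sum_range_succ, ih, show 2 * (N + 1) = 2 * N + 1 + 1 by ring, Finset.sum_range_succ,
      Finset.sum_range_succ]
    ring

lemma blk_supp {R : ℕ} {x : Vert d} {i : ℕ × Vert d × (Fin d × Bool)} (h : feat d R x i ≠ 0) :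
    x ∈ box 0 R ∧ x ∈ box (fun k => 2 ^ (blk i).1 * (blk i).2 k) (3 * 2 ^ (blk i).1) := by
  obtain ⟨k, z, p⟩ := i
  unfold feat at h
  split_ifs at h with hx
  · refine ⟨hx, ?_⟩
    have hb : z ∈ box x (k + 1) := by
      by_contra hz
      apply h
      have h1 : pn k x z = 0 := pn_range fun h => hz (box_sub (by simp [linf_self]) h)
      have h2 : pn k x (z + ev p) = 0 := pn_range fun h => hz (by
        rw [mem_box] at *
        intro i
        have := h i
        have := ev_natAbs p i
        simp only [Pi.add_apply] at *; omega)
      simp [h1, h2]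
    have hk : k + 1 < 2 ^ (Nat.log 2 (k + 1) + 1) := Nat.lt_pow_succ_log_self (by norm_num) _
    simp only [blk]
    set j := Nat.log 2 (k + 1)
    rw [mem_box] at *
    intro m
    have h1 := hb m
    have h2 := Int.mul_ediv_add_emod (z m) (2 ^ j)
    have h3 := Int.emod_nonneg (z m) (show (2:ℤ) ^ j ≠ 0 by positivity)
    have h4 := Int.emod_lt_of_pos (z m) (show (0:ℤ) < 2 ^ j by positivity)
    rw [pow_succ] at hk
    have h5 : ((2 ^ j : ℕ) : ℤ) = 2 ^ j := by push_cast; rfl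
    have hk' : ((k:ℤ) + 1) < 2 ^ j * 2 := by exact_mod_cast hk
    zify at h1 ⊢
    rw [abs_le] at *
    constructor <;> linarith
  · exact absurd rfl h

lemma blk_near {x : Vert d} {j : ℕ} {q : Vert d} (h : x ∈ box (fun k => 2 ^ j * q k) (3 * 2 ^ j)) :
    q ∈ box (fun k => x k / 2 ^ j) 3 := by
  rw [mem_box] at *
  intro m
  have h1 := h m
  have h2 := Int.mul_ediv_add_emod (x m) (2 ^ j)
  have h3 := Int.emod_nonneg (x m) (show (2:ℤ) ^ j ≠ 0 by positivity)
  have h4 := Int.emod_lt_of_pos (x m) (show (0:ℤ) < 2 ^ j by positivity)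
  have hp : (0:ℤ) < 2 ^ j := by positivity
  zify at h1 ⊢
  rw [abs_le] at *
  set t := x m / 2 ^ j
  have h5 : 2 ^ j * (q m - t) < 2 ^ j * 4 := by nlinarith
  have h6 : 2 ^ j * (-4) < 2 ^ j * (q m - t) := by nlinarith
  have h7 := lt_of_mul_lt_mul_left h5 hp.le
  have h8 := lt_of_mul_lt_mul_left h6 hp.le
  constructor <;> omega

lemma blk_var (hd : 3 ≤ d) (R : ℕ) (b : ℕ × Vert d) (x : Vert d) :
    ∑ i ∈ (bidx d R).filter (fun i => blk i = b), feat d R x i * feat d R x i ≤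
      (4 * KH d + 2) * (2:ℝ) ^ (-((b.1:ℝ) / 2)) := by
  have hK := KH_pos hd
  by_cases hx : x ∈ box 0 R
  swap
  · have : ∀ i, feat d R x i = 0 := fun i => by rw [feat, if_neg hx]
    simp only [this, mul_zero, Finset.sum_const_zero]
    positivity
  obtain ⟨j, q⟩ := b
  have h1 : ∑ i ∈ (bidx d R).filter (fun i => blk i = (j, q)), feat d R x i * feat d R x i ≤
      ∑ k ∈ (Finset.range (2 ^ R - 1)).filter (fun k => Nat.log 2 (k + 1) = j),
        (pn (2 * k) x x + pn (2 * k + 1) x x) := by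
    rw [Finset.sum_congr rfl (g := fun k => ∑ z ∈ box (0 : Vert d) (R + 2 ^ R), ∑ p, feat d R x (k, z, p) * feat d R x (k, z, p))
      (s₁ := (Finset.range (2 ^ R - 1)).filter (fun k => Nat.log 2 (k + 1) = j)) fun k hk => by
        rw [feat_sum (by omega) R hx hx (Finset.mem_range.1 (Finset.mem_filter.1 hk).1)]]
    have : ∀ k, ∑ z ∈ box (0 : Vert d) (R + 2 ^ R), ∑ p, feat d R x (k, z, p) * feat d R x (k, z, p) =
        ∑ r ∈ box (0 : Vert d) (R + 2 ^ R) ×ˢ Finset.univ, feat d R x (k, r) * feat d R x (k, r) := fun k => by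
      rw [Finset.sum_product]
    simp only [this]
    rw [← Finset.sum_product' (f := fun k r => feat d R x (k, r) * feat d R x (k, r))]
    refine Finset.sum_le_sum_of_subset_of_nonneg ?_ fun i _ _ => mul_self_nonneg _
    intro i hi
    rw [Finset.mem_filter, bidx, Finset.mem_product] at hi
    rw [Finset.mem_product, Finset.mem_filter]
    exact ⟨⟨hi.1.1, congrArg Prod.fst hi.2⟩, hi.1.2⟩
  refine h1.trans ?_
  simp only
  rcases Nat.eq_zero_or_pos j with rfl | hj
  · have hsub : (Finset.range (2 ^ R - 1)).filter (fun k => Nat.log 2 (k + 1) = 0) ⊆ {0} := by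
      intro k hk
      have := (Finset.mem_filter.1 hk).2
      rw [Nat.log_eq_zero_iff] at this
      simp; omega
    refine (Finset.sum_le_sum_of_subset_of_nonneg hsub fun i _ _ => add_nonneg (pn_nonneg _ _ _) (pn_nonneg _ _ _)).trans ?_
    have h2 := pn_le_one (d := d) (by omega) 0 x x
    have h3 := pn_le_one (d := d) (by omega) 1 x x
    simp only [Finset.sum_singleton, mul_zero, zero_add, Nat.cast_zero, zero_div, neg_zero, Real.rpow_zero]
    linarith
  · have h2 : ∑ k ∈ (Finset.range (2 ^ R - 1)).filter (fun k => Nat.log 2 (k + 1) = j),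
        (pn (2 * k) x x + pn (2 * k + 1) x x) ≤ ∑ n ∈ Finset.range (2 * 2 ^ R), pn (2 ^ j + n) x x := by
      rw [← sum_pairs (fun n => pn (2 ^ j + n) x x)]
      have : ∀ k ∈ (Finset.range (2 ^ R - 1)).filter (fun k => Nat.log 2 (k + 1) = j), 2 ^ (j-1) ≤ k ∧ k < 2 ^ R := by
        intro k hk
        obtain ⟨h3, h4⟩ := Finset.mem_filter.1 hk
        have h5 := Nat.pow_log_le_self 2 (Nat.succ_ne_zero k)
        simp only [Nat.succ_eq_add_one, h4] at h5
        have h6 : 2 ^ j = 2 * 2 ^ (j - 1) := by rw [← pow_succ']; congr 1; omega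
        have h7 : 1 ≤ 2 ^ (j - 1) := Nat.one_le_two_pow
        have := Finset.mem_range.1 h3
        omega
      have e : ∑ k ∈ (Finset.range (2 ^ R - 1)).filter (fun k => Nat.log 2 (k + 1) = j),
          (pn (2 * k) x x + pn (2 * k + 1) x x) =
          ∑ m ∈ ((Finset.range (2 ^ R - 1)).filter (fun k => Nat.log 2 (k + 1) = j)).image (fun k => k - 2 ^ (j - 1)),
            (pn (2 ^ j + 2 * m) x x + pn (2 ^ j + (2 * m + 1)) x x) := by
        rw [Finset.sum_image]
        · refine Finset.sum_congr rfl fun k hk => ?_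
          have h3 := this k hk
          have h6 : 2 ^ j = 2 * 2 ^ (j - 1) := by rw [← pow_succ']; congr 1; omega
          rw [show 2 ^ j + 2 * (k - 2 ^ (j - 1)) = 2 * k by omega,
            show 2 ^ j + (2 * (k - 2 ^ (j - 1)) + 1) = 2 * k + 1 by omega]
        · intro a ha b hb hab
          have h1 := this a ha
          have h2 := this b hb
          simp only at hab
          omega
      rw [e]
      refine Finset.sum_le_sum_of_subset_of_nonneg ?_ fun i _ _ => add_nonneg (pn_nonneg _ _ _) (pn_nonneg _ _ _)
      intro m hm
      obtain ⟨k, hk, rfl⟩ := Finset.mem_image.1 hm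
      exact Finset.mem_range.2 (lt_of_le_of_lt (Nat.sub_le _ _) (this k hk).2)
    refine h2.trans ((pn_sum_tail hd (N := 2 ^ j) (by positivity) _ x x).trans ?_)
    have h3 : (((2 ^ j : ℕ) : ℝ)) ^ (-bexp d) ≤ (2:ℝ) ^ (-((j:ℝ) / 2)) := by
      push_cast
      rw [← Real.rpow_natCast, ← Real.rpow_mul (by norm_num)]
      refine Real.rpow_le_rpow_of_exponent_le (by norm_num) ?_
      have := bexp_ge (d := d)
      have : (0:ℝ) ≤ j := by positivity
      nlinarith
    exact mul_le_mul (by linarith) h3 (by positivity) (by positivity)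

theorem blocks (hd : 3 ≤ d) (hμ : GaussLaw μ (gr (d := d))) {R : ℕ} (hR : 1 ≤ R) :
    ∃ (I : Type) (_ : Fintype I) (lab : I → ℕ) (ν : I → Measure (Vert d → ℝ))
      (C : I → Vert d → Vert d → ℝ) (S : I → Finset (Vert d)),
      (∀ i, GaussLaw (ν i) (C i)) ∧ (∀ i x, x ∉ S i → C i x x = 0) ∧ (∀ i, S i ⊆ box 0 R) ∧
      (∀ i x, C i x x ≤ (4 * KH d + 2) * (2:ℝ) ^ (-((lab i:ℝ) / 2))) ∧
      (∀ i, ((S i).card : ℝ) ≤ 7 ^ d * 2 ^ (lab i * d)) ∧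
      (∀ j x, (Finset.univ.filter fun i => lab i = j ∧ x ∈ S i).card ≤ 7 ^ d) ∧
      (∀ x ∈ box 0 R, ∀ y ∈ box 0 R, ∑ i, C i x y = gr x y) := by
  set N := 2 ^ R - 1 with hN
  have h2R : 2 ≤ 2 ^ R := by
    calc 2 = 2 ^ 1 := rfl
      _ ≤ 2 ^ R := Nat.pow_le_pow_right (by norm_num) hR
  have hK := KH_pos hd
  set T := (bidx d R).image blk with hT
  have hlt : ∀ b ∈ T, b.1 < R := by
    intro b hb
    obtain ⟨i, hi, rfl⟩ := Finset.mem_image.1 hb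
    rw [bidx, Finset.mem_product, Finset.mem_range] at hi
    have h9 : i.1 + 1 < 2 ^ R := by omega
    exact Nat.log_lt_of_lt_pow (Nat.succ_ne_zero _) h9
  choose ν0 hν0 using fun b : ℕ × Vert d => gauss_gram ((bidx d R).filter (fun i => blk i = b)) (feat d R)
  set a1 : Vert d → Vert d → ℝ := fun x z => if x ∈ box 0 R then pn N x z else 0
  have hν1 := hμ.map_lin (fun x : Vert d => box x N) a1
  refine ⟨Option T, inferInstance, fun i => i.elim R fun b => b.1.1, fun i => i.elim (μ.map fun ω k => ∑ x ∈ box k N, a1 k x * ω x) fun b => ν0 b.1,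
    fun i => i.elim (fun k l => ∑ x ∈ box k N, ∑ y ∈ box l N, a1 k x * a1 l y * gr x y) fun b => fun x y => ∑ i ∈ (bidx d R).filter (fun i => blk i = b.1), feat d R x i * feat d R y i,
    fun i => i.elim (box 0 R) fun b => (box 0 R).filter fun x => x ∈ box (fun k => 2 ^ b.1.1 * b.1.2 k) (3 * 2 ^ b.1.1),
    ?_, ?_, ?_, ?_, ?_, ?_, ?_⟩
  · rintro (_ | b)
    · exact hν1
    · exact hν0 b.1
  · rintro (_ | b) x hx
    · simp only [Option.elim_none] at hx ⊢
      simp [a1, hx]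
    · simp only [Option.elim_some, Finset.mem_filter, not_and] at hx ⊢
      refine Finset.sum_eq_zero fun i hi => ?_
      rw [Finset.mem_filter] at hi
      by_contra h
      have := blk_supp (fun h0 => h (by rw [h0, zero_mul]) : feat d R x i ≠ 0)
      rw [hi.2] at this
      exact hx this.1 this.2
  · rintro (_ | b)
    · exact subset_rfl
    · exact Finset.filter_subset _ _
  · rintro (_ | b) x
    · simp only [Option.elim_none]
      by_cases hx : x ∈ box 0 R
      · simp only [a1, if_pos hx]
        rw [rem_cov hd]
        refine (gr_tail hd (by omega) x x).trans ?_
        have h3 : (((2 * N : ℕ) : ℝ)) ^ (-bexp d) ≤ (2:ℝ) ^ (-((R:ℝ) / 2)) := by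
          have h4 : ((2 ^ R : ℕ) : ℝ) ≤ ((2 * N : ℕ) : ℝ) := by exact_mod_cast (by omega)
          refine (Real.rpow_le_rpow_of_nonpos (by positivity) h4 (by have := bexp_pos (d := d); linarith)).trans ?_
          push_cast
          rw [← Real.rpow_natCast, ← Real.rpow_mul (by norm_num)]
          refine Real.rpow_le_rpow_of_exponent_le (by norm_num) ?_
          have := bexp_ge (d := d)
          have : (0:ℝ) ≤ R := by positivity
          nlinarith
        exact mul_le_mul (by linarith) h3 (by positivity) (by positivity)
      · simp only [a1, if_neg hx, zero_mul, Finset.sum_const_zero]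
        positivity
    · exact blk_var hd R b.1 x
  · rintro (_ | b)
    · simp only [Option.elim_none, card_box]
      have h1 : R < 2 ^ R := Nat.lt_two_pow_self
      have : (2 * R + 1) ^ d ≤ (7 * 2 ^ R) ^ d := Nat.pow_le_pow_left (by omega) d
      rw [mul_pow, ← pow_mul] at this
      exact_mod_cast this
    · simp only [Option.elim_some]
      have h1 : 1 ≤ 2 ^ b.1.1 := Nat.one_le_two_pow
      have : (2 * (3 * 2 ^ b.1.1) + 1) ^ d ≤ (7 * 2 ^ b.1.1) ^ d := Nat.pow_le_pow_left (by omega) d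
      rw [mul_pow, ← pow_mul, ← card_box (fun k => 2 ^ b.1.1 * b.1.2 k)] at this
      have h2 : ((box (0 : Vert d) R).filter fun x => x ∈ box (fun k => 2 ^ b.1.1 * b.1.2 k) (3 * 2 ^ b.1.1)).card ≤ _ :=
        (Finset.card_le_card fun x hx => (Finset.mem_filter.1 hx).2).trans this
      exact_mod_cast h2
  · intro j x
    by_cases hj : j = R
    · have : (Finset.univ.filter fun i : Option T => i.elim R (fun b => b.1.1) = j ∧ x ∈ i.elim (box 0 R) (fun b => (box 0 R).filter fun x => x ∈ box (fun k => 2 ^ b.1.1 * b.1.2 k) (3 * 2 ^ b.1.1))) ⊆ {none} := by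
        rintro (_ | b) hi
        · simp
        · have h1 := hlt b.1 b.2
          have h2 := (Finset.mem_filter.1 hi).2.1
          simp only [Option.elim_some] at h2
          omega
      exact (Finset.card_le_card this).trans (by simpa using Nat.one_le_pow _ _ (by norm_num))
    · have hcb : (box (fun k => x k / 2 ^ j) 3 : Finset (Vert d)).card = 7 ^ d := by rw [card_box]
      rw [← hcb]
      refine Finset.card_le_card_of_injOn (fun i => i.elim 0 fun b => b.1.2) ?_ ?_
      · rintro (_ | b) hi
        · have := (Finset.mem_filter.1 hi).2.1
          simp only [Option.elim_none] at this
          exact absurd this.symm hj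
        · have h2 := (Finset.mem_filter.1 hi).2
          simp only [Option.elim_some, Finset.mem_filter] at h2
          obtain ⟨h3, h4, h5⟩ := h2
          rw [h3] at h5
          exact blk_near h5
      · rintro (_ | b) hb (_ | c) hc hbc
        · rfl
        · have := (Finset.mem_filter.1 hb).2.1
          exact absurd this.symm hj
        · have := (Finset.mem_filter.1 hc).2.1
          exact absurd this.symm hj
        · have h1 := (Finset.mem_filter.1 hb).2.1
          have h2 := (Finset.mem_filter.1 hc).2.1
          simp only [Option.elim_some] at h1 h2 hbc
          exact congrArg some (Subtype.ext (Prod.ext (h1.trans h2.symm) hbc))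
  · intro x hx y hy
    rw [Fintype.sum_option]
    simp only [Option.elim_none, Option.elim_some, a1, if_pos hx, if_pos hy]
    rw [rem_cov hd]
    rw [Finset.sum_coe_sort T (fun b => ∑ i ∈ (bidx d R).filter (fun i => blk i = b), feat d R x i * feat d R y i)]
    rw [Finset.sum_fiberwise_of_maps_to (fun i hi => Finset.mem_image_of_mem _ hi)]
    rw [bidx, Finset.sum_product]
    have : ∀ k ∈ Finset.range N, ∑ r ∈ box (0 : Vert d) (R + 2 ^ R) ×ˢ Finset.univ, feat d R x (k, r) * feat d R y (k, r) =
        pn (2 * k) x y + pn (2 * k + 1) x y := fun k hk => by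
      rw [Finset.sum_product, feat_sum (by omega) R hx hy (Finset.mem_range.1 hk)]
    rw [Finset.sum_congr rfl this, sum_pairs (fun n => pn n x y), gr]
    rw [← (pn_summable hd x y).sum_add_tsum_nat_add (2 * N)]
    rw [add_comm]
    simp only [add_comm]

end Blocks
end

section
/-! ### Influence bound -/
section Infl
variable {ι : Type} {τ : Measure (ι → ℝ)} {C : ι → ι → ℝ}

/-- rotation of a pair -/
noncomputable def rot (s : ℝ) (p : (ι → ℝ) × (ι → ℝ)) : (ι → ℝ) × (ι → ℝ) :=
  (Real.cos s • p.1 + Real.sin s • p.2, (-Real.sin s) • p.1 + Real.cos s • p.2)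

lemma rot_meas (s : ℝ) : Measurable (rot (ι := ι) s) := by
  unfold rot; fun_prop

lemma rot_mgf (h : GaussLaw τ C) (s : ℝ) (U : Finset ι) (a b : ι → ℝ) :
    Integrable (fun p : (ι → ℝ) × (ι → ℝ) => Real.exp (∑ x ∈ U, (a x * (rot s p).1 x + b x * (rot s p).2 x))) (τ.prod τ) ∧
    ∫ p, Real.exp (∑ x ∈ U, (a x * (rot s p).1 x + b x * (rot s p).2 x)) ∂τ.prod τ =
      Real.exp ((∑ x ∈ U, ∑ y ∈ U, (a x * a y + b x * b y) * C x y) / 2) := by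
  have := h.prob
  set f : (ι → ℝ) → ℝ := fun z => Real.exp (∑ x ∈ U, (a x * Real.cos s - b x * Real.sin s) * z x) with hf
  set g : (ι → ℝ) → ℝ := fun z => Real.exp (∑ x ∈ U, (a x * Real.sin s + b x * Real.cos s) * z x) with hg
  have e : (fun p : (ι → ℝ) × (ι → ℝ) => Real.exp (∑ x ∈ U, (a x * (rot s p).1 x + b x * (rot s p).2 x)))
      = fun p => f p.1 * g p.2 := by
    funext p
    rw [hf, hg, ← Real.exp_add, ← Finset.sum_add_distrib]
    congr 1
    refine Finset.sum_congr rfl fun x _ => ?_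
    simp only [rot, Pi.add_apply, Pi.smul_apply, smul_eq_mul]
    ring
  rw [e]
  refine ⟨(h.int_exp U _).mul_prod (h.int_exp U _), ?_⟩
  rw [integral_prod_mul (μ := τ) (ν := τ) f g, hf, hg, h.mgf, h.mgf, ← Real.exp_add, ← add_div,
    ← Finset.sum_add_distrib]
  congr 2
  refine Finset.sum_congr rfl fun x _ => ?_
  rw [← Finset.sum_add_distrib]
  refine Finset.sum_congr rfl fun y _ => ?_
  have := Real.sin_sq_add_cos_sq s
  linear_combination ((a x * a y + b x * b y) * C x y) * this

lemma rot_zero (p : (ι → ℝ) × (ι → ℝ)) : rot 0 p = p := by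
  simp [rot]

lemma rot_pres (h : GaussLaw τ C) (s : ℝ) : (τ.prod τ).map (rot s) = τ.prod τ := by
  have := h.prob
  set e := (MeasurableEquiv.sumPiEquivProdPi (fun _ : ι ⊕ ι => ℝ)).symm with he
  have key : ∀ s, ∀ (u : Finset (ι ⊕ ι)) (c : ι ⊕ ι → ℝ), ∃ (U : Finset ι) (a b : ι → ℝ),
      ∀ p, ∑ k ∈ u, c k * e (rot s p) k = ∑ x ∈ U, (a x * (rot s p).1 x + b x * (rot s p).2 x) := by
    intro s u c
    refine ⟨u.toLeft ∪ u.toRight, fun x => if x ∈ u.toLeft then c (Sum.inl x) else 0,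
      fun x => if x ∈ u.toRight then c (Sum.inr x) else 0, fun p => ?_⟩
    rw [Finset.sum_add_distrib]
    conv_lhs => rw [← Finset.toLeft_disjSum_toRight (u := u), Finset.sum_disjSum]
    congr 1
    · rw [← Finset.sum_subset (Finset.subset_union_left (s₂ := u.toRight))]
      · exact Finset.sum_congr rfl fun x hx => by simp only [hx, if_true]; rfl
      · intro x _ hx; simp only [hx, if_false, zero_mul]
    · rw [← Finset.sum_subset (Finset.subset_union_right (s₁ := u.toLeft))]
      · exact Finset.sum_congr rfl fun x hx => by simp only [hx, if_true]; rfl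
      · intro x _ hx; simp only [hx, if_false, zero_mul]
  have hE : (τ.prod τ).map (fun p => e (rot s p)) = (τ.prod τ).map (fun p => e (rot 0 p)) := by
    have hm : ∀ s, Measurable fun p : (ι → ℝ) × (ι → ℝ) => e (rot s p) := fun s => e.measurable.comp (rot_meas s)
    have := fun s => Measure.isProbabilityMeasure_map (μ := τ.prod τ) (hm s).aemeasurable
    have hq : ∀ (u : Finset (ι ⊕ ι)) (c : ι ⊕ ι → ℝ), Measurable fun ω : ι ⊕ ι → ℝ => Real.exp (∑ k ∈ u, c k * ω k) := by
      intro u c; fun_prop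
    refine ext_of_mgf (fun u c => ?_) (fun u c => ?_)
    · rw [integrable_map_measure (hq u c).aestronglyMeasurable (hm s).aemeasurable]
      obtain ⟨U, a, b, hU⟩ := key s u c
      have := (rot_mgf h s U a b).1
      simp only [← hU] at this
      exact this
    · rw [integral_map (hm s).aemeasurable (hq u c).aestronglyMeasurable,
        integral_map (hm 0).aemeasurable (hq u c).aestronglyMeasurable]
      obtain ⟨U, a, b, hU⟩ := key s u c
      obtain ⟨V, a', b', hV⟩ := key 0 u c
      -- the coefficients do not depend on s
      have hU0 : ∀ p, ∑ k ∈ u, c k * e (rot 0 p) k = ∑ x ∈ U, (a x * (rot 0 p).1 x + b x * (rot 0 p).2 x) := by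
        intro p
        have h1 := hU (rot (-s) p)
        have h2 : rot s (rot (-s) p) = rot 0 p := by
          have := Real.sin_sq_add_cos_sq s
          refine Prod.ext ?_ ?_ <;> funext x <;>
            simp only [rot, Pi.add_apply, Pi.smul_apply, smul_eq_mul, Real.cos_neg, Real.sin_neg, Real.cos_zero, Real.sin_zero]
          · linear_combination p.1 x * this
          · linear_combination p.2 x * this
        rwa [h2] at h1
      simp only [hU, hU0]
      rw [(rot_mgf h s U a b).2, (rot_mgf h 0 U a b).2]
  have h2 := congrArg (Measure.map e.symm) hE
  rw [Measure.map_map e.symm.measurable (show Measurable fun p => e (rot s p) from e.measurable.comp (rot_meas s)),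
    Measure.map_map e.symm.measurable (show Measurable fun p => e (rot 0 p) from e.measurable.comp (rot_meas 0))] at h2
  have h3 : ∀ s, (e.symm ∘ fun p => e (rot s p)) = rot s := fun s => by funext p; simp
  rw [h3, h3] at h2
  rw [h2]
  have : rot (ι := ι) 0 = id := funext rot_zero
  rw [this, Measure.map_id]

/-- sup over a finite set -/
noncomputable def supM (S : Finset ι) (z : ι → ℝ) : ℝ := ((S.sup fun x => ‖z x‖₊ : NNReal) : ℝ)

lemma supM_nonneg (S : Finset ι) (z : ι → ℝ) : 0 ≤ supM S z := NNReal.coe_nonneg _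

lemma le_supM (S : Finset ι) (z : ι → ℝ) {x : ι} (hx : x ∈ S) : |z x| ≤ supM S z := by
  have := Finset.le_sup (f := fun x => ‖z x‖₊) hx
  exact_mod_cast this

lemma supM_meas (S : Finset ι) : Measurable (supM S : (ι → ℝ) → ℝ) := by
  unfold supM
  refine measurable_coe_nnreal_real.comp ?_
  induction S using Finset.induction_on with
  | empty => simp
  | insert a s ha ih =>
    simp only [Finset.sup_insert]
    exact Measurable.sup (by fun_prop) ih

lemma supM_le_sum (S : Finset ι) (z : ι → ℝ) : supM S z ≤ ∑ x ∈ S, |z x| := by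
  unfold supM
  have : S.sup (fun x => ‖z x‖₊) ≤ ∑ x ∈ S, ‖z x‖₊ :=
    Finset.sup_le fun x hx => Finset.single_le_sum (f := fun x => ‖z x‖₊) (fun _ _ => zero_le) hx
  have h2 : ((S.sup (fun x => ‖z x‖₊) : NNReal) : ℝ) ≤ ((∑ x ∈ S, ‖z x‖₊ : NNReal) : ℝ) := by exact_mod_cast this
  refine h2.trans (le_of_eq ?_)
  push_cast
  rfl

lemma supM_memLp (h : GaussLaw τ C) (S : Finset ι) (p : NNReal) : MemLp (supM S) p τ := by
  have h1 : MemLp (fun z : ι → ℝ => ∑ x ∈ S, |z x|) p τ := by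
    refine memLp_finsetSum _ fun x _ => ?_
    have := (h.memLp {x} 1 p)
    simp only [Finset.sum_singleton, Pi.one_apply, one_mul] at this
    exact this.abs
  refine h1.mono (supM_meas S).aestronglyMeasurable (ae_of_all _ fun z => ?_)
  rw [Real.norm_of_nonneg (supM_nonneg S z), Real.norm_of_nonneg (Finset.sum_nonneg fun _ _ => abs_nonneg _)]
  exact supM_le_sum S z

lemma supM_exp (h : GaussLaw τ C) (S : Finset ι) (hS : S.Nonempty) {σ : ℝ} (hσ : 0 < σ) (hC : ∀ x, C x x ≤ σ ^ 2) :
    ∫ z, supM S z ∂τ ≤ σ * (Real.log (2 * S.card) + 1 / 2) := by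
  have := h.prob
  have hnt : Integrable (supM S) τ := by
    have := supM_memLp h S 1
    exact memLp_one_iff_integrable.1 (by exact_mod_cast this)
  have hx : ∀ (x : ι) (c : ℝ), Integrable (fun z : ι → ℝ => Real.exp (c * z x)) τ ∧
      ∫ z, Real.exp (c * z x) ∂τ = Real.exp (c * c * C x x / 2) := by
    intro x c
    have h1 := h.int_exp {x} (fun _ => c)
    have h2 := h.mgf {x} (fun _ => c)
    simp only [Finset.sum_singleton] at h1 h2
    exact ⟨h1, h2⟩
  have hpt : ∀ z, Real.exp (σ⁻¹ * supM S z) ≤ ∑ x ∈ S, (Real.exp (σ⁻¹ * z x) + Real.exp (-σ⁻¹ * z x)) := by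
    intro z
    obtain ⟨x, hxS, hx2⟩ := Finset.exists_mem_eq_sup S hS (fun x => ‖z x‖₊)
    have h3 : supM S z = |z x| := by unfold supM; rw [hx2]; simp
    rw [h3]
    refine le_trans ?_ (Finset.single_le_sum (f := fun x => Real.exp (σ⁻¹ * z x) + Real.exp (-σ⁻¹ * z x))
      (fun _ _ => by positivity) hxS)
    rcases abs_cases (z x) with ⟨h4, _⟩ | ⟨h4, _⟩ <;> rw [h4]
    · have := Real.exp_pos (-σ⁻¹ * z x); linarith
    · have := Real.exp_pos (σ⁻¹ * z x)
      rw [show σ⁻¹ * -z x = -σ⁻¹ * z x by ring]; linarith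
  have hi2 : Integrable (fun z : ι → ℝ => ∑ x ∈ S, (Real.exp (σ⁻¹ * z x) + Real.exp (-σ⁻¹ * z x))) τ :=
    integrable_finsetSum _ fun x _ => (hx x _).1.add (hx x _).1
  have hi1 : Integrable (fun z : ι → ℝ => Real.exp (σ⁻¹ * supM S z)) τ := by
    refine hi2.mono (Measurable.aestronglyMeasurable ?_) (ae_of_all _ fun z => ?_)
    · exact ((supM_meas S).const_mul _).exp
    · rw [Real.norm_of_nonneg (Real.exp_pos _).le, Real.norm_of_nonneg (Finset.sum_nonneg fun _ _ => by positivity)]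
      exact hpt z
  have hJ : Real.exp (∫ z, σ⁻¹ * supM S z ∂τ) ≤ ∫ z, Real.exp (σ⁻¹ * supM S z) ∂τ :=
    convexOn_exp.map_integral_le Real.continuous_exp.continuousOn isClosed_univ (by simp) (hnt.const_mul _) hi1
  have hc : (0:ℝ) < S.card := by exact_mod_cast hS.card_pos
  have hB : ∫ z, Real.exp (σ⁻¹ * supM S z) ∂τ ≤ (2 * S.card) * Real.exp (1 / 2) := by
    refine (integral_mono hi1 hi2 hpt).trans ?_
    rw [integral_finsetSum _ (f := fun x (z : ι → ℝ) => Real.exp (σ⁻¹ * z x) + Real.exp (-σ⁻¹ * z x)) fun x _ =>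
      (hx x _).1.add (hx x _).1]
    have : ∀ x ∈ S, ∫ z, (Real.exp (σ⁻¹ * z x) + Real.exp (-σ⁻¹ * z x)) ∂τ ≤ 2 * Real.exp (1 / 2) := by
      intro x _
      rw [integral_add (hx x _).1 (hx x _).1, (hx x _).2, (hx x _).2]
      have h5 : σ⁻¹ * σ⁻¹ * C x x ≤ 1 := by
        have h6 := mul_le_mul_of_nonneg_left (hC x) (by positivity : 0 ≤ σ⁻¹ * σ⁻¹)
        have : σ⁻¹ * σ⁻¹ * σ ^ 2 = 1 := by field_simp
        linarith
      have h7 : Real.exp (σ⁻¹ * σ⁻¹ * C x x / 2) ≤ Real.exp (1 / 2) := Real.exp_le_exp.2 (by linarith)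
      rw [show -σ⁻¹ * -σ⁻¹ * C x x = σ⁻¹ * σ⁻¹ * C x x by ring]
      linarith
    refine (Finset.sum_le_sum this).trans (le_of_eq ?_)
    rw [Finset.sum_const, nsmul_eq_mul]; ring
  have h8 := Real.log_le_log (Real.exp_pos _) (hJ.trans hB)
  rw [Real.log_exp, Real.log_mul (by positivity) (by positivity), Real.log_exp, integral_const_mul] at h8
  have h9 := mul_le_mul_of_nonneg_left h8 hσ.le
  rwa [← mul_assoc, mul_inv_cancel₀ hσ.ne', one_mul] at h9

end Infl
end

section
section Infl2
variable {d : ℕ} {μ : Measure (Vert d → ℝ)} {I : Type} [Fintype I] {ν : I → Measure (Vert d → ℝ)}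
  {C : I → Vert d → Vert d → ℝ}

/-- total field -/
noncomputable def fld (X : I → Vert d → ℝ) : Vert d → ℝ := fun k => ∑ b, X b k

/-- total field without block i -/
noncomputable def fldo (i : I) (X : I → Vert d → ℝ) : Vert d → ℝ := fun k => ∑ b ∈ Finset.univ.erase i, X b k

lemma fld_meas : Measurable (fld : (I → Vert d → ℝ) → Vert d → ℝ) := by
  refine measurable_pi_lambda _ fun k => Finset.measurable_sum _ fun b _ => ?_
  exact (measurable_pi_apply k).comp (measurable_pi_apply b)

lemma fldo_meas (i : I) : Measurable (fldo i : (I → Vert d → ℝ) → Vert d → ℝ) := by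
  refine measurable_pi_lambda _ fun k => Finset.measurable_sum _ fun b _ => ?_
  exact (measurable_pi_apply k).comp (measurable_pi_apply b)

lemma fld_update (i : I) (X : I → Vert d → ℝ) (a : Vert d → ℝ) :
    fld (Function.update X i a) = fldo i X + a := by
  funext k
  simp only [fld, fldo, Pi.add_apply]
  rw [← Finset.sum_erase_add _ _ (Finset.mem_univ i), Function.update_self]
  congr 1
  exact Finset.sum_congr rfl fun b hb => by rw [Function.update_of_ne (Finset.ne_of_mem_erase hb)]

lemma fldo_update (i : I) (X : I → Vert d → ℝ) (a : Vert d → ℝ) :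
    fldo i (Function.update X i a) = fldo i X := by
  funext k
  exact Finset.sum_congr rfl fun b hb => by rw [Function.update_of_ne (Finset.ne_of_mem_erase hb)]

/-- locality on a box -/
def LocalOn (R : ℕ) (A : Set (Vert d → ℝ)) : Prop :=
  ∀ ω ω' : Vert d → ℝ, (∀ x ∈ box 0 R, ω x = ω' x) → (ω ∈ A ↔ ω' ∈ A)

lemma local_shift {R : ℕ} {A : Set (Vert d → ℝ)} (h : LocalOn R A) (a : Vert d → ℝ) :
    LocalOn R {ω | ω + a ∈ A} := fun ω ω' hω => h _ _ fun x hx => by simp [hω x hx]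

lemma fld_law (hμ : GaussLaw μ (gr (d := d))) (hν : ∀ i, GaussLaw (ν i) (C i)) {R : ℕ}
    (hC : ∀ x ∈ box 0 R, ∀ y ∈ box 0 R, ∑ i, C i x y = gr x y) {A : Set (Vert d → ℝ)}
    (hA : MeasurableSet A) (hloc : LocalOn R A) : Measure.pi ν {X | fld X ∈ A} = μ A := by
  have h1 : GaussLaw ((Measure.pi ν).map fld) _ := GaussLaw.sum_pi hν
  have hm : Measurable fun (ω : Vert d → ℝ) (k : Vert d) =>
      ∑ x ∈ (if k ∈ box 0 R then {k} else ∅ : Finset (Vert d)), (1:ℝ) * ω x := by fun_prop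
  have h2 := h1.map_lin (fun k : Vert d => if k ∈ box 0 R then {k} else ∅) (fun _ _ => 1)
  have h3 := hμ.map_lin (fun k : Vert d => if k ∈ box 0 R then {k} else ∅) (fun _ _ => 1)
  have h4 := GaussLaw.ext (h2.congr_cov (fun x y => by
    by_cases hx : x ∈ box 0 R <;> by_cases hy : y ∈ box 0 R <;> simp [hx, hy]
    exact hC x hx y hy)) (h3.congr_cov fun x y => rfl)
  have h5 := congrArg (fun m => m A) h4
  have e : ∀ ω : Vert d → ℝ, ((fun (k : Vert d) =>
      ∑ x ∈ (if k ∈ box 0 R then {k} else ∅ : Finset (Vert d)), (1:ℝ) * ω x) ∈ A) ↔ ω ∈ A := by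
    intro ω
    refine hloc _ _ fun x hx => by simp [hx]
  rw [Measure.map_map hm fld_meas, Measure.map_apply (hm.comp fld_meas) hA, Measure.map_apply hm hA] at h5
  convert h5 using 2
  · ext X
    exact (e (fld X)).symm
  · ext ω
    exact (e ω).symm

lemma fldo_int [∀ i, IsProbabilityMeasure (ν i)] (i : I) {B : Set (Vert d → ℝ)} (hB : MeasurableSet B) :
    ∫⁻ z, Measure.pi ν {Y | fldo i Y + z ∈ B} ∂ν i = Measure.pi ν {Y | fld Y ∈ B} := by
  have hm : MeasurableSet {Y : I → Vert d → ℝ | fld Y ∈ B} := fld_meas hB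
  rw [← lintegral_indicator_one hm, lint_update (ν := ν) i (measurable_one.indicator hm)]
  refine lintegral_congr fun z => ?_
  have hm2 : MeasurableSet {Y : I → Vert d → ℝ | fldo i Y + z ∈ B} := ((fldo_meas i).add_const z) hB
  rw [← lintegral_indicator_one hm2]
  refine lintegral_congr fun Y => ?_
  simp only [Set.indicator, Set.mem_setOf_eq, fld_update, Pi.one_apply]

/-- disagreement probability -/
noncomputable def GG (ν : I → Measure (Vert d → ℝ)) (A : Set (Vert d → ℝ)) (i : I) (z a : Vert d → ℝ) : ℝ≥0∞ :=
  Measure.pi ν {Y | ¬ (fldo i Y + z ∈ A ↔ fldo i Y + a ∈ A)}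

lemma iff_meas {α : Type*} [MeasurableSpace α] {p q : α → Prop} (hp : MeasurableSet {x | p x})
    (hq : MeasurableSet {x | q x}) : MeasurableSet {x | ¬ (p x ↔ q x)} := by
  have : {x | ¬ (p x ↔ q x)} = ({x | p x} \ {x | q x}) ∪ ({x | q x} \ {x | p x}) := by
    ext x; simp; tauto
  rw [this]
  exact (hp.diff hq).union (hq.diff hp)

lemma GG_meas [∀ i, IsProbabilityMeasure (ν i)] {A : Set (Vert d → ℝ)} (hA : MeasurableSet A) (i : I) :
    Measurable fun p : (Vert d → ℝ) × (Vert d → ℝ) => GG ν A i p.1 p.2 := by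
  have h1 : Measurable fun q : ((Vert d → ℝ) × (Vert d → ℝ)) × (I → Vert d → ℝ) => fldo i q.2 + q.1.1 :=
    ((fldo_meas i).comp measurable_snd).add (measurable_fst.comp measurable_fst)
  have h2 : Measurable fun q : ((Vert d → ℝ) × (Vert d → ℝ)) × (I → Vert d → ℝ) => fldo i q.2 + q.1.2 :=
    ((fldo_meas i).comp measurable_snd).add (measurable_snd.comp measurable_fst)
  have := measurable_measure_prodMk_left (ν := Measure.pi ν) (iff_meas (h1 hA) (h2 hA))
  exact this

lemma GG_tri [∀ i, IsProbabilityMeasure (ν i)] (A : Set (Vert d → ℝ)) (i : I) (z a c : Vert d → ℝ) :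
    GG ν A i z a ≤ GG ν A i z c + GG ν A i c a := by
  refine le_trans (measure_mono fun Y hY => ?_) (measure_union_le _ _)
  simp only [Set.mem_union, Set.mem_setOf_eq] at hY ⊢
  tauto

lemma infl_eq [∀ i, IsProbabilityMeasure (ν i)] {A : Set (Vert d → ℝ)} (hA : MeasurableSet A) (i : I) :
    infl ν {X | fld X ∈ A} i = ∫⁻ p, GG ν A i p.1 p.2 ∂(ν i).prod (ν i) := by
  rw [lintegral_prod _ (GG_meas hA i).aemeasurable]
  unfold infl
  refine lintegral_congr fun a => ?_
  have hm : MeasurableSet {Y : I → Vert d → ℝ | ¬ (Function.update Y i a ∈ {X | fld X ∈ A} ↔ Y ∈ {X | fld X ∈ A})} := by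
    refine iff_meas ?_ (fld_meas hA)
    exact (fld_meas.comp measurable_update_left) hA
  rw [← lintegral_indicator_one hm, lint_update (ν := ν) i (measurable_one.indicator hm)]
  refine lintegral_congr fun z => ?_
  unfold GG
  have hm2 : MeasurableSet {Y : I → Vert d → ℝ | ¬ (fldo i Y + a ∈ A ↔ fldo i Y + z ∈ A)} :=
    iff_meas (((fldo_meas i).add_const a) hA) (((fldo_meas i).add_const z) hA)
  rw [← lintegral_indicator_one hm2]
  refine lintegral_congr fun Y => ?_
  simp only [Set.indicator, Set.mem_setOf_eq, fld_update, fldo_update, Pi.one_apply]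

lemma rot_add (s η : ℝ) (p : (Vert d → ℝ) × (Vert d → ℝ)) : rot (s + η) p = rot η (rot s p) := by
  refine Prod.ext ?_ ?_ <;> funext x <;>
    simp only [rot, Pi.add_apply, Pi.smul_apply, smul_eq_mul, Real.cos_add, Real.sin_add] <;> ring

lemma infl_chain (hν : ∀ i, GaussLaw (ν i) (C i)) {A : Set (Vert d → ℝ)} (hA : MeasurableSet A) (i : I)
    {K : ℕ} (hK : 0 < K) :
    infl ν {X | fld X ∈ A} i ≤ K * ∫⁻ p, GG ν A i p.1 (rot (Real.pi / (2 * K)) p).1 ∂(ν i).prod (ν i) := by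
  have := fun i => (hν i).prob
  set η := Real.pi / (2 * K) with hη
  set J := ∫⁻ p, GG ν A i p.1 (rot η p).1 ∂(ν i).prod (ν i) with hJ
  have hmJ : Measurable fun p : (Vert d → ℝ) × (Vert d → ℝ) => GG ν A i p.1 (rot η p).1 :=
    (GG_meas hA i).comp (measurable_fst.prodMk (measurable_fst.comp (rot_meas η)))
  have key : ∀ k : ℕ, ∫⁻ p, GG ν A i p.1 (rot (k * η) p).1 ∂(ν i).prod (ν i) ≤ k * J := by
    intro k
    induction k with
    | zero => simp [rot_zero, GG]
    | succ k ih =>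
      have h1 : ∫⁻ p, GG ν A i (rot (k * η) p).1 (rot ((k + 1 : ℕ) * η) p).1 ∂(ν i).prod (ν i) = J := by
        rw [hJ]
        conv_rhs => rw [← rot_pres (hν i) (k * η)]
        rw [lintegral_map hmJ (rot_meas _)]
        refine lintegral_congr fun p => ?_
        rw [← rot_add]
        push_cast
        rw [add_mul, one_mul]
      calc ∫⁻ p, GG ν A i p.1 (rot ((k + 1 : ℕ) * η) p).1 ∂(ν i).prod (ν i)
          ≤ ∫⁻ p, (GG ν A i p.1 (rot (k * η) p).1 + GG ν A i (rot (k * η) p).1 (rot ((k + 1 : ℕ) * η) p).1) ∂(ν i).prod (ν i) :=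
            lintegral_mono fun p => GG_tri A i _ _ _
        _ = ∫⁻ p, GG ν A i p.1 (rot (k * η) p).1 ∂(ν i).prod (ν i) + J := by
            rw [lintegral_add_left, h1]
            exact (GG_meas hA i).comp (measurable_fst.prodMk (measurable_fst.comp (rot_meas _)))
        _ ≤ k * J + J := by gcongr
        _ = (k + 1 : ℕ) * J := by push_cast; rw [add_mul, one_mul]
  refine le_trans (le_of_eq ?_) (key K)
  rw [infl_eq hA]
  refine lintegral_congr fun p => ?_
  have h0 : (K:ℝ) ≠ 0 := by positivity
  have : (K:ℝ) * η = Real.pi / 2 := by rw [hη]; field_simp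
  rw [this]
  simp [rot]

lemma zero_off (hν : ∀ i, GaussLaw (ν i) (C i)) (i : I) {S : Finset (Vert d)} (hS : ∀ x, x ∉ S → C i x x = 0) :
    ∀ᵐ z ∂ν i, ∀ x, x ∉ S → z x = 0 := by
  have := fun i => (hν i).prob
  rw [ae_all_iff]
  intro x
  by_cases hx : x ∈ S
  · simp [hx]
  have h1 := fun s : ℝ => fun (r : ℝ) (hr : 0 < r) (v : ℝ) (hv : 0 < v) => (hν i).tail {x} (fun _ => s) hv hr.le (by simp [hS x hx, hv.le])
  have h2 : ∀ s : ℝ, ∀ r : ℝ, 0 < r → ν i {ω | r ≤ s * ω x} = 0 := by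
    intro s r hr
    have h3 : (ν i).real {ω | r ≤ s * ω x} ≤ 0 := by
      have h4 : Tendsto (fun v : ℝ => Real.exp (-(r ^ 2 / (2 * v)))) (𝓝[>] 0) (𝓝 0) := by
        refine Real.tendsto_exp_neg_atTop_nhds_zero.comp ?_
        have : Tendsto (fun v : ℝ => r ^ 2 / 2 * v⁻¹) (𝓝[>] 0) atTop :=
          tendsto_inv_nhdsGT_zero.const_mul_atTop (by positivity)
        refine this.congr fun v => ?_
        rw [div_mul_eq_div_div, div_eq_mul_inv (r ^ 2 / 2)]
      refine ge_of_tendsto h4 ?_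
      filter_upwards [self_mem_nhdsWithin] with v hv
      have := h1 s r hr v hv
      simpa using this
    have h5 : (ν i).real {ω | r ≤ s * ω x} = 0 := le_antisymm h3 measureReal_nonneg
    exact (measureReal_eq_zero_iff).1 h5
  have h6 : ∀ᵐ z ∂ν i, ∀ n : ℕ, ¬ (1 / ((n:ℝ) + 1) ≤ 1 * z x) ∧ ¬ (1 / ((n:ℝ) + 1) ≤ -1 * z x) := by
    rw [ae_all_iff]
    intro n
    refine Filter.Eventually.and ?_ ?_
    · rw [ae_iff]; simpa using h2 1 (1 / ((n:ℝ) + 1)) (by positivity)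
    · rw [ae_iff]; simpa using h2 (-1) (1 / ((n:ℝ) + 1)) (by positivity)
  filter_upwards [h6] with z hz _
  by_contra hne
  obtain ⟨n, hn⟩ := exists_nat_one_div_lt (abs_pos.2 hne)
  obtain ⟨h7, h8⟩ := hz n
  rcases abs_cases (z x) with ⟨h9, _⟩ | ⟨h9, _⟩ <;> rw [h9] at hn <;> linarith

lemma infl_J (hν : ∀ i, GaussLaw (ν i) (C i)) {A : Set (Vert d → ℝ)} (hA : MeasurableSet A) (hup : IsUpperSet A) (i : I)
    {S : Finset (Vert d)} (hS : ∀ x, x ∉ S → C i x x = 0) {η L : ℝ} (hη : 0 ≤ η) (hL : 0 ≤ L) :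
    ∫⁻ p, GG ν A i p.1 (rot η p).1 ∂(ν i).prod (ν i) ≤ ν i {z | L < supM S z} +
      ∫⁻ z, Measure.pi ν {Y | fld Y ∈ {ω | ω + (η * supM S z + η ^ 2 * L / 2) • rst S 1 ∈ A ∧
        ¬ ω + (-(η * supM S z + η ^ 2 * L / 2)) • rst S 1 ∈ A}} ∂ν i := by
  have := fun i => (hν i).prob
  set m : (Vert d → ℝ) → ℝ := fun z => η * supM S z + η ^ 2 * L / 2 with hm
  have hmm : Measurable m := ((supM_meas S).const_mul η).add_const _
  have hz : ∀ᵐ z ∂ν i, ∀ x, x ∉ S → z x = 0 := zero_off hν i hS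
  have hset : MeasurableSet {q : ((Vert d → ℝ) × (Vert d → ℝ)) × (I → Vert d → ℝ) |
      fldo i q.2 + q.1.1 ∈ {ω | ω + m q.1.2 • rst S 1 ∈ A ∧ ¬ ω + (-m q.1.2) • rst S 1 ∈ A}} := by
    have h1 : ∀ f : (Vert d → ℝ) → ℝ, Measurable f → Measurable fun q : ((Vert d → ℝ) × (Vert d → ℝ)) × (I → Vert d → ℝ) =>
        fldo i q.2 + q.1.1 + f q.1.2 • rst S 1 := by
      intro f hf
      refine (((fldo_meas i).comp measurable_snd).add (measurable_fst.comp measurable_fst)).add ?_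
      exact (hf.comp (measurable_snd.comp measurable_fst)).smul_const _
    exact ((h1 m hmm) hA).inter ((h1 _ hmm.neg) hA).compl
  have hG := measurable_measure_prodMk_left (ν := Measure.pi ν) hset
  have hLm : MeasurableSet {p : (Vert d → ℝ) × (Vert d → ℝ) | L < supM S p.1} :=
    measurableSet_lt measurable_const ((supM_meas S).comp measurable_fst)
  calc ∫⁻ p, GG ν A i p.1 (rot η p).1 ∂(ν i).prod (ν i)
      ≤ ∫⁻ p, ({p : (Vert d → ℝ) × (Vert d → ℝ) | L < supM S p.1}.indicator 1 p + Measure.pi ν {Y | fldo i Y + p.1 ∈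
          {ω | ω + m p.2 • rst S 1 ∈ A ∧ ¬ ω + (-m p.2) • rst S 1 ∈ A}}) ∂(ν i).prod (ν i) := by
        have hz1 : ∀ᵐ p ∂(ν i).prod (ν i), ∀ x, x ∉ S → p.1 x = 0 :=
          Measure.quasiMeasurePreserving_fst.ae hz
        have hz2 : ∀ᵐ p ∂(ν i).prod (ν i), ∀ x, x ∉ S → p.2 x = 0 :=
          Measure.quasiMeasurePreserving_snd.ae hz
        refine lintegral_mono_ae ?_
        filter_upwards [hz1, hz2] with p h1 h2
        by_cases hp : L < supM S p.1
        · refine le_trans ?_ le_self_add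
          simp only [Set.indicator, Set.mem_setOf_eq, hp, if_true, Pi.one_apply]
          exact prob_le_one
        · refine le_trans ?_ le_add_self
          have hbd : ∀ x, |(rot η p).1 x - p.1 x| ≤ m p.2 * rst S 1 x := by
            intro x
            by_cases hx : x ∈ S
            · have e : (rot η p).1 x - p.1 x = (Real.cos η - 1) * p.1 x + Real.sin η * p.2 x := by
                simp only [rot, Pi.add_apply, Pi.smul_apply, smul_eq_mul]; ring
              have h3 : |Real.cos η - 1| ≤ η ^ 2 / 2 := by
                rw [abs_le]
                have := Real.one_sub_sq_div_two_le_cos (x := η)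
                have := Real.cos_le_one η
                constructor <;> [linarith; nlinarith [sq_nonneg η]]
              have h4 : |Real.sin η| ≤ η := by
                have := Real.abs_sin_le_abs (x := η)
                rwa [abs_of_nonneg hη] at this
              have h5 := le_supM S p.1 hx
              have h6 := le_supM S p.2 hx
              push Not at hp
              have h7 : |p.1 x| ≤ L := h5.trans hp
              rw [e]
              refine (abs_add_le _ _).trans ?_
              rw [abs_mul, abs_mul]
              have h8 := mul_le_mul h3 h7 (abs_nonneg _) (by positivity)
              have h9 := mul_le_mul h4 h6 (abs_nonneg _) hη
              simp only [rst, hx, if_true, Pi.one_apply, hm]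
              linarith
            · have e : (rot η p).1 x - p.1 x = 0 := by
                simp only [rot, Pi.add_apply, Pi.smul_apply, smul_eq_mul, h1 x hx, h2 x hx]; ring
              rw [e]
              simp [rst, hx]
          have hm0 : 0 ≤ m p.2 := by
            have := supM_nonneg S p.2
            simp only [hm]; positivity
          have hr0 : ∀ x, 0 ≤ rst S 1 x := fun x => by unfold rst; split_ifs <;> simp
          refine measure_mono fun Y hY => ?_
          simp only [Set.mem_setOf_eq] at hY ⊢
          have hle1 : fldo i Y + p.1 ≤ fldo i Y + p.1 + m p.2 • rst S 1 := fun x => by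
            simp only [Pi.add_apply, Pi.smul_apply, smul_eq_mul]
            have := mul_nonneg hm0 (hr0 x); linarith
          have hle2 : fldo i Y + (rot η p).1 ≤ fldo i Y + p.1 + m p.2 • rst S 1 := fun x => by
            have := (abs_le.1 (hbd x)).2
            simp only [Pi.add_apply, Pi.smul_apply, smul_eq_mul]
            linarith
          have hle3 : fldo i Y + p.1 + (-m p.2) • rst S 1 ≤ fldo i Y + p.1 := fun x => by
            simp only [Pi.add_apply, Pi.smul_apply, smul_eq_mul]
            have := mul_nonneg hm0 (hr0 x); linarith
          have hle4 : fldo i Y + p.1 + (-m p.2) • rst S 1 ≤ fldo i Y + (rot η p).1 := fun x => by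
            have := (abs_le.1 (hbd x)).1
            simp only [Pi.add_apply, Pi.smul_apply, smul_eq_mul]
            linarith
          by_cases hq : fldo i Y + p.1 ∈ A
          · refine ⟨hup hle1 hq, fun h => hY ?_⟩
            exact iff_of_true hq (hup hle4 h)
          · refine ⟨hup hle2 ?_, fun h => hq (hup hle3 h)⟩
            by_contra h
            exact hY (iff_of_false hq h)
    _ = ν i {z | L < supM S z} + ∫⁻ p, Measure.pi ν {Y | fldo i Y + p.1 ∈
          {ω | ω + m p.2 • rst S 1 ∈ A ∧ ¬ ω + (-m p.2) • rst S 1 ∈ A}} ∂(ν i).prod (ν i) := by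
        rw [lintegral_add_left (measurable_one.indicator hLm), lintegral_indicator_one hLm]
        congr 1
        have : {p : (Vert d → ℝ) × (Vert d → ℝ) | L < supM S p.1} = {z | L < supM S z} ×ˢ Set.univ := by
          ext p; simp
        rw [this, Measure.prod_prod]; simp
    _ = _ := by
        congr 1
        refine (lintegral_prod_symm _ hG.aemeasurable).trans ?_
        refine lintegral_congr fun z' => ?_
        have hB : MeasurableSet {ω : Vert d → ℝ | ω + m z' • rst S 1 ∈ A ∧ ¬ ω + (-m z') • rst S 1 ∈ A} := by
          have h1 : ∀ a : Vert d → ℝ, MeasurableSet {ω : Vert d → ℝ | ω + a ∈ A} := fun a => (measurable_id.add_const a) hA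
          exact (h1 _).inter (h1 _).compl
        exact fldo_int (ν := ν) i hB

theorem infl_bound (hd : 3 ≤ d) (hμ : GaussLaw μ (gr (d := d))) (hν : ∀ i, GaussLaw (ν i) (C i)) {R : ℕ}
    (hC : ∀ x ∈ box 0 R, ∀ y ∈ box 0 R, ∑ i, C i x y = gr x y)
    {A : Set (Vert d → ℝ)} (hA : MeasurableSet A) (hup : IsUpperSet A) (hloc : LocalOn R A) (i : I)
    {S : Finset (Vert d)} (hS : ∀ x, x ∉ S → C i x x = 0) :
    infl ν {X | fld X ∈ A} i ≤ ENNReal.ofReal (Real.pi * (∫ z, supM S z ∂ν i) * ∑ z ∈ S, DD μ A z) := by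
  have := fun i => (hν i).prob
  have := hμ.prob
  set F : ℝ → ℝ := fun t => μ.real {ω | ω + t • rst S 1 ∈ A} with hF
  set D := ∑ z ∈ S, DD μ A z with hD
  have hder : HasDerivAt F D 0 := gff_deriv' hd hμ S hA
  have hD0 : 0 ≤ D := Finset.sum_nonneg fun z _ => DD_nonneg hd hμ hA hup z
  set E1 := ∫ z, supM S z ∂ν i with hE1
  set E2 := ∫ z, supM S z ^ 2 ∂ν i with hE2
  set E4 := ∫ z, supM S z ^ 4 ∂ν i with hE4
  have hi1 : Integrable (supM S) (ν i) :=
    memLp_one_iff_integrable.1 (by exact_mod_cast supM_memLp (hν i) S 1)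
  have hi2 : Integrable (fun z => supM S z ^ 2) (ν i) :=
    (show MemLp (supM S) 2 (ν i) by exact_mod_cast supM_memLp (hν i) S 2).integrable_sq
  have hi4 : Integrable (fun z => supM S z ^ 4) (ν i) := by
    have := (show MemLp (supM S) (4 : ℕ) (ν i) by exact_mod_cast supM_memLp (hν i) S 4).integrable_norm_pow (by norm_num)
    refine this.congr (ae_of_all _ fun z => ?_)
    simp only [Real.norm_of_nonneg (supM_nonneg S z)]
  have hE20 : 0 ≤ E2 := integral_nonneg fun z => sq_nonneg _
  have hE10 : 0 ≤ E1 := integral_nonneg fun z => supM_nonneg S z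
  have hr0 : ∀ x, 0 ≤ rst S 1 x := fun x => by unfold rst; split_ifs <;> simp
  have hmeas : ∀ a : Vert d → ℝ, MeasurableSet {ω : Vert d → ℝ | ω + a ∈ A} := fun a => (measurable_id.add_const a) hA
  suffices h : ∀ ε : ℝ, 0 < ε → infl ν {X | fld X ∈ A} i ≤ ENNReal.ofReal (Real.pi * E1 * (D + ε)) by
    have ht : Tendsto (fun ε : ℝ => ENNReal.ofReal (Real.pi * E1 * (D + ε))) (𝓝[>] 0) (𝓝 (ENNReal.ofReal (Real.pi * E1 * (D + 0)))) := by
      refine tendsto_nhdsWithin_of_tendsto_nhds (Continuous.tendsto ?_ 0)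
      exact ENNReal.continuous_ofReal.comp (by fun_prop)
    rw [add_zero] at ht
    refine ge_of_tendsto ht ?_
    filter_upwards [self_mem_nhdsWithin] with ε hε using h ε hε
  intro ε hε
  obtain ⟨t0, ht0, hbd⟩ : ∃ t0 > 0, ∀ t, |t| < t0 → |F t - F 0 - D * t| ≤ ε * |t| := by
    have h1 := hder.isLittleO.bound hε
    obtain ⟨t0, ht0, h2⟩ := Metric.eventually_nhds_iff.1 h1
    refine ⟨t0, ht0, fun t ht => ?_⟩
    have := h2 (y := t) (by simpa using ht)
    simpa [mul_comm] using this
  have hFle : ∀ t, 0 ≤ t → F t - F (-t) ≤ 2 * (D + ε) * t + t ^ 2 / t0 ^ 2 := by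
    intro t ht
    by_cases h1 : t < t0
    · have h2 := (abs_le.1 (hbd t (by rwa [abs_of_nonneg ht]))).2
      have h3 := (abs_le.1 (hbd (-t) (by rwa [abs_neg, abs_of_nonneg ht]))).1
      rw [abs_neg, abs_of_nonneg ht] at h3
      rw [abs_of_nonneg ht] at h2
      have : 0 ≤ t ^ 2 / t0 ^ 2 := by positivity
      nlinarith
    · have h2 : F t ≤ 1 := measureReal_le_one
      have h3 : 0 ≤ F (-t) := measureReal_nonneg
      have h4 : 1 ≤ t ^ 2 / t0 ^ 2 := by
        rw [le_div_iff₀ (by positivity), one_mul]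
        exact pow_le_pow_left₀ ht0.le (not_lt.1 h1) 2
      have : 0 ≤ 2 * (D + ε) * t := by positivity
      linarith
  have hPF : ∀ t, 0 ≤ t → Measure.pi ν {Y | fld Y ∈ {ω | ω + t • rst S 1 ∈ A ∧ ¬ ω + (-t) • rst S 1 ∈ A}} ≤
      ENNReal.ofReal (2 * (D + ε) * t + t ^ 2 / t0 ^ 2) := by
    intro t ht
    have hB : MeasurableSet {ω : Vert d → ℝ | ω + t • rst S 1 ∈ A ∧ ¬ ω + (-t) • rst S 1 ∈ A} :=
      (hmeas _).inter (hmeas _).compl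
    rw [fld_law hμ hν hC hB (fun ω ω' h => and_congr (local_shift hloc _ ω ω' h)
      (not_congr (local_shift hloc _ ω ω' h)))]
    refine le_trans ?_ (ENNReal.ofReal_le_ofReal (hFle t ht))
    rw [hF]
    simp only
    have hsub : {ω | ω + (-t) • rst S 1 ∈ A} ⊆ {ω | ω + t • rst S 1 ∈ A} := by
      intro ω hω
      refine hup (fun x => ?_) hω
      simp only [Pi.add_apply, Pi.smul_apply, smul_eq_mul]
      nlinarith [hr0 x]
    rw [← measureReal_diff hsub (hmeas _), ofReal_measureReal]
    exact measure_mono fun ω hω => hω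
  set Q : ℝ → ℝ := fun w => Real.pi / 2 * w ^ 2 * E4 + Real.pi * (D + ε) * (E1 + w / 2) +
    Real.pi / 2 * (2 * w ^ 2 * E2 + w ^ 4 / 2) / t0 ^ 2 with hQ
  have hmain : ∀ K : ℕ, 0 < K → infl ν {X | fld X ∈ A} i ≤ ENNReal.ofReal (Q (Real.sqrt (Real.pi / (2 * K)))) := by
    intro K hK
    set w := Real.sqrt (Real.pi / (2 * K)) with hw
    have hK' : (0:ℝ) < K := by exact_mod_cast hK
    have hpi := Real.pi_pos
    have hw0 : 0 < w := Real.sqrt_pos.2 (by positivity)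
    have hw2 : w ^ 2 = Real.pi / (2 * K) := Real.sq_sqrt (by positivity)
    have hKw : (K:ℝ) * w ^ 2 = Real.pi / 2 := by rw [hw2]; field_simp
    refine (infl_chain hν hA i hK).trans ?_
    have h1 := infl_J hν hA hup i hS (η := w ^ 2) (L := w⁻¹) (by positivity) (by positivity)
    rw [← hw2]
    have h2 : ν i {z | w⁻¹ < supM S z} ≤ ENNReal.ofReal (w ^ 4 * E4) := by
      have h3 := mul_meas_ge_le_integral_of_nonneg (μ := ν i) (f := fun z => supM S z ^ 4) (ae_of_all _ fun z => pow_nonneg (M₀ := ℝ) (supM_nonneg S z) 4) hi4 (w⁻¹ ^ 4)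
      have h4 : (ν i).real {z | w⁻¹ < supM S z} ≤ w ^ 4 * E4 := by
        have h5 : (ν i).real {z | w⁻¹ < supM S z} ≤ (ν i).real {z | w⁻¹ ^ 4 ≤ supM S z ^ 4} :=
          measureReal_mono fun z (hz : w⁻¹ < supM S z) =>
            (pow_le_pow_left₀ (inv_nonneg.2 hw0.le) hz.le 4 : w⁻¹ ^ 4 ≤ supM S z ^ 4)
        have h6 := mul_le_mul_of_nonneg_left h3 (by positivity : 0 ≤ w ^ 4)
        rw [← mul_assoc, ← mul_pow, mul_inv_cancel₀ hw0.ne', one_pow, one_mul] at h6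
        exact h5.trans h6
      rw [← ofReal_measureReal]
      exact ENNReal.ofReal_le_ofReal h4
    have h3 : ∫⁻ z, Measure.pi ν {Y | fld Y ∈ {ω | ω + (w ^ 2 * supM S z + (w ^ 2) ^ 2 * w⁻¹ / 2) • rst S 1 ∈ A ∧
        ¬ ω + (-(w ^ 2 * supM S z + (w ^ 2) ^ 2 * w⁻¹ / 2)) • rst S 1 ∈ A}} ∂ν i ≤
        ENNReal.ofReal (2 * (D + ε) * (w ^ 2 * E1 + w ^ 3 / 2) + (2 * w ^ 4 * E2 + w ^ 6 / 2) / t0 ^ 2) := by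
      have e : (w ^ 2) ^ 2 * w⁻¹ / 2 = w ^ 3 / 2 := by field_simp
      rw [e]
      have hp : ∀ z, Measure.pi ν {Y | fld Y ∈ {ω | ω + (w ^ 2 * supM S z + w ^ 3 / 2) • rst S 1 ∈ A ∧
        ¬ ω + (-(w ^ 2 * supM S z + w ^ 3 / 2)) • rst S 1 ∈ A}} ≤ ENNReal.ofReal
          (2 * (D + ε) * (w ^ 2 * supM S z + w ^ 3 / 2) + (2 * w ^ 4 * supM S z ^ 2 + w ^ 6 / 2) / t0 ^ 2) := by
        intro z
        have hz := supM_nonneg S z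
        refine (hPF _ (by positivity)).trans (ENNReal.ofReal_le_ofReal ?_)
        have : (w ^ 2 * supM S z + w ^ 3 / 2) ^ 2 ≤ 2 * w ^ 4 * supM S z ^ 2 + w ^ 6 / 2 := by
          nlinarith [sq_nonneg (w ^ 2 * supM S z - w ^ 3 / 2)]
        have := div_le_div_of_nonneg_right this (by positivity : 0 ≤ t0 ^ 2)
        linarith
      have hia : Integrable (fun z => 2 * (D + ε) * (w ^ 2 * supM S z + w ^ 3 / 2)) (ν i) :=
        ((hi1.const_mul _).add (integrable_const _)).const_mul _
      have hib : Integrable (fun z => (2 * w ^ 4 * supM S z ^ 2 + w ^ 6 / 2) / t0 ^ 2) (ν i) :=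
        ((hi2.const_mul _).add (integrable_const _)).div_const _
      refine (lintegral_mono hp).trans ?_
      have hab := hia.add hib
      simp only [Pi.add_def] at hab
      rw [← ofReal_integral_eq_lintegral_ofReal hab (ae_of_all _ fun z => by
        have := supM_nonneg S z
        show (0:ℝ) ≤ 2 * (D + ε) * (w ^ 2 * supM S z + w ^ 3 / 2) + (2 * w ^ 4 * supM S z ^ 2 + w ^ 6 / 2) / t0 ^ 2
        positivity)]
      refine ENNReal.ofReal_le_ofReal (le_of_eq ?_)
      rw [integral_add hia hib, integral_const_mul, integral_div, integral_add (hi1.const_mul _) (integrable_const _),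
        integral_add (hi2.const_mul _) (integrable_const _), integral_const_mul, integral_const_mul]
      simp
      rfl
    refine (mul_le_mul_right (h1.trans (add_le_add h2 h3)) _).trans ?_
    have hE40 : 0 ≤ E4 := integral_nonneg fun z => pow_nonneg (supM_nonneg S z) 4
    rw [← ENNReal.ofReal_add (by positivity) (by positivity), ← ENNReal.ofReal_natCast, ← ENNReal.ofReal_mul hK'.le]
    refine ENNReal.ofReal_le_ofReal (le_of_eq ?_)
    rw [hQ]
    simp only
    have e2 : Real.pi = 2 * (K * w ^ 2) := by rw [hKw]; ring
    rw [e2]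
    field_simp
    ring
  have hlim : Tendsto (fun K : ℕ => ENNReal.ofReal (Q (Real.sqrt (Real.pi / (2 * K))))) atTop (𝓝 (ENNReal.ofReal (Q 0))) := by
    refine (ENNReal.continuous_ofReal.tendsto _).comp ?_
    have hQc : Continuous Q := by rw [hQ]; fun_prop
    refine (hQc.tendsto 0).comp ?_
    rw [← Real.sqrt_zero]
    refine (Real.continuous_sqrt.tendsto 0).comp ?_
    have : Tendsto (fun K : ℕ => Real.pi / 2 * (1 / (K:ℝ))) atTop (𝓝 (Real.pi / 2 * 0)) :=
      tendsto_one_div_atTop_nhds_zero_nat.const_mul _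
    rw [mul_zero] at this
    refine this.congr fun K => ?_
    by_cases hK : (K:ℝ) = 0
    · simp [hK]
    · field_simp
  have hfin := ge_of_tendsto hlim (by filter_upwards [eventually_gt_atTop 0] with K hK using hmain K hK)
  refine hfin.trans (ENNReal.ofReal_le_ofReal (le_of_eq ?_))
  simp [hQ]; ring

end Infl2
end

section
section Algo
variable {d : ℕ} {I : Type} [Fintype I]

lemma vis_final {E : Type} [MeasurableSpace E] {nxt : Finset I → (I → E) → Option I} (hr : Rule nxt) (n : ℕ)
    (S : Finset I) (X : I → E) (hn : Fintype.card I ≤ n + S.card) : nxt (S ∪ vis nxt n S X) X = none := by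
  induction n generalizing S with
  | zero =>
    have hS : S = Finset.univ := Finset.eq_univ_of_card S (le_antisymm (Finset.card_le_univ S) (by omega))
    cases h : nxt (S ∪ vis nxt 0 S X) X with
    | none => rfl
    | some i => exact absurd (by rw [hS]; simp) (hr.fresh _ _ _ h)
  | succ n ih =>
    rw [vis]
    cases h : nxt S X with
    | none => simpa using h
    | some i =>
      have hi := hr.fresh S X i h
      have := ih (insert i S) (by rw [Finset.card_insert_of_notMem hi]; omega)
      simp only
      rwa [Finset.union_insert, ← Finset.insert_union]

lemma vis_reveal {E : Type} [MeasurableSpace E] {nxt : Finset I → (I → E) → Option I} (n : ℕ)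
    (S : Finset I) (X : I → E) : ∀ i ∈ vis nxt n S X, ∃ T, nxt T X = some i := by
  induction n generalizing S with
  | zero => intro i hi; simp [vis] at hi
  | succ n ih =>
    intro i hi
    rw [vis] at hi
    cases h : nxt S X with
    | none => simp [h] at hi
    | some k =>
      simp only [h, Finset.mem_insert] at hi
      rcases hi with rfl | hi
      · exact ⟨S, h⟩
      · exact ih _ i hi

/-- masked total field -/
noncomputable def fldS (S : I → Finset (Vert d)) (X : I → Vert d → ℝ) : Vert d → ℝ :=
  fun x => ∑ b, if x ∈ S b then X b x else 0

lemma fldS_meas (S : I → Finset (Vert d)) : Measurable (fldS S) := by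
  refine measurable_pi_lambda _ fun k => Finset.measurable_sum _ fun b _ => ?_
  split_ifs
  · exact (measurable_pi_apply k).comp (measurable_pi_apply b)
  · exact measurable_const

/-- known open sites -/
noncomputable def opk (S : I → Finset (Vert d)) (R : ℕ) (h : ℝ) (T : Finset I) (X : I → Vert d → ℝ) : Finset (Vert d) :=
  (box 0 R).filter fun x => (∀ i, x ∈ S i → i ∈ T) ∧ h ≤ fldS S X x

/-- active sites -/
def actv (r : ℕ) (G : Set (Vert d)) (x : Vert d) : Prop :=
  linfDist 0 x = r ∨ ∃ y z, adj y x ∧ linfDist 0 z = r ∧ VConnectedIn G z y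

lemma actv_mono {r : ℕ} {G G' : Set (Vert d)} (h : G ⊆ G') {x : Vert d} (hx : actv r G x) : actv r G' x := by
  rcases hx with hx | ⟨y, z, h1, h2, h3⟩
  · exact Or.inl hx
  · exact Or.inr ⟨y, z, h1, h2, vconn_mono h h3⟩

noncomputable def cand (S : I → Finset (Vert d)) (r : ℕ) (T : Finset I) (G : Finset (Vert d)) : Finset I :=
  Finset.univ.filter fun i => i ∉ T ∧ ∃ x ∈ S i, actv r (G : Set (Vert d)) x

noncomputable def psel (F : Finset I) : Option I := if h : F.Nonempty then some h.choose else none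

lemma psel_some {F : Finset I} {i : I} (h : psel F = some i) : i ∈ F := by
  unfold psel at h
  split_ifs at h with hF
  rw [← Option.some_inj.1 h]
  exact hF.choose_spec

lemma psel_none {F : Finset I} (h : psel F = none) : F = ∅ := by
  unfold psel at h
  split_ifs at h with hF
  exact Finset.not_nonempty_iff_eq_empty.1 hF

/-- the exploration of clusters of the sphere of radius r -/
noncomputable def xnxt (S : I → Finset (Vert d)) (R : ℕ) (h : ℝ) (r : ℕ) (T : Finset I) (X : I → Vert d → ℝ) : Option I :=
  psel (cand S r T (opk S R h T X))

lemma fldS_known {S : I → Finset (Vert d)} {T : Finset I} {X Y : I → Vert d → ℝ} (hXY : ∀ i ∈ T, X i = Y i)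
    {x : Vert d} (hx : ∀ i, x ∈ S i → i ∈ T) : fldS S X x = fldS S Y x := by
  refine Finset.sum_congr rfl fun b _ => ?_
  split_ifs with hb
  · rw [hXY b (hx b hb)]
  · rfl

lemma opk_congr {S : I → Finset (Vert d)} {R : ℕ} {h : ℝ} {T : Finset I} {X Y : I → Vert d → ℝ}
    (hXY : ∀ i ∈ T, X i = Y i) : opk S R h T X = opk S R h T Y := by
  refine Finset.filter_congr fun x _ => ?_
  refine and_congr_right fun hx => ?_
  rw [fldS_known hXY hx]

lemma xrule (S : I → Finset (Vert d)) (R : ℕ) (h : ℝ) (r : ℕ) : Rule (xnxt S R h r) := by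
  refine ⟨fun T X i hi => ?_, fun T X Y hXY => ?_, fun T i => ?_⟩
  · exact (Finset.mem_filter.1 (psel_some hi)).2.1
  · unfold xnxt; rw [opk_congr hXY]
  · have hm : ∀ G : Finset (Vert d), MeasurableSet {X : I → Vert d → ℝ | opk S R h T X = G} := by
      intro G
      have e : {X : I → Vert d → ℝ | opk S R h T X = G} = ⋂ x : Vert d, {X | x ∈ opk S R h T X ↔ x ∈ G} := by
        ext X; simp [Finset.ext_iff]
      rw [e]
      refine MeasurableSet.iInter fun x => ?_
      have h1 : MeasurableSet {X : I → Vert d → ℝ | x ∈ opk S R h T X} := by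
        simp only [opk, Finset.mem_filter]
        refine (MeasurableSet.const _).inter ((MeasurableSet.const _).inter ?_)
        exact measurableSet_le measurable_const ((measurable_pi_apply x).comp (fldS_meas S))
      by_cases hx : x ∈ G
      · simpa [hx] using h1
      · have e2 : {X : I → Vert d → ℝ | x ∈ opk S R h T X ↔ x ∈ G} = {X | x ∈ opk S R h T X}ᶜ := by
          ext X; simp [hx]
        rw [e2]; exact h1.compl
    have e : {X : I → Vert d → ℝ | xnxt S R h r T X = some i} =
        ⋃ G ∈ {G : Finset (Vert d) | psel (cand S r T G) = some i}, {X | opk S R h T X = G} := by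
      ext X; simp [xnxt]
    rw [e]
    exact MeasurableSet.biUnion (Set.to_countable _) fun G _ => hm G

/-- open sites in the box -/
def ops (S : I → Finset (Vert d)) (R : ℕ) (h : ℝ) (X : I → Vert d → ℝ) : Set (Vert d) :=
  {x | x ∈ box 0 R ∧ h ≤ fldS S X x}

lemma opk_sub (S : I → Finset (Vert d)) (R : ℕ) (h : ℝ) (T : Finset I) (X : I → Vert d → ℝ) :
    (opk S R h T X : Set (Vert d)) ⊆ ops S R h X := by
  intro x hx
  have := Finset.mem_filter.1 (Finset.mem_coe.1 hx)
  exact ⟨this.1, this.2.2⟩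

lemma vconn_snoc {S : Set (Vert d)} {x y z : Vert d} (h : VConnectedIn S x y) (ha : adj y z) (hz : z ∈ S) :
    VConnectedIn S x z :=
  vconn_symm (vconn_cons hz (adj_symm ha) (vconn_symm h))

lemma expl_key {S : I → Finset (Vert d)} {R : ℕ} {h : ℝ} {r : ℕ} {T : Finset I} {X Y : I → Vert d → ℝ}
    (hXY : ∀ i ∈ T, Y i = X i) (hN : xnxt S R h r T X = none) {z y : Vert d} (hz : linfDist 0 z = r)
    (hc : VConnectedIn (ops S R h Y) z y) : VConnectedIn (opk S R h T X : Set (Vert d)) z y := by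
  have hemp := psel_none hN
  have hknown : ∀ x, actv r (opk S R h T X : Set (Vert d)) x → x ∈ ops S R h Y → x ∈ opk S R h T X := by
    intro x hx hxo
    have hk : ∀ i, x ∈ S i → i ∈ T := by
      intro i hi
      by_contra hiT
      have : i ∈ cand S r T (opk S R h T X) := Finset.mem_filter.2 ⟨Finset.mem_univ _, hiT, x, hi, hx⟩
      rw [hemp] at this
      simp at this
    refine Finset.mem_filter.2 ⟨hxo.1, hk, ?_⟩
    rw [← fldS_known hXY hk]
    exact hxo.2
  refine vconn_induct (vconn_symm hc) (motive := fun a => VConnectedIn (opk S R h T X : Set (Vert d)) z a) ?_ ?_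
  · exact vconn_refl (hknown z (Or.inl hz) (vconn_mem hc).1)
  · intro a b ha hab _ ih
    exact vconn_snoc ih (adj_symm hab) (hknown a (Or.inr ⟨b, z, adj_symm hab, hz, ih⟩) ha)

lemma arm_ops (hd : 0 < d) {S : I → Finset (Vert d)} {R : ℕ} {h : ℝ} {X : I → Vert d → ℝ} :
    fd h R 0 (fldS S X) = 0 ↔ ∃ y, linfDist 0 y = R ∧ VConnectedIn (ops S R h X) 0 y := by
  rw [fd_eq_zero hd]
  constructor
  · rintro ⟨y, hy, p, hp, h1, h2⟩
    exact ⟨y, hy, p, hp, fun v hv => ⟨mem_box_iff.2 (h2 v hv), h1 v hv⟩⟩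
  · rintro ⟨y, hy, p, hp, h1⟩
    exact ⟨y, hy, p, hp, fun v hv => (h1 v hv).2, fun v hv => mem_box_iff.1 (h1 v hv).1⟩

lemma cross (G : Set (Vert d)) {y : Vert d} {r : ℕ} (hy : r ≤ linfDist 0 y) (hc : VConnectedIn G 0 y) :
    ∃ z, linfDist 0 z = r ∧ VConnectedIn G z 0 ∧ VConnectedIn G z y := by
  obtain ⟨p, hp, hG⟩ := hc
  obtain ⟨p1, p2, z, e, h1, h2, -⟩ := exit_pre (c := 0) (R := r) hp (by simp [linf_self]) ⟨y, isPath_end_mem hp, hy⟩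
  have h3 : VConnectedIn G z 0 := vconn_symm ⟨p1, h1, fun v hv => hG v (by rw [e]; simp [hv])⟩
  exact ⟨z, h2, h3, vconn_trans h3 ⟨p, hp, hG⟩⟩

lemma expl_det (hd : 0 < d) {S : I → Finset (Vert d)} {R : ℕ} {h : ℝ} {r : ℕ} (hr : r ≤ R) (X Y : I → Vert d → ℝ)
    (hXY : ∀ i ∈ vis (xnxt S R h r) (Fintype.card I) ∅ X, Y i = X i) :
    fd h R 0 (fldS S Y) = 0 ↔ fd h R 0 (fldS S X) = 0 := by
  have hN := vis_final (xrule S R h r) (Fintype.card I) ∅ X (by simp)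
  rw [Finset.empty_union] at hN
  set T := vis (xnxt S R h r) (Fintype.card I) ∅ X
  rw [arm_ops hd, arm_ops hd]
  constructor
  · rintro ⟨y, hy, hc⟩
    obtain ⟨z, hz, h1, h2⟩ := cross _ (hr.trans hy.ge) hc
    refine ⟨y, hy, ?_⟩
    have h3 := vconn_mono (opk_sub S R h T X) (expl_key hXY hN hz h1)
    have h4 := vconn_mono (opk_sub S R h T X) (expl_key hXY hN hz h2)
    exact vconn_trans (vconn_symm h3) h4
  · rintro ⟨y, hy, hc⟩
    obtain ⟨z, hz, h1, h2⟩ := cross _ (hr.trans hy.ge) hc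
    refine ⟨y, hy, ?_⟩
    have e : opk S R h T X = opk S R h T Y := opk_congr fun i hi => (hXY i hi).symm
    have h3 := expl_key (fun i _ => rfl) hN hz h1
    have h4 := expl_key (fun i _ => rfl) hN hz h2
    rw [e] at h3 h4
    exact vconn_trans (vconn_symm (vconn_mono (opk_sub S R h T Y) h3)) (vconn_mono (opk_sub S R h T Y) h4)

lemma expl_reveal {S : I → Finset (Vert d)} {R : ℕ} {h : ℝ} {r : ℕ} {n : ℕ} {X : I → Vert d → ℝ} {i : I}
    (hi : i ∈ vis (xnxt S R h r) n ∅ X) : ∃ x ∈ S i, actv r (ops S R h X) x := by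
  obtain ⟨T, hT⟩ := vis_reveal n ∅ X i hi
  obtain ⟨-, -, x, hx, ha⟩ := Finset.mem_filter.1 (psel_some hT)
  exact ⟨x, hx, actv_mono (opk_sub S R h T X) ha⟩

/-- absolute difference in ℕ -/
def nd (a b : ℕ) : ℕ := (a - b) + (b - a)

lemma actv_arm (hd : 0 < d) {R : ℕ} {h : ℝ} {r : ℕ} {ω : Vert d → ℝ} {x : Vert d}
    (hx : actv r {x | x ∈ box 0 R ∧ h ≤ ω x} x) :
    linfDist 0 x = r ∨ ∃ y ∈ nbrs x, y ∈ box 0 R ∧ fd h (nd r (linfDist 0 y)) y ω = 0 := by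
  rcases hx with hx | ⟨y, z, h1, h2, h3⟩
  · exact Or.inl hx
  · right
    refine ⟨y, adj_iff_nbrs.1 (adj_symm h1), (vconn_mem h3).2.1, ?_⟩
    obtain ⟨p, hp, hG⟩ := vconn_symm h3
    have hdist : nd r (linfDist 0 y) ≤ linfDist y z := by
      have := linf_triangle 0 y z
      have := linf_triangle 0 z y
      have := linf_symm y z
      unfold nd; omega
    obtain ⟨p1, p2, w, e, g1, g2, g3⟩ := exit_pre (c := y) hp (by simp [linf_self]) ⟨z, isPath_end_mem hp, hdist⟩
    exact (fd_eq_zero hd).2 ⟨w, g2, p1, g1, fun v hv => (hG v (by rw [e]; simp [hv])).2, g3⟩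

end Algo
end

section
section Algo2
variable {d : ℕ} {μ : Measure (Vert d → ℝ)} {I : Type} [Fintype I] {ν : I → Measure (Vert d → ℝ)}
  {C : I → Vert d → Vert d → ℝ} {S : I → Finset (Vert d)}

lemma fldS_ae (hν : ∀ i, GaussLaw (ν i) (C i)) (hS : ∀ i x, x ∉ S i → C i x x = 0) :
    ∀ᵐ X ∂Measure.pi ν, fldS S X = fld X := by
  have := fun i => (hν i).prob
  have h1 : ∀ᵐ X ∂Measure.pi ν, ∀ i, ∀ x, x ∉ S i → X i x = 0 := by
    rw [ae_all_iff]
    intro i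
    exact (Measure.quasiMeasurePreserving_eval ν i).ae (zero_off hν i (hS i))
  filter_upwards [h1] with X hX
  funext x
  refine Finset.sum_congr rfl fun b _ => ?_
  split_ifs with hb
  · rfl
  · rw [hX b x hb]

lemma infl_congr [∀ i, IsProbabilityMeasure (ν i)] {A A' : Set (I → Vert d → ℝ)}
    (h : ∀ᵐ X ∂Measure.pi ν, (X ∈ A ↔ X ∈ A')) (i : I) : infl ν A i = infl ν A' i := by
  have hm : Measurable (fun p : (Vert d → ℝ) × (I → Vert d → ℝ) => Function.update p.2 i p.1) :=
    measurable_update'.comp (measurable_snd.prodMk measurable_fst)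
  have h1 : ∀ᵐ p ∂(ν i).prod (Measure.pi ν), (Function.update p.2 i p.1 ∈ A ↔ Function.update p.2 i p.1 ∈ A') := by
    have h2 := h
    rw [← pi_update ν i] at h2
    exact ae_of_ae_map hm.aemeasurable h2
  have h3 := Measure.ae_ae_of_ae_prod h1
  refine lintegral_congr_ae ?_
  filter_upwards [h3] with a ha
  refine measure_congr ?_
  filter_upwards [ha, h] with Y h4 h5
  exact propext (by
    change (¬ (_ ↔ _)) ↔ (¬ (_ ↔ _))
    rw [h4, h5])

lemma fldS_law (hμ : GaussLaw μ (gr (d := d))) (hν : ∀ i, GaussLaw (ν i) (C i)) (hS : ∀ i x, x ∉ S i → C i x x = 0) {R : ℕ}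
    (hC : ∀ x ∈ box 0 R, ∀ y ∈ box 0 R, ∑ i, C i x y = gr x y) {A : Set (Vert d → ℝ)}
    (hA : MeasurableSet A) (hloc : LocalOn R A) : Measure.pi ν {X | fldS S X ∈ A} = μ A := by
  rw [← fld_law hμ hν hC hA hloc]
  refine measure_congr ?_
  filter_upwards [fldS_ae hν hS] with X hX
  exact propext (by change fldS S X ∈ A ↔ fld X ∈ A; rw [hX])

/-- close everything outside the box -/
noncomputable def trn (R : ℕ) (h : ℝ) (ω : Vert d → ℝ) : Vert d → ℝ := fun x => if x ∈ box 0 R then ω x else h - 1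

lemma trn_meas (R : ℕ) (h : ℝ) : Measurable (trn (d := d) R h) := by
  refine measurable_pi_lambda _ fun x => ?_
  unfold trn
  split_ifs
  · exact measurable_pi_apply x
  · exact measurable_const

lemma trn_fd (hd : 0 < d) {R : ℕ} {h : ℝ} {k : ℕ} {y : Vert d} {ω : Vert d → ℝ} (h0 : fd h k y (trn R h ω) = 0) :
    fd h k y ω = 0 := by
  obtain ⟨z, hz, p, hp, h1, h2⟩ := (fd_eq_zero hd).1 h0
  refine (fd_eq_zero hd).2 ⟨z, hz, p, hp, fun v hv => ?_, h2⟩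
  have := h1 v hv
  unfold trn at this
  split_ifs at this
  · exact this
  · linarith

lemma th_at (hd : 0 < d) (hμ : GaussLaw μ (gr (d := d))) (h : ℝ) (k : ℕ) (y : Vert d) :
    μ.real {ω | fd h k y ω = 0} = th μ h k := by
  have := shift_event hμ y (arm_meas hd h k 0)
  unfold th Measure.real
  rw [← this]
  congr 2
  ext ω
  have := fd_shift hd h k 0 y ω
  rw [zero_add] at this
  simp [this]

/-- probability of revealing block i in the exploration from radius r -/
noncomputable def prv (ν : I → Measure (Vert d → ℝ)) (S : I → Finset (Vert d)) (R : ℕ) (h : ℝ) (r : ℕ) (i : I) : ℝ :=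
  (Measure.pi ν).real {X | i ∈ vis (xnxt S R h r) (Fintype.card I) ∅ X}

lemma prv_bound (hd : 0 < d) (hμ : GaussLaw μ (gr (d := d))) (hν : ∀ i, GaussLaw (ν i) (C i))
    (hS : ∀ i x, x ∉ S i → C i x x = 0) {R : ℕ}
    (hC : ∀ x ∈ box 0 R, ∀ y ∈ box 0 R, ∑ i, C i x y = gr x y) (h : ℝ) (r : ℕ) (i : I) :
    prv ν S R h r i ≤ ∑ x ∈ S i, ((if linfDist 0 x = r then 1 else 0) +
      ∑ y ∈ (nbrs x).filter (· ∈ box 0 R), th μ h (nd r (linfDist 0 y))) := by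
  have := fun i => (hν i).prob
  have := hμ.prob
  have hev : ∀ y : Vert d, ∀ k, (Measure.pi ν).real {X | fd h k y (trn R h (fldS S X)) = 0} ≤ th μ h k := by
    intro y k
    have h1 := fldS_law hμ hν hS hC (A := {ω | fd h k y (trn R h ω) = 0}) ((trn_meas R h) (arm_meas hd h k y))
      (fun ω ω' hω => by
        have : trn R h ω = trn R h ω' := by
          funext x; unfold trn; split_ifs with hx
          · exact hω x hx
          · rfl
        simp [this])
    have h2 : (Measure.pi ν).real {X | fd h k y (trn R h (fldS S X)) = 0} = μ.real {ω | fd h k y (trn R h ω) = 0} := by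
      unfold Measure.real; rw [← h1]; rfl
    rw [h2, ← th_at hd hμ h k y]
    exact measureReal_mono fun ω hω => trn_fd hd hω
  have hsub : {X | i ∈ vis (xnxt S R h r) (Fintype.card I) ∅ X} ⊆ ⋃ x ∈ S i, ({_X : I → Vert d → ℝ | linfDist 0 x = r} ∪
      ⋃ y ∈ (nbrs x).filter (· ∈ box 0 R), {X | fd h (nd r (linfDist 0 y)) y (trn R h (fldS S X)) = 0}) := by
    intro X hX
    obtain ⟨x, hx, ha⟩ := expl_reveal hX
    have e : ops S R h X = {x | x ∈ box 0 R ∧ h ≤ trn R h (fldS S X) x} := by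
      ext v
      unfold ops trn
      simp only [Set.mem_setOf_eq]
      exact and_congr_right fun hv => by rw [if_pos hv]
    rw [e] at ha
    simp only [Set.mem_iUnion, Set.mem_union, Set.mem_setOf_eq, Finset.mem_filter, exists_prop]
    refine ⟨x, hx, ?_⟩
    rcases actv_arm hd ha with h1 | ⟨y, h1, h2, h3⟩
    · exact Or.inl h1
    · exact Or.inr ⟨y, ⟨h1, h2⟩, h3⟩
  unfold prv
  refine (measureReal_mono hsub (measure_ne_top _ _)).trans ((measureReal_biUnion_finset_le _ _).trans (Finset.sum_le_sum fun x _ => ?_))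
  refine (measureReal_union_le _ _).trans (add_le_add ?_ ?_)
  · split_ifs with hx
    · exact measureReal_le_one
    · simp [hx]
  · exact (measureReal_biUnion_finset_le _ _).trans (Finset.sum_le_sum fun y _ => hev y _)

/-- partial sums of the one-arm probabilities -/
noncomputable def Sg (μ : Measure (Vert d → ℝ)) (h : ℝ) (R : ℕ) : ℝ := ∑ k ∈ Finset.range (R + 1), th μ h k

lemma Sg_ge (h : ℝ) (R : ℕ) : th μ h 0 ≤ Sg μ h R :=
  Finset.single_le_sum (f := fun k => th μ h k) (fun k _ => th_nonneg h k) (by simp)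

lemma Sg_nonneg (h : ℝ) (R : ℕ) : 0 ≤ Sg μ h R := Finset.sum_nonneg fun k _ => th_nonneg h k

lemma nd_sum {h : ℝ} {R m : ℕ} (hm : m ≤ R) : ∑ r ∈ Finset.Icc 1 R, th μ h (nd r m) ≤ 2 * Sg μ h R := by
  rw [← Finset.sum_filter_add_sum_filter_not _ (fun r => r ≤ m), two_mul]
  refine add_le_add ?_ ?_
  · rw [← Finset.sum_image (s := (Finset.Icc 1 R).filter (fun r => r ≤ m)) (g := fun r => nd r m) (f := fun k => th μ h k)]
    · refine Finset.sum_le_sum_of_subset_of_nonneg (fun k hk => ?_) fun k _ _ => th_nonneg h k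
      obtain ⟨r, hr, rfl⟩ := Finset.mem_image.1 hk
      simp only [Finset.mem_filter, Finset.mem_Icc] at hr
      simp only [Finset.mem_range, nd]; omega
    · intro a ha b hb hab
      simp only [Finset.coe_filter, Finset.mem_Icc, Set.mem_setOf_eq] at ha hb
      simp only [nd] at hab; omega
  · rw [← Finset.sum_image (s := (Finset.Icc 1 R).filter (fun r => ¬ r ≤ m)) (g := fun r => nd r m) (f := fun k => th μ h k)]
    · refine Finset.sum_le_sum_of_subset_of_nonneg (fun k hk => ?_) fun k _ _ => th_nonneg h k
      obtain ⟨r, hr, rfl⟩ := Finset.mem_image.1 hk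
      simp only [Finset.mem_filter, Finset.mem_Icc] at hr
      simp only [Finset.mem_range, nd]; omega
    · intro a ha b hb hab
      simp only [Finset.coe_filter, Finset.mem_Icc, Set.mem_setOf_eq] at ha hb
      simp only [nd] at hab; omega

lemma nbrs_card (x : Vert d) : ((nbrs x).card : ℝ) ≤ 2 * d := by
  have : (nbrs x).card ≤ 2 * d := by
    rw [nbrs_eq]
    refine Finset.card_image_le.trans ?_
    simp [mul_comm]
  exact_mod_cast this

lemma prv_sum (hd : 0 < d) (hμ : GaussLaw μ (gr (d := d))) (hν : ∀ i, GaussLaw (ν i) (C i))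
    (hS : ∀ i x, x ∉ S i → C i x x = 0) {R : ℕ}
    (hC : ∀ x ∈ box 0 R, ∀ y ∈ box 0 R, ∑ i, C i x y = gr x y) {h : ℝ} (h0 : 0 < th μ h 0) (i : I) :
    ∑ r ∈ Finset.Icc 1 R, prv ν S R h r i ≤ (S i).card * ((4 * d + 1) / th μ h 0 * Sg μ h R) := by
  have := hμ.prob
  refine (Finset.sum_le_sum fun r _ => prv_bound hd hμ hν hS hC h r i).trans ?_
  rw [Finset.sum_comm, ← nsmul_eq_mul]
  refine Finset.sum_le_card_nsmul _ _ _ fun x _ => ?_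
  rw [Finset.sum_add_distrib]
  have hS0 := Sg_ge (μ := μ) h R
  have e1 : 1 ≤ 1 / th μ h 0 * Sg μ h R := by
    rw [one_div, ← div_eq_inv_mul, le_div_iff₀ h0]; linarith
  have hle : 1 ≤ 1 / th μ h 0 := by
    rw [le_div_iff₀ h0]; linarith [th_le_one (μ := μ) h 0]
  have e2 : ∑ r ∈ Finset.Icc 1 R, (if linfDist 0 x = r then (1:ℝ) else 0) ≤ 1 := by
    rw [Finset.sum_ite_eq]
    split_ifs <;> norm_num
  have e3 : ∑ r ∈ Finset.Icc 1 R, ∑ y ∈ (nbrs x).filter (· ∈ box 0 R), th μ h (nd r (linfDist 0 y)) ≤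
      2 * d * (2 * Sg μ h R) := by
    rw [Finset.sum_comm]
    refine (Finset.sum_le_card_nsmul _ _ (2 * Sg μ h R) fun y hy => ?_).trans ?_
    · have := mem_box_iff.1 (Finset.mem_filter.1 hy).2
      exact nd_sum this
    · rw [nsmul_eq_mul]
      refine mul_le_mul_of_nonneg_right ?_ (by linarith [Sg_nonneg (μ := μ) h R])
      exact le_trans (by exact_mod_cast Finset.card_filter_le _ _) (nbrs_card x)
  have e4 : 2 * d * (2 * Sg μ h R) ≤ 4 * d * (1 / th μ h 0 * Sg μ h R) := by
    have : Sg μ h R ≤ 1 / th μ h 0 * Sg μ h R := le_mul_of_one_le_left (Sg_nonneg h R) hle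
    have h4 : (0:ℝ) ≤ 4 * d := by positivity
    linarith [mul_le_mul_of_nonneg_left this h4]
  have e5 : (4 * d + 1) / th μ h 0 * Sg μ h R = 4 * d * (1 / th μ h 0 * Sg μ h R) + 1 / th μ h 0 * Sg μ h R := by ring
  rw [e5]
  linarith

end Algo2
end

section
section Algo3
variable {d : ℕ} {μ : Measure (Vert d → ℝ)}

/-- the exponent -/
noncomputable def kap (d : ℕ) : ℝ := 1 / (8 * d)

lemma kap_pos (hd : 0 < d) : 0 < kap d := by unfold kap; positivity

lemma kap_le (hd : 0 < d) : kap d ≤ 1 / 8 := by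
  have : (1:ℝ) ≤ d := by exact_mod_cast hd
  unfold kap
  exact one_div_le_one_div_of_le (by norm_num) (by linarith)

/-- weights of scales -/
noncomputable def gs (j : ℕ) : ℝ := (j + 1) * (2 ^ (-(1/8:ℝ))) ^ j

lemma gs_nonneg (j : ℕ) : 0 ≤ gs j := by unfold gs; positivity

lemma gs_summable : Summable gs := by
  have hq : ‖(2:ℝ) ^ (-(1/8:ℝ))‖ < 1 := by
    rw [Real.norm_of_nonneg (by positivity)]
    exact Real.rpow_lt_one_of_one_lt_of_neg (by norm_num) (by norm_num)
  have h1 := summable_pow_mul_geometric_of_norm_lt_one 1 hq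
  have h2 := summable_geometric_of_norm_lt_one hq
  refine (h1.add h2).congr fun j => ?_
  unfold gs; ring

lemma rpow_min {t k : ℝ} (hk : 0 < k) (hk1 : k ≤ 1) (ht : 0 ≤ t) {a : ℝ} (h1 : a ≤ 1) (h2 : a ≤ t) : a ≤ t ^ k := by
  rcases le_total 1 t with h | h
  · exact h1.trans (Real.one_le_rpow h hk.le)
  · refine h2.trans ?_
    rcases ht.eq_or_lt with rfl | ht
    · rw [Real.zero_rpow hk.ne']
    · conv_lhs => rw [← Real.rpow_one t]
      exact Real.rpow_le_rpow_of_exponent_ge ht h hk1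

lemma blk_term (hd : 0 < d) {n j : ℕ} (hn0 : 0 < n) (hn : (n:ℝ) ≤ 7 ^ d * 2 ^ (j * d)) {e : ℝ} (he : 0 ≤ e) {Kσ : ℝ} (hK : 0 < Kσ) :
    ((n:ℝ) * e) ^ kap d * (Real.sqrt (Kσ * 2 ^ (-((j:ℝ)/2))) * (Real.log (2 * n) + 1 / 2)) ≤
      e ^ kap d * (28 * d * Real.sqrt Kσ) * gs j := by
  have hk := kap_pos hd
  have hd1 : (1:ℝ) ≤ d := by exact_mod_cast hd
  have hn0' : (0:ℝ) < n := by exact_mod_cast hn0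
  have e1 : (n:ℝ) ^ kap d ≤ 7 * 2 ^ ((j:ℝ) / 8) := by
    have h1 : (7:ℝ) ^ d * 2 ^ (j * d) = (7 * 2 ^ j) ^ (d:ℝ) := by
      rw [Real.rpow_natCast, mul_pow, pow_mul]
    calc (n:ℝ) ^ kap d ≤ ((7 * 2 ^ j) ^ (d:ℝ)) ^ kap d := by
          rw [← h1]; exact Real.rpow_le_rpow hn0'.le hn hk.le
      _ = (7 * 2 ^ j) ^ (1/8:ℝ) := by
          rw [← Real.rpow_mul (by positivity)]; congr 1; unfold kap; field_simp
      _ = 7 ^ (1/8:ℝ) * 2 ^ ((j:ℝ)/8) := by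
          rw [Real.mul_rpow (by norm_num) (by positivity), ← Real.rpow_natCast 2 j, ← Real.rpow_mul (by norm_num)]
          congr 2; ring
      _ ≤ 7 * 2 ^ ((j:ℝ)/8) := by
          refine mul_le_mul_of_nonneg_right ?_ (by positivity)
          conv_rhs => rw [← Real.rpow_one (7:ℝ)]
          exact Real.rpow_le_rpow_of_exponent_le (by norm_num) (by norm_num)
  have e2 : Real.sqrt (Kσ * 2 ^ (-((j:ℝ)/2))) = Real.sqrt Kσ * 2 ^ (-((j:ℝ)/4)) := by
    rw [Real.sqrt_mul hK.le]
    congr 1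
    rw [Real.sqrt_eq_rpow, ← Real.rpow_mul (by norm_num)]
    congr 1; ring
  have e3 : Real.log (2 * n) + 1 / 2 ≤ 4 * d * (j + 1) := by
    have h2 : Real.log (2 * n) ≤ Real.log (2 * (7 ^ d * 2 ^ (j * d))) :=
      Real.log_le_log (by positivity) (by linarith)
    rw [Real.log_mul (x := 2) (y := 7 ^ d * 2 ^ (j * d)) (by norm_num) (by positivity),
      Real.log_mul (x := 7 ^ d) (by positivity) (by positivity), Real.log_pow, Real.log_pow] at h2
    have h7 : Real.log 7 ≤ 2 := by
      have : Real.log 7 ≤ Real.log 8 := Real.log_le_log (by norm_num) (by norm_num)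
      rw [show (8:ℝ) = 2 ^ 3 by norm_num, Real.log_pow] at this
      have := Real.log_two_lt_d9
      push_cast at *
      have h77 : Real.log 7 ≤ Real.log (Real.exp 1 ^ 2) := by
        refine Real.log_le_log (by norm_num) ?_
        have := Real.exp_one_gt_d9
        nlinarith
      rw [Real.log_pow, Real.log_exp] at h77
      norm_num at h77
      exact h77
    have hl2 : Real.log 2 ≤ 1 := by linarith [Real.log_two_lt_d9]
    have h3 : (d:ℝ) * Real.log 7 ≤ d * 2 := mul_le_mul_of_nonneg_left h7 (by positivity)
    have h4 : ((j * d : ℕ):ℝ) * Real.log 2 ≤ (j * d : ℕ) * 1 := mul_le_mul_of_nonneg_left hl2 (by positivity)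
    push_cast at h4 h2
    have h5 : (0:ℝ) ≤ j * d := by positivity
    linarith
  have e4 : (0:ℝ) ≤ Real.log (2 * n) + 1 / 2 := by
    have : (0:ℝ) ≤ Real.log (2 * n) := Real.log_nonneg (by have : (1:ℝ) ≤ n := by exact_mod_cast hn0
                                                           linarith)
    linarith
  rw [Real.mul_rpow hn0'.le he, e2]
  have hz : (2:ℝ) ^ ((j:ℝ)/8) * 2 ^ (-((j:ℝ)/4)) = (2 ^ (-(1/8:ℝ))) ^ j := by
    rw [← Real.rpow_add (by norm_num), ← Real.rpow_natCast, ← Real.rpow_mul (by norm_num)]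
    congr 1; ring
  have hE : 0 ≤ e ^ kap d := by positivity
  calc (n:ℝ) ^ kap d * e ^ kap d * (Real.sqrt Kσ * 2 ^ (-((j:ℝ)/4)) * (Real.log (2 * n) + 1 / 2))
      ≤ (7 * 2 ^ ((j:ℝ)/8)) * e ^ kap d * (Real.sqrt Kσ * 2 ^ (-((j:ℝ)/4)) * (4 * d * (j + 1))) := by
        refine mul_le_mul (mul_le_mul_of_nonneg_right e1 hE) (mul_le_mul_of_nonneg_left e3 (by positivity))
          (mul_nonneg (by positivity) e4) (by positivity)
    _ = e ^ kap d * (28 * d * Real.sqrt Kσ) * ((j + 1) * (2 ^ ((j:ℝ)/8) * 2 ^ (-((j:ℝ)/4)))) := by ring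
    _ = _ := by rw [hz]; rfl

/-- arm event -/
def arm (h : ℝ) (R : ℕ) : Set (Vert d → ℝ) := {ω | fd h R 0 ω = 0}

lemma arm_up (hd : 0 < d) (h : ℝ) (R : ℕ) : IsUpperSet (arm (d := d) h R) := by
  intro ω ω' hle (hω : fd h R 0 ω = 0)
  have := fd_anti hd (h := h) (R := R) (x := 0) (ω := ω) (ω' := ω') fun v _ => hle v
  exact Nat.le_zero.1 (this.trans hω.le)

lemma arm_local (h : ℝ) (R : ℕ) : LocalOn R (arm (d := d) h R) := fun ω ω' e => by
  unfold arm
  simp only [Set.mem_setOf_eq]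
  rw [fd_congr e]

/-- total derivative -/
noncomputable def DT (μ : Measure (Vert d → ℝ)) (h : ℝ) (R : ℕ) : ℝ := ∑ z ∈ box 0 R, DD μ (arm h R) z

lemma DT_nonneg (hd : 3 ≤ d) (hμ : GaussLaw μ (gr (d := d))) (h : ℝ) (R : ℕ) : 0 ≤ DT μ h R :=
  Finset.sum_nonneg fun z _ => DD_nonneg hd hμ (arm_meas (by omega) h R 0) (arm_up (by omega) h R) z

lemma th_deriv (hd : 3 ≤ d) (hμ : GaussLaw μ (gr (d := d))) (h : ℝ) (R : ℕ) :
    HasDerivAt (fun s => th μ s R) (-DT μ h R) h := by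
  have h1 := gff_deriv' hd hμ (box 0 R) (arm_meas (by omega) h R 0)
  have e : (fun t : ℝ => μ.real {ω | ω + t • rst (box 0 R) 1 ∈ {ω : Vert d → ℝ | fd h R 0 ω = 0}}) = fun t => th μ (h - t) R := by
    funext t
    unfold th
    congr 1
    ext ω
    simp only [Set.mem_setOf_eq]
    rw [← fd_shift_level h t, fd_congr (ω' := fun v => ω v + t)]
    intro v hv
    simp [rst, hv]
  rw [e] at h1
  have h2 : HasDerivAt (fun s : ℝ => h - s) (-1) h := by simpa using (hasDerivAt_id h).const_sub h
  have h3 : HasDerivAt (fun t : ℝ => th μ (h - t) R) (∑ z ∈ box 0 R, DD μ {ω | fd h R 0 ω = 0} z) (h - h) := by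
    rw [sub_self]; exact h1
  have h4 := HasDerivAt.comp (h := fun s : ℝ => h - s) (h₂ := fun t : ℝ => th μ (h - t) R) h h3 h2
  have e2 : ((fun t : ℝ => th μ (h - t) R) ∘ fun s => h - s) = fun s => th μ s R := by
    funext s; simp
  rw [e2] at h4
  have e3 : (∑ z ∈ box 0 R, DD μ {ω | fd h R 0 ω = 0} z) * -1 = -DT μ h R := by unfold DT arm; ring
  rwa [e3] at h4

theorem sharp_ineq (hd : 3 ≤ d) (hμ : GaussLaw μ (gr (d := d))) : ∃ c : ℝ, 0 < c ∧ ∀ h : ℝ, ∀ R : ℕ, 1 ≤ R →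
    c * th μ h 0 * (th μ h R * (1 - th μ h R)) ≤ (Sg μ h R / R) ^ kap d * DT μ h R := by
  have hd0 : 0 < d := by omega
  have hd1 : (1:ℝ) ≤ d := by exact_mod_cast hd0
  have := hμ.prob
  have hk := kap_pos hd0
  have hk8 := kap_le hd0
  set Kσ : ℝ := 4 * KH d + 2 with hKσ
  have hK : 0 < Kσ := by have := KH_pos hd; positivity
  set G : ℝ := ∑' j, gs j with hG
  have hG1 : 1 ≤ G := by
    have : gs 0 ≤ G := gs_summable.le_tsum 0 fun j _ => gs_nonneg j
    simpa [gs] using this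
  set B : ℝ := (4 * d + 1) * (Real.pi * (28 * d * Real.sqrt Kσ)) * (7 ^ d * G) with hB
  have hBpos : 0 < B := by positivity
  refine ⟨2 / B, by positivity, fun h R hR => ?_⟩
  have hR0 : (0:ℝ) < R := by exact_mod_cast hR
  set η := Sg μ h R / R with hη
  have hη0 : 0 ≤ η := div_nonneg (Sg_nonneg h R) hR0.le
  have hDT := DT_nonneg hd hμ h R
  rcases (th_nonneg (μ := μ) h 0).eq_or_lt with h0 | h0
  · rw [← h0]; simp only [mul_zero, zero_mul]; positivity
  obtain ⟨I, _, lab, ν, C, S, hν, hS, hSb, hCd, hcard, hover, hC⟩ := blocks hd hμ hR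
  have := fun i => (hν i).prob
  have hAm : MeasurableSet (arm (d := d) h R) := arm_meas hd0 h R (0 : Vert d)
  have hDD := fun z => DD_nonneg hd hμ hAm (arm_up hd0 h R) z
  set e := (4 * d + 1) / th μ h 0 * η with he
  have he0 : 0 ≤ e := by positivity
  set b : I → ℝ := fun i => Real.pi * (∫ z, supM (S i) z ∂ν i) * ∑ z ∈ S i, DD μ (arm h R) z with hb
  have hb0 : ∀ i, 0 ≤ b i := fun i => mul_nonneg (mul_nonneg Real.pi_pos.le (integral_nonneg fun z => supM_nonneg _ _))
    (Finset.sum_nonneg fun z _ => hDD z)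
  have hp0 : ∀ r i, 0 ≤ prv ν S R h r i := fun r i => measureReal_nonneg
  -- osss
  have hos : ∀ r ∈ Finset.Icc 1 R, 2 * (th μ h R * (1 - th μ h R)) ≤ ∑ i, prv ν S R h r i * b i := by
    intro r hr
    have hA' : MeasurableSet {X : I → Vert d → ℝ | fldS S X ∈ arm h R} := (fldS_meas S) hAm
    have h1 := osss (ν := ν) (xrule S R h r) hA' (Fintype.card I) fun X Y hXY =>
      expl_det hd0 (Finset.mem_Icc.1 hr).2 X Y hXY
    have h2 : Measure.pi ν {X | fldS S X ∈ arm h R} = ENNReal.ofReal (th μ h R) := by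
      rw [fldS_law hμ hν hS hC hAm (arm_local h R)]
      exact (ofReal_measureReal).symm
    have h3 : Measure.pi ν {X | fldS S X ∈ arm h R}ᶜ = ENNReal.ofReal (1 - th μ h R) := by
      rw [prob_compl_eq_one_sub hA', h2, ENNReal.ofReal_sub _ (th_nonneg h R), ENNReal.ofReal_one]
    rw [h2, h3] at h1
    have h4 : ∀ i, Measure.pi ν {X | i ∈ vis (xnxt S R h r) (Fintype.card I) ∅ X} * infl ν {X | fldS S X ∈ arm h R} i ≤
        ENNReal.ofReal (prv ν S R h r i * b i) := by
      intro i
      rw [ENNReal.ofReal_mul (hp0 r i)]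
      refine mul_le_mul' (ofReal_measureReal).ge ?_
      rw [infl_congr (A' := {X | fld X ∈ arm h R}) ?_ i]
      · exact infl_bound hd hμ hν hC hAm (arm_up hd0 h R) (arm_local h R) i (hS i)
      · filter_upwards [fldS_ae hν hS] with X hX
        simp [hX]
    have h5 := h1.trans (Finset.sum_le_sum fun i _ => h4 i)
    rw [← ENNReal.ofReal_sum_of_nonneg (fun i _ => mul_nonneg (hp0 r i) (hb0 i))] at h5
    have e2 : (2:ℝ≥0∞) = ENNReal.ofReal 2 := by simp
    rw [e2, ← ENNReal.ofReal_mul (by norm_num), ← ENNReal.ofReal_mul (by have := th_nonneg (μ := μ) h R; positivity)] at h5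
    have h6 := (ENNReal.ofReal_le_ofReal_iff (Finset.sum_nonneg fun i _ => mul_nonneg (hp0 r i) (hb0 i))).1 h5
    rw [mul_assoc] at h6
    exact h6
  -- average
  have hav : 2 * (th μ h R * (1 - th μ h R)) * R ≤ ∑ i, (∑ r ∈ Finset.Icc 1 R, prv ν S R h r i) * b i := by
    have h1 := Finset.sum_le_sum hos
    rw [Finset.sum_const, Nat.card_Icc, Nat.add_sub_cancel, nsmul_eq_mul, Finset.sum_comm] at h1
    rw [mul_comm]
    refine h1.trans (le_of_eq ?_)
    exact Finset.sum_congr rfl fun i _ => (Finset.sum_mul _ _ _).symm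
  have hterm : ∀ i, (∑ r ∈ Finset.Icc 1 R, prv ν S R h r i) * b i ≤
      R * (e ^ kap d * (Real.pi * (28 * d * Real.sqrt Kσ))) * (gs (lab i) * ∑ z ∈ S i, DD μ (arm h R) z) := by
    intro i
    have hDi : 0 ≤ ∑ z ∈ S i, DD μ (arm h R) z := Finset.sum_nonneg fun z _ => hDD z
    rcases (S i).eq_empty_or_nonempty with hemp | hne
    · simp [hb, hemp]
    have hq1 : ∑ r ∈ Finset.Icc 1 R, prv ν S R h r i ≤ R * ((S i).card * e) ^ kap d := by
      have p1 : (∑ r ∈ Finset.Icc 1 R, prv ν S R h r i) / R ≤ 1 := by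
        rw [div_le_one hR0]
        refine (Finset.sum_le_card_nsmul _ _ 1 fun r _ => measureReal_le_one).trans (by simp)
      have p2 : (∑ r ∈ Finset.Icc 1 R, prv ν S R h r i) / R ≤ (S i).card * e := by
        rw [div_le_iff₀ hR0]
        refine (prv_sum hd0 hμ hν hS hC h0 i).trans (le_of_eq ?_)
        rw [he, hη]; field_simp
      have p3 := rpow_min hk (by linarith) (by positivity) p1 p2
      rw [div_le_iff₀ hR0] at p3
      linarith
    have hE := supM_exp (hν i) (S i) hne (σ := Real.sqrt (Kσ * 2 ^ (-((lab i:ℝ)/2)))) (by positivity)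
      (fun x => by rw [Real.sq_sqrt (by positivity)]; exact hCd i x)
    have hbt := blk_term hd0 hne.card_pos (hcard i) he0 hK
    have hc0 : (0:ℝ) ≤ ((S i).card * e) ^ kap d := by positivity
    calc (∑ r ∈ Finset.Icc 1 R, prv ν S R h r i) * b i
        ≤ (R * ((S i).card * e) ^ kap d) * b i := mul_le_mul_of_nonneg_right hq1 (hb0 i)
      _ = R * Real.pi * (∑ z ∈ S i, DD μ (arm h R) z) * (((S i).card * e) ^ kap d * ∫ z, supM (S i) z ∂ν i) := by
          rw [hb]; ring
      _ ≤ R * Real.pi * (∑ z ∈ S i, DD μ (arm h R) z) * (e ^ kap d * (28 * d * Real.sqrt Kσ) * gs (lab i)) := by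
          refine mul_le_mul_of_nonneg_left ?_ (by positivity)
          exact (mul_le_mul_of_nonneg_left hE hc0).trans hbt
      _ = _ := by ring
  have hsum : ∑ i, gs (lab i) * ∑ z ∈ S i, DD μ (arm h R) z ≤ 7 ^ d * G * DT μ h R := by
    have h1 : ∀ i, gs (lab i) * ∑ z ∈ S i, DD μ (arm h R) z = ∑ z ∈ box 0 R, if z ∈ S i then gs (lab i) * DD μ (arm h R) z else 0 := by
      intro i
      rw [Finset.mul_sum, ← Finset.sum_filter]
      refine Finset.sum_congr ?_ fun _ _ => rfl
      ext z
      simp only [Finset.mem_filter]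
      exact ⟨fun hz => ⟨hSb i hz, hz⟩, fun hz => hz.2⟩
    rw [Finset.sum_congr rfl fun i _ => h1 i, Finset.sum_comm]
    unfold DT
    rw [Finset.mul_sum]
    refine Finset.sum_le_sum fun z _ => ?_
    rw [← Finset.sum_filter, ← Finset.sum_mul]
    refine mul_le_mul_of_nonneg_right ?_ (hDD z)
    -- group by label
    obtain ⟨N, hN⟩ : ∃ N, ∀ i, lab i < N := ⟨(Finset.univ.sup lab) + 1, fun i => Nat.lt_succ_of_le (Finset.le_sup (Finset.mem_univ i))⟩
    rw [← Finset.sum_fiberwise_of_maps_to (t := Finset.range N) (g := lab) fun i _ => Finset.mem_range.2 (hN i)]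
    calc _ ≤ ∑ j ∈ Finset.range N, 7 ^ d * gs j := by
          refine Finset.sum_le_sum fun j _ => ?_
          refine (Finset.sum_le_card_nsmul _ _ (gs j) fun i hi => (by rw [(Finset.mem_filter.1 hi).2])).trans ?_
          rw [nsmul_eq_mul]
          refine mul_le_mul_of_nonneg_right ?_ (gs_nonneg j)
          have := hover j z
          refine le_trans (Nat.cast_le.2 (Finset.card_le_card ?_)) (le_trans (Nat.cast_le.2 this) (by simp))
          intro i hi
          simp only [Finset.mem_filter, Finset.mem_univ, true_and] at hi ⊢
          exact ⟨hi.2, hi.1⟩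
      _ ≤ 7 ^ d * G := by
          rw [← Finset.mul_sum]
          exact mul_le_mul_of_nonneg_left (gs_summable.sum_le_tsum _ fun j _ => gs_nonneg j) (by positivity)
  have hfin := hav.trans (Finset.sum_le_sum fun i _ => hterm i)
  rw [← Finset.mul_sum] at hfin
  have hfin2 := hfin.trans (mul_le_mul_of_nonneg_left hsum (by positivity))
  have hek : e ^ kap d ≤ (4 * d + 1) / th μ h 0 * η ^ kap d := by
    have hc1 : 1 ≤ (4 * d + 1) / th μ h 0 := by
      rw [le_div_iff₀ h0]; linarith [th_le_one (μ := μ) h 0]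
    rw [he, Real.mul_rpow (by positivity) hη0]
    refine mul_le_mul_of_nonneg_right ?_ (by positivity)
    conv_rhs => rw [← Real.rpow_one ((4 * d + 1) / th μ h 0)]
    exact Real.rpow_le_rpow_of_exponent_le hc1 (by linarith)
  have hfin3 : 2 * (th μ h R * (1 - th μ h R)) * R ≤
      R * (((4 * d + 1) / th μ h 0 * η ^ kap d) * (Real.pi * (28 * d * Real.sqrt Kσ))) * (7 ^ d * G * DT μ h R) := by
    refine hfin2.trans (mul_le_mul_of_nonneg_right ?_ (by positivity))
    exact mul_le_mul_of_nonneg_left (mul_le_mul_of_nonneg_right hek (by positivity)) hR0.le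
  have hfin4 : 2 * (th μ h R * (1 - th μ h R)) ≤ B / th μ h 0 * (η ^ kap d * DT μ h R) := by
    refine le_of_mul_le_mul_right (hfin3.trans (le_of_eq ?_)) hR0
    rw [hB]; ring
  have : 2 / B * th μ h 0 * (th μ h R * (1 - th μ h R)) = th μ h 0 / B * (2 * (th μ h R * (1 - th μ h R))) := by ring
  rw [this]
  refine (mul_le_mul_of_nonneg_left hfin4 (by positivity)).trans (le_of_eq ?_)
  field_simp

end Algo3
end

section
section Sharp
variable {d : ℕ} {μ : Measure (Vert d → ℝ)}

lemma th_pos (hd : 3 ≤ d) (hμ : GaussLaw μ (gr (d := d))) (h : ℝ) (n : ℕ) : 0 < th μ h n := by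
  have hd0 : 0 < d := by omega
  have := hμ.prob
  refine lt_of_le_of_ne (th_nonneg h n) fun h0 => ?_
  have h1 : μ {ω | fd h n 0 ω = 0} = 0 := (measureReal_eq_zero_iff).1 h0.symm
  have h2 : μ (⋃ t : ℕ, {ω | ω + rst (box 0 n) (fun _ => (t:ℝ)) ∈ {ω : Vert d → ℝ | fd h n 0 ω = 0}}) = 0 :=
    measure_iUnion_null fun t => gff_ac hd hμ (box 0 n) _ (arm_meas hd0 h n 0) h1
  have h3 : (⋃ t : ℕ, {ω | ω + rst (box 0 n) (fun _ => (t:ℝ)) ∈ {ω : Vert d → ℝ | fd h n 0 ω = 0}}) = Set.univ := by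
    refine Set.eq_univ_of_forall fun ω => ?_
    obtain ⟨t, ht⟩ := exists_nat_ge (∑ x ∈ box 0 n, |h - ω x|)
    refine Set.mem_iUnion.2 ⟨t, ?_⟩
    obtain ⟨p, hp⟩ := exists_arm hd0 (0 : Vert d) n
    have h4 := fd_le (h := h) (ω := ω + rst (box 0 n) (fun _ => (t:ℝ))) hp
    have h5 : cost h (ω + rst (box 0 n) (fun _ => (t:ℝ))) p = 0 := by
      refine cost_eq_zero.2 fun v hv => ?_
      obtain ⟨y, -, -, h6⟩ := hp
      have hvb : v ∈ box 0 n := mem_box_iff.2 (h6 v hv)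
      have h7 : |h - ω v| ≤ ∑ x ∈ box 0 n, |h - ω x| :=
        Finset.single_le_sum (f := fun x => |h - ω x|) (fun x _ => abs_nonneg _) hvb
      have h8 := le_abs_self (h - ω v)
      simp only [Pi.add_apply, rst, if_pos hvb]
      linarith
    exact Nat.le_zero.1 (h5 ▸ h4)
  rw [h3] at h2
  simp at h2

lemma Sg_pos (hd : 3 ≤ d) (hμ : GaussLaw μ (gr (d := d))) (h : ℝ) (n : ℕ) : 0 < Sg μ h n :=
  (th_pos hd hμ h 0).trans_le (Sg_ge h n)

lemma Sg_anti (hd : 0 < d) [IsProbabilityMeasure μ] {h h' : ℝ} (hh : h ≤ h') (n : ℕ) : Sg μ h' n ≤ Sg μ h n :=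
  Finset.sum_le_sum fun _ _ => th_anti hd hh le_rfl

lemma Sg_succ (h : ℝ) (n : ℕ) : Sg μ h (n + 1) = Sg μ h n + th μ h (n + 1) := Finset.sum_range_succ _ _

lemma th_le_Sg (hd : 0 < d) [IsProbabilityMeasure μ] (h : ℝ) (n : ℕ) : (n + 1) * th μ h n ≤ Sg μ h n := by
  have : ∑ _k ∈ Finset.range (n + 1), th μ h n ≤ Sg μ h n := Finset.sum_le_sum fun k hk =>
    th_anti hd le_rfl (by simp at hk; omega)
  simpa using this

lemma Sg_le [IsProbabilityMeasure μ] (h : ℝ) (n : ℕ) : Sg μ h n ≤ n + 1 := by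
  have : Sg μ h n ≤ ∑ _k ∈ Finset.range (n + 1), 1 := Finset.sum_le_sum fun k hk => th_le_one h k
  simpa using this

lemma DT_lower (hd : 3 ≤ d) (hμ : GaussLaw μ (gr (d := d))) {c : ℝ} (hc : 0 < c)
    (H : ∀ h : ℝ, ∀ R : ℕ, 1 ≤ R → c * th μ h 0 * (th μ h R * (1 - th μ h R)) ≤ (Sg μ h R / R) ^ kap d * DT μ h R)
    {e : ℝ} {h : ℝ} (he : h ≤ e) {n : ℕ} (hn : 1 ≤ n) (h2 : th μ h n ≤ 1 / 2) :
    c * th μ e 0 / 2 * th μ h n * (n / Sg μ h n) ^ kap d ≤ DT μ h n := by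
  have := hμ.prob
  have hn0 : (0:ℝ) < n := by exact_mod_cast hn
  have hS := Sg_pos hd hμ h n
  have h3 := H h n hn
  have hq : 0 < (Sg μ h n / n) ^ kap d := by positivity
  have e1 : (n / Sg μ h n) ^ kap d = ((Sg μ h n / n) ^ kap d)⁻¹ := by
    rw [← Real.inv_rpow (by positivity), inv_div]
  rw [e1, ← div_eq_mul_inv, div_le_iff₀ hq]
  refine le_trans ?_ (h3.trans_eq (mul_comm _ _))
  have h4 : th μ e 0 ≤ th μ h 0 := th_anti (by omega) he le_rfl
  have h5 := th_nonneg (μ := μ) h n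
  have h6 : c * th μ e 0 ≤ c * th μ h 0 := mul_le_mul_of_nonneg_left h4 hc.le
  have h7 : th μ h n * (1 / 2) ≤ th μ h n * (1 - th μ h n) := mul_le_mul_of_nonneg_left (by linarith) h5
  have h8 := mul_le_mul h6 h7 (by positivity) (mul_nonneg hc.le (th_nonneg h 0))
  linarith

lemma mvt_icc {f f' : ℝ → ℝ} {a b M : ℝ} (hab : a ≤ b) (hf : ∀ x ∈ Set.Icc a b, HasDerivAt f (f' x) x)
    (hM : ∀ x ∈ Set.Icc a b, f' x ≤ M) : f b - f a ≤ M * (b - a) := by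
  refine (convex_Icc a b).image_sub_le_mul_sub_of_deriv_le (fun x hx => (hf x hx).continuousAt.continuousWithinAt)
    (fun x hx => (hf x (interior_subset hx)).differentiableAt.differentiableWithinAt)
    (fun x hx => ?_) a (Set.left_mem_Icc.2 hab) b (Set.right_mem_Icc.2 hab) hab
  rw [(hf x (interior_subset hx)).deriv]
  exact hM x (interior_subset hx)

lemma log_step (hd : 3 ≤ d) (hμ : GaussLaw μ (gr (d := d))) (h : ℝ) {i : ℕ} (hi : 1 ≤ i) :
    Real.log (Sg μ h i) - Real.log (Sg μ h (i - 1)) ≤ 2 * (th μ h i / Sg μ h i) := by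
  have := hμ.prob
  obtain ⟨k, rfl⟩ : ∃ k, i = k + 1 := ⟨i - 1, by omega⟩
  simp only [Nat.add_sub_cancel]
  have h1 := Sg_pos hd hμ h k
  have h2 := Sg_pos hd hμ h (k + 1)
  have h3 := Sg_succ (μ := μ) h k
  have h4 : th μ h (k + 1) ≤ Sg μ h k := by
    have h5 := Finset.single_le_sum (f := fun k => th μ h k) (fun k _ => th_nonneg h k) (Finset.mem_range.2 (Nat.lt_succ_self k))
    exact (th_anti (by omega) le_rfl (Nat.le_succ k)).trans h5
  rw [← Real.log_div h2.ne' h1.ne']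
  refine (Real.log_le_sub_one_of_pos (by positivity)).trans ?_
  have e : Sg μ h (k + 1) / Sg μ h k - 1 = th μ h (k + 1) / Sg μ h k := by
    rw [h3]; field_simp; ring
  rw [e, ← mul_div_assoc, div_le_div_iff₀ h1 h2]
  have := mul_le_mul_of_nonneg_left (show Sg μ h (k + 1) ≤ 2 * Sg μ h k by linarith) (th_nonneg (μ := μ) h (k + 1))
  linarith

lemma drt_one (hd : 3 ≤ d) (hμ : GaussLaw μ (gr (d := d))) {a b : ℝ} (hab : a < b)
    (h0 : μ {ω : Vert d → ℝ | PercolatesIn {v | a ≤ ω v}} = 0) :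
    ∃ C : ℝ, 0 < C ∧ ∃ N : ℕ, ∀ n, N ≤ n → Sg μ b n ≤ C * Real.sqrt n := by
  have := hμ.prob
  have hd0 : 0 < d := by omega
  have hk := kap_pos hd0
  have hk8 := kap_le hd0
  obtain ⟨c, hc, H⟩ := sharp_ineq hd hμ
  set c' := c * th μ b 0 / 2 with hc'
  have hc'0 : 0 < c' := by have := th_pos hd hμ b 0; positivity
  set ε := (b - a) * (kap d * c') / 4 with hε
  have hε0 : 0 < ε := by have := sub_pos.2 hab; positivity
  have ht := th_tendsto_zero hd0 hμ h0
  have ht2 : Tendsto (fun n => (th μ a n) ^ kap d) atTop (𝓝 0) := by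
    have := (Real.continuous_rpow_const hk.le).tendsto 0 |>.comp ht
    rw [Real.zero_rpow hk.ne'] at this
    exact this
  obtain ⟨N, hN⟩ := eventually_atTop.1 ((ht.eventually (gt_mem_nhds (by norm_num : (0:ℝ) < 1 / 2))).and
    (ht2.eventually (gt_mem_nhds hε0)))
  set N0 := N + 1 with hN0
  refine ⟨N0 * Real.exp (1 / 2), by positivity, N0, fun n hn => ?_⟩
  have hn1 : 1 ≤ n := by omega
  have hn0 : (0:ℝ) < n := by exact_mod_cast hn1
  set F : ℝ → ℝ := fun h => ∑ i ∈ Finset.Icc N0 n, th μ h i ^ kap d / i with hF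
  set F' : ℝ → ℝ := fun h => ∑ i ∈ Finset.Icc N0 n, (-DT μ h i * kap d * th μ h i ^ (kap d - 1)) / i with hF'
  have hFd : ∀ x ∈ Set.Icc a b, HasDerivAt F (F' x) x := by
    intro x _
    refine HasDerivAt.fun_sum fun i _ => ?_
    exact ((th_deriv hd hμ x i).rpow_const (Or.inl (th_pos hd hμ x i).ne')).div_const _
  set L := Real.log (Sg μ b n) - Real.log N0 with hL
  have hF'b : ∀ x ∈ Set.Icc a b, F' x ≤ -(kap d * c' / 2 * L) := by
    intro x hx
    have hterm : ∀ i ∈ Finset.Icc N0 n, (-DT μ x i * kap d * th μ x i ^ (kap d - 1)) / i ≤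
        -(kap d * c' / 2 * (Real.log (Sg μ x i) - Real.log (Sg μ x (i - 1)))) := by
      intro i hi
      have hi1 : 1 ≤ i := by have := (Finset.mem_Icc.1 hi).1; omega
      have hi0 : (0:ℝ) < i := by exact_mod_cast hi1
      have hti := th_pos hd hμ x i
      have hSi := Sg_pos hd hμ x i
      have h1 : th μ x i ≤ 1 / 2 := (th_anti hd0 hx.1 le_rfl).trans (hN i (by have := (Finset.mem_Icc.1 hi).1; omega)).1.le
      have h2 := DT_lower hd hμ hc H hx.2 hi1 h1
      have h3 := log_step hd hμ x hi1
      have h4 : i * th μ x i / Sg μ x i ≤ 1 := by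
        rw [div_le_one hSi]
        have := th_le_Sg (μ := μ) hd0 x i
        linarith
      have h5 : i * th μ x i / Sg μ x i ≤ th μ x i ^ kap d * (i / Sg μ x i) ^ kap d := by
        rw [← Real.mul_rpow hti.le (by positivity)]
        refine (rpow_min hk (by linarith) (by positivity) h4 le_rfl).trans (le_of_eq ?_)
        congr 1; ring
      have h6 : c' * (i * th μ x i / Sg μ x i) ≤ DT μ x i * th μ x i ^ (kap d - 1) := by
        have e : th μ x i * th μ x i ^ (kap d - 1) = th μ x i ^ kap d := by
          rw [Real.rpow_sub_one hti.ne']; field_simp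
        calc c' * (i * th μ x i / Sg μ x i) ≤ c' * (th μ x i ^ kap d * (i / Sg μ x i) ^ kap d) :=
              mul_le_mul_of_nonneg_left h5 hc'0.le
          _ = (c' * th μ x i * (i / Sg μ x i) ^ kap d) * th μ x i ^ (kap d - 1) := by rw [← e]; ring
          _ ≤ _ := mul_le_mul_of_nonneg_right h2 (by positivity)
      have h7 : c' * (th μ x i / Sg μ x i) ≤ DT μ x i * th μ x i ^ (kap d - 1) / i := by
        rw [le_div_iff₀ hi0]
        refine le_trans (le_of_eq ?_) h6
        ring
      have h8 := mul_le_mul_of_nonneg_left h7 hk.le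
      have h9 := mul_le_mul_of_nonneg_left h3 (show 0 ≤ kap d * c' / 2 by positivity)
      have e2 : (-DT μ x i * kap d * th μ x i ^ (kap d - 1)) / i = -(kap d * (DT μ x i * th μ x i ^ (kap d - 1) / i)) := by ring
      rw [e2]
      linarith
    refine (Finset.sum_le_sum hterm).trans ?_
    rw [Finset.sum_neg_distrib, ← Finset.mul_sum]
    refine neg_le_neg (mul_le_mul_of_nonneg_left ?_ (by positivity))
    have htel : ∀ m, N ≤ m → ∑ i ∈ Finset.Icc N0 m, (Real.log (Sg μ x i) - Real.log (Sg μ x (i - 1))) =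
        Real.log (Sg μ x m) - Real.log (Sg μ x N) := by
      intro m hm
      induction m, hm using Nat.le_induction with
      | base => rw [Finset.Icc_eq_empty (by omega)]; simp
      | succ m hm ih => rw [Finset.sum_Icc_succ_top (by omega), ih]; simp
    rw [htel n (by omega), hL]
    have g1 := Real.log_le_log (Sg_pos hd hμ b n) (Sg_anti hd0 hx.2 n)
    have g2 := Real.log_le_log (Sg_pos hd hμ x N) (Sg_le (μ := μ) x N)
    rw [hN0]
    push_cast
    linarith
  have hmv := mvt_icc hab.le hFd hF'b
  have hFb : 0 ≤ F b := Finset.sum_nonneg fun i _ => div_nonneg (Real.rpow_nonneg (th_nonneg _ _) _) (by positivity)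
  have hFa : F a ≤ ε * (1 + Real.log n) := by
    have g1 : F a ≤ ∑ i ∈ Finset.Icc N0 n, ε * (i:ℝ)⁻¹ := by
      refine Finset.sum_le_sum fun i hi => ?_
      rw [div_eq_mul_inv]
      exact mul_le_mul_of_nonneg_right (hN i (by have := (Finset.mem_Icc.1 hi).1; omega)).2.le (by positivity)
    have g2 : ∑ i ∈ Finset.Icc N0 n, ε * (i:ℝ)⁻¹ ≤ ∑ i ∈ Finset.Icc 1 n, ε * (i:ℝ)⁻¹ :=
      Finset.sum_le_sum_of_subset_of_nonneg (Finset.Icc_subset_Icc_left (by omega)) fun _ _ _ => by positivity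
    rw [← Finset.mul_sum (Finset.Icc 1 n)] at g2
    have g3 := harmonic_le_one_add_log n
    rw [harmonic_eq_sum_Icc] at g3
    push_cast at g3
    exact g1.trans (g2.trans (mul_le_mul_of_nonneg_left g3 hε0.le))
  have hLb : L ≤ (1 + Real.log n) / 2 := by
    have h1 : (kap d * c' / 2 * L) * (b - a) ≤ ε * (1 + Real.log n) := by linarith
    have h2 : (b - a) * (kap d * c') / 2 * L ≤ (b - a) * (kap d * c') / 2 * ((1 + Real.log n) / 2) := by
      rw [hε] at h1; linarith
    exact le_of_mul_le_mul_left h2 (by have := sub_pos.2 hab; positivity)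
  have hN0p : (0:ℝ) < N0 := by positivity
  have hfin : Real.log (Sg μ b n) ≤ Real.log (N0 * Real.exp (1 / 2) * Real.sqrt n) := by
    rw [Real.log_mul (by positivity) (by positivity), Real.log_mul hN0p.ne' (by positivity), Real.log_exp,
      Real.log_sqrt hn0.le]
    linarith
  exact (Real.log_le_log_iff (Sg_pos hd hμ b n) (by positivity)).1 hfin

/-- stretched exponential decay above a non-percolating level -/
lemma drt_two (hd : 3 ≤ d) (hμ : GaussLaw μ (gr (d := d))) {a e : ℝ} (hae : a < e)
    (h0 : μ {ω : Vert d → ℝ | PercolatesIn {v | a ≤ ω v}} = 0) :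
    ∃ c : ℝ, 0 < c ∧ ∃ N : ℕ, ∀ n, N ≤ n → th μ e n ≤ Real.exp (-(c * (n:ℝ) ^ (kap d / 2))) := by
  have := hμ.prob
  have hd0 : 0 < d := by omega
  have hk := kap_pos hd0
  set b := (a + e) / 2 with hb
  have hab : a < b := by rw [hb]; linarith
  have hbe : b < e := by rw [hb]; linarith
  obtain ⟨C, hC, N, hN⟩ := drt_one hd hμ hab h0
  obtain ⟨c, hc, H⟩ := sharp_ineq hd hμ
  obtain ⟨N1, hN1⟩ := eventually_atTop.1 ((th_tendsto_zero hd0 hμ h0).eventually (gt_mem_nhds (by norm_num : (0:ℝ) < 1 / 2)))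
  set c' := c * th μ e 0 / 2 with hc'
  have hc'0 : 0 < c' := by have := th_pos hd hμ e 0; positivity
  refine ⟨c' * (C⁻¹) ^ kap d * (e - b), by have := sub_pos.2 hbe; positivity, max N (max N1 1), fun n hn => ?_⟩
  have hn1 : 1 ≤ n := by omega
  have hn0 : (0:ℝ) < n := by exact_mod_cast hn1
  have hd1 : ∀ x ∈ Set.Icc b e, HasDerivAt (fun h => Real.log (th μ h n)) (-DT μ x n / th μ x n) x := fun x _ =>
    (th_deriv hd hμ x n).log (th_pos hd hμ x n).ne'
  have hb1 : ∀ x ∈ Set.Icc b e, -DT μ x n / th μ x n ≤ -(c' * (C⁻¹) ^ kap d * (n:ℝ) ^ (kap d / 2)) := by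
    intro x hx
    have hti := th_pos hd hμ x n
    have hSi := Sg_pos hd hμ x n
    have h1 : th μ x n ≤ 1 / 2 := (th_anti hd0 (hab.le.trans hx.1) le_rfl).trans (hN1 n (by omega)).le
    have h2 := DT_lower hd hμ hc H hx.2 hn1 h1
    have h3 : Sg μ x n ≤ C * Real.sqrt n := (Sg_anti hd0 hx.1 n).trans (hN n (by omega))
    have h4 : C⁻¹ * Real.sqrt n ≤ n / Sg μ x n := by
      rw [le_div_iff₀ hSi]
      calc C⁻¹ * Real.sqrt n * Sg μ x n ≤ C⁻¹ * Real.sqrt n * (C * Real.sqrt n) :=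
            mul_le_mul_of_nonneg_left h3 (by positivity)
        _ = Real.sqrt n * Real.sqrt n := by field_simp
        _ = n := Real.mul_self_sqrt hn0.le
    have h5 : (C⁻¹) ^ kap d * (n:ℝ) ^ (kap d / 2) ≤ (n / Sg μ x n) ^ kap d := by
      refine le_trans (le_of_eq ?_) (Real.rpow_le_rpow (by positivity) h4 hk.le)
      rw [Real.mul_rpow (by positivity) (by positivity), Real.sqrt_eq_rpow, ← Real.rpow_mul hn0.le]
      congr 2; ring
    rw [neg_div, neg_le_neg_iff, le_div_iff₀ hti]
    refine le_trans ?_ h2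
    refine le_trans (le_of_eq ?_) (mul_le_mul_of_nonneg_left h5 (show 0 ≤ c' * th μ x n by positivity))
    ring
  have hmv := mvt_icc hbe.le hd1 hb1
  have hlb : Real.log (th μ b n) ≤ 0 := Real.log_nonpos (th_nonneg _ _) (th_le_one _ _)
  rw [← Real.log_le_iff_le_exp (th_pos hd hμ e n)]
  linarith

lemma decay_of_noperc (hd : 3 ≤ d) (hμ : GaussLaw μ (gr (d := d))) {a b : ℝ} (hab : a < b)
    (h0 : μ {ω : Vert d → ℝ | PercolatesIn {v | a ≤ ω v}} = 0) : Decay μ b := by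
  have hk := kap_pos (d := d) (by omega)
  set e := (a + b) / 2 with he
  obtain ⟨c, hc, N, hN⟩ := drt_two hd hμ (show a < e by rw [he]; linarith) h0
  have hr := renorm hd hμ (show 0 < b - e by rw [he]; linarith)
  have hev : ∀ᶠ n : ℕ in atTop, Real.log 2 + (8 * d * (Real.log n + CR) + 1) ≤ c * (n:ℝ) ^ (kap d / 2) := by
    have h1 : Tendsto (fun x : ℝ => (Real.log 2 + 8 * d * CR + 1) / x ^ (kap d / 2) + 8 * d * (Real.log x / x ^ (kap d / 2)))
        atTop (𝓝 (0 + 8 * d * 0)) := by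
      refine Tendsto.add ?_ (Tendsto.const_mul _ ?_)
      · exact Tendsto.const_div_atTop (tendsto_rpow_atTop (by positivity)) _
      · exact (isLittleO_log_rpow_atTop (by positivity)).tendsto_div_nhds_zero
    rw [show (0:ℝ) + 8 * d * 0 = 0 by ring] at h1
    have h2 := (h1.comp tendsto_natCast_atTop_atTop).eventually (gt_mem_nhds hc)
    filter_upwards [h2, eventually_ge_atTop 1] with n h3 hn
    have hn0 : (0:ℝ) < n := by exact_mod_cast hn
    have hp : 0 < (n:ℝ) ^ (kap d / 2) := by positivity
    simp only [Function.comp] at h3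
    rw [← mul_div_assoc, ← add_div, div_lt_iff₀ hp] at h3
    linarith
  obtain ⟨n, ⟨h1, h2⟩, h3⟩ := ((hr.and hev).and (eventually_ge_atTop N)).exists
  have h4 := h1 e (by
    refine (hN n h3).trans ?_
    have : (1/2:ℝ) = Real.exp (-Real.log 2) := by rw [Real.exp_neg, Real.exp_log (by norm_num)]; norm_num
    rw [this, ← Real.exp_add]
    exact Real.exp_le_exp.2 (by linarith))
  simpa using h4

end Sharp
end

section
section HS
variable {d : ℕ} {μ : Measure (Vert d → ℝ)}

lemma pn_mass (hd : 0 < d) (n : ℕ) (x : Vert d) {N : ℕ} (hN : n ≤ N) : ∑ y ∈ box x N, pn n x y = 1 := by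
  suffices h : ∀ n x (S : Finset (Vert d)), box x n ⊆ S → ∑ y ∈ S, pn n x y = 1 from
    h n x _ (box_sub (by simpa [linf_self] using hN))
  intro n
  induction n with
  | zero =>
    intro x S hS
    have : x ∈ S := hS (by rw [mem_box_iff, linf_self])
    simp [pn_zero, this]
  | succ n ih =>
    intro x S hS
    simp only [pn_succ]
    rw [← Finset.sum_div, Finset.sum_comm]
    rw [Finset.sum_congr rfl fun p _ => ih (x + ev p) S (fun z hz => hS ?_), sum_const_ev hd]
    rw [mem_box_iff] at *
    have h1 := linf_triangle x (x + ev p) z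
    have h2 : linfDist x (x + ev p) ≤ 1 := linf_adj (adj_iff_nbrs.2 (by rw [nbrs_eq]; exact Finset.mem_image_of_mem _ (Finset.mem_univ _)))
    omega

lemma gr_bd (hd : 3 ≤ d) : ∃ G : ℕ, 0 < G ∧ ∀ x y : Vert d, gr x y ≤ G := by
  refine ⟨⌈1 + 4 * KH d⌉₊ + 1, by omega, fun x y => ?_⟩
  have h1 := gr_tail hd one_pos x y
  rw [gr, (pn_summable hd x y).tsum_eq_zero_add]
  have h2 := pn_le_one (by omega) 0 x y
  have h3 := Nat.le_ceil (1 + 4 * KH d)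
  simp only [Nat.cast_one, Real.one_rpow, mul_one, add_comm 1] at h1
  push_cast
  linarith

lemma gr_lower (hd : 3 ≤ d) : ∃ C : ℝ, 0 < C ∧ ∀ m : ℕ, 1 ≤ m → ∃ y : Vert d, y ∉ box 0 m ∧
    1 ≤ C * (m:ℝ) ^ (d * d) * gr y 0 := by
  obtain ⟨G, hG, hb⟩ := gr_bd hd
  have hd0 : 0 < d := by omega
  refine ⟨((2 * (3 ^ d * G) + 1 : ℕ) : ℝ) ^ d, by positivity, fun m hm => ?_⟩
  set n := (2 * m + 1) ^ d * G with hn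
  have h1 : ((n:ℝ) + 1) ≤ ∑ y ∈ box (0 : Vert d) n, gr 0 y := by
    have : ∑ y ∈ box (0 : Vert d) n, ∑ k ∈ Finset.range (n + 1), pn k 0 y = (n:ℝ) + 1 := by
      rw [Finset.sum_comm, Finset.sum_congr rfl fun k hk => pn_mass hd0 k 0 (by have := Finset.mem_range.1 hk; omega)]
      simp
    rw [← this]
    exact Finset.sum_le_sum fun y _ => (pn_summable hd 0 y).sum_le_tsum _ fun _ _ => pn_nonneg _ _ _
  have h2 : ∑ y ∈ box (0 : Vert d) m, gr 0 y ≤ n := by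
    refine (Finset.sum_le_card_nsmul _ _ _ fun y _ => hb 0 y).trans ?_
    rw [card_box, nsmul_eq_mul, hn]; push_cast; rfl
  have hmn : m ≤ n := by
    rw [hn]
    have h3 : 2 * m + 1 ≤ (2 * m + 1) ^ d := Nat.le_self_pow (by omega) _
    nlinarith
  have hsub : box (0 : Vert d) m ⊆ box 0 n := box_sub (by simpa [linf_self] using hmn)
  have h3 := Finset.sum_sdiff (f := fun y => gr 0 y) hsub
  set D := box (0 : Vert d) n \ box 0 m
  have hDn : D.Nonempty := by
    rw [Finset.nonempty_iff_ne_empty]; intro h; rw [h] at h3; simp at h3; linarith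
  have hle : 2 * n + 1 ≤ (2 * (3 ^ d * G) + 1) * m ^ d := by
    have h5 : (2 * m + 1) ^ d ≤ 3 ^ d * m ^ d := by rw [← mul_pow]; exact Nat.pow_le_pow_left (by omega) _
    have h6 : 1 ≤ m ^ d := Nat.one_le_pow _ _ hm
    have h7 : n ≤ 3 ^ d * m ^ d * G := Nat.mul_le_mul_right G h5
    calc 2 * n + 1 ≤ 2 * (3 ^ d * m ^ d * G) + m ^ d := by omega
      _ = _ := by ring
  have hn0 : (0:ℝ) < ((2 * n + 1 : ℕ):ℝ) ^ d := by positivity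
  obtain ⟨y, hy, h4⟩ := Finset.exists_le_of_sum_le (s := D) (f := fun _ => 1 / ((2 * n + 1 : ℕ):ℝ) ^ d) (g := fun y => gr 0 y) hDn (by
    have hc : (D.card : ℝ) ≤ ((2 * n + 1 : ℕ):ℝ) ^ d := by
      have := Finset.card_le_card (Finset.sdiff_subset (s := box (0 : Vert d) n) (t := box 0 m))
      rw [card_box] at this
      exact_mod_cast this
    rw [Finset.sum_const, nsmul_eq_mul, mul_one_div]
    have : (D.card : ℝ) / ((2 * n + 1 : ℕ):ℝ) ^ d ≤ 1 := (div_le_one hn0).2 hc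
    linarith)
  refine ⟨y, (Finset.mem_sdiff.1 hy).2, ?_⟩
  rw [gr_symm]
  rw [div_le_iff₀ hn0] at h4
  refine h4.trans ?_
  rw [mul_comm]
  refine mul_le_mul_of_nonneg_right ?_ (gr_nonneg _ _)
  rw [pow_mul, ← mul_pow]
  exact pow_le_pow_left₀ (by positivity) (by exact_mod_cast hle) _

/-- the cluster of the origin together with its boundary -/
def Kb (S : Set (Vert d)) : Set (Vert d) := {y | y = 0 ∨ ∃ z, (z = y ∨ adj z y) ∧ VConnectedIn S 0 z}

lemma Kb_congr {S S' : Set (Vert d)} (h : ∀ v ∈ Kb S, v ∈ S ↔ v ∈ S') : Kb S' = Kb S := by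
  have key : ∀ y, VConnectedIn S' 0 y ↔ VConnectedIn S 0 y := by
    intro y
    constructor
    · intro hc
      refine vconn_induct (motive := fun a => VConnectedIn S 0 a) (vconn_symm hc) ?_ ?_
      · exact vconn_refl ((h 0 (Or.inl rfl)).2 (vconn_mem hc).1)
      · intro a b ha hab _ hb
        exact vconn_snoc hb (adj_symm hab) ((h a (Or.inr ⟨b, Or.inr (adj_symm hab), hb⟩)).2 ha)
    · intro hc
      refine vconn_induct (motive := fun a => VConnectedIn S' 0 a) (vconn_symm hc) ?_ ?_
      · exact vconn_refl ((h 0 (Or.inl rfl)).1 (vconn_mem hc).1)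
      · intro a b ha hab hb hb'
        exact vconn_snoc hb' (adj_symm hab) ((h a (Or.inr ⟨b, Or.inr (adj_symm hab), vconn_symm hb⟩)).1 ha)
  ext y
  simp only [Kb, key]

lemma vconn_meas (h : ℝ) (x y : Vert d) : MeasurableSet {ω : Vert d → ℝ | VConnectedIn {v | h ≤ ω v} x y} := by
  simp only [VConnectedIn, Set.setOf_exists, Set.setOf_and, Set.setOf_forall, Set.mem_setOf_eq]
  refine MeasurableSet.iUnion fun p => (MeasurableSet.const _).inter (MeasurableSet.iInter fun v => MeasurableSet.iInter fun _ => ?_)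
  exact measurableSet_le measurable_const (measurable_pi_apply v)

lemma mem_Kb_meas (h : ℝ) (y : Vert d) : MeasurableSet {ω : Vert d → ℝ | y ∈ Kb {v | h ≤ ω v}} := by
  have : {ω : Vert d → ℝ | y ∈ Kb {v | h ≤ ω v}} = {_ω | y = 0} ∪ ⋃ z, {_ω | z = y ∨ adj z y} ∩
      {ω | VConnectedIn {v | h ≤ ω v} 0 z} := by
    ext ω; simp [Kb]
  rw [this]
  exact (MeasurableSet.const _).union (MeasurableSet.iUnion fun z => (MeasurableSet.const _).inter (vconn_meas h 0 z))

lemma Kb_meas (h : ℝ) (A : Set (Vert d)) : MeasurableSet {ω : Vert d → ℝ | Kb {v | h ≤ ω v} = A} := by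
  have : {ω : Vert d → ℝ | Kb {v | h ≤ ω v} = A} = ⋂ y, {ω | y ∈ Kb {v | h ≤ ω v} ↔ y ∈ A} := by
    ext ω; simp [Set.ext_iff]
  rw [this]
  refine MeasurableSet.iInter fun y => ?_
  by_cases hy : y ∈ A
  · simpa [hy] using mem_Kb_meas h y
  · simp only [hy, iff_false]
    exact (mem_Kb_meas h y).compl

lemma coord_int (hμ : GaussLaw μ (gr (d := d))) (y : Vert d) : Integrable (fun ω => ω y) μ := by
  have := hμ.prob
  have h := hμ.memLp {y} (fun _ => 1) 1
  simp only [Finset.sum_singleton, one_mul] at h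
  exact memLp_one_iff_integrable.1 (by simpa using h)

lemma coord_sq (hμ : GaussLaw μ (gr (d := d))) (y : Vert d) : Integrable (fun ω => ω y ^ 2) μ ∧
    ∫ ω, ω y ^ 2 ∂μ = ∫ ω, ω 0 ^ 2 ∂μ := by
  have := hμ.prob
  constructor
  · have h := hμ.memLp {y} (fun _ => 1) 2
    simp only [Finset.sum_singleton, one_mul] at h
    exact MemLp.integrable_sq (by simpa using h)
  · conv_rhs => rw [← gff_shift hμ y]
    have hm : Measurable fun (ω : Vert d → ℝ) (x : Vert d) => ω (x + y) :=
      measurable_pi_lambda _ fun x => measurable_pi_apply _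
    rw [integral_map hm.aemeasurable ((measurable_pi_apply (0 : Vert d)).pow_const 2).aestronglyMeasurable]
    simp

lemma Kb_mean (hd : 3 ≤ d) (hμ : GaussLaw μ (gr (d := d))) {G : ℝ} (hG : 0 < G)
    (hb : ∀ x y : Vert d, gr x y ≤ G) (A : Finset (Vert d)) {y : Vert d} (hy : y ∉ A) :
    ∫ ω in {ω : Vert d → ℝ | Kb {v | -1 ≤ ω v} = A}, ω y ∂μ ≤
      -(gr y 0 / G * μ.real {ω : Vert d → ℝ | Kb {v | -1 ≤ ω v} = A}) := by
  have := hμ.prob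
  set E := {ω : Vert d → ℝ | Kb {v | -1 ≤ ω v} = A} with hE
  have hEm : MeasurableSet E := Kb_meas _ _
  by_cases h0 : (0 : Vert d) ∈ A
  swap
  · have : E = ∅ := by
      ext ω
      simp only [hE, Set.mem_setOf_eq, Set.mem_empty_iff_false, iff_false]
      intro h
      exact h0 (by have : (0 : Vert d) ∈ Kb {v | -1 ≤ ω v} := Or.inl rfl
                   rw [h] at this; exact this)
    simp [this]
  rw [gff_cond_mean hd hμ A hEm ?_ hy]
  · have h1 : ∀ z ∈ A, hit A y z * ∫ ω in E, ω z ∂μ ≤ hit A y z * -μ.real E := by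
      intro z hz
      by_cases hn : nbrs z ⊆ A
      · rw [hit_interior hy hn]; simp
      refine mul_le_mul_of_nonneg_left ?_ (hit_nonneg _ _ _)
      have h2 : ∫ ω in E, ω z ∂μ ≤ ∫ ω in E, (-1:ℝ) ∂μ := by
        refine setIntegral_mono_on (coord_int hμ z).integrableOn (integrable_const _).integrableOn hEm fun ω hω => ?_
        by_contra hlt
        refine hn fun w hw => ?_
        have hzS : z ∈ {v | -1 ≤ ω v} := (not_le.1 hlt).le
        have hzK : VConnectedIn {v | -1 ≤ ω v} 0 z := by
          have : z ∈ Kb {v | -1 ≤ ω v} := by rw [show Kb {v | -1 ≤ ω v} = A from hω]; exact hz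
          rcases this with rfl | ⟨u, rfl | hu, hc⟩
          · exact vconn_refl hzS
          · exact hc
          · exact vconn_snoc hc hu hzS
        have : w ∈ Kb {v | -1 ≤ ω v} := Or.inr ⟨z, Or.inr (adj_iff_nbrs.2 hw), hzK⟩
        rw [show Kb {v | -1 ≤ ω v} = A from hω] at this; exact this
      simpa using h2
    refine (Finset.sum_le_sum h1).trans ?_
    rw [← Finset.sum_mul, mul_neg, neg_le_neg_iff]
    refine mul_le_mul_of_nonneg_right ?_ measureReal_nonneg
    rw [div_le_iff₀ hG, ← hit_green hd A y h0, Finset.sum_mul]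
    exact Finset.sum_le_sum fun z _ => mul_le_mul_of_nonneg_left (hb _ _) (hit_nonneg _ _ _)
  · intro ω ω' h hω
    rw [hE, Set.mem_setOf_eq] at *
    rw [← hω]
    refine Kb_congr fun v hv => ?_
    rw [hω] at hv
    simp [h v hv]

lemma Kb_box {m : ℕ} (hm : 1 ≤ m) (hd : 0 < d) {ω : Vert d → ℝ} (h : fd (-1) m 0 ω ≠ 0) :
    Kb {v | -1 ≤ ω v} ⊆ box (0 : Vert d) m := by
  have hK : ∀ z, VConnectedIn {v | -1 ≤ ω v} 0 z → linfDist 0 z < m := by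
    rintro z ⟨p, hp, hop⟩
    by_contra hz
    obtain ⟨p1, p2, w, e, h1, h2, h3⟩ := exit_pre hp (c := 0) (R := m) (by simp [linf_self]) ⟨z, isPath_end_mem hp, not_lt.1 hz⟩
    exact h ((fd_eq_zero hd).2 ⟨w, h2, p1, h1, fun v hv => hop v (by rw [e]; simp [hv]), h3⟩)
  rintro y (rfl | ⟨z, hzy, hz⟩)
  · simp [mem_box_iff, linf_self]
  · have := hK z hz
    rw [Finset.mem_coe, mem_box_iff]
    rcases hzy with rfl | hzy
    · omega
    · have h1 := linf_triangle 0 z y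
      have h2 := linf_adj hzy
      omega

lemma Kb_final (hd : 3 ≤ d) (hμ : GaussLaw μ (gr (d := d))) {G : ℝ} (hG : 0 < G)
    (hb : ∀ x y : Vert d, gr x y ≤ G) {m : ℕ} (hm : 1 ≤ m) {y : Vert d} (hy : y ∉ box 0 m) {l : ℝ} (hl : 0 < l) :
    gr y 0 / G * (1 - th μ (-1) m) ≤ l * ∫ ω, ω 0 ^ 2 ∂μ + th μ (-1) m / l := by
  have := hμ.prob
  have hd0 : 0 < d := by omega
  set E : Finset (Vert d) → Set (Vert d → ℝ) := fun A => {ω : Vert d → ℝ | Kb {v | -1 ≤ ω v} = A} with hE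
  have hEm : ∀ A, MeasurableSet (E A) := fun A => Kb_meas _ _
  set P := (box (0 : Vert d) m).powerset
  set U := ⋃ A ∈ P, E A with hU
  have hUm : MeasurableSet U := Finset.measurableSet_biUnion _ fun A _ => hEm A
  have hdis : Set.PairwiseDisjoint (P : Set (Finset (Vert d))) E := by
    intro A _ B _ hAB
    refine Set.disjoint_left.2 fun ω h1 h2 => hAB ?_
    have : (A : Set (Vert d)) = B := (show Kb _ = (A : Set (Vert d)) from h1).symm.trans h2
    exact_mod_cast this
  have hUc : Uᶜ ⊆ {ω | fd (-1) m 0 ω = 0} := by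
    intro ω hω
    by_contra hne
    have hsub := Kb_box hm hd0 hne
    refine hω ?_
    have hfin : (Kb {v | -1 ≤ ω v}).Finite := (box (0 : Vert d) m).finite_toSet.subset hsub
    rw [hU, Set.mem_iUnion₂]
    refine ⟨hfin.toFinset, Finset.mem_powerset.2 ?_, ?_⟩
    · intro z hz; exact hsub (by simpa using hz)
    · simp [hE]
  have h1 : ∫ ω in U, ω y ∂μ ≤ -(gr y 0 / G * μ.real U) := by
    rw [hU, integral_biUnion_finset _ (fun A _ => hEm A) hdis fun A _ => (coord_int hμ y).integrableOn,
      measureReal_biUnion_finset hdis fun A _ => hEm A, Finset.mul_sum, ← Finset.sum_neg_distrib]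
    exact Finset.sum_le_sum fun A hA => Kb_mean hd hμ hG hb A fun h => hy (Finset.mem_powerset.1 hA h)
  have h2 : ∫ ω, ω y ∂μ = 0 := by
    have := gff_cond_mean hd hμ ∅ MeasurableSet.univ (fun _ _ _ h => h) (Finset.notMem_empty y)
    simpa using this
  have h3 := integral_add_compl hUm (coord_int hμ y)
  have hth : μ.real Uᶜ ≤ th μ (-1) m := measureReal_mono hUc (measure_ne_top _ _)
  have hc := probReal_compl_eq_one_sub (μ := μ) hUm
  have h4 : ∫ ω in Uᶜ, ω y ∂μ ≤ l * ∫ ω, ω 0 ^ 2 ∂μ + μ.real Uᶜ / l := by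
    obtain ⟨hi, he⟩ := coord_sq hμ y
    have hi' : Integrable (fun ω : Vert d → ℝ => l * ω y ^ 2) μ := hi.const_mul _
    calc ∫ ω in Uᶜ, ω y ∂μ ≤ ∫ ω in Uᶜ, (l * ω y ^ 2 + 1 / l) ∂μ := by
          refine integral_mono (coord_int hμ y).integrableOn (hi'.integrableOn.add (integrable_const _)) fun ω => ?_
          have h5 : 0 ≤ (l * ω y - 1) ^ 2 := sq_nonneg _
          have h6 : 0 ≤ (l * ω y) ^ 2 := sq_nonneg _
          have h7 : l * ω y ^ 2 + 1 / l - ω y = ((l * ω y) ^ 2 + 1 - l * ω y) / l := by field_simp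
          have h8 : 0 ≤ ((l * ω y) ^ 2 + 1 - l * ω y) / l := div_nonneg (by nlinarith) hl.le
          simp only
          linarith
      _ = (∫ ω in Uᶜ, l * ω y ^ 2 ∂μ) + μ.real Uᶜ / l := by
          rw [integral_add hi'.integrableOn (integrable_const _)]
          simp [div_eq_mul_inv]
      _ ≤ _ := by
          rw [← he, ← integral_const_mul]
          have := setIntegral_le_integral (s := Uᶜ) hi' (Eventually.of_forall fun ω => by positivity)
          linarith
  have h5 : μ.real Uᶜ / l ≤ th μ (-1) m / l := div_le_div_of_nonneg_right hth hl.le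
  have h6 : gr y 0 / G * (1 - th μ (-1) m) ≤ gr y 0 / G * μ.real U :=
    mul_le_mul_of_nonneg_left (by linarith) (div_nonneg (gr_nonneg _ _) hG.le)
  linarith

/-- percolation does occur at some level -/
lemma perc_exists (hd : 3 ≤ d) (hμ : GaussLaw μ (gr (d := d))) :
    ∃ h : ℝ, μ {ω : Vert d → ℝ | PercolatesIn {v | h ≤ ω v}} ≠ 0 := by
  by_contra hno
  push Not at hno
  have := hμ.prob
  have hk := kap_pos (d := d) (by omega)
  obtain ⟨c, hc, N, hN⟩ := drt_two hd hμ (show (-2:ℝ) < -1 by norm_num) (hno (-2))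
  obtain ⟨G, hG, hb⟩ := gr_bd hd
  obtain ⟨C, hC, hlow⟩ := gr_lower hd
  have hG' : (0:ℝ) < G := by exact_mod_cast hG
  set M := ∫ ω, ω 0 ^ 2 ∂μ with hM
  have hM0 : 0 ≤ M := integral_nonneg fun ω => by positivity
  have hlim : Tendsto (fun m : ℕ => (m:ℝ) ^ (d * d) * Real.exp (-(c / 2) * (m:ℝ) ^ (kap d / 2))) atTop (𝓝 0) := by
    have h1 := tendsto_rpow_mul_exp_neg_mul_atTop_nhds_zero (((d * d : ℕ):ℝ) / (kap d / 2)) (c / 2) (by positivity)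
    have h2 : Tendsto (fun m : ℕ => (m:ℝ) ^ (kap d / 2)) atTop atTop :=
      (tendsto_rpow_atTop (by positivity)).comp tendsto_natCast_atTop_atTop
    refine (h1.comp h2).congr fun m => ?_
    simp only [Function.comp]
    rw [← Real.rpow_mul (by positivity), mul_div_cancel₀ _ (by positivity), Real.rpow_natCast]
  have hlim2 : Tendsto (fun m : ℕ => Real.exp (-(c / 2) * (m:ℝ) ^ (kap d / 2))) atTop (𝓝 0) := by
    refine Real.tendsto_exp_atBot.comp ?_
    exact Tendsto.const_mul_atTop_of_neg (by linarith) ((tendsto_rpow_atTop (by positivity)).comp tendsto_natCast_atTop_atTop)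
  have he1 := hlim.eventually (gt_mem_nhds (show (0:ℝ) < 1 / (4 * (C * G * (M + 1))) by positivity))
  have he2 := hlim2.eventually (gt_mem_nhds (show (0:ℝ) < 1 / 2 by norm_num))
  obtain ⟨m, ⟨⟨h1, h2⟩, h3⟩, h4⟩ := (((he1.and he2).and (eventually_ge_atTop N)).and (eventually_ge_atTop 1)).exists
  obtain ⟨y, hy, hl⟩ := hlow m h4
  set l := Real.exp (-(c / 2) * (m:ℝ) ^ (kap d / 2)) with hle
  have hl0 : 0 < l := Real.exp_pos _
  have hth : th μ (-1) m ≤ l * l := by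
    refine (hN m h3).trans (le_of_eq ?_)
    rw [hle, ← Real.exp_add]; congr 1; ring
  have hf := Kb_final hd hμ hG' hb h4 hy hl0
  have h5 : th μ (-1) m / l ≤ l := (div_le_iff₀ hl0).2 hth
  have h6 : th μ (-1) m ≤ 1 / 2 := by nlinarith
  have hg0 := gr_nonneg y 0
  have h7 : gr y 0 / G * (1 / 2) ≤ gr y 0 / G * (1 - th μ (-1) m) :=
    mul_le_mul_of_nonneg_left (by linarith) (by positivity)
  have h8 : gr y 0 / G * (1 / 2) ≤ l * (M + 1) := by
    rw [← hM] at hf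
    linarith
  have h9 : gr y 0 ≤ 2 * G * (l * (M + 1)) := by
    rw [div_mul_eq_mul_div, div_le_iff₀ hG'] at h8
    linarith
  rw [lt_div_iff₀ (by positivity)] at h1
  have h10 : C * (m:ℝ) ^ (d * d) * gr y 0 ≤ C * (m:ℝ) ^ (d * d) * (2 * G * (l * (M + 1))) :=
    mul_le_mul_of_nonneg_left h9 (by positivity)
  nlinarith

/-- no percolation at high levels -/
lemma perc_bdd (hd : 3 ≤ d) (hμ : GaussLaw μ (gr (d := d))) :
    ∃ h : ℝ, μ {ω : Vert d → ℝ | PercolatesIn {v | h ≤ ω v}} = 0 := by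
  have := hμ.prob
  have hd0 : 0 < d := by omega
  obtain ⟨L, hL⟩ := (renorm hd hμ one_pos).exists
  set ε := 1 / 2 * Real.exp (-(8 * d * (Real.log L + CR) + 1)) with hε
  have hε0 : 0 < ε := by positivity
  obtain ⟨G, hG, hb⟩ := gr_bd hd
  have hG' : (0:ℝ) < G := by exact_mod_cast hG
  have hlim : Tendsto (fun r : ℝ => Real.exp (-(r ^ 2 / (2 * G)))) atTop (𝓝 0) :=
    Real.tendsto_exp_neg_atTop_nhds_zero.comp
      ((tendsto_pow_atTop (by norm_num)).atTop_div_const (by positivity))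
  obtain ⟨r, h1, h2⟩ := ((hlim.eventually (gt_mem_nhds hε0)).and (eventually_ge_atTop 0)).exists
  refine ⟨r + 1, decay_no_perc hd0 hμ (hL r ?_)⟩
  have h3 := hμ.tail {0} (fun _ => 1) hG' h2 (by simpa using hb 0 0)
  refine le_trans ?_ (h3.trans h1.le)
  refine measureReal_mono ?_ (measure_ne_top _ _)
  intro ω hω
  obtain ⟨y, -, p, hp, hop, -⟩ := (fd_eq_zero hd0).1 hω
  simpa using hop 0 (isPath_start_mem hp)

lemma perc_mono {h h' : ℝ} (hh : h ≤ h') (hp : μ {ω : Vert d → ℝ | PercolatesIn {v | h' ≤ ω v}} ≠ 0) :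
    μ {ω : Vert d → ℝ | PercolatesIn {v | h ≤ ω v}} ≠ 0 := by
  intro h0
  refine hp (measure_mono_null ?_ h0)
  rintro ω ⟨x, hx⟩
  exact ⟨x, hx.mono fun y hy => vconn_mono (fun v hv => hh.trans hv) hy⟩

end HS
end

section
section BK
variable {d : ℕ} {μ : Measure (Vert d → ℝ)}

/-- the Burton-Keane counting bound -/
lemma trif_count {W : Set (Vert d)} {Y T : Finset (Vert d)} {D : Vert d → Set (Vert d)} {a : Vert d → Fin 3 → Vert d}
    (hDc : ∀ t ∈ T, ∀ v ∈ D t, VConnectedIn (D t) t v) (hDW : ∀ t ∈ T, D t ⊆ W)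
    (hdis : ∀ t ∈ T, ∀ s ∈ T, t ≠ s → Disjoint (D t) (D s))
    (hadj : ∀ t ∈ T, ∀ i, ∃ u ∈ D t, adj u (a t i))
    (hleaf : ∀ t ∈ T, ∀ i, ∃ y ∈ Y, VConnectedIn (W \ D t) (a t i) y)
    (hsep : ∀ t ∈ T, ∀ i j, i ≠ j → ¬ VConnectedIn (W \ D t) (a t i) (a t j)) : T.card ≤ Y.card := by
  have hsub : ∀ t ∈ T, ∀ s ∈ T, t ≠ s → D t ⊆ W \ D s := fun t ht s hs hts v hv =>
    ⟨hDW t ht hv, Set.disjoint_left.1 (hdis t ht s hs hts) hv⟩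
  have key : ∀ t ∈ T, ∀ s ∈ T, t ≠ s → ∀ i v, ¬ VConnectedIn (W \ D t) (a t i) s →
      VConnectedIn (W \ D t) (a t i) v → VConnectedIn (W \ D s) t v := by
    intro t ht s hs hts i v hns hv
    have hout : ∀ u, VConnectedIn (W \ D t) (a t i) u → u ∈ W \ D s := fun u hu =>
      ⟨(vconn_mem hu).2.1, fun hus => hns (vconn_trans hu
        (vconn_symm (vconn_mono (hsub s hs t ht hts.symm) (hDc s hs u hus))))⟩
    obtain ⟨u, hu, hua⟩ := hadj t ht i
    have h1 : VConnectedIn (W \ D s) t u := vconn_mono (hsub t ht s hs hts) (hDc t ht u hu)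
    refine vconn_induct (motive := fun v => VConnectedIn (W \ D s) t v) (vconn_symm hv) ?_ ?_
    · exact vconn_snoc h1 hua (hout _ (vconn_refl (vconn_mem hv).1))
    · intro p q hp hpq hq ih
      exact vconn_snoc ih (adj_symm hpq) (hout _ (vconn_snoc (vconn_symm hq) (adj_symm hpq) hp))
  let e : Vert d → ℕ := Encodable.encode
  have hbest : ∀ t ∈ T, ∃ i, ∃ y ∈ Y, VConnectedIn (W \ D t) (a t i) y ∧
      (∀ y' ∈ Y, VConnectedIn (W \ D t) (a t i) y' → e y ≤ e y') ∧
      ∀ j, j ≠ i → ∃ y' ∈ Y, VConnectedIn (W \ D t) (a t j) y' ∧ e y' < e y := by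
    intro t ht
    have hmin : ∀ i, ∃ y ∈ Y, VConnectedIn (W \ D t) (a t i) y ∧
        ∀ y' ∈ Y, VConnectedIn (W \ D t) (a t i) y' → e y ≤ e y' := by
      intro i
      obtain ⟨y, hy, h1⟩ := Finset.exists_min_image (Y.filter fun y => VConnectedIn (W \ D t) (a t i) y) e
        (by obtain ⟨y, h1, h2⟩ := hleaf t ht i; exact ⟨y, Finset.mem_filter.2 ⟨h1, h2⟩⟩)
      rw [Finset.mem_filter] at hy
      exact ⟨y, hy.1, hy.2, fun y' h2 h3 => h1 y' (Finset.mem_filter.2 ⟨h2, h3⟩)⟩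
    choose m h1 h2 h3 using hmin
    obtain ⟨i, -, hi⟩ := Finset.exists_max_image (Finset.univ : Finset (Fin 3)) (fun i => e (m i)) ⟨0, Finset.mem_univ _⟩
    refine ⟨i, m i, h1 i, h2 i, h3 i, fun j hj => ⟨m j, h1 j, h2 j, lt_of_le_of_ne (hi j (Finset.mem_univ _)) fun h => ?_⟩⟩
    have h4 : m j = m i := Encodable.encode_injective h
    exact hsep t ht j i hj (vconn_trans (h2 j) (vconn_symm (by rw [h4]; exact h2 i)))
  choose! br y hyY hyc hymin hyo using hbest
  have hmain : ∀ t ∈ T, ∀ s ∈ T, t ≠ s → y t = y s → ¬ VConnectedIn (W \ D t) (a t (br t)) s := by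
    intro t ht s hs hts hy hc
    have hj : ∃ j, j ≠ br s ∧ ¬ VConnectedIn (W \ D s) (a s j) t := by
      by_contra hno
      push Not at hno
      have h2 : ∀ i : Fin 3, ∃ j j' : Fin 3, j ≠ i ∧ j' ≠ i ∧ j ≠ j' := by decide
      obtain ⟨j, j', h3, h4, h5⟩ := h2 (br s)
      exact hsep s hs j j' h5 (vconn_trans (hno j h3) (vconn_symm (hno j' h4)))
    obtain ⟨j, hj, hn⟩ := hj
    obtain ⟨y', h1, h2, h3⟩ := hyo s hs j hj
    have h4 := key s hs t ht hts.symm j y' hn h2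
    have h5 := hymin t ht y' h1 (vconn_trans hc h4)
    rw [hy] at h5
    omega
  refine Finset.card_le_card_of_injOn y (fun t ht => hyY t ht) fun t ht s hs hys => ?_
  by_contra hts
  have h1 := key t ht s hs hts (br t) (y t) (hmain t ht s hs hts hys) (hyc t ht)
  refine hmain s hs t ht (Ne.symm hts) hys.symm (vconn_trans (hyc s hs) ?_)
  rw [← hys]; exact vconn_symm h1

lemma box_conn (t : Vert d) (R : ℕ) : ∀ v ∈ box t R, VConnectedIn (box t R : Set (Vert d)) t v := by
  suffices h : ∀ (n : ℕ) (v : Vert d), ∑ i, (v i - t i).natAbs = n → v ∈ box t R → VConnectedIn (box t R : Set (Vert d)) t v from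
    fun v hv => h _ v rfl hv
  intro n
  induction n using Nat.strong_induction_on with
  | _ n ih =>
    intro v hn hv
    by_cases h0 : v = t
    · subst h0; exact vconn_refl hv
    obtain ⟨i, hi⟩ := Function.ne_iff.1 h0
    set w := Function.update v i (v i - (v i - t i).sign) with hw
    have hwi : w i = v i - (v i - t i).sign := by simp [hw]
    have hwj : ∀ j, j ≠ i → w j = v j := fun j hj => by simp [hw, hj]
    have hs : (v i - t i).sign = 1 ∧ 0 < v i - t i ∨ (v i - t i).sign = -1 ∧ v i - t i < 0 := by
      rcases lt_or_gt_of_ne (sub_ne_zero.2 hi) with h | h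
      · exact Or.inr ⟨Int.sign_eq_neg_one_of_neg h, h⟩
      · exact Or.inl ⟨Int.sign_eq_one_of_pos h, h⟩
    have hle : ∀ j, (w j - t j).natAbs ≤ (v j - t j).natAbs := by
      intro j
      by_cases hj : j = i
      · subst hj; rw [hwi]; omega
      · rw [hwj j hj]
    have hwb : w ∈ box t R := mem_box.2 fun j => (hle j).trans (mem_box.1 hv j)
    have hlt : ∑ j, (w j - t j).natAbs < n := by
      rw [← hn]
      exact Finset.sum_lt_sum (fun j _ => hle j) ⟨i, Finset.mem_univ _, by rw [hwi]; omega⟩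
    refine vconn_snoc (ih _ hlt w rfl hwb) ?_ hv
    show ∑ j, (w j - v j).natAbs = 1
    rw [Finset.sum_eq_single i (fun j _ hj => by rw [hwj j hj]; simp) (by simp), hwi]
    omega

/-- `0` is the centre of a trifurcation box -/
def Tri (h : ℝ) (R : ℕ) (ω : Vert d → ℝ) : Prop := (∀ v ∈ box (0 : Vert d) R, h ≤ ω v) ∧
  ∃ a : Fin 3 → Vert d, (∀ i, ∃ u ∈ box (0 : Vert d) R, adj u (a i)) ∧
    (∀ i N, ∃ y, y ∉ box (0 : Vert d) N ∧ VConnectedIn {v | h ≤ ω v ∧ v ∉ box (0 : Vert d) R} (a i) y) ∧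
    ∀ i j, i ≠ j → ¬ VConnectedIn {v | h ≤ ω v ∧ v ∉ box (0 : Vert d) R} (a i) (a j)

lemma vconn_meas' (h : ℝ) (Q : Vert d → Prop) (x y : Vert d) :
    MeasurableSet {ω : Vert d → ℝ | VConnectedIn {v | h ≤ ω v ∧ Q v} x y} := by
  simp only [VConnectedIn, Set.setOf_exists, Set.setOf_and, Set.setOf_forall, Set.mem_setOf_eq, Set.mem_inter_iff]
  exact MeasurableSet.iUnion fun p => (MeasurableSet.const _).inter (MeasurableSet.iInter fun v => MeasurableSet.iInter fun _ =>
    (measurableSet_le measurable_const (measurable_pi_apply v)).inter (MeasurableSet.const _))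

lemma Tri_meas (h : ℝ) (R : ℕ) : MeasurableSet {ω : Vert d → ℝ | Tri h R ω} := by
  have : {ω : Vert d → ℝ | Tri h R ω} = (⋂ v ∈ box (0 : Vert d) R, {ω | h ≤ ω v}) ∩
      ⋃ a : Fin 3 → Vert d, {_ω | ∀ i, ∃ u ∈ box (0 : Vert d) R, adj u (a i)} ∩
      ((⋂ i, ⋂ N, ⋃ y, {_ω | y ∉ box (0 : Vert d) N} ∩ {ω | VConnectedIn {v | h ≤ ω v ∧ v ∉ box (0 : Vert d) R} (a i) y}) ∩
      ⋂ i, ⋂ j, ⋂ _ : i ≠ j, {ω | VConnectedIn {v | h ≤ ω v ∧ v ∉ box (0 : Vert d) R} (a i) (a j)}ᶜ) := by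
    ext ω
    simp only [Tri, Set.mem_setOf_eq, Set.mem_inter_iff, Set.mem_iInter, Set.mem_iUnion, Set.mem_compl_iff]
  rw [this]
  refine MeasurableSet.inter (Finset.measurableSet_biInter _ fun v _ => measurableSet_le measurable_const (measurable_pi_apply v))
    (MeasurableSet.iUnion fun a => (MeasurableSet.const _).inter (MeasurableSet.inter ?_ ?_))
  · exact MeasurableSet.iInter fun i => MeasurableSet.iInter fun N => MeasurableSet.iUnion fun y =>
      (MeasurableSet.const _).inter (vconn_meas' h _ _ _)
  · exact MeasurableSet.iInter fun i => MeasurableSet.iInter fun j => MeasurableSet.iInter fun _ => (vconn_meas' h _ _ _).compl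

lemma vconn_shift {S : Set (Vert d)} {a b z : Vert d} :
    VConnectedIn S (a + z) (b + z) ↔ VConnectedIn {v | v + z ∈ S} a b := by
  have h : ∀ (S : Set (Vert d)) (a b z : Vert d), VConnectedIn {v | v + z ∈ S} a b → VConnectedIn S (a + z) (b + z) := by
    rintro S a b z ⟨p, hp, hop⟩
    refine ⟨_, isPath_shift hp, fun v hv => ?_⟩
    obtain ⟨w, hw, rfl⟩ := List.mem_map.1 hv
    exact hop w hw
  refine ⟨fun hc => ?_, h S a b z⟩
  have := h {v | v + z ∈ S} (a + z) (b + z) (-z) (by simpa using hc)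
  simpa using this

lemma box_shift {v z : Vert d} {R : ℕ} : v + z ∈ box z R ↔ v ∈ box 0 R := by
  rw [mem_box_iff, mem_box_iff, ← linf_add 0 v z, zero_add]

/-- deterministic bound on the number of trifurcation boxes -/
lemma tri_card (h : ℝ) (R n : ℕ) (ω : Vert d → ℝ) :
    ((box (0 : Vert d) n).filter fun w => Tri h R fun v => ω (v + (2 * R + 3) • w)).card ≤
      (box (0 : Vert d) ((2 * R + 3) * n + R + 1) \ box 0 ((2 * R + 3) * n + R)).card := by
  set L := 2 * R + 3 with hL
  set F := (box (0 : Vert d) n).filter fun w => Tri h R fun v => ω (v + L • w)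
  have hinj : Function.Injective fun w : Vert d => L • w := fun w w' hw => by
    ext i
    have := congrFun hw i
    simp only [Pi.smul_apply, nsmul_eq_mul] at this
    exact mul_left_cancel₀ (by rw [hL]; positivity) this
  rw [← Finset.card_image_of_injective F hinj]
  set N := L * n + R + 1 with hN
  set W := {v | h ≤ ω v ∧ linfDist 0 v ≤ N}
  have hz : ∀ t ∈ F.image fun w => L • w, linfDist 0 t ≤ L * n ∧ (Tri h R fun v => ω (v + t)) := by
    intro t ht
    obtain ⟨w, hw, rfl⟩ := Finset.mem_image.1 ht
    rw [Finset.mem_filter] at hw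
    refine ⟨?_, hw.2⟩
    rw [← mem_box_iff, mem_box]
    intro i
    have := mem_box.1 hw.1 i
    simp only [Pi.smul_apply, Pi.zero_apply, sub_zero, nsmul_eq_mul, Int.natAbs_mul, Int.natAbs_natCast] at *
    exact Nat.mul_le_mul_left _ this
  choose! hz1 hz2 using hz
  have hz3 : ∀ t ∈ F.image fun w => L • w, ∃ a : Fin 3 → Vert d, (∀ i, ∃ u ∈ box t R, adj u (a i)) ∧
      (∀ i, ∃ y ∈ box (0 : Vert d) N \ box 0 (L * n + R), VConnectedIn (W \ (box t R : Set (Vert d))) (a i) y) ∧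
      ∀ i j, i ≠ j → ¬ VConnectedIn (W \ (box t R : Set (Vert d))) (a i) (a j) := by
    intro t ht
    obtain ⟨-, a, h1, h2, h3⟩ := hz2 t ht
    have hset : {v | v + t ∈ {v | h ≤ ω v ∧ v ∉ box t R}} = {v | h ≤ ω (v + t) ∧ v ∉ box (0 : Vert d) R} := by
      ext v; simp [box_shift]
    have hadj : ∀ i, ∃ u ∈ box t R, adj u (a i + t) := by
      intro i
      obtain ⟨u, hu, hua⟩ := h1 i
      refine ⟨u + t, box_shift.2 hu, ?_⟩
      simpa [adj] using hua
    refine ⟨fun i => a i + t, hadj, fun i => ?_, fun i j hij hc => h3 i j hij ?_⟩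
    · obtain ⟨y, hy, hc⟩ := h2 i (N + linfDist 0 t)
      rw [← hset, ← vconn_shift] at hc
      obtain ⟨p, hp, hop⟩ := hc
      have hy' : N ≤ linfDist 0 (y + t) := by
        rw [mem_box_iff, not_le] at hy
        have h4 := linf_triangle t (0) (y + t)
        have h5 := linf_add 0 y t
        rw [zero_add] at h5
        have h6 := linf_symm t 0
        omega
      have hai : linfDist 0 (a i + t) ≤ N := by
        obtain ⟨u, hu, hua⟩ := hadj i
        have h4 := linf_triangle 0 t (a i + t)
        have h5 := linf_triangle t u (a i + t)
        have h6 := linf_adj hua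
        have h7 := hz1 t ht
        rw [mem_box_iff] at hu
        omega
      obtain ⟨p1, p2, z, e, h4, h5, h6⟩ := exit_pre hp hai ⟨_, isPath_end_mem hp, hy'⟩
      refine ⟨z, by rw [Finset.mem_sdiff, mem_box_iff, mem_box_iff]; omega, p1, h4, fun v hv => ?_⟩
      have h7 := hop v (by rw [e]; simp [hv])
      exact ⟨⟨h7.1, h6 v hv⟩, h7.2⟩
    · rw [← hset, ← vconn_shift]
      exact vconn_mono (T := {v | h ≤ ω v ∧ v ∉ box t R})
        (fun v (hv : v ∈ W \ (box t R : Set (Vert d))) => ⟨hv.1.1, hv.2⟩) hc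
  choose! a ha1 ha2 ha3 using hz3
  refine trif_count (W := W) (D := fun t => (box t R : Set (Vert d))) (a := a) (fun t _ => box_conn t R) (fun t ht v hv => ?_) ?_ ha1 ha2 ha3
  · have h1 := hz1 t ht
    have h2 := linf_triangle 0 t v
    rw [Finset.mem_coe, ← sub_add_cancel v t, box_shift] at hv
    have h3 := (hz2 t ht).1 _ hv
    rw [← box_shift (z := t), mem_box_iff] at hv
    simp only [sub_add_cancel] at h3 hv
    exact ⟨h3, by omega⟩
  · intro t ht s hs hts
    obtain ⟨w, -, rfl⟩ := Finset.mem_image.1 ht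
    obtain ⟨w', -, rfl⟩ := Finset.mem_image.1 hs
    refine Set.disjoint_left.2 fun v hv hv' => hts ?_
    rw [Finset.mem_coe, mem_box] at hv hv'
    ext i
    have h1 := hv i
    have h2 := hv' i
    simp only [Pi.smul_apply, nsmul_eq_mul] at *
    have h3 : w i = w' i := by
      have h4 : ((L:ℤ) * (w i - w' i)).natAbs ≤ 2 * R := by rw [mul_sub]; omega
      rw [Int.natAbs_mul, Int.natAbs_natCast] at h4
      by_contra hne
      have h5 : 1 ≤ (w i - w' i).natAbs := by omega
      have h6 := Nat.mul_le_mul_left L h5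
      omega
    rw [h3]

lemma no_tri (hd : 3 ≤ d) (hμ : GaussLaw μ (gr (d := d))) (h : ℝ) (R : ℕ) : μ {ω | Tri h R ω} = 0 := by
  have := hμ.prob
  by_contra hne
  set p := μ.real {ω | Tri h R ω} with hp
  have hp0 : 0 < p := measureReal_nonneg.lt_of_ne fun h0 => hne ((measureReal_eq_zero_iff).1 h0.symm)
  set L := 2 * R + 3 with hL
  have hlow : ∀ n : ℕ, p * (2 * n + 1) ≤ 2 * d * (L:ℝ) ^ d := by
    intro n
    set c := (box (0 : Vert d) (L * n + R + 1) \ box 0 (L * n + R)).card with hc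
    have hT := Tri_meas (d := d) h R
    have hsm : ∀ w : Vert d, MeasurableSet {ω : Vert d → ℝ | Tri h R fun v => ω (v + L • w)} := fun w =>
      (measurable_pi_lambda _ fun x => measurable_pi_apply _ : Measurable fun (ω : Vert d → ℝ) v => ω (v + L • w)) hT
    have h1 : p * (2 * n + 1) ^ d ≤ c := by
      have h2 : ∀ w : Vert d, ∫ ω, Set.indicator {ω : Vert d → ℝ | Tri h R fun v => ω (v + L • w)} (fun _ => (1:ℝ)) ω ∂μ = p := by
        intro w
        rw [integral_indicator_const _ (hsm w), smul_eq_mul, mul_one, hp, measureReal_def, measureReal_def,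
          ← shift_event hμ (L • w) hT]
        rfl
      have h3 : ∫ ω, ∑ w ∈ box (0 : Vert d) n, Set.indicator {ω : Vert d → ℝ | Tri h R fun v => ω (v + L • w)} (fun _ => (1:ℝ)) ω ∂μ
          ≤ ∫ _ω, (c:ℝ) ∂μ := by
        refine integral_mono (integrable_finsetSum _ fun w _ => (integrable_const _).indicator (hsm w)) (integrable_const _) fun ω => ?_
        have h4 := tri_card h R n ω
        rw [← hL, ← hc, Finset.card_filter] at h4
        simp only [Set.indicator, Set.mem_setOf_eq]
        exact_mod_cast h4
      rw [integral_finsetSum _ fun w _ => (integrable_const _).indicator (hsm w), Finset.sum_congr rfl fun w _ => h2 w] at h3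
      simp only [Finset.sum_const, card_box, nsmul_eq_mul, integral_const, probReal_univ, smul_eq_mul, one_mul] at h3
      push_cast at h3
      linarith
    have h2 : (c:ℝ) ≤ 2 * d * (L * (2 * n + 1):ℝ) ^ d / (2 * n + 1) := by
      have hsub : box (0 : Vert d) (L * n + R) ⊆ box 0 (L * n + R + 1) := box_sub (by rw [linf_self]; omega)
      have h3 := Finset.card_sdiff_add_card_eq_card hsub
      rw [← hc, card_box, card_box] at h3
      set X : ℝ := L * (2 * n + 1) with hX
      have hX1 : (2 * n + 1 : ℝ) ≤ X := by
        rw [hX]; exact le_mul_of_one_le_left (by positivity) (by exact_mod_cast (by omega : 1 ≤ L))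
      have hX3 : 3 ≤ X := by
        rw [hX, hL]; push_cast; have : (0:ℝ) ≤ R := by positivity
        have : (0:ℝ) ≤ n := by positivity
        nlinarith
      have h4 : (c:ℝ) + (X - 2) ^ d = X ^ d := by
        have e1 : X - 2 = ((2 * (L * n + R) + 1 : ℕ) : ℝ) := by rw [hX, hL]; push_cast; ring
        have e2 : X = ((2 * (L * n + R + 1) + 1 : ℕ) : ℝ) := by rw [hX, hL]; push_cast; ring
        rw [e1, e2]; exact_mod_cast h3
      have h5 : 1 + d * (-(2 / X)) ≤ (1 + -(2 / X)) ^ d := one_add_mul_le_pow (by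
        have : 2 / X ≤ 1 := (div_le_one (by linarith)).2 (by linarith)
        linarith) d
      have h6 : (X - 2) ^ d = X ^ d * (1 + -(2 / X)) ^ d := by
        rw [← mul_pow]; congr 1; field_simp; ring
      have h7 : X ^ d * (1 + d * (-(2 / X))) ≤ (X - 2) ^ d := by
        rw [h6]; exact mul_le_mul_of_nonneg_left h5 (by positivity)
      have h8 : (c:ℝ) ≤ 2 * d * X ^ d / X := by
        have : X ^ d * (1 + d * (-(2 / X))) = X ^ d - 2 * d * X ^ d / X := by field_simp; ring
        linarith
      exact h8.trans (div_le_div_of_nonneg_left (by positivity) (by positivity) hX1)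
    have h3 := h1.trans h2
    have hn0 : (0:ℝ) < 2 * n + 1 := by positivity
    rw [le_div_iff₀ hn0, mul_pow] at h3
    have hq : (0:ℝ) < (2 * n + 1) ^ d := by positivity
    refine le_of_mul_le_mul_right (le_trans (le_of_eq ?_) (h3.trans (le_of_eq ?_))) hq <;> ring
  obtain ⟨n, hn⟩ := exists_nat_gt (2 * d * (L:ℝ) ^ d / p)
  have h1 := hlow n
  rw [div_lt_iff₀ hp0] at hn
  have h2 : (0:ℝ) ≤ n := by positivity
  nlinarith

end BK
end

section
section BK2
variable {d : ℕ} {μ : Measure (Vert d → ℝ)}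

lemma last_exit {S : Set (Vert d)} {B : Finset (Vert d)} {u y : Vert d} (h : VConnectedIn S u y) (hy : y ∉ B) :
    (u ∉ B ∧ VConnectedIn {v | v ∈ S ∧ v ∉ B} u y) ∨
      ∃ b, (∃ w ∈ B, adj w b) ∧ VConnectedIn S u b ∧ VConnectedIn {v | v ∈ S ∧ v ∉ B} b y := by
  refine vconn_induct h (motive := fun u => (u ∉ B ∧ VConnectedIn {v | v ∈ S ∧ v ∉ B} u y) ∨
      ∃ b, (∃ w ∈ B, adj w b) ∧ VConnectedIn S u b ∧ VConnectedIn {v | v ∈ S ∧ v ∉ B} b y) ?_ ?_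
  · exact Or.inl ⟨hy, vconn_refl ⟨(vconn_mem h).2, hy⟩⟩
  · rintro a b ha hab hb (⟨h1, h2⟩ | ⟨c, h1, h2, h3⟩)
    · by_cases haB : a ∈ B
      · exact Or.inr ⟨b, ⟨a, haB, hab⟩, vconn_cons ha hab (vconn_refl (vconn_mem hb).1), h2⟩
      · exact Or.inl ⟨haB, vconn_cons ⟨ha, haB⟩ hab h2⟩
    · exact Or.inr ⟨c, h1, vconn_cons ha hab h2, h3⟩

lemma three_tri {h : ℝ} {R : ℕ} {ω : Vert d → ℝ} {u : Fin 3 → Vert d} (hu : ∀ i, u i ∈ box (0 : Vert d) R)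
    (hinf : ∀ i, {y | VConnectedIn {v | h ≤ ω v} (u i) y}.Infinite)
    (hsep : ∀ i j, i ≠ j → ¬ VConnectedIn {v | h ≤ ω v} (u i) (u j)) :
    ∃ k : ℕ, Tri h R (ω + rst (box 0 R) fun _ => (k:ℝ)) := by
  set B := box (0 : Vert d) R with hB
  have hex : ∀ i, ∃ b, (∃ w ∈ B, adj w b) ∧ VConnectedIn {v | h ≤ ω v} (u i) b ∧
      ∀ N, ∃ y, y ∉ box (0 : Vert d) N ∧ VConnectedIn {v | h ≤ ω v ∧ v ∉ B} b y := by
    intro i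
    by_contra hno
    push Not at hno
    choose! Nb hNb using hno
    set N := max R ((box (0 : Vert d) (R + 1)).sup Nb) with hN
    obtain ⟨y, hy, hyN⟩ := (hinf i).exists_notMem_finset (box 0 N)
    have hmon : ∀ n, n ≤ N → y ∉ box (0 : Vert d) n := fun n hn h' =>
      hyN (box_sub (by rw [linf_self]; omega) h')
    rcases last_exit (B := B) hy (hmon R (le_max_left _ _)) with h1 | ⟨b, ⟨w, hw, hwb⟩, h2, h3⟩
    · exact h1.1 (hu i)
    · have hb : b ∈ box (0 : Vert d) (R + 1) := by
        rw [hB, mem_box_iff] at hw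
        rw [mem_box_iff]
        have := linf_triangle 0 w b
        have := linf_adj hwb
        omega
      exact hNb b ⟨w, hw, hwb⟩ h2 y (hmon _ ((Finset.le_sup hb).trans (le_max_right _ _))) h3
  choose b hb1 hb2 hb3 using hex
  obtain ⟨k, hk⟩ := exists_nat_ge (∑ v ∈ B, |h - ω v|)
  have hset : {v | h ≤ (ω + rst B fun _ => (k:ℝ)) v ∧ v ∉ B} = {v | h ≤ ω v ∧ v ∉ B} := by
    ext v
    refine and_congr_left fun hv => ?_
    simp [rst, hv]
  refine ⟨k, fun v hv => ?_, b, hb1, ?_, ?_⟩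
  · have h1 := Finset.single_le_sum (f := fun v => |h - ω v|) (fun _ _ => abs_nonneg _) hv
    have h2 := le_abs_self (h - ω v)
    have : rst B (fun _ => (k:ℝ)) v = k := by simp [rst, hB, hv]
    rw [Pi.add_apply, this]
    linarith
  · rw [hset]; exact hb3
  · rw [hset]
    intro i j hij hc
    refine hsep i j hij (vconn_trans (hb2 i) (vconn_trans ?_ (vconn_symm (hb2 j))))
    exact vconn_mono (T := {v | h ≤ ω v}) (fun v (hv : v ∈ {v | h ≤ ω v ∧ v ∉ B}) => hv.1) hc

lemma no_three (hd : 3 ≤ d) (hμ : GaussLaw μ (gr (d := d))) (h : ℝ) (u : Fin 3 → Vert d) :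
    ∀ᵐ ω ∂μ, (∀ i, {y | VConnectedIn {v | h ≤ ω v} (u i) y}.Infinite) →
      ∃ i j, i ≠ j ∧ VConnectedIn {v | h ≤ ω v} (u i) (u j) := by
  set R := Finset.univ.sup fun i => linfDist 0 (u i)
  have h0 : μ (⋃ k : ℕ, {ω | ω + rst (box 0 R) (fun _ => (k:ℝ)) ∈ {ω | Tri h R ω}}) = 0 :=
    measure_iUnion_null fun k => gff_ac hd hμ _ _ (Tri_meas h R) (no_tri hd hμ h R)
  refine measure_mono_null (fun ω hω => ?_) h0
  simp only [Set.mem_compl_iff, Set.mem_setOf_eq, not_forall, not_exists, not_and] at hω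
  obtain ⟨hinf, hsep⟩ := hω
  exact Set.mem_iUnion.2 (three_tri (fun i => mem_box_iff.2
    (Finset.le_sup (f := fun i => linfDist 0 (u i)) (Finset.mem_univ i))) hinf hsep)

lemma two_pt (hd : 3 ≤ d) (hμ : GaussLaw μ (gr (d := d))) (h : ℝ) (u : ℕ → Vert d) (M : ℕ) :
    M * μ.real {ω : Vert d → ℝ | ∀ R, fd h R 0 ω = 0} ≤
      2 + M * ∑ p ∈ (Finset.range M).offDiag, μ.real {ω : Vert d → ℝ | VConnectedIn {v | h ≤ ω v} (u p.1) (u p.2)} := by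
  have := hμ.prob
  have hd0 : 0 < d := by omega
  have hae : ∀ᵐ ω ∂μ, ∀ q : Fin 3 → ℕ, (∀ i, {y | VConnectedIn {v | h ≤ ω v} (u (q i)) y}.Infinite) →
      ∃ i j, i ≠ j ∧ VConnectedIn {v | h ≤ ω v} (u (q i)) (u (q j)) :=
    ae_all_iff.2 fun q => no_three hd hμ h fun i => u (q i)
  have hi1 : ∀ j, Integrable (Set.indicator {ω : Vert d → ℝ | ∀ R, fd h R (u j) ω = 0} fun _ => (1:ℝ)) μ := fun j =>
    (integrable_const _).indicator (inf_meas hd0 h _)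
  have hi2 : ∀ p : ℕ × ℕ, Integrable (Set.indicator {ω : Vert d → ℝ | VConnectedIn {v | h ≤ ω v} (u p.1) (u p.2)} fun _ => (1:ℝ)) μ :=
    fun p => (integrable_const _).indicator (vconn_meas h _ _)
  have key : ∫ ω, ∑ j ∈ Finset.range M, Set.indicator {ω : Vert d → ℝ | ∀ R, fd h R (u j) ω = 0} (fun _ => (1:ℝ)) ω ∂μ ≤
      ∫ ω, (2 + M * ∑ p ∈ (Finset.range M).offDiag,
        Set.indicator {ω : Vert d → ℝ | VConnectedIn {v | h ≤ ω v} (u p.1) (u p.2)} (fun _ => (1:ℝ)) ω) ∂μ := by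
    refine integral_mono_ae (integrable_finsetSum _ fun j _ => hi1 j)
      ((integrable_const _).add ((integrable_finsetSum _ fun p _ => hi2 p).const_mul _)) ?_
    filter_upwards [hae] with ω hω
    simp only [Set.indicator, Set.mem_setOf_eq]
    rw [← Finset.natCast_card_filter]
    set F := (Finset.range M).filter fun j => ∀ R, fd h R (u j) ω = 0 with hF
    have hs0 : (0:ℝ) ≤ ∑ p ∈ (Finset.range M).offDiag, if VConnectedIn {v | h ≤ ω v} (u p.1) (u p.2) then (1:ℝ) else 0 :=
      Finset.sum_nonneg fun p _ => by split_ifs <;> norm_num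
    by_cases hc : F.card ≤ 2
    · have : (F.card : ℝ) ≤ 2 := by exact_mod_cast hc
      have := mul_nonneg (Nat.cast_nonneg (α := ℝ) M) hs0
      linarith
    · obtain ⟨a, ha, b, hb, c, hc, hab, hac, hbc⟩ := Finset.two_lt_card.1 (not_le.1 hc)
      set q : Fin 3 → ℕ := ![a, b, c] with hq
      have hqF : ∀ i, q i ∈ F := by intro i; fin_cases i <;> simp [hq, ha, hb, hc]
      have hqi : Function.Injective q := by
        intro i j hij
        fin_cases i <;> fin_cases j <;> simp_all
      obtain ⟨i, j, hij, hcon⟩ := hω q fun i => (infinite_iff hd0).2 (Finset.mem_filter.1 (hqF i)).2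
      have h1 : (1:ℝ) ≤ ∑ p ∈ (Finset.range M).offDiag, if VConnectedIn {v | h ≤ ω v} (u p.1) (u p.2) then (1:ℝ) else 0 := by
        have := Finset.single_le_sum (s := (Finset.range M).offDiag)
          (f := fun p => if VConnectedIn {v | h ≤ ω v} (u p.1) (u p.2) then (1:ℝ) else 0)
          (fun p _ => by split_ifs <;> norm_num)
          (show (q i, q j) ∈ (Finset.range M).offDiag from
            Finset.mem_offDiag.2 ⟨(Finset.mem_filter.1 (hqF i)).1, (Finset.mem_filter.1 (hqF j)).1, hqi.ne hij⟩)
        simpa [hcon] using this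
      have h2 : (F.card : ℝ) ≤ M := by
        have := Finset.card_filter_le (Finset.range M) fun j => ∀ R, fd h R (u j) ω = 0
        rw [Finset.card_range] at this
        exact_mod_cast this
      have h3 := le_mul_of_one_le_right (Nat.cast_nonneg (α := ℝ) M) h1
      linarith
  rw [integral_finsetSum _ fun j _ => hi1 j,
    integral_add (integrable_const _) ((integrable_finsetSum _ fun p _ => hi2 p).const_mul _), integral_const_mul,
    integral_finsetSum _ fun p _ => hi2 p] at key
  simp only [integral_indicator_const _ (inf_meas hd0 h _), integral_indicator_const _ (vconn_meas h _ _),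
    integral_const, probReal_univ, smul_eq_mul, mul_one, one_mul, measureReal_def, inf_shift hd0 hμ h,
    Finset.sum_const, Finset.card_range, nsmul_eq_mul] at key
  simpa only [measureReal_def, measure_univ, ENNReal.toReal_one, one_mul] using key

/-- if the connection probability in some direction vanishes, there is no percolation -/
lemma perc_zero_of_conn (hd : 3 ≤ d) (hμ : GaussLaw μ (gr (d := d))) {h : ℝ} {x : Vert d}
    (hq : Tendsto (fun n : ℕ => μ {ω : Vert d → ℝ | VConnectedIn {v | h ≤ ω v} 0 (n • x)}) atTop (𝓝 0)) :
    μ {ω : Vert d → ℝ | PercolatesIn {v | h ≤ ω v}} = 0 := by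
  have := hμ.prob
  have hd0 : 0 < d := by omega
  rw [perc_zero_iff hd0 hμ h, ← measureReal_eq_zero_iff]
  set θ := μ.real {ω : Vert d → ℝ | ∀ R, fd h R 0 ω = 0}
  have hq' : Tendsto (fun n : ℕ => μ.real {ω : Vert d → ℝ | VConnectedIn {v | h ≤ ω v} 0 (n • x)}) atTop (𝓝 0) := by
    have := (ENNReal.tendsto_toReal zero_ne_top).comp hq
    simpa [Function.comp_def, measureReal_def] using this
  have hsh : ∀ i j : ℕ, i < j → μ.real {ω : Vert d → ℝ | VConnectedIn {v | h ≤ ω v} (i • x) (j • x)} =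
      μ.real {ω : Vert d → ℝ | VConnectedIn {v | h ≤ ω v} 0 ((j - i) • x)} := by
    intro i j hij
    rw [measureReal_def, measureReal_def, ← shift_event hμ (i • x) (vconn_meas h 0 ((j - i) • x))]
    congr 2
    ext ω
    have := vconn_shift (S := {v | h ≤ ω v}) (a := 0) (b := (j - i) • x) (z := i • x)
    rw [zero_add, ← add_smul, Nat.sub_add_cancel hij.le] at this
    exact this
  have hM : ∀ M : ℕ, M * θ ≤ 2 := by
    intro M
    have hterm : ∀ i j : ℕ, i < j → Tendsto (fun K : ℕ => μ.real {ω : Vert d → ℝ | VConnectedIn {v | h ≤ ω v}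
        ((i * K) • x) ((j * K) • x)}) atTop (𝓝 0) := by
      intro i j hij
      have h1 : Tendsto (fun K : ℕ => (j - i) * K) atTop atTop :=
        tendsto_id.const_mul_atTop' (by omega)
      refine (hq'.comp h1).congr' ?_
      filter_upwards [eventually_gt_atTop 0] with K hK
      rw [hsh _ _ (Nat.mul_lt_mul_of_pos_right hij hK), Function.comp, Nat.sub_mul]
    have hlim : Tendsto (fun K : ℕ => 2 + M * ∑ p ∈ (Finset.range M).offDiag,
        μ.real {ω : Vert d → ℝ | VConnectedIn {v | h ≤ ω v} ((p.1 * K) • x) ((p.2 * K) • x)}) atTop (𝓝 (2 + M * 0)) := by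
      refine Tendsto.const_add _ (Tendsto.const_mul _ ?_)
      rw [← Finset.sum_const_zero (s := (Finset.range M).offDiag)]
      refine tendsto_finsetSum _ fun p hp => ?_
      rcases lt_or_gt_of_ne (Finset.mem_offDiag.1 hp).2.2 with hlt | hlt
      · exact hterm _ _ hlt
      · refine (hterm _ _ hlt).congr fun K => ?_
        congr 1; ext ω; exact ⟨vconn_symm, vconn_symm⟩
    have := ge_of_tendsto hlim (Eventually.of_forall fun K => two_pt hd hμ h (fun j => (j * K) • x) M)
    simpa using this
  by_contra hne
  have hθ : 0 < θ := measureReal_nonneg.lt_of_ne (Ne.symm hne)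
  obtain ⟨M, h1⟩ := exists_nat_gt (2 / θ)
  rw [div_lt_iff₀ hθ] at h1
  exact absurd (hM M) (not_le.2 h1)

end BK2
end

section
variable {d : ℕ}

lemma vfpp_meas (x y : Vert d) : Measurable fun w : Vert d → ℝ≥0∞ => vfppDist w x y := by
  have : Countable (Vert d) := inferInstanceAs (Countable (Fin d → ℤ))
  refine Measurable.iInf fun p => ?_
  have : ∀ l : List (Vert d), Measurable fun w : Vert d → ℝ≥0∞ => vertPathWeight w l := by
    intro l
    induction l with
    | nil => exact measurable_const
    | cons a l ih => exact (measurable_pi_apply a).add ih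
  exact this p.1

lemma wt_meas (h : ℝ) : Measurable (wt (d := d) h) :=
  measurable_pi_lambda _ fun x => Measurable.ite (measurableSet_lt (measurable_pi_apply x) measurable_const)
    measurable_const measurable_const

lemma vfpp_zero {h : ℝ} {ω : Vert d → ℝ} {x y : Vert d} (hc : VConnectedIn {v | h ≤ ω v} x y) :
    vfppDist (wt h ω) x y = 0 := by
  obtain ⟨p, hp, hv⟩ := hc
  refine le_antisymm ?_ bot_le
  have h1 : vfppDist (wt h ω) x y ≤ vertPathWeight (wt h ω) p :=
    iInf_le (fun p : {p : List (Vert d) // IsPathFrom x y p} => vertPathWeight (wt h ω) p.1) ⟨p, hp⟩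
  rw [wt_path, cost_eq_zero.2 hv] at h1
  simpa using h1

variable {μ : Measure (Vert d → ℝ)}

lemma mconst_zero (hd : 3 ≤ d) (hμ : GaussLaw μ (gr (d := d))) {h : ℝ} {x : Vert d} {m : ℝ≥0∞}
    (hp : μ {ω : Vert d → ℝ | PercolatesIn {v | h ≤ ω v}} ≠ 0)
    (ht : ∀ᵐ ω ∂μ, Tendsto (fun n : ℕ => vfppDist (wt h ω) 0 (n • x) / (n : ℝ≥0∞)) atTop (𝓝 m)) :
    m = 0 := by
  have := hμ.prob
  by_contra hm
  refine hp (perc_zero_of_conn (x := x) hd hμ ?_)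
  have := tendsto_measure_of_ae_tendsto_indicator_of_isFiniteMeasure (μ := μ) (A := ∅)
    (As := fun n : ℕ => {ω : Vert d → ℝ | VConnectedIn {v | h ≤ ω v} 0 (n • x)}) atTop
    MeasurableSet.empty (fun n => vconn_meas h 0 (n • x)) ?_
  · simpa using this
  · filter_upwards [ht] with ω hω
    filter_upwards [hω.eventually (lt_mem_nhds (pos_iff_ne_zero.2 hm))] with n hn
    simp only [Set.mem_setOf_eq, Set.mem_empty_iff_false, iff_false]
    intro hc
    rw [vfpp_zero hc, ENNReal.zero_div] at hn
    exact lt_irrefl _ hn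

lemma mconst_pos (hd : 3 ≤ d) (hμ : GaussLaw μ (gr (d := d))) {h : ℝ} {x : Vert d} (hx : x ≠ 0) {m : ℝ≥0∞}
    (hD : Decay μ h)
    (ht : ∀ᵐ ω ∂μ, Tendsto (fun n : ℕ => vfppDist (wt h ω) 0 (n • x) / (n : ℝ≥0∞)) atTop (𝓝 m)) :
    0 < m := by
  have := hμ.prob
  rw [pos_iff_ne_zero]
  rintro rfl
  obtain ⟨c2, c3, h2, h3, hb⟩ := decay_main (by omega) hμ hD (show (4:ℝ) < 5 by norm_num)
  have h1 := tendsto_measure_of_ae_tendsto_indicator_of_isFiniteMeasure (μ := μ) (A := Set.univ)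
    (As := fun n : ℕ => {ω : Vert d → ℝ | vfppDist (wt h ω) 0 (n • x) ≤ ENNReal.ofReal (c2 * n)}) atTop
    MeasurableSet.univ
    (fun n => measurableSet_le ((vfpp_meas 0 (n • x)).comp (wt_meas h)) measurable_const) ?_
  · rw [measure_univ] at h1
    set e : ℝ := if d = 3 then 5 else 0 with he
    have he0 : (0:ℝ) ≤ e := by rw [he]; split_ifs <;> norm_num
    have h4 := ((isLittleO_log_rpow_rpow_atTop e (one_pos : (0:ℝ) < 1)).bound h3).natCast_atTop
    have h5 : ∀ᶠ n : ℕ in atTop, μ {ω : Vert d → ℝ | vfppDist (wt h ω) 0 (n • x) ≤ ENNReal.ofReal (c2 * n)} ≤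
        ENNReal.ofReal (Real.exp (-1)) := by
      filter_upwards [h4, eventually_ge_atTop 3] with n hn hn3
      refine (hb n x hx).trans (ENNReal.ofReal_le_ofReal (Real.exp_le_exp.2 (neg_le_neg ?_)))
      have hl : 0 < Real.log n := Real.log_pos (by exact_mod_cast (by omega : 1 < n))
      have hl' : 0 < Real.log n ^ e := Real.rpow_pos_of_pos hl e
      rw [Real.rpow_one, Real.norm_of_nonneg hl'.le, Real.norm_of_nonneg (Nat.cast_nonneg n)] at hn
      rwa [one_le_div hl']
    have h6 := le_of_tendsto h1 h5
    rw [ENNReal.one_le_ofReal, Real.one_le_exp_iff] at h6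
    linarith
  · filter_upwards [ht] with ω hω
    filter_upwards [hω.eventually (gt_mem_nhds (ENNReal.ofReal_pos.2 h2)), eventually_ge_atTop 1] with n hn hn1
    simp only [Set.mem_setOf_eq, Set.mem_univ, iff_true]
    rw [ENNReal.ofReal_mul h2.le, ENNReal.ofReal_natCast]
    refine (ENNReal.div_le_iff_le_mul (Or.inl ?_) (Or.inl (ENNReal.natCast_ne_top n))).1 hn.le
    exact_mod_cast (by omega : n ≠ 0)
end

/-- Theorem `the:mainGFF`: for vertex FPP with weights
distributed as `𝟙{φ_x < h}` for the Gaussian free field `φ` on `ℤ^d`, `d ≥ 3`,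
the time constant is positive iff `h > h_*` (resp. vanishes for `h < h_*`), and
above `h_*` the FPP distance is linear with (stretched) exponentially small
exceptional probability, with a logarithmic correction only in `d = 3`. -/
theorem statement6
    {d : ℕ} (hd : 3 ≤ d)
    {ΩG : Type*} [MeasurableSpace ΩG] (PG : Measure ΩG) [IsProbabilityMeasure PG]
    (φ : ΩG → Vert d → ℝ)
    (hGFF : IsCenteredGaussianField PG φ fun x y => (greenSRW d x y).toReal)
    {Ω : Type*} [MeasurableSpace Ω]
    (Ph : ℝ → Measure Ω) (hPh : ∀ h, IsProbabilityMeasure (Ph h))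
    (t : Ω → Vert d → ℝ≥0∞) (htmeas : ∀ x, Measurable fun ω => t ω x)
    -- `(t_x^ω)` has the same law under `P^h` as `(𝟙{φ_x < h})` under `P^G`
    (hlaw : ∀ h : ℝ, Measure.map (fun ω => t ω) (Ph h) =
      Measure.map (fun ω x => if φ ω x < h then (1 : ℝ≥0∞) else 0) PG) :
    (∀ h : ℝ, ∀ x : Vert d, x ≠ 0 → ∀ μ : ℝ≥0∞,
      (∀ᵐ ω ∂(Ph h),
        Tendsto (fun n : ℕ => vfppDist (t ω) 0 (n • x) / (n : ℝ≥0∞)) atTop (𝓝 μ)) →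
      (hstar PG φ < h → 0 < μ) ∧ (h < hstar PG φ → μ = 0)) ∧
    (∀ h : ℝ, hstar PG φ < h → ∀ δ : ℝ, 4 < δ →
      ∃ c2 c3 : ℝ, 0 < c2 ∧ 0 < c3 ∧
        ∀ (n : ℕ) (x : Vert d), x ≠ 0 →
          Ph h {ω | vfppDist (t ω) 0 (n • x) ≤ ENNReal.ofReal (c2 * n)} ≤
            ENNReal.ofReal
              (Real.exp (-(c3 * n / Real.log n ^ (if d = 3 then δ else 0))))) := by
  have hφ : Measurable φ := measurable_pi_lambda _ hGFF.1
  have htm : Measurable t := measurable_pi_lambda _ htmeas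
  have hd0 : 0 < d := by omega
  set ν : Measure (Vert d → ℝ) := PG.map φ with hν
  have hG : GaussLaw ν (gr (d := d)) := by
    refine ⟨Measure.isProbabilityMeasure_map hφ.aemeasurable, fun s c => ?_⟩
    have h1 : Measurable fun ω : Vert d → ℝ => Real.exp (∑ x ∈ s, c x * ω x) :=
      Real.measurable_exp.comp (Finset.measurable_sum _ fun x _ => (measurable_pi_apply x).const_mul _)
    rw [hν, integral_map hφ.aemeasurable h1.aestronglyMeasurable]
    have := hGFF.2 s c 1
    simpa only [one_mul, one_pow, greenSRW_toReal hd] using this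
  have hl : ∀ h, (Ph h).map t = ν.map (wt h) := by
    intro h
    rw [hν, Measure.map_map (wt_meas h) hφ]
    exact hlaw h
  have hset : {h : ℝ | PG {ω | PercolatesIn {x | h ≤ φ ω x}} ≠ 0} =
      {h : ℝ | ν {ω : Vert d → ℝ | PercolatesIn {v | h ≤ ω v}} ≠ 0} := by
    ext h
    simp only [Set.mem_setOf_eq]
    rw [hν, Measure.map_apply hφ (perc_meas hd0 h)]
    rfl
  have hs : hstar PG φ = sSup {h : ℝ | ν {ω : Vert d → ℝ | PercolatesIn {v | h ≤ ω v}} ≠ 0} := by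
    rw [hstar, hset]
  have hbdd : BddAbove {h : ℝ | ν {ω : Vert d → ℝ | PercolatesIn {v | h ≤ ω v}} ≠ 0} := by
    obtain ⟨b, hb⟩ := perc_bdd hd hG
    exact ⟨b, fun h hh => le_of_not_gt fun hlt => perc_mono hlt.le hh hb⟩
  have hne : {h : ℝ | ν {ω : Vert d → ℝ | PercolatesIn {v | h ≤ ω v}} ≠ 0}.Nonempty := perc_exists hd hG
  have hdec : ∀ h, hstar PG φ < h → Decay ν h := by
    intro h hh
    obtain ⟨a, ha, hah⟩ := exists_between hh
    refine decay_of_noperc hd hG hah ?_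
    by_contra hc
    rw [hs] at ha
    exact absurd (le_csSup hbdd hc) (not_le.2 ha)
  refine ⟨fun h x hx m hm => ?_, fun h hh δ hδ => ?_⟩
  · have hA : MeasurableSet {w : Vert d → ℝ≥0∞ |
        Tendsto (fun n : ℕ => vfppDist w 0 (n • x) / (n : ℝ≥0∞)) atTop (𝓝 m)} :=
      measurableSet_tendsto (𝓝 m) fun n => (vfpp_meas 0 (n • x)).div_const _
    have h1 : ∀ᵐ ω ∂ν, Tendsto (fun n : ℕ => vfppDist (wt h ω) 0 (n • x) / (n : ℝ≥0∞)) atTop (𝓝 m) := by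
      have h2 := (ae_map_iff htm.aemeasurable hA).2 hm
      rw [hl h] at h2
      exact (ae_map_iff (wt_meas h).aemeasurable hA).1 h2
    refine ⟨fun hh => mconst_pos hd hG hx (hdec h hh) h1, fun hh => ?_⟩
    rw [hs] at hh
    obtain ⟨h', hh', hlt⟩ := exists_lt_of_lt_csSup hne hh
    exact mconst_zero hd hG (perc_mono hlt.le hh') h1
  · obtain ⟨c2, c3, h2, h3, hb⟩ := decay_main hd0 hG (hdec h hh) hδ
    refine ⟨c2, c3, h2, h3, fun n x hx => ?_⟩
    have hA : MeasurableSet {w : Vert d → ℝ≥0∞ | vfppDist w 0 (n • x) ≤ ENNReal.ofReal (c2 * n)} :=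
      measurableSet_le (vfpp_meas 0 (n • x)) measurable_const
    have h4 : Ph h {ω | vfppDist (t ω) 0 (n • x) ≤ ENNReal.ofReal (c2 * n)} =
        ν {ω | vfppDist (wt h ω) 0 (n • x) ≤ ENNReal.ofReal (c2 * n)} := by
      have := congrArg (fun ρ => ρ {w : Vert d → ℝ≥0∞ | vfppDist w 0 (n • x) ≤ ENNReal.ofReal (c2 * n)}) (hl h)
      simp only [Measure.map_apply htm hA, Measure.map_apply (wt_meas h) hA] at this
      exact this
    rw [h4]
    exact hb n x hx

end FPPPaper
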